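/- Let (M,p) be a germ of a generic real-analytic submanifold of ℂ^N which is minimal at p, and let a deformation (M'_ε)_{ε ∈ X} of targets through p' ∈ ℂ^{N'} be given. Fix ℓ ∈ ℕ and suppose the mapping locus E_ℓ ⊆ X contains a real-analytic submanifold R ⊆ X; let ε ∈ R and let U be a neighborhood of ε in R. Then there exist δ₁ ∈ U, an open neighborhood V of δ₁ in R, an open neighborhood V' of p in ℂ^N, and a map 𝐇 : V × V' → ℂ^{N'} which is real-analytic in the first variable and holomorphic in the second, such that for every δ ∈ V the map H^δ := 𝐇(δ, ·) satisfies H^δ(p) = p', H^δ(M ∩ V') ⊆ M'_δ, and H^δ is finitely nondegenerate of order at most ℓ at p with respect to I_{p'}(M'_δ). -/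

import Mathlib

open Complex Topology

noncomputable section

/-- `ℂ^n`. -/
abbrev Cn (n : ℕ) : Type := EuclideanSpace ℂ (Fin n)

/-- `ℝ^m`. -/
abbrev Rm (m : ℕ) : Type := EuclideanSpace ℝ (Fin m)

/-- The vector of `ℂ^n` with entry `c` in the `j`-th coordinate and `0` elsewhere. -/
def cbasis {n : ℕ} (j : Fin n) (c : ℂ) : Cn n := EuclideanSpace.single j c

/-- The `j`-th component of the Wirtinger gradient `∂f(q)` of a real-valued function `f`. -/
def wirtD {n : ℕ} (f : Cn n → ℝ) (q : Cn n) : Fin n → ℂ := fun j =>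
  (1 / 2 : ℂ) * ((fderiv ℝ f q (cbasis j 1) : ℂ)
    - Complex.I * (fderiv ℝ f q (cbasis j Complex.I) : ℂ))

/-- The `j`-th component of `∂̄g(q)` for a complex-valued function `g`. -/
def wirtDBar {n : ℕ} (g : Cn n → ℂ) (q : Cn n) : Fin n → ℂ := fun j =>
  (1 / 2 : ℂ) * (fderiv ℝ g q (cbasis j 1) + Complex.I * fderiv ℝ g q (cbasis j Complex.I))

/-- The `j`-th component of `∂̄f(q)` for a real-valued function `f`. -/
def wirtDBarR {n : ℕ} (f : Cn n → ℝ) (q : Cn n) : Fin n → ℂ := fun j =>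
  (1 / 2 : ℂ) * ((fderiv ℝ f q (cbasis j 1) : ℂ)
    + Complex.I * (fderiv ℝ f q (cbasis j Complex.I) : ℂ))

/-- `M` is a generic real-analytic submanifold of codimension `d` near `p`. -/
def IsGenericAt {n : ℕ} (M : Set (Cn n)) (d : ℕ) (p : Cn n) : Prop :=
  p ∈ M ∧ ∃ (U : Set (Cn n)) (ρ : Cn n → Fin d → ℝ),
    IsOpen U ∧ p ∈ U ∧ (∀ k, AnalyticOnNhd ℝ (fun z => ρ z k) U) ∧
    (M ∩ U = {z | z ∈ U ∧ ∀ k, ρ z k = 0}) ∧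
    ∀ q ∈ M ∩ U, LinearIndependent ℂ (fun k : Fin d => wirtD (fun z => ρ z k) q)

/-- `S` is, near its point `q`, a real-analytic submanifold of (real) dimension `mdim`. -/
def IsRASubmanifoldAt {E : Type*} [NormedAddCommGroup E] [NormedSpace ℝ E]
    (S : Set E) (q : E) (mdim : ℕ) : Prop :=
  ∃ (c : ℕ) (U : Set E) (ρ : E → Fin c → ℝ),
    IsOpen U ∧ q ∈ U ∧ mdim + c = Module.finrank ℝ E ∧
    (∀ k, AnalyticOnNhd ℝ (fun z => ρ z k) U) ∧
    (S ∩ U = {z | z ∈ U ∧ ∀ k, ρ z k = 0}) ∧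
    ∀ x ∈ S ∩ U, LinearIndependent ℝ (fun k : Fin c => fderiv ℝ (fun z => ρ z k) x)

/-- The tangent space of a set at a point: the span of the tangent cone. -/
def tangentSpaceAt {E : Type*} [NormedAddCommGroup E] [NormedSpace ℝ E] (S : Set E) (q : E) :
    Submodule ℝ E := Submodule.span ℝ (tangentConeAt ℝ S q)

/-- Multiplication by `i` on `ℂ^n` as an `ℝ`-linear map. -/
def mulI {n : ℕ} : Cn n →ₗ[ℝ] Cn n :=
  (LinearMap.lsmul ℂ (Cn n) Complex.I).restrictScalars ℝ

/-- `M` (a generic submanifold of codimension `d`, hence of real dimension `2n - d`) is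
minimal at `p`: there is no real-analytic submanifold `S ⊆ M` through `p` of strictly
smaller dimension whose tangent spaces contain the complex tangent spaces of `M`. -/
def IsMinimalAt {n : ℕ} (M : Set (Cn n)) (d : ℕ) (p : Cn n) : Prop :=
  ¬ ∃ (S : Set (Cn n)) (mdim : ℕ), S ⊆ M ∧ p ∈ S ∧ mdim < 2 * n - d ∧
      (∀ q ∈ S, IsRASubmanifoldAt S q mdim) ∧
      ∀ q ∈ S, tangentSpaceAt M q ⊓ (tangentSpaceAt M q).map mulI ≤ tangentSpaceAt S q

/-- A real-analytic CR vector field of `M` near `p`. -/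
structure CRVectorField {N : ℕ} (M : Set (Cn N)) (p : Cn N) where
  coeff : Cn N → Fin N → ℂ
  dom : Set (Cn N)
  isOpen : IsOpen dom
  mem : p ∈ dom
  analytic : ∀ j, AnalyticOnNhd ℝ (fun z => coeff z j) dom
  tangent : ∀ (f : Cn N → ℝ) (U : Set (Cn N)), IsOpen U → p ∈ U → AnalyticOnNhd ℝ f U →
    (∀ z ∈ M ∩ U, f z = 0) →
    ∃ V, IsOpen V ∧ p ∈ V ∧ ∀ z ∈ M ∩ V, (∑ j, coeff z j * wirtDBarR f z j) = 0

/-- Application of a CR vector field to a complex-valued function. -/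
def CRVectorField.apply {N : ℕ} {M : Set (Cn N)} {p : Cn N} (L : CRVectorField M p)
    (g : Cn N → ℂ) : Cn N → ℂ := fun z => ∑ j, L.coeff z j * wirtDBar g z j

/-- Iterated application `L̄₁ ⋯ L̄ₖ g` of a list of CR vector fields. -/
def CRApplyList {N : ℕ} {M : Set (Cn N)} {p : Cn N} (Ls : List (CRVectorField M p))
    (g : Cn N → ℂ) : Cn N → ℂ := Ls.foldr CRVectorField.apply g

/-- `H` is finitely nondegenerate of order at most `ℓ` at `p` (as a map of `M` into `M'`). -/
def FinNondeg {N N' : ℕ} (M : Set (Cn N)) (p : Cn N) (M' : Set (Cn N')) (ℓ : ℕ)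
    (H : Cn N → Cn N') : Prop :=
  Submodule.span ℂ
    { v : Fin N' → ℂ | ∃ (Ls : List (CRVectorField M p)) (ρ' : Cn N' → ℝ) (U' : Set (Cn N')),
        Ls.length ≤ ℓ ∧ IsOpen U' ∧ H p ∈ U' ∧ AnalyticOnNhd ℝ ρ' U' ∧
        (∀ w ∈ M' ∩ U', ρ' w = 0) ∧
        v = fun j => CRApplyList Ls (fun z => wirtD ρ' (H z) j) p } = ⊤

/-- The mapping locus `E_ℓ ⊆ M'`. -/
def MappingLocus {N N' : ℕ} (M : Set (Cn N)) (p : Cn N) (M' : Set (Cn N')) (ℓ : ℕ) :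
    Set (Cn N') :=
  { p' | p' ∈ M' ∧ ∃ (Ω : Set (Cn N)) (H : Cn N → Cn N'),
      IsOpen Ω ∧ p ∈ Ω ∧ DifferentiableOn ℂ H Ω ∧ H p = p' ∧
      (∀ z ∈ M ∩ Ω, H z ∈ M') ∧ FinNondeg M p M' ℓ H }

/-- A semi-analytic subset of a real vector space. -/
def SemiAnalyticSet {E : Type*} [NormedAddCommGroup E] [NormedSpace ℝ E] (A : Set E) : Prop :=
  ∀ x : E, ∃ U : Set E, IsOpen U ∧ x ∈ U ∧
    ∃ (n k : ℕ) (f : Fin n → Fin k → E → ℝ) (iseq : Fin n → Fin k → Bool),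
      (∀ i j, AnalyticOnNhd ℝ (f i j) U) ∧
      A ∩ U = ⋃ i, ⋂ j, {x | x ∈ U ∧ if iseq i j then f i j x = 0 else 0 < f i j x}

/-- `A` is locally semi-analytic along `M'`. -/
def LocallySemiAnalyticOn {E : Type*} [NormedAddCommGroup E] [NormedSpace ℝ E]
    (M' A : Set E) : Prop :=
  ∀ q ∈ M', ∃ U : Set E, IsOpen U ∧ q ∈ U ∧ SemiAnalyticSet (A ∩ U)

/-- A real-analytic deformation `(M'_ε)_{ε ∈ X}` of generic submanifolds of codimension `d`
through `p' ∈ ℂ^{N'}`, parametrized by a compact semi-analytic set `X ⊆ ℝ^m`. -/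
structure Deformation (N' m d : ℕ) (p' : Cn N') where
  X : Set (Rm m)
  compact_X : IsCompact X
  semiAnalytic_X : SemiAnalyticSet X
  W : Set (Rm m)
  isOpen_W : IsOpen W
  X_subset_W : X ⊆ W
  U' : Set (Cn N')
  isOpen_U' : IsOpen U'
  basept_mem : p' ∈ U'
  ρ : Cn N' → Rm m → Fin d → ℝ
  analytic_ρ : ∀ k, AnalyticOnNhd ℝ (fun we : Cn N' × Rm m => ρ we.1 we.2 k) (U' ×ˢ W)
  basept : ∀ ε ∈ W, ∀ k, ρ p' ε k = 0
  generic : ∀ ε ∈ X, ∀ q ∈ U', (∀ k, ρ q ε k = 0) →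
    LinearIndependent ℂ (fun k : Fin d => wirtD (fun w => ρ w ε k) q)

/-- The fiber `M'_ε` of a deformation. -/
def Deformation.Mfib {N' m d : ℕ} {p' : Cn N'} (D : Deformation N' m d p') (ε : Rm m) :
    Set (Cn N') := {w | w ∈ D.U' ∧ ∀ k, D.ρ w ε k = 0}

/-- The mapping locus `E_ℓ ⊆ X` of a deformation. -/
def DefLocus {N N' m d : ℕ} (M : Set (Cn N)) (p : Cn N) {p' : Cn N'}
    (D : Deformation N' m d p') (ℓ : ℕ) : Set (Rm m) :=
  { ε | ε ∈ D.X ∧ ∃ (Ω : Set (Cn N)) (H : Cn N → Cn N'),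
      IsOpen Ω ∧ p ∈ Ω ∧ DifferentiableOn ℂ H Ω ∧ H p = p' ∧
      (∀ z ∈ M ∩ Ω, H z ∈ D.Mfib ε) ∧ FinNondeg M p (D.Mfib ε) ℓ H }

section AnalyticTools

variable {𝕜 : Type*} [RCLike 𝕜]
  {E : Type*} [NormedAddCommGroup E] [NormedSpace 𝕜 E]
  {F : Type*} [NormedAddCommGroup F] [NormedSpace 𝕜 F]
  {G : Type*} [NormedAddCommGroup G] [NormedSpace 𝕜 G]

@[fun_prop]
theorem AnalyticAt.clm_const_apply (L : F →L[𝕜] G) {f : E → F} {a : E} (hf : AnalyticAt 𝕜 f a) :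
    AnalyticAt 𝕜 (fun x => L (f x)) a :=
  (L.analyticAt _).comp hf

/-- Analytic inverse function theorem. -/
theorem AnalyticAt.exists_local_inverse [CompleteSpace E] [CompleteSpace F] {f : E → F} {a : E}
    (hf : AnalyticAt 𝕜 f a) (e : E ≃L[𝕜] F) (he : (e : E →L[𝕜] F) = fderiv 𝕜 f a) :
    ∃ g : F → E, AnalyticAt 𝕜 g (f a) ∧ g (f a) = a ∧ (∀ᶠ x in 𝓝 a, g (f x) = x) ∧
      ∀ᶠ y in 𝓝 (f a), f (g y) = y := by
  have hc : ContDiffAt 𝕜 ⊤ f a := hf.contDiffAt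
  have hd : HasFDerivAt f (e : E →L[𝕜] F) a := he ▸ hf.differentiableAt.hasFDerivAt
  have hs := hc.hasStrictFDerivAt' hd (by simp)
  refine ⟨hc.localInverse hd (by simp), ?_, ?_, ?_, ?_⟩
  · exact (hc.to_localInverse hd (by simp)).analyticAt
  · exact hc.localInverse_apply_image hd (by simp)
  · exact hs.eventually_left_inverse
  · exact hs.eventually_right_inverse

theorem AnalyticAt.exists_local_inverse_of_injective [FiniteDimensional 𝕜 E]
    [FiniteDimensional 𝕜 F] {f : E → F} {a : E} (hf : AnalyticAt 𝕜 f a)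
    (hinj : ∀ v, fderiv 𝕜 f a v = 0 → v = 0)
    (hdim : Module.finrank 𝕜 E = Module.finrank 𝕜 F) :
    ∃ g : F → E, AnalyticAt 𝕜 g (f a) ∧ g (f a) = a ∧ (∀ᶠ x in 𝓝 a, g (f x) = x) ∧
      ∀ᶠ y in 𝓝 (f a), f (g y) = y := by
  have := FiniteDimensional.complete 𝕜 E
  have := FiniteDimensional.complete 𝕜 F
  have hi : Function.Injective (fderiv 𝕜 f a : E →ₗ[𝕜] F) :=
    (injective_iff_map_eq_zero _).2 (by simpa using hinj)
  let e := LinearEquiv.ofInjectiveOfFinrankEq (fderiv 𝕜 f a : E →ₗ[𝕜] F) hi hdim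
  exact hf.exists_local_inverse e.toContinuousLinearEquiv (by ext v; rfl)

/-- A submersion has an analytic local section. -/
theorem AnalyticAt.exists_local_section [FiniteDimensional 𝕜 E]
    [FiniteDimensional 𝕜 F] {f : E → F} {a : E} (hf : AnalyticAt 𝕜 f a)
    (hsurj : ∀ w, ∃ v, fderiv 𝕜 f a v = w) :
    ∃ g : F → E, AnalyticAt 𝕜 g (f a) ∧ g (f a) = a ∧ ∀ᶠ y in 𝓝 (f a), f (g y) = y := by
  have := FiniteDimensional.complete 𝕜 E
  have := FiniteDimensional.complete 𝕜 F
  obtain ⟨B, hB⟩ := (fderiv 𝕜 f a : E →ₗ[𝕜] F).exists_rightInverse_of_surjective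
    (LinearMap.range_eq_top.2 hsurj)
  obtain ⟨L, hBL⟩ : ∃ L : F →L[𝕜] E, ∀ w, fderiv 𝕜 f a (L w) = w :=
    ⟨LinearMap.toContinuousLinearMap B, fun w => LinearMap.congr_fun hB w⟩
  let j : F → E := fun y => a + L (y - f a)
  have hj : AnalyticAt 𝕜 j (f a) := by
    simp only [j]; fun_prop
  have hja : j (f a) = a := by simp [j]
  have hfj : AnalyticAt 𝕜 (f ∘ j) (f a) := by
    apply AnalyticAt.comp _ hj; rwa [hja]
  have hjd : HasFDerivAt j L (f a) := by
    have := HasFDerivAt.comp (f := fun y => y - f a) (f a) (L.hasFDerivAt (x := f a - f a))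
      ((hasFDerivAt_id (𝕜 := 𝕜) (f a)).sub_const (f a))
    exact this.const_add a
  have hd : fderiv 𝕜 (f ∘ j) (f a) = ContinuousLinearMap.id 𝕜 F := by
    have h1 : HasFDerivAt f (fderiv 𝕜 f a) (j (f a)) := by
      rw [hja]; exact hf.differentiableAt.hasFDerivAt
    rw [(h1.comp (f a) hjd).fderiv]
    ext w; simp [hBL]
  obtain ⟨g, h1, h2, h3, h4⟩ := hfj.exists_local_inverse (ContinuousLinearEquiv.refl 𝕜 F)
    (by rw [hd]; rfl)
  have hfa : (f ∘ j) (f a) = f a := by simp [hja]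
  rw [hfa] at h1 h2 h4
  refine ⟨j ∘ g, ?_, by simp [h2, hja], h4⟩
  exact AnalyticAt.comp (by rwa [h2]) h1

end AnalyticTools

theorem exists_continuous_projection (𝕜 : Type*) [RCLike 𝕜] {F : Type*} [NormedAddCommGroup F]
    [NormedSpace 𝕜 F] [FiniteDimensional 𝕜 F] (V : Submodule 𝕜 F) :
    ∃ P : F →L[𝕜] V, ∀ v : V, P v = v := by
  obtain ⟨P, hP⟩ := V.subtype.exists_leftInverse_of_injective V.ker_subtype
  exact ⟨LinearMap.toContinuousLinearMap P, fun v => LinearMap.congr_fun hP v⟩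

section ConstantRank

variable {E : Type*} [NormedAddCommGroup E] [NormedSpace ℝ E] [FiniteDimensional ℝ E]
  {F : Type*} [NormedAddCommGroup F] [NormedSpace ℝ F] [FiniteDimensional ℝ F]

/-- Constant rank theorem: `f` factors locally through a projection onto the range of its
derivative at `a`. -/
theorem AnalyticAt.exists_factor_of_rank_le {f : E → F} {a : E} (hf : AnalyticAt ℝ f a)
    (V : Submodule ℝ F) (hV : (fderiv ℝ f a : E →ₗ[ℝ] F).range = V)
    (hr : ∀ᶠ x in 𝓝 a, Module.finrank ℝ (fderiv ℝ f x : E →ₗ[ℝ] F).range ≤ Module.finrank ℝ V)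
    (P : F →L[ℝ] V) (hP : ∀ v : V, P v = v) :
    ∃ h : V → F, AnalyticAt ℝ h (P (f a)) ∧ (∀ᶠ x in 𝓝 a, f x = h (P (f x))) ∧
      ∀ᶠ y in 𝓝 (P (f a)), P (h y) = y ∧ ∃ x, h y = f x := by
  let K := (fderiv ℝ f a : E →ₗ[ℝ] F).ker
  obtain ⟨Q, hQ⟩ := exists_continuous_projection ℝ K
  let ψ : E → V × K := fun x => (P (f x), Q x)
  have hψ : AnalyticAt ℝ ψ a := by
    have h1 : AnalyticAt ℝ (fun x => P (f x)) a := (P.analyticAt _).comp hf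
    exact h1.prod (Q.analyticAt a)
  have hfd := hf.differentiableAt.hasFDerivAt
  have hψd : HasFDerivAt ψ ((P.comp (fderiv ℝ f a)).prod Q) a :=
    (P.hasFDerivAt.comp a hfd).prodMk Q.hasFDerivAt
  have hmem : ∀ v, fderiv ℝ f a v ∈ V := fun v => hV ▸ ⟨v, rfl⟩
  obtain ⟨g, g1, g2, g3, g4⟩ := hψ.exists_local_inverse_of_injective (by
      intro v hv
      rw [hψd.fderiv] at hv
      simp only [ContinuousLinearMap.prod_apply, ContinuousLinearMap.comp_apply,
        Prod.mk_eq_zero] at hv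
      have h1 := hP ⟨_, hmem v⟩
      rw [hv.1] at h1
      have h2 : fderiv ℝ f a v = 0 := by simpa using (congrArg Subtype.val h1).symm
      have h3 := hQ ⟨v, h2⟩
      rw [hv.2] at h3
      simpa using (congrArg Subtype.val h3).symm) (by
      rw [Module.finrank_prod, ← hV]
      exact ((fderiv ℝ f a : E →ₗ[ℝ] F).finrank_range_add_finrank_ker).symm)
  -- near `a`, `P` is injective on the range of the derivative
  have hinj : ∀ᶠ x in 𝓝 a, ∀ u, P (fderiv ℝ f x u) = 0 → fderiv ℝ f x u = 0 := by
    obtain ⟨B, hB⟩ : ∃ B : V →L[ℝ] E, ∀ w, P (fderiv ℝ f a (B w)) = w := by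
      obtain ⟨B, hB⟩ := ((P.comp (fderiv ℝ f a)) : E →ₗ[ℝ] V).exists_rightInverse_of_surjective
        (LinearMap.range_eq_top.2 (by
          rintro ⟨w, hw⟩
          obtain ⟨v, rfl⟩ := hV ▸ hw
          exact ⟨v, hP ⟨_, hw⟩⟩))
      exact ⟨LinearMap.toContinuousLinearMap B, fun w => LinearMap.congr_fun hB w⟩
    have hcont : ContinuousAt (fun x => P.comp ((fderiv ℝ f x).comp B)) a := by
      have := hf.fderiv.continuousAt
      fun_prop
    have hunit : ∀ᶠ x in 𝓝 a, IsUnit (P.comp ((fderiv ℝ f x).comp B)) := by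
      apply hcont.eventually (p := IsUnit)
      have h0 : P.comp ((fderiv ℝ f a).comp B) = 1 := by
        ext w; simp [hB]
      have := FiniteDimensional.complete ℝ V
      have h1 : {T : V →L[ℝ] V | IsUnit T} ∈ 𝓝 (1 : V →L[ℝ] V) :=
        (Units.isOpen (R := V →L[ℝ] V)).mem_nhds isUnit_one
      rw [← h0] at h1
      exact h1
    filter_upwards [hunit, hr] with x hx hrx u hu
    have hsur : Function.Surjective
        ((P : F →ₗ[ℝ] V).domRestrict (fderiv ℝ f x : E →ₗ[ℝ] F).range) := by
      intro w
      obtain ⟨T, hT⟩ := hx.exists_right_inv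
      refine ⟨⟨fderiv ℝ f x (B (T w)), ⟨_, rfl⟩⟩, ?_⟩
      simpa using DFunLike.congr_fun hT w
    have hle := LinearMap.finrank_le_finrank_of_surjective hsur
    have := (LinearMap.injective_iff_surjective_of_finrank_eq_finrank
      (le_antisymm hrx hle)).2 hsur
    have h0 := @this ⟨fderiv ℝ f x u, ⟨u, rfl⟩⟩ 0 (by simpa using hu)
    simpa using congrArg Subtype.val h0
  have hga : AnalyticAt ℝ f (g (ψ a)) := by rwa [g2]
  have hfg : AnalyticAt ℝ (fun q => f (g q)) (ψ a) := hga.comp g1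
  -- the composite does not depend on the second variable
  have hder : ∀ᶠ q in 𝓝 (ψ a), ∀ κ : K, fderiv ℝ (fun q => f (g q)) q (0, κ) = 0 := by
    have c1 : Filter.Tendsto g (𝓝 (ψ a)) (𝓝 a) := by
      simpa [ContinuousAt, g2] using g1.continuousAt
    filter_upwards [c1.eventually hinj, c1.eventually hf.eventually_analyticAt,
      g1.eventually_analyticAt, g4.eventually_nhds] with q h1 h2 h3 h4 κ
    have e1 : HasFDerivAt (fun q => f (g q)) ((fderiv ℝ f (g q)).comp (fderiv ℝ g q)) q :=
      h2.differentiableAt.hasFDerivAt.comp q h3.differentiableAt.hasFDerivAt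
    have e2 := P.hasFDerivAt.comp q e1
    have e3 : HasFDerivAt (fun q : V × K => q.1) (P.comp ((fderiv ℝ f (g q)).comp (fderiv ℝ g q))) q :=
      e2.congr_of_eventuallyEq (by
        filter_upwards [h4] with y hy
        exact (congrArg Prod.fst hy).symm)
    have e4 := e3.unique hasFDerivAt_fst
    rw [e1.fderiv]
    apply h1
    simpa using DFunLike.congr_fun e4 (0, κ)
  have hG : ∀ᶠ q in 𝓝 (ψ a), f (g q) = f (g (q.1, Q a)) := by
    obtain ⟨ε, hε, hball⟩ := Metric.eventually_nhds_iff_ball.1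
      (hder.and hfg.eventually_analyticAt)
    filter_upwards [Metric.ball_mem_nhds _ hε] with q hq
    have hconv : Convex ℝ (Metric.ball (ψ a).2 ε) := convex_ball _ _
    have hmemb : ∀ k ∈ Metric.ball (ψ a).2 ε, (q.1, k) ∈ Metric.ball (ψ a) ε := by
      intro k hk
      rw [Metric.mem_ball, Prod.dist_eq] at hq ⊢
      exact max_lt (lt_of_le_of_lt (le_max_left _ _) hq) hk
    have hdk : ∀ k ∈ Metric.ball (ψ a).2 ε,
        HasFDerivAt (fun k => f (g (q.1, k))) (0 : K →L[ℝ] F) k := by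
      intro k hk
      obtain ⟨h1, h2⟩ := hball _ (hmemb k hk)
      have := h2.differentiableAt.hasFDerivAt.comp k (hasFDerivAt_prodMk_right q.1 k)
      refine this.congr_fderiv ?_
      ext κ
      simpa using h1 κ
    have hq2 : q.2 ∈ Metric.ball (ψ a).2 ε := by
      rw [Metric.mem_ball, Prod.dist_eq] at hq
      exact lt_of_le_of_lt (le_max_right _ _) hq
    exact hconv.is_const_of_fderivWithin_eq_zero (𝕜 := ℝ) (f := fun k => f (g (q.1, k)))
      (fun k hk => (hdk k hk).differentiableAt.differentiableWithinAt)
      (fun k hk => by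
        rw [fderivWithin_of_isOpen Metric.isOpen_ball hk, (hdk k hk).fderiv]) hq2
      (Metric.mem_ball_self hε)
  refine ⟨fun y => f (g (y, Q a)), ?_, ?_, ?_⟩
  · exact hfg.comp₂ analyticAt_id analyticAt_const
  · filter_upwards [g3, hψ.continuousAt.eventually hG] with x h1 h2
    rw [h1] at h2
    exact h2
  · have c : ContinuousAt (fun y : V => (y, Q a)) (P (f a)) := by fun_prop
    filter_upwards [c.eventually g4] with y hy
    exact ⟨congrArg Prod.fst hy, _, rfl⟩

end ConstantRank

section AnalyticTools

variable {𝕜 : Type*} [RCLike 𝕜]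
  {E : Type*} [NormedAddCommGroup E] [NormedSpace 𝕜 E]
  {F : Type*} [NormedAddCommGroup F] [NormedSpace 𝕜 F]
  {G : Type*} [NormedAddCommGroup G] [NormedSpace 𝕜 G]

@[fun_prop]
theorem AnalyticAt.fst_comp {f : E → F × G} {a : E} (hf : AnalyticAt 𝕜 f a) :
    AnalyticAt 𝕜 (fun x => (f x).1) a := analyticAt_fst.comp hf

@[fun_prop]
theorem AnalyticAt.snd_comp {f : E → F × G} {a : E} (hf : AnalyticAt 𝕜 f a) :
    AnalyticAt 𝕜 (fun x => (f x).2) a := analyticAt_snd.comp hf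

@[fun_prop]
theorem AnalyticAt.clm_apply_of {A : E → F →L[𝕜] G} {v : E → F} {a : E}
    (hA : AnalyticAt 𝕜 A a) (hv : AnalyticAt 𝕜 v a) : AnalyticAt 𝕜 (fun x => A x (v x)) a :=
  ((ContinuousLinearMap.id 𝕜 (F →L[𝕜] G)).analyticAt_bilinear (A a, v a)).comp₂ hA hv

theorem AnalyticAt.comp_eq {g : F → G} {f : E → F} {a : E} {b : F} (hg : AnalyticAt 𝕜 g b)
    (hf : AnalyticAt 𝕜 f a) (h : f a = b) : AnalyticAt 𝕜 (fun x => g (f x)) a := by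
  subst h; exact hg.comp hf

theorem AnalyticAt.fderiv_apply_const [CompleteSpace F] {f : E → F} {a : E} (hf : AnalyticAt 𝕜 f a)
    (v : E) : AnalyticAt 𝕜 (fun x => fderiv 𝕜 f x v) a :=
  hf.fderiv.clm_apply_of analyticAt_const

/-- The level set of a submersion is parametrized by the kernel of its derivative. -/
theorem AnalyticAt.exists_level_chart [FiniteDimensional 𝕜 E]
    [FiniteDimensional 𝕜 F] {f : E → F} {a : E} (hf : AnalyticAt 𝕜 f a)
    (hsurj : ∀ w, ∃ v, fderiv 𝕜 f a v = w) {K : Submodule 𝕜 E}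
    (hK : ∀ v, v ∈ K ↔ fderiv 𝕜 f a v = 0) (Q : E →L[𝕜] K) (hQ : ∀ v : K, Q v = v) :
    ∃ φ : K → E, AnalyticAt 𝕜 φ 0 ∧ φ 0 = a ∧
      (∀ᶠ t in 𝓝 0, f (φ t) = f a ∧ Q (φ t - a) = t) ∧
      ∀ᶠ x in 𝓝 a, f x = f a → φ (Q (x - a)) = x := by
  let ψ : E → F × K := fun x => (f x, Q (x - a))
  have hψ : AnalyticAt 𝕜 ψ a := by
    have h1 : AnalyticAt 𝕜 (fun x => Q (x - a)) a := by fun_prop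
    exact hf.prod h1
  have hψa : ψ a = (f a, 0) := by simp [ψ]
  have hψd : HasFDerivAt ψ ((fderiv 𝕜 f a).prod Q) a :=
    hf.differentiableAt.hasFDerivAt.prodMk
      (HasFDerivAt.comp (f := fun x => x - a) a Q.hasFDerivAt ((hasFDerivAt_id a).sub_const a))
  have hKe : K = (fderiv 𝕜 f a : E →ₗ[𝕜] F).ker := by ext v; simp [hK]
  obtain ⟨g, g1, g2, g3, g4⟩ := hψ.exists_local_inverse_of_injective (by
      intro v hv
      rw [hψd.fderiv] at hv
      simp only [ContinuousLinearMap.prod_apply, Prod.mk_eq_zero] at hv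
      obtain ⟨hv1, hv2⟩ := hv
      have h3 := hQ ⟨v, (hK v).2 hv1⟩
      rw [hv2] at h3
      simpa using (congrArg Subtype.val h3).symm) (by
      rw [Module.finrank_prod, hKe, ← (fderiv 𝕜 f a : E →ₗ[𝕜] F).finrank_range_add_finrank_ker,
        LinearMap.range_eq_top.2 hsurj, finrank_top])
  rw [hψa] at g1 g2 g4
  have hc : ContinuousAt (fun t : K => (f a, t)) 0 := by fun_prop
  refine ⟨fun t => g (f a, t), ?_, g2, ?_, ?_⟩
  · exact g1.comp₂ analyticAt_const analyticAt_id
  · filter_upwards [hc.eventually g4] with t ht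
    exact ⟨congrArg Prod.fst ht, congrArg Prod.snd ht⟩
  · filter_upwards [g3] with x hx hfx
    rw [← hfx]; exact hx

/-- A function vanishing on the level set of a submersion has derivative vanishing on the
kernel of the derivative of the submersion. -/
theorem AnalyticAt.fderiv_eq_zero_of_level [FiniteDimensional 𝕜 E]
    [FiniteDimensional 𝕜 F] {f : E → F} {a : E} (hf : AnalyticAt 𝕜 f a)
    (hsurj : ∀ w, ∃ v, fderiv 𝕜 f a v = w) {g : E → G} (hg : DifferentiableAt 𝕜 g a)
    (h0 : ∀ᶠ x in 𝓝 a, f x = f a → g x = 0) {v : E} (hv : fderiv 𝕜 f a v = 0) :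
    fderiv 𝕜 g a v = 0 := by
  let K := (fderiv 𝕜 f a : E →ₗ[𝕜] F).ker
  obtain ⟨Q, hQ⟩ := exists_continuous_projection 𝕜 K
  obtain ⟨φ, h1, h2, h3, -⟩ := hf.exists_level_chart hsurj (K := K) (fun v => Iff.rfl) Q hQ
  have hφ := h1.differentiableAt.hasFDerivAt
  have e1 : fderiv 𝕜 f a (fderiv 𝕜 φ 0 ⟨v, hv⟩) = 0 := by
    have a1 : HasFDerivAt f (fderiv 𝕜 f a) (φ 0) := by
      rw [h2]; exact hf.differentiableAt.hasFDerivAt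
    have a2 := a1.comp 0 hφ
    have a3 := a2.unique ((hasFDerivAt_const (f a) (0 : K)).congr_of_eventuallyEq
      (h3.mono fun t ht => ht.1))
    simpa using DFunLike.congr_fun a3 ⟨v, hv⟩
  have e2 : Q (fderiv 𝕜 φ 0 ⟨v, hv⟩) = ⟨v, hv⟩ := by
    have a2 := Q.hasFDerivAt.comp 0 (hφ.sub_const a)
    have a3 := a2.unique ((hasFDerivAt_id (0 : K)).congr_of_eventuallyEq
      (h3.mono fun t ht => ht.2))
    simpa using DFunLike.congr_fun a3 ⟨v, hv⟩
  have e3 : fderiv 𝕜 φ 0 ⟨v, hv⟩ = v := by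
    have := hQ ⟨_, e1⟩
    rw [e2] at this
    exact (congrArg Subtype.val this).symm
  have a1 : HasFDerivAt g (fderiv 𝕜 g a) (φ 0) := by
    rw [h2]; exact hg.hasFDerivAt
  have a2 := a1.comp 0 hφ
  have hc : Filter.Tendsto φ (𝓝 0) (𝓝 a) := by simpa [ContinuousAt, h2] using h1.continuousAt
  have a3 := a2.unique ((hasFDerivAt_const (0 : G) (0 : K)).congr_of_eventuallyEq (by
    filter_upwards [h3, hc.eventually h0] with t ht1 ht2
    exact ht2 ht1.1))
  have := DFunLike.congr_fun a3 ⟨v, hv⟩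
  simpa [e3] using this

/-- Implicit function theorem with local uniqueness. -/
theorem AnalyticAt.exists_implicit [FiniteDimensional 𝕜 E] [FiniteDimensional 𝕜 F]
    [FiniteDimensional 𝕜 G] {g : E × F → G} {w₀ : E} {y₀ : F} (hg : AnalyticAt 𝕜 g (w₀, y₀))
    (h0 : g (w₀, y₀) = 0) (hinj : ∀ v, fderiv 𝕜 g (w₀, y₀) (v, 0) = 0 → v = 0)
    (hdim : Module.finrank 𝕜 E = Module.finrank 𝕜 G) :
    ∃ Φ : F → E, AnalyticAt 𝕜 Φ y₀ ∧ Φ y₀ = w₀ ∧ (∀ᶠ y in 𝓝 y₀, g (Φ y, y) = 0) ∧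
      ∀ᶠ q in 𝓝 (w₀, y₀), g q = 0 → q.1 = Φ q.2 := by
  let ψ : E × F → G × F := fun q => (g q, q.2)
  have hψ : AnalyticAt 𝕜 ψ (w₀, y₀) := hg.prod analyticAt_snd
  have hψd : HasFDerivAt ψ ((fderiv 𝕜 g (w₀, y₀)).prod (ContinuousLinearMap.snd 𝕜 E F))
      (w₀, y₀) := hg.differentiableAt.hasFDerivAt.prodMk hasFDerivAt_snd
  obtain ⟨k, k1, k2, k3, k4⟩ := hψ.exists_local_inverse_of_injective (by
      rintro ⟨v, u⟩ hv
      rw [hψd.fderiv] at hv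
      simp only [ContinuousLinearMap.prod_apply, Prod.mk_eq_zero,
        ContinuousLinearMap.coe_snd'] at hv
      obtain ⟨h1, rfl⟩ := hv
      rw [hinj v h1]; rfl) (by
      rw [Module.finrank_prod, Module.finrank_prod, hdim])
  have hψa : ψ (w₀, y₀) = (0, y₀) := by simp [ψ, h0]
  rw [hψa] at k1 k2 k4
  have hc : ContinuousAt (fun y : F => ((0 : G), y)) y₀ := by fun_prop
  refine ⟨fun y => (k (0, y)).1, ?_, by simp [k2], ?_, ?_⟩
  · exact (k1.comp₂ analyticAt_const analyticAt_id).fst_comp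
  · filter_upwards [hc.eventually k4] with y hy
    have h2 : (k (0, y)).2 = y := congrArg Prod.snd hy
    have h1 : g (k (0, y)) = 0 := congrArg Prod.fst hy
    rw [← Prod.mk.eta (p := k (0, y)), h2] at h1
    exact h1
  · filter_upwards [k3] with q hq hgq
    rw [← hgq]
    exact (congrArg Prod.fst hq).symm

/-- If every member of a derivation-stable class of analytic functions vanishes at `a`, then
the members vanish near `a`. -/
theorem eventually_eq_zero_of_fderiv_stable [CompleteSpace F] (𝒞 : (E → F) → Prop) {a : E}
    (h0 : ∀ g, 𝒞 g → AnalyticAt 𝕜 g a ∧ g a = 0)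
    (hD : ∀ g, 𝒞 g → ∀ v, 𝒞 fun x => fderiv 𝕜 g x v) {g : E → F} (hg : 𝒞 g) :
    ∀ᶠ x in 𝓝 a, g x = 0 := by
  have key : ∀ n : ℕ, ∀ g, 𝒞 g → ∀ m, iteratedFDeriv 𝕜 n g a m = 0 := by
    intro n
    induction n with
    | zero => intro g hg m; simpa using (h0 g hg).2
    | succ n ih =>
      intro g hg m
      rw [iteratedFDeriv_succ_apply_right]
      have hc : ContDiffAt 𝕜 n (fun y => fderiv 𝕜 g y) a := (h0 g hg).1.fderiv.contDiffAt
      have := (ContinuousLinearMap.apply 𝕜 F (m (Fin.last n))).iteratedFDeriv_comp_left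
        hc le_rfl
      have h2 := ih _ (hD g hg (m (Fin.last n))) (Fin.init m)
      rw [← h2]
      exact (DFunLike.congr_fun this (Fin.init m)).symm
  obtain ⟨P, r, hP⟩ := (h0 g hg).1
  have hr := hP.r_pos
  filter_upwards [Metric.eball_mem_nhds a hr] with x hx
  have hx' : x - a ∈ Metric.eball (0 : E) r := by
    rw [Metric.mem_eball] at hx ⊢
    simpa [edist_eq_enorm_sub] using hx
  have := hP.hasSum_iteratedFDeriv hx'
  simp only [key _ g hg, smul_zero, add_sub_cancel] at this
  exact this.unique hasSum_zero

end AnalyticTools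

section Minors

variable {X : Type*} [NormedAddCommGroup X] [NormedSpace ℝ X]

/-- The minor of a family of covector fields on a family of vectors. -/
def covMinor {k : ℕ} (ω : Fin k → X → X →L[ℝ] ℝ) (v : Fin k → X) (x : X) : ℝ :=
  (Matrix.of fun i j => ω i x (v j)).det

theorem covMinor_analyticAt {k : ℕ} {ω : Fin k → X → X →L[ℝ] ℝ} (v : Fin k → X) {x : X}
    (h : ∀ i, AnalyticAt ℝ (ω i) x) : AnalyticAt ℝ (covMinor ω v) x := by
  have h1 : ∀ i j, AnalyticAt ℝ (fun x => ω i x (v j)) x := fun i j =>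
    (h i).clm_apply_of analyticAt_const
  unfold covMinor
  simp only [Matrix.det_apply]
  refine Finset.analyticAt_fun_sum _ fun σ _ => ?_
  simp only [Units.smul_def, zsmul_eq_mul]
  exact analyticAt_const.mul (Finset.analyticAt_fun_prod _ fun i _ => h1 _ _)

theorem covMinor_surjective {k : ℕ} {ω : Fin k → X → X →L[ℝ] ℝ} {v : Fin k → X} {x : X}
    (h : covMinor ω v x ≠ 0) (w : Fin k → ℝ) : ∃ u, ∀ i, ω i x u = w i := by
  obtain ⟨c, hc⟩ := (Matrix.mulVec_surjective_iff_isUnit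
    (A := Matrix.of fun i j => ω i x (v j))).2
    ((Matrix.isUnit_iff_isUnit_det _).2 (isUnit_iff_ne_zero.2 h)) w
  refine ⟨∑ j, c j • v j, fun i => ?_⟩
  rw [← hc]
  simp [Matrix.mulVec, dotProduct, map_sum, mul_comm]

theorem covMinor_snoc {k : ℕ} {ω : Fin k → X → X →L[ℝ] ℝ} {v : Fin k → X} {x u : X}
    {η : X → X →L[ℝ] ℝ} (hu : ∀ i, ω i x u = 0) :
    covMinor (Fin.snoc (α := fun _ => X → X →L[ℝ] ℝ) ω η) (Fin.snoc (α := fun _ => X) v u) x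
      = covMinor ω v x * η x u := by
  unfold covMinor
  rw [← Matrix.det_submatrix_equiv_self finSumFinEquiv]
  have : ((Matrix.of fun i j => (Fin.snoc (α := fun _ => X → X →L[ℝ] ℝ) ω η : Fin (k + 1) → _) i x
      ((Fin.snoc (α := fun _ => X) v u : Fin (k + 1) → X) j)).submatrix finSumFinEquiv
        finSumFinEquiv) =
      Matrix.fromBlocks (Matrix.of fun i j => ω i x (v j)) 0
        (Matrix.of fun (_ : Fin 1) j => η x (v j)) (Matrix.of fun (_ _ : Fin 1) => η x u) := by
    have hl : ∀ i : Fin 1, Fin.natAdd k i = Fin.last k := fun i => by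
      ext; simp
    have hc : ∀ i : Fin k, Fin.castAdd 1 i = Fin.castSucc i := fun i => rfl
    ext (i | i) (j | j) <;> simp [hl, hc, hu]
  rw [this, Matrix.det_fromBlocks_zero₁₂]
  simp

variable [FiniteDimensional ℝ X]

theorem covMinor_le_finrank {k : ℕ} {ω : Fin k → X → X →L[ℝ] ℝ} {v : Fin k → X} {x : X}
    (h : covMinor ω v x ≠ 0) : k ≤ Module.finrank ℝ X := by
  have := LinearMap.finrank_le_finrank_of_surjective
    (f := LinearMap.pi fun i => (ω i x : X →ₗ[ℝ] ℝ)) (fun w => by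
      obtain ⟨u, hu⟩ := covMinor_surjective h w
      exact ⟨u, funext hu⟩)
  simpa using this

theorem finrank_ker_of_covMinor {k : ℕ} {ω : Fin k → X → X →L[ℝ] ℝ} {v : Fin k → X} {x : X}
    (h : covMinor ω v x ≠ 0) (W : Submodule ℝ X) (hW : ∀ u, u ∈ W ↔ ∀ i, ω i x u = 0) :
    k + Module.finrank ℝ W = Module.finrank ℝ X := by
  let L : X →ₗ[ℝ] Fin k → ℝ := LinearMap.pi fun i => (ω i x : X →ₗ[ℝ] ℝ)
  have hL : W = L.ker := by ext u; simp [hW, L, funext_iff]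
  have := L.finrank_range_add_finrank_ker
  rw [LinearMap.range_eq_top.2 (fun w => by
      obtain ⟨u, hu⟩ := covMinor_surjective h w
      exact ⟨u, funext hu⟩), finrank_top] at this
  rw [hL]; simpa using this

/-- A set of covector fields has a minor of maximal size on a nonempty set. -/
theorem exists_maximal_covMinor (𝒟 : Set (X → X →L[ℝ] ℝ)) {S : Set X} (hS : S.Nonempty) :
    ∃ (k : ℕ) (ω : Fin k → X → X →L[ℝ] ℝ) (v : Fin k → X), (∀ i, ω i ∈ 𝒟) ∧
      (∃ x ∈ S, covMinor ω v x ≠ 0) ∧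
      ∀ x ∈ S, ∀ η ∈ 𝒟, ∀ u,
        covMinor (Fin.snoc (α := fun _ => X → X →L[ℝ] ℝ) ω η) (Fin.snoc (α := fun _ => X) v u) x
          = 0 := by
  let Pr : ℕ → Prop := fun k => ∃ (ω : Fin k → X → X →L[ℝ] ℝ) (v : Fin k → X),
    (∀ i, ω i ∈ 𝒟) ∧ ∃ x ∈ S, covMinor ω v x ≠ 0
  have hb : ∀ k, Pr k → k ≤ Module.finrank ℝ X := by
    rintro k ⟨ω, v, -, x, -, h⟩; exact covMinor_le_finrank h
  have h0 : Pr 0 := by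
    obtain ⟨x, hx⟩ := hS
    exact ⟨Fin.elim0, Fin.elim0, fun i => i.elim0, x, hx, by simp [covMinor]⟩
  classical
  have hk := Nat.findGreatest_spec (P := Pr) (Nat.zero_le (Module.finrank ℝ X)) h0
  obtain ⟨ω, v, h1, h2⟩ := hk
  refine ⟨_, ω, v, h1, h2, ?_⟩
  intro x hx η hη u
  by_contra hne
  have hP : Pr (Nat.findGreatest Pr (Module.finrank ℝ X) + 1) := by
    refine ⟨_, _, ?_, x, hx, hne⟩
    intro i
    refine Fin.lastCases ?_ (fun i => ?_) i
    · simpa using hη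
    · simpa using h1 i
  have := Nat.le_findGreatest (hb _ hP) hP
  omega

end Minors

section Vanishing

variable {E : Type*} [NormedAddCommGroup E] [NormedSpace ℝ E]

/-- All iterated directional derivatives of `g` of order at most `m` vanish at `a`. -/
def VanishTo : ℕ → (E → ℝ) → E → Prop
  | 0, g, a => g a = 0
  | m + 1, g, a => g a = 0 ∧ ∀ v, VanishTo m (fun x => fderiv ℝ g x v) a

theorem VanishTo.pred {m : ℕ} : ∀ {g : E → ℝ} {a : E}, VanishTo (m + 1) g a → VanishTo m g a := by
  induction m with
  | zero => intro g a h; exact h.1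
  | succ m ih => intro g a h; exact ⟨h.1, fun v => ih (h.2 v)⟩

theorem VanishTo.congr {m : ℕ} : ∀ {g g' : E → ℝ} {a : E}, VanishTo m g a → g =ᶠ[𝓝 a] g' →
    VanishTo m g' a := by
  induction m with
  | zero => intro g g' a h e; exact e.eq_of_nhds.symm.trans h
  | succ m ih =>
    intro g g' a h e
    refine ⟨e.eq_of_nhds ▸ h.1, fun v => ih (h.2 v) ?_⟩
    filter_upwards [e.fderiv (𝕜 := ℝ)] with x hx
    rw [hx]

theorem VanishTo.add {m : ℕ} : ∀ {g g' : E → ℝ} {a : E}, VanishTo m g a → VanishTo m g' a →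
    AnalyticAt ℝ g a → AnalyticAt ℝ g' a → VanishTo m (fun x => g x + g' x) a := by
  induction m with
  | zero => intro g g' a h h' _ _; simp only [VanishTo] at *; rw [h, h', add_zero]
  | succ m ih =>
    intro g g' a h h' hg hg'
    refine ⟨by simp [h.1, h'.1], fun v => ?_⟩
    refine (ih (h.2 v) (h'.2 v) (hg.fderiv_apply_const v) (hg'.fderiv_apply_const v)).congr ?_
    filter_upwards [hg.eventually_analyticAt, hg'.eventually_analyticAt] with x hx hx'
    have := (hx.differentiableAt.hasFDerivAt.add hx'.differentiableAt.hasFDerivAt).fderiv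
    change _ = fderiv ℝ (g + g') x v
    rw [this]; rfl

theorem VanishTo.mul {m : ℕ} : ∀ {c g : E → ℝ} {a : E}, VanishTo m g a →
    AnalyticAt ℝ c a → AnalyticAt ℝ g a → VanishTo m (fun x => c x * g x) a := by
  induction m with
  | zero => intro c g a h _ _; simp only [VanishTo] at *; rw [h, mul_zero]
  | succ m ih =>
    intro c g a h hc hg
    refine ⟨by simp [h.1], fun v => ?_⟩
    refine ((ih (h.2 v) hc (hg.fderiv_apply_const v)).add
      (ih h.pred (hc.fderiv_apply_const v) hg) (hc.mul (hg.fderiv_apply_const v))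
      ((hc.fderiv_apply_const v).mul hg)).congr ?_
    filter_upwards [hc.eventually_analyticAt, hg.eventually_analyticAt] with x hx hx'
    have := (hx.differentiableAt.hasFDerivAt.mul hx'.differentiableAt.hasFDerivAt).fderiv
    change _ = fderiv ℝ (c * g) x v
    rw [this]; simp [mul_comm]

theorem VanishTo.zero_fun {m : ℕ} : ∀ {a : E}, VanishTo m (fun _ => 0) a := by
  induction m with
  | zero => intro a; rfl
  | succ m ih => intro a; exact ⟨rfl, fun v => by simpa using ih⟩

theorem VanishTo.sum {m : ℕ} {ι : Type*} (s : Finset ι) {g : ι → E → ℝ} {a : E}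
    (h : ∀ i ∈ s, VanishTo m (g i) a) (hg : ∀ i ∈ s, AnalyticAt ℝ (g i) a) :
    VanishTo m (fun x => ∑ i ∈ s, g i x) a := by
  classical
  induction s using Finset.induction_on with
  | empty => simpa using VanishTo.zero_fun
  | insert i s hi ih =>
    simp only [Finset.sum_insert hi]
    exact (h i (by simp)).add (ih (fun j hj => h j (by simp [hj])) fun j hj => hg j (by simp [hj]))
      (hg i (by simp)) (Finset.analyticAt_fun_sum s fun j hj => hg j (by simp [hj]))

theorem eventually_eq_zero_of_vanishTo {g : E → ℝ} {a : E} (hg : AnalyticAt ℝ g a)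
    (h : ∀ m, VanishTo m g a) : ∀ᶠ x in 𝓝 a, g x = 0 :=
  eventually_eq_zero_of_fderiv_stable (𝕜 := ℝ)
    (fun g => AnalyticAt ℝ g a ∧ ∀ m, VanishTo m g a)
    (fun _ h => ⟨h.1, h.2 0⟩)
    (fun _ h v => ⟨h.1.fderiv_apply_const v, fun m => (h.2 (m + 1)).2 v⟩) ⟨hg, h⟩

end Vanishing

section LocalStructure

variable {X : Type*} [NormedAddCommGroup X] [NormedSpace ℝ X]

theorem covMinor_snoc_sum {k : ℕ} (ω : Fin k → X → X →L[ℝ] ℝ) (v : Fin k → X) (x : X)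
    (η : X → X →L[ℝ] ℝ) {ι : Type*} (s : Finset ι) (c : ι → ℝ) (e : ι → X) :
    covMinor (Fin.snoc (α := fun _ => X → X →L[ℝ] ℝ) ω η)
        (Fin.snoc (α := fun _ => X) v (∑ i ∈ s, c i • e i)) x
      = ∑ i ∈ s, c i * covMinor (Fin.snoc (α := fun _ => X → X →L[ℝ] ℝ) ω η)
        (Fin.snoc (α := fun _ => X) v (e i)) x := by
  set Ω := (Fin.snoc (α := fun _ => X → X →L[ℝ] ℝ) ω η : Fin (k + 1) → _) with hΩ
  let M : Matrix (Fin (k + 1)) (Fin (k + 1)) ℝ :=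
    Matrix.of fun i j => Ω i x ((Fin.snoc (α := fun _ => X) v 0 : Fin (k + 1) → X) j)
  have key : ∀ u, covMinor Ω (Fin.snoc (α := fun _ => X) v u) x
      = (M.updateCol (Fin.last k) (fun i => Ω i x u)).det := by
    intro u
    unfold covMinor
    congr 1
    ext i j
    refine Fin.lastCases ?_ (fun j => ?_) j
    · simp
    · simp [M, (Fin.castSucc_lt_last j).ne]
  let T : X →ₗ[ℝ] ℝ :=
    { toFun := fun u => (M.updateCol (Fin.last k) (fun i => Ω i x u)).det
      map_add' := fun a b => by
        rw [← Matrix.det_updateCol_add]; congr 2; ext i; simp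
      map_smul' := fun a b => by
        simp only [RingHom.id_apply, smul_eq_mul]
        rw [← Matrix.det_updateCol_smul]; congr 2; ext i; simp }
  simp only [key]
  have := map_sum T (fun i => c i • e i) s
  simp only [map_smul] at this
  exact this

variable [FiniteDimensional ℝ X]

/-- Where the rank of the differentials of the ideal `I` is maximal, the zero set of `I` is a
submanifold. -/
theorem exists_chart_zeroLocus {Ω : Set X} (hΩ : IsOpen Ω) {I : Set (X → ℝ)}
    (hI : ∀ f ∈ I, AnalyticOnNhd ℝ f Ω) {Z : Set X} (hZ : ∀ x, x ∈ Z ↔ x ∈ Ω ∧ ∀ f ∈ I, f x = 0)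
    (hIZ : ∀ g, AnalyticOnNhd ℝ g Ω → (∀ x ∈ Z, g x = 0) → g ∈ I)
    {k : ℕ} {ω : Fin k → X → X →L[ℝ] ℝ} {v : Fin k → X} (hω : ∀ i, ∃ f ∈ I, ω i = fderiv ℝ f)
    (hmax : ∀ x ∈ Z, ∀ f ∈ I, ∀ u, covMinor (Fin.snoc (α := fun _ => X → X →L[ℝ] ℝ) ω (fderiv ℝ f))
      (Fin.snoc (α := fun _ => X) v u) x = 0) {x₀ : X} (hx₀ : x₀ ∈ Z) (hΔ : covMinor ω v x₀ ≠ 0) :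
    ∃ (W : Submodule ℝ X) (Q : X →L[ℝ] W) (φ : W → X), (∀ u, u ∈ W ↔ ∀ i, ω i x₀ u = 0) ∧
      AnalyticAt ℝ φ 0 ∧ φ 0 = x₀ ∧ (∀ᶠ t in 𝓝 0, φ t ∈ Z ∧ Q (φ t - x₀) = t) ∧
      ∀ᶠ y in 𝓝 x₀, y ∈ Z → φ (Q (y - x₀)) = y := by
  choose f hfI hf using hω
  have hΩ₀ := ((hZ x₀).1 hx₀).1
  let Fm : X → Fin k → ℝ := fun x i => f i x
  have hF : AnalyticAt ℝ Fm x₀ := AnalyticAt.pi fun i => hI _ (hfI i) x₀ hΩ₀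
  have hFd : ∀ x ∈ Ω, ∀ u, fderiv ℝ Fm x u = fun i => ω i x u := by
    intro x hx u
    have : HasFDerivAt Fm (ContinuousLinearMap.pi fun i => ω i x) x := by
      refine hasFDerivAt_pi.2 fun i => ?_
      rw [hf]
      exact (hI _ (hfI i) x hx).differentiableAt.hasFDerivAt
    rw [this.fderiv]; rfl
  have hωa : ∀ i, ∀ x ∈ Ω, AnalyticAt ℝ (ω i) x := fun i x hx => by
    rw [hf]; exact (hI _ (hfI i) x hx).fderiv
  let W : Submodule ℝ X := (fderiv ℝ Fm x₀ : X →ₗ[ℝ] Fin k → ℝ).ker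
  obtain ⟨Q, hQ⟩ := exists_continuous_projection ℝ W
  obtain ⟨φ, p1, p2, p3, p4⟩ := hF.exists_level_chart (K := W) (fun w => by
    obtain ⟨u, hu⟩ := covMinor_surjective hΔ w
    exact ⟨u, by rw [hFd _ hΩ₀]; exact funext hu⟩) (fun v => Iff.rfl) Q hQ
  have hF0 : ∀ x ∈ Z, Fm x = 0 := fun x hx => funext fun i => ((hZ x).1 hx).2 _ (hfI i)
  rw [hF0 _ hx₀] at p3 p4
  have hφΩ : ∀ᶠ t in 𝓝 0, φ t ∈ Ω := p1.continuousAt.eventually (by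
    rw [p2]; exact hΩ.mem_nhds hΩ₀)
  have hΔa : ∀ x ∈ Ω, AnalyticAt ℝ (covMinor ω v) x := fun x hx =>
    covMinor_analyticAt v fun i => hωa i x hx
  have hΔφ : ∀ᶠ t in 𝓝 0, covMinor ω v (φ t) ≠ 0 := by
    have : ContinuousAt (fun t => covMinor ω v (φ t)) 0 :=
      ((hΔa x₀ hΩ₀).comp_eq p1 p2).continuousAt
    exact this.eventually_ne (by rwa [p2])
  let b := Module.finBasis ℝ X
  have key : ∀ m, ∀ g ∈ I, VanishTo m (fun t => g (φ t)) 0 := by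
    intro m
    induction m with
    | zero => intro g hg; change g (φ 0) = 0; rw [p2]; exact ((hZ x₀).1 hx₀).2 g hg
    | succ m ih =>
      intro g hg
      refine ⟨by simpa only [p2] using ((hZ x₀).1 hx₀).2 g hg, fun κ => ?_⟩
      let B : Fin (Module.finrank ℝ X) → X → ℝ := fun j => covMinor
        (Fin.snoc (α := fun _ => X → X →L[ℝ] ℝ) ω (fderiv ℝ g)) (Fin.snoc (α := fun _ => X) v (b j))
      have hBa : ∀ j, AnalyticOnNhd ℝ (B j) Ω := fun j x hx => covMinor_analyticAt _ (by
        intro i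
        refine Fin.lastCases ?_ (fun i => ?_) i
        · simpa using (hI g hg x hx).fderiv
        · simpa using hωa i x hx)
      have hB : ∀ j, B j ∈ I := fun j => hIZ _ (hBa j) fun x hx => hmax x hx g hg _
      let c : Fin (Module.finrank ℝ X) → W → ℝ := fun j t =>
        (covMinor ω v (φ t))⁻¹ * LinearMap.toContinuousLinearMap (b.coord j) (fderiv ℝ φ t κ)
      have hca : ∀ j, AnalyticAt ℝ (c j) 0 := fun j => by
        have h1 : AnalyticAt ℝ (fun t => covMinor ω v (φ t)) 0 := (hΔa x₀ hΩ₀).comp_eq p1 p2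
        have h2 : AnalyticAt ℝ (fun t => fderiv ℝ φ t κ) 0 := p1.fderiv_apply_const κ
        exact (h1.inv (by rwa [p2])).mul (h2.clm_const_apply _)
      have hBφ : ∀ j, AnalyticAt ℝ (fun t => B j (φ t)) 0 := fun j => (hBa j x₀ hΩ₀).comp_eq p1 p2
      have hv : VanishTo m (fun t => ∑ j, c j t * B j (φ t)) 0 :=
        VanishTo.sum _ (fun j _ => (ih _ (hB j)).mul (hca j) (hBφ j))
          fun j _ => (hca j).mul (hBφ j)
      refine hv.congr ?_
      filter_upwards [p3.eventually_nhds, hφΩ, hΔφ, p1.eventually_analyticAt] with t h3 hΩt hΔt hat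
      have hφd := hat.differentiableAt.hasFDerivAt
      have hgd : HasFDerivAt (fun t => g (φ t)) ((fderiv ℝ g (φ t)).comp (fderiv ℝ φ t)) t :=
        (hI g hg _ hΩt).differentiableAt.hasFDerivAt.comp t hφd
      rw [hgd.fderiv]
      have hker : ∀ i, ω i (φ t) (fderiv ℝ φ t κ) = 0 := by
        intro i
        have h1 : HasFDerivAt (fun t => f i (φ t)) ((fderiv ℝ (f i) (φ t)).comp (fderiv ℝ φ t)) t :=
          (hI _ (hfI i) _ hΩt).differentiableAt.hasFDerivAt.comp t hφd
        have h2 := h1.unique ((hasFDerivAt_const (0 : ℝ) t).congr_of_eventuallyEq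
          (h3.mono fun s hs => congrFun hs.1 i))
        rw [hf]
        simpa using DFunLike.congr_fun h2 κ
      have e1 := covMinor_snoc (v := v) (η := fderiv ℝ g) hker
      rw [← b.sum_repr (fderiv ℝ φ t κ), covMinor_snoc_sum, b.sum_repr] at e1
      simp only [ContinuousLinearMap.comp_apply]
      rw [eq_comm, ← mul_right_inj' hΔt, ← e1, Finset.mul_sum]
      refine Finset.sum_congr rfl fun j _ => ?_
      simp only [c, B]
      field_simp
      exact mul_comm _ _
  refine ⟨W, Q, φ, ?_, p1, p2, ?_, ?_⟩
  · intro u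
    change fderiv ℝ Fm x₀ u = 0 ↔ _
    rw [hFd _ hΩ₀, funext_iff]; rfl
  · obtain ⟨r, hr, hball⟩ := Metric.eventually_nhds_iff_ball.1 (hφΩ.and p1.eventually_analyticAt)
    filter_upwards [p3, Metric.ball_mem_nhds _ hr] with t ht htr
    refine ⟨(hZ _).2 ⟨(hball t htr).1, fun g hg => ?_⟩, ht.2⟩
    have hga : AnalyticOnNhd ℝ (fun t => g (φ t)) (Metric.ball 0 r) := fun s hs =>
      (hI g hg _ (hball s hs).1).comp (hball s hs).2
    have h0 := eventually_eq_zero_of_vanishTo (hga 0 (Metric.mem_ball_self hr)) fun m => key m g hg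
    exact hga.eqOn_zero_of_preconnected_of_eventuallyEq_zero (convex_ball _ _).isPreconnected
      (Metric.mem_ball_self hr) h0 htr
  · filter_upwards [p4] with y hy hyZ
    exact hy (hF0 y hyZ)

end LocalStructure

section Selection

open MeasureTheory

theorem volume_image_null_of_locally_null {X : Type*} [TopologicalSpace X]
    [SecondCountableTopology X] {r : ℕ} (π : X → Fin r → ℝ) {T : Set X}
    (h : ∀ x ∈ T, ∃ O ∈ 𝓝 x, volume (π '' (T ∩ O)) = 0) : volume (π '' T) = 0 := by
  choose! O hO h0 using h
  obtain ⟨t, hts, htc, hcov⟩ := TopologicalSpace.countable_cover_nhdsWithin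
    (f := O) (s := T) fun x hx => mem_nhdsWithin_of_mem_nhds (hO x hx)
  have hsub : π '' T ⊆ ⋃ x ∈ t, π '' (T ∩ O x) := by
    rintro _ ⟨y, hy, rfl⟩
    obtain ⟨x, hx, hyx⟩ := Set.mem_iUnion₂.1 (hcov hy)
    exact Set.mem_iUnion₂.2 ⟨x, hx, y, ⟨hy, hyx⟩, rfl⟩
  exact measure_mono_null hsub ((measure_biUnion_null_iff htc).2 fun x hx => h0 x (hts hx))

theorem exists_nhds_volume_image_null {r : ℕ} (V : Submodule ℝ (Fin r → ℝ)) (hV : V ≠ ⊤)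
    {h : V → Fin r → ℝ} {b : V} (hh : AnalyticAt ℝ h b) : ∃ O ∈ 𝓝 b, volume (h '' O) = 0 := by
  obtain ⟨P, hP⟩ := exists_continuous_projection ℝ V
  have hV0 : volume (V : Set (Fin r → ℝ)) = 0 := Measure.addHaar_submodule volume V hV
  refine ⟨{y | AnalyticAt ℝ h y}, hh.eventually_analyticAt, ?_⟩
  have hd : DifferentiableOn ℝ (fun x => h (P x)) {x | x ∈ V ∧ AnalyticAt ℝ h (P x)} := by
    rintro x ⟨-, hx⟩
    exact (hx.differentiableAt.comp x P.differentiableAt).differentiableWithinAt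
  have := addHaar_image_eq_zero_of_differentiableOn_of_addHaar_eq_zero volume hd
    (measure_mono_null (fun x hx => hx.1) hV0)
  refine measure_mono_null ?_ this
  rintro _ ⟨y, hy, rfl⟩
  exact ⟨y, ⟨y.2, by rw [hP]; exact hy⟩, by simp [hP]⟩

/-- An analytic set with non-negligible projection admits an analytic local section. -/
theorem exists_analytic_section {r : ℕ} {Λ : Type*} [NormedAddCommGroup Λ] [NormedSpace ℝ Λ]
    [FiniteDimensional ℝ Λ] {Ω : Set ((Fin r → ℝ) × Λ)} (hΩ : IsOpen Ω)
    {𝓕 : Set ((Fin r → ℝ) × Λ → ℝ)} (h𝓕 : ∀ f ∈ 𝓕, AnalyticOnNhd ℝ f Ω)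
    (hpos : volume (Prod.fst '' {x | x ∈ Ω ∧ ∀ f ∈ 𝓕, f x = 0}) ≠ 0) :
    ∃ (u₁ : Fin r → ℝ) (s : (Fin r → ℝ) → Λ), AnalyticAt ℝ s u₁ ∧
      ∀ᶠ u in 𝓝 u₁, (u, s u) ∈ Ω ∧ ∀ f ∈ 𝓕, f (u, s u) = 0 := by
  have := FiniteDimensional.proper ℝ Λ
  set Z₀ : Set ((Fin r → ℝ) × Λ) := {x | x ∈ Ω ∧ ∀ f ∈ 𝓕, f x = 0} with hZ₀
  let I : Set (((Fin r → ℝ) × Λ) → ℝ) := {f | AnalyticOnNhd ℝ f Ω ∧ volume (Prod.fst '' {x ∈ Z₀ | f x ≠ 0}) = 0}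
  let Z : Set ((Fin r → ℝ) × Λ) := {x | x ∈ Ω ∧ ∀ f ∈ I, f x = 0}
  have hFI : 𝓕 ⊆ I := fun f hf => ⟨h𝓕 f hf, by
    have : {x ∈ Z₀ | f x ≠ 0} = ∅ := by
      ext x; simp only [Set.mem_ofPred_eq, Set.mem_empty_iff_false, iff_false, not_and, not_not]
      exact fun hx => hx.2 f hf
    rw [this]; simp⟩
  have hdiff : volume (Prod.fst '' (Z₀ \ Z)) = 0 := by
    refine volume_image_null_of_locally_null _ ?_
    rintro x ⟨hx, hxZ⟩
    have : ∃ f ∈ I, f x ≠ 0 := by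
      by_contra! hc
      exact hxZ ⟨hx.1, hc⟩
    obtain ⟨f, hf, hfx⟩ := this
    refine ⟨{y | f y ≠ 0}, (hf.1 x hx.1).continuousAt.eventually_ne hfx, ?_⟩
    refine measure_mono_null (Set.image_mono ?_) hf.2
    rintro y ⟨hy, hfy⟩
    exact ⟨hy.1, hfy⟩
  have hIZ : ∀ g : ((Fin r → ℝ) × Λ) → ℝ, AnalyticOnNhd ℝ g Ω → (∀ x ∈ Z, g x = 0) → g ∈ I := by
    intro g hg h0
    refine ⟨hg, measure_mono_null (Set.image_mono ?_) hdiff⟩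
    rintro y ⟨hy, hgy⟩
    exact ⟨hy, fun hyZ => hgy (h0 y hyZ)⟩
  have hbig : ∀ g : ((Fin r → ℝ) × Λ) → ℝ, AnalyticOnNhd ℝ g Ω → (∃ x ∈ Z, g x ≠ 0) →
      volume (Prod.fst '' {x ∈ Z | g x ≠ 0}) ≠ 0 := by
    rintro g hg ⟨x, hx, hgx⟩ h0
    have hgI : g ∈ I := by
      refine ⟨hg, ?_⟩
      refine measure_mono_null ?_ (measure_union_null h0 hdiff)
      rintro _ ⟨y, hy, rfl⟩
      by_cases hyZ : y ∈ Z
      · exact Or.inl ⟨y, ⟨hyZ, hy.2⟩, rfl⟩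
      · exact Or.inr ⟨y, ⟨hy.1, hyZ⟩, rfl⟩
    exact hgx (hx.2 g hgI)
  have hZne : Z.Nonempty := by
    by_contra hne
    rw [Set.not_nonempty_iff_eq_empty] at hne
    rw [hne, Set.sdiff_empty] at hdiff
    exact hpos hdiff
  have hI : ∀ f ∈ I, AnalyticOnNhd ℝ f Ω := fun f hf => hf.1
  -- maximal minors
  obtain ⟨k, ω, v, hω, ⟨x₁, hx₁, hΔ₁⟩, hmax⟩ :=
    exists_maximal_covMinor {η : ((Fin r → ℝ) × Λ) → ((Fin r → ℝ) × Λ) →L[ℝ] ℝ | ∃ f ∈ I, η = fderiv ℝ f} hZne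
  let π : Fin r → ((Fin r → ℝ) × Λ) →L[ℝ] ℝ := fun b =>
    (ContinuousLinearMap.proj b).comp (ContinuousLinearMap.fst ℝ (Fin r → ℝ) Λ)
  let 𝒟₂ : Set (((Fin r → ℝ) × Λ) → ((Fin r → ℝ) × Λ) →L[ℝ] ℝ) := {η | (∃ f ∈ I, η = fderiv ℝ f) ∨ ∃ b, η = fun _ => π b}
  obtain ⟨k₂, ω₂, v₂, hω₂, ⟨x₂, hx₂, hΔ₂⟩, hmax₂⟩ :=
    exists_maximal_covMinor 𝒟₂ (S := {x ∈ Z | covMinor ω v x ≠ 0}) ⟨x₁, hx₁, hΔ₁⟩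
  have hDa : ∀ η ∈ 𝒟₂, ∀ x ∈ Ω, AnalyticAt ℝ η x := by
    rintro η (⟨f, hf, rfl⟩ | ⟨b, rfl⟩) x hx
    · exact (hI f hf x hx).fderiv
    · exact analyticAt_const
  have ha₁ : AnalyticOnNhd ℝ (covMinor ω v) Ω := fun x hx =>
    covMinor_analyticAt v fun i => hDa _ (Or.inl (hω i)) x hx
  have ha₂ : AnalyticOnNhd ℝ (covMinor ω₂ v₂) Ω := fun x hx =>
    covMinor_analyticAt v₂ fun i => hDa _ (hω₂ i) x hx
  have hTpos := hbig (fun x => covMinor ω v x * covMinor ω₂ v₂ x) (ha₁.mul ha₂)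
    ⟨x₂, hx₂.1, mul_ne_zero hx₂.2 hΔ₂⟩
  set T : Set ((Fin r → ℝ) × Λ) := {x ∈ Z | covMinor ω v x * covMinor ω₂ v₂ x ≠ 0} with hT
  by_contra hcon
  refine hTpos (volume_image_null_of_locally_null _ fun x₀ hx₀ => ?_)
  obtain ⟨W, Q, φ, hW, p1, p2, p3, p4⟩ := exists_chart_zeroLocus hΩ hI (Z := Z) (fun x => Iff.rfl)
    hIZ hω (fun x hx f hf u => hmax x hx _ ⟨f, hf, rfl⟩ u) hx₀.1 (left_ne_zero_of_mul hx₀.2)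
  have hφT : ∀ᶠ t in 𝓝 0, φ t ∈ T := by
    have hc : ContinuousAt (fun t => covMinor ω v (φ t) * covMinor ω₂ v₂ (φ t)) 0 :=
      (((ha₁ x₀ hx₀.1.1).comp_eq p1 p2).mul ((ha₂ x₀ hx₀.1.1).comp_eq p1 p2)).continuousAt
    filter_upwards [p3, hc.eventually_ne (by rw [p2]; exact hx₀.2)] with t h1 h2
    exact ⟨h1.1, h2⟩
  have hWdim := finrank_ker_of_covMinor (left_ne_zero_of_mul hx₀.2) W hW
  let f : W → Fin r → ℝ := fun t => (φ t).1
  have hf : AnalyticAt ℝ f 0 := p1.fst_comp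
  -- the rank of `f` is constant
  have hrank : ∀ᶠ t in 𝓝 0,
      Module.finrank ℝ (fderiv ℝ f t : W →ₗ[ℝ] Fin r → ℝ).range + k = k₂ := by
    filter_upwards [p1.eventually_analyticAt, hφT, hφT.eventually_nhds, p3.eventually_nhds]
      with t hat htT hTe h3e
    have hφd := hat.differentiableAt.hasFDerivAt
    have hfd : fderiv ℝ f t = (ContinuousLinearMap.fst ℝ (Fin r → ℝ) Λ).comp (fderiv ℝ φ t) :=
      (hasFDerivAt_fst.comp t hφd).fderiv
    have hφinj : Function.Injective (fderiv ℝ φ t) := by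
      have a1 := Q.hasFDerivAt.comp t (hφd.sub_const x₀)
      have a2 := a1.unique ((hasFDerivAt_id t).congr_of_eventuallyEq
        (h3e.mono fun t ht => ht.2))
      intro a b hab
      have ha := DFunLike.congr_fun a2 a
      have hb := DFunLike.congr_fun a2 b
      simp only [ContinuousLinearMap.comp_apply, ContinuousLinearMap.id_apply] at ha hb
      rw [← ha, ← hb, hab]
    have hIker : ∀ g ∈ I, ∀ κ, fderiv ℝ g (φ t) (fderiv ℝ φ t κ) = 0 := by
      intro g hg κ
      have h1 : HasFDerivAt (fun t => g (φ t)) ((fderiv ℝ g (φ t)).comp (fderiv ℝ φ t)) t :=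
        (hI _ hg _ htT.1.1).differentiableAt.hasFDerivAt.comp t hφd
      have h2 := h1.unique ((hasFDerivAt_const (0 : ℝ) t).congr_of_eventuallyEq
        (hTe.mono fun s hs => hs.1.2 g hg))
      simpa using DFunLike.congr_fun h2 κ
    let Kt : Submodule ℝ ((Fin r → ℝ) × Λ) := (LinearMap.pi fun i => (ω (i) (φ t) : ((Fin r → ℝ) × Λ) →ₗ[ℝ] ℝ)).ker
    have hKt : ∀ u, u ∈ Kt ↔ ∀ i, ω i (φ t) u = 0 := fun u => by
      simp [Kt, funext_iff]
    have hKdim := finrank_ker_of_covMinor (left_ne_zero_of_mul htT.2) Kt hKt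
    have hrange : (fderiv ℝ φ t : W →ₗ[ℝ] ((Fin r → ℝ) × Λ)).range = Kt := by
      apply Submodule.eq_of_le_of_finrank_eq
      · rintro _ ⟨κ, rfl⟩
        rw [hKt]
        intro i
        obtain ⟨g, hg, hgi⟩ := hω i
        rw [hgi]; exact hIker g hg κ
      · rw [LinearMap.finrank_range_of_inj hφinj]; omega
    let K₂ : Submodule ℝ ((Fin r → ℝ) × Λ) := (LinearMap.pi fun i => (ω₂ (i) (φ t) : ((Fin r → ℝ) × Λ) →ₗ[ℝ] ℝ)).ker
    have hK₂ : ∀ u, u ∈ K₂ ↔ ∀ i, ω₂ i (φ t) u = 0 := fun u => by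
      simp [K₂, funext_iff]
    have hK₂dim := finrank_ker_of_covMinor (right_ne_zero_of_mul htT.2) K₂ hK₂
    have hker : (fderiv ℝ f t : W →ₗ[ℝ] Fin r → ℝ).ker.map (fderiv ℝ φ t : W →ₗ[ℝ] ((Fin r → ℝ) × Λ)) = K₂ := by
      ext u
      rw [hK₂]
      constructor
      · rintro ⟨κ, hκ, rfl⟩ i
        rcases hω₂ i with ⟨g, hg, hgi⟩ | ⟨b, hb⟩
        · rw [hgi]; exact hIker g hg κ
        · rw [hb]
          have : fderiv ℝ f t κ = 0 := hκ
          rw [hfd] at this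
          exact congrFun this b
      · intro hu
        have hall : ∀ η ∈ 𝒟₂, η (φ t) u = 0 := by
          intro η hη
          have h1 := hmax₂ (φ t) ⟨htT.1, left_ne_zero_of_mul htT.2⟩ η hη u
          rw [covMinor_snoc hu] at h1
          exact (mul_eq_zero.1 h1).resolve_left (right_ne_zero_of_mul htT.2)
        have huK : u ∈ Kt := (hKt u).2 fun i => hall _ (Or.inl (hω i))
        rw [← hrange] at huK
        obtain ⟨κ, rfl⟩ := huK
        refine ⟨κ, ?_, rfl⟩
        change fderiv ℝ f t κ = 0
        rw [hfd]
        ext b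
        exact hall _ (Or.inr ⟨b, rfl⟩)
    have h1 := (fderiv ℝ f t : W →ₗ[ℝ] Fin r → ℝ).finrank_range_add_finrank_ker
    have h2 := (Submodule.equivMapOfInjective (fderiv ℝ φ t : W →ₗ[ℝ] ((Fin r → ℝ) × Λ)) hφinj
      (fderiv ℝ f t : W →ₗ[ℝ] Fin r → ℝ).ker).finrank_eq
    rw [hker] at h2
    omega
  set V := (fderiv ℝ f 0 : W →ₗ[ℝ] Fin r → ℝ).range with hV
  obtain ⟨P, hP⟩ := exists_continuous_projection ℝ V
  by_cases hVtop : V = ⊤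
  · exfalso
    obtain ⟨g, g1, g2, g3⟩ := hf.exists_local_section (fun w => LinearMap.range_eq_top.1 hVtop w)
    refine hcon ⟨f 0, fun u => (φ (g u)).2, (p1.comp_eq g1 g2).snd_comp, ?_⟩
    have hgc : Filter.Tendsto g (𝓝 (f 0)) (𝓝 0) := by
      simpa [ContinuousAt, g2] using g1.continuousAt
    filter_upwards [g3, hgc.eventually hφT] with u h1 h2
    have : (u, (φ (g u)).2) = φ (g u) := Prod.ext h1.symm rfl
    rw [this]
    exact ⟨h2.1.1, fun f hf => h2.1.2 f (hFI hf)⟩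
  · have hr0 := hrank.self_of_nhds
    rw [← hV] at hr0
    obtain ⟨h, h1, h2, -⟩ := hf.exists_factor_of_rank_le V rfl (by
      filter_upwards [hrank] with t ht
      omega) P hP
    obtain ⟨O, hO, hO0⟩ := exists_nhds_volume_image_null V hVtop h1
    have hQc : ContinuousAt (fun y => Q (y - x₀)) x₀ := by fun_prop
    have hQc' : Filter.Tendsto (fun y => Q (y - x₀)) (𝓝 x₀) (𝓝 0) := by
      simpa [ContinuousAt] using hQc
    have hPc : Filter.Tendsto (fun y : ((Fin r → ℝ) × Λ) => P y.1) (𝓝 x₀) (𝓝 (P (f 0))) := by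
      have : ContinuousAt (fun y : ((Fin r → ℝ) × Λ) => P y.1) x₀ := by fun_prop
      simpa [ContinuousAt, f, p2] using this
    refine ⟨_, Filter.inter_mem (Filter.inter_mem p4 (hQc'.eventually h2)) (hPc hO), ?_⟩
    refine measure_mono_null ?_ hO0
    rintro _ ⟨y, ⟨hyT, ⟨hy4, hy2⟩, hyO⟩, rfl⟩
    have e1 : φ (Q (y - x₀)) = y := hy4 hyT.1
    have e2 : f (Q (y - x₀)) = h (P (f (Q (y - x₀)))) := hy2
    have e3 : f (Q (y - x₀)) = y.1 := by simp only [f, e1]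
    rw [e3] at e2
    exact ⟨P y.1, hyO, e2.symm⟩

end Selection

section Complexification

/-- Extension of a continuous multilinear form from `ℝ^k` to `ℂ^k`. -/
def complexifyForm {k n : ℕ} (p : (Fin k → ℝ) [×n]→L[ℝ] ℝ) : (Fin k → ℂ) [×n]→L[ℂ] ℂ :=
  ∑ α : Fin n → Fin k, ((p fun i => Pi.single (α i) 1 : ℝ) : ℂ) •
    (ContinuousMultilinearMap.mkPiAlgebra ℂ (Fin n) ℂ).compContinuousLinearMap
      fun i => ContinuousLinearMap.proj (α i)

theorem complexifyForm_ofReal {k n : ℕ} (p : (Fin k → ℝ) [×n]→L[ℝ] ℝ) (v : Fin n → Fin k → ℝ) :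
    complexifyForm p (fun i j => (v i j : ℂ)) = (p v : ℝ) := by
  have hv : v = fun i => ∑ j, v i j • (Pi.single j 1 : Fin k → ℝ) := by
    funext i
    exact pi_eq_sum_univ' (v i)
  have h1 : p v = ∑ α : Fin n → Fin k, (∏ i, v i (α i)) * p fun i => Pi.single (α i) 1 := by
    conv_lhs => rw [hv]
    rw [ContinuousMultilinearMap.map_sum]
    refine Finset.sum_congr rfl fun α _ => ?_
    rw [ContinuousMultilinearMap.map_smul_univ, smul_eq_mul]
  rw [h1]
  push_cast
  rw [complexifyForm, _root_.sum_apply]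
  refine Finset.sum_congr rfl fun α _ => ?_
  simp [mul_comm]

theorem norm_complexifyForm_le {k n : ℕ} (p : (Fin k → ℝ) [×n]→L[ℝ] ℝ) :
    ‖complexifyForm p‖ ≤ k ^ n * ‖p‖ := by
  refine (norm_sum_le _ _).trans ?_
  have : ∀ α ∈ (Finset.univ : Finset (Fin n → Fin k)),
      ‖((p fun i => Pi.single (α i) 1 : ℝ) : ℂ) •
        (ContinuousMultilinearMap.mkPiAlgebra ℂ (Fin n) ℂ).compContinuousLinearMap
          fun i => (ContinuousLinearMap.proj (α i) : (Fin k → ℂ) →L[ℂ] ℂ)‖ ≤ ‖p‖ := by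
    intro α _
    rw [norm_smul]
    have h1 : ‖((p fun i => Pi.single (α i) 1 : ℝ) : ℂ)‖ ≤ ‖p‖ := by
      rw [Complex.norm_real]
      refine (p.le_opNorm _).trans ?_
      refine mul_le_of_le_one_right (norm_nonneg _) (Finset.prod_le_one (fun _ _ => norm_nonneg _) ?_)
      intro i _
      rw [pi_norm_le_iff_of_nonneg zero_le_one]
      intro j
      by_cases h : j = α i
      · subst h; simp
      · simp [h]
    have h2 : ‖(ContinuousMultilinearMap.mkPiAlgebra ℂ (Fin n) ℂ).compContinuousLinearMap
          fun i => (ContinuousLinearMap.proj (α i) : (Fin k → ℂ) →L[ℂ] ℂ)‖ ≤ 1 := by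
      refine ContinuousMultilinearMap.opNorm_le_bound zero_le_one fun m => ?_
      simp only [ContinuousMultilinearMap.compContinuousLinearMap_apply,
        ContinuousLinearMap.proj_apply, ContinuousMultilinearMap.mkPiAlgebra_apply, norm_prod,
        one_mul]
      exact Finset.prod_le_prod (fun _ _ => norm_nonneg _) fun i _ => norm_le_pi_norm (m i) (α i)
    calc _ ≤ ‖p‖ * 1 := mul_le_mul h1 h2 (norm_nonneg _) (norm_nonneg _)
      _ = _ := mul_one _
  refine (Finset.sum_le_card_nsmul _ _ _ this).trans ?_
  simp

theorem exists_complex_extension {k : ℕ} {f : (Fin k → ℝ) → ℝ} {a : Fin k → ℝ}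
    (hf : AnalyticAt ℝ f a) : ∃ F : (Fin k → ℂ) → ℂ, AnalyticAt ℂ F (fun j => (a j : ℂ)) ∧
      ∀ᶠ v in 𝓝 a, F (fun j => (v j : ℂ)) = f v := by
  obtain ⟨p, r, hp⟩ := hf
  let q : FormalMultilinearSeries ℂ (Fin k → ℂ) ℂ := fun n => complexifyForm (p n)
  obtain ⟨ρ, hρ0, hρ⟩ := ENNReal.lt_iff_exists_nnreal_btwn.1 (hp.r_pos.trans_le hp.r_le)
  have hρ0' : 0 < ρ := by exact_mod_cast hρ0
  obtain ⟨C, -, hC⟩ := p.norm_mul_pow_le_of_lt_radius hρ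
  have hrad : 0 < q.radius := by
    refine lt_of_lt_of_le ?_ (q.le_radius_of_bound (r := ρ / (k + 1)) C fun n => ?_)
    · have : 0 < ρ / (k + 1) := by positivity
      exact_mod_cast this
    · have h1 := norm_complexifyForm_le (p n)
      have h2 : (k : ℝ) ^ n * (1 / (k + 1)) ^ n ≤ 1 := by
        rw [← mul_pow]
        refine pow_le_one₀ (by positivity) ?_
        rw [mul_one_div, div_le_one (by positivity)]
        linarith
      calc ‖q n‖ * ((ρ / (k + 1) : NNReal) : ℝ) ^ n
          ≤ (k ^ n * ‖p n‖) * ((ρ / (k + 1) : NNReal) : ℝ) ^ n := by gcongr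
        _ = (‖p n‖ * (ρ : ℝ) ^ n) * ((k : ℝ) ^ n * (1 / (k + 1)) ^ n) := by
            push_cast; ring
        _ ≤ (‖p n‖ * (ρ : ℝ) ^ n) * 1 := by gcongr
        _ ≤ C := by rw [mul_one]; exact hC n
  have hq := q.hasFPowerSeriesOnBall hrad
  refine ⟨fun z => q.sum (z - fun j => (a j : ℂ)), ?_, ?_⟩
  · simpa using (hq.comp_sub (fun j => (a j : ℂ))).analyticAt
  · have hev : ∀ᶠ v in 𝓝 a, v ∈ Metric.eball a r ∧
        ((fun j => (v j : ℂ)) - fun j => (a j : ℂ)) ∈ Metric.eball (0 : Fin k → ℂ) q.radius := by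
      refine Filter.Eventually.and (Metric.eball_mem_nhds a hp.r_pos) ?_
      have hc : ContinuousAt (fun v : Fin k → ℝ => (fun j => (v j : ℂ)) - fun j => (a j : ℂ)) a := by
        refine ContinuousAt.sub (continuousAt_pi.2 fun j => ?_) continuousAt_const
        exact Complex.continuous_ofReal.continuousAt.comp (continuousAt_apply j a)
      refine hc.eventually ?_
      simp only [sub_self]
      exact Metric.eball_mem_nhds (0 : Fin k → ℂ) hrad
    filter_upwards [hev] with v hv
    have s1 : HasSum (fun n => ((p n fun _ => v - a : ℝ) : ℂ)) (f v) :=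
      (Complex.hasSum_ofReal).2 (hp.hasSum_sub hv.1)
    have s2 := hq.hasSum hv.2
    have : (fun n => q n fun _ => (fun j => (v j : ℂ)) - fun j => (a j : ℂ)) =
        fun n => ((p n fun _ => v - a : ℝ) : ℂ) := by
      funext n
      rw [← complexifyForm_ofReal]
      simp only [q]
      congr 1
      funext i j
      simp
    rw [this] at s2
    simpa using s2.unique s1

variable {E Δ : Type*} [NormedAddCommGroup E] [NormedSpace ℂ E] [NormedSpace ℝ E]
  [IsScalarTower ℝ ℂ E] [FiniteDimensional ℝ E] [NormedAddCommGroup Δ] [NormedSpace ℝ Δ]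
  [FiniteDimensional ℝ Δ]

/-- A real-analytic function extends to a function holomorphic in a first and antiholomorphic in
a second variable, whose restriction to the diagonal is the given function. -/
theorem AnalyticAt.exists_sesqui_extension {ρ : E × Δ → ℝ} {w : E} {δ : Δ}
    (hρ : AnalyticAt ℝ ρ (w, δ)) : ∃ R : E × E × Δ → ℂ, AnalyticAt ℝ R (w, w, δ) ∧
      (∀ᶠ q in 𝓝 (w, w, δ), ∀ a b, fderiv ℝ R q (I • a, -(I • b), 0) =
        I * fderiv ℝ R q (a, b, 0)) ∧
      ∀ᶠ x in 𝓝 (w, δ), R (x.1, x.1, x.2) = ρ x := by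
  obtain ⟨e⟩ : Nonempty ((E × Δ) ≃L[ℝ] (Fin (Module.finrank ℝ (E × Δ)) → ℝ)) :=
    ⟨ContinuousLinearEquiv.ofFinrankEq (by simp)⟩
  set k := Module.finrank ℝ (E × Δ)
  have hf : AnalyticAt ℝ (fun v => ρ (e.symm v)) (e (w, δ)) := by
    refine AnalyticAt.comp_eq hρ ?_ (e.symm_apply_apply _)
    exact (e.symm : (Fin k → ℝ) →L[ℝ] (E × Δ)).analyticAt _
  obtain ⟨F, hF, hFf⟩ := exists_complex_extension hf
  obtain ⟨Ec, hEc⟩ : ∃ Ec : (E × Δ) →L[ℝ] (Fin k → ℂ), ∀ x j, Ec x j = (e x j : ℂ) :=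
    ⟨ContinuousLinearMap.pi fun j => Complex.ofRealCLM.comp
      ((ContinuousLinearMap.proj j).comp (e : (E × Δ) →L[ℝ] (Fin k → ℝ))), fun x j => rfl⟩
  have hEc' : ∀ x, Ec x = fun j => (e x j : ℂ) := fun x => funext (hEc x)
  obtain ⟨mI, hmI⟩ : ∃ mI : E →L[ℝ] E, ∀ x, mI x = I • x :=
    ⟨((LinearMap.lsmul ℂ E I).restrictScalars ℝ).toContinuousLinearMap, fun x => rfl⟩
  obtain ⟨C, hC⟩ : ∃ C : (E × E × Δ) →L[ℝ] (Fin k → ℂ), ∀ x, C x =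
      Ec ((1 / 2 : ℝ) • (x.1 + x.2.1), x.2.2) - I • Ec ((1 / 2 : ℝ) • mI (x.1 - x.2.1), 0) := by
    let A1 : (E × E × Δ) →L[ℝ] (E × Δ) := ((1 / 2 : ℝ) • (ContinuousLinearMap.fst ℝ E (E × Δ) +
      (ContinuousLinearMap.fst ℝ E Δ).comp (ContinuousLinearMap.snd ℝ E (E × Δ)))).prod
        ((ContinuousLinearMap.snd ℝ E Δ).comp (ContinuousLinearMap.snd ℝ E (E × Δ)))
    let A2 : (E × E × Δ) →L[ℝ] (E × Δ) := ((1 / 2 : ℝ) • mI.comp (ContinuousLinearMap.fst ℝ E (E × Δ) -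
      (ContinuousLinearMap.fst ℝ E Δ).comp (ContinuousLinearMap.snd ℝ E (E × Δ)))).prod 0
    exact ⟨Ec.comp A1 - I • Ec.comp A2, fun x => rfl⟩
  have hCd : ∀ x : E × Δ, C (x.1, x.1, x.2) = fun j => (e x j : ℂ) := by
    intro x
    rw [hC, ← hEc']
    simp only [sub_self, map_zero, smul_zero]
    rw [show ((0 : E), (0 : Δ)) = 0 from rfl, map_zero, smul_zero, sub_zero, ← two_smul ℝ x.1,
      smul_smul]
    norm_num
  have hCI : ∀ a b, C (I • a, -(I • b), 0) = I • C (a, b, 0) := by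
    intro a b
    have h1 : (1 / 2 : ℝ) • (I • a + -(I • b)) = (1 / 2 : ℝ) • mI (a - b) := by
      rw [hmI, smul_sub, sub_eq_add_neg]
    have h2 : (1 / 2 : ℝ) • mI (I • a - -(I • b)) = -((1 / 2 : ℝ) • (a + b)) := by
      rw [hmI, sub_neg_eq_add, ← smul_add, smul_smul, I_mul_I, neg_one_smul, smul_neg]
    rw [hC, hC]
    simp only
    rw [h1, h2]
    have h3 : ((-((1 / 2 : ℝ) • (a + b)) : E), (0 : Δ)) = -(((1 / 2 : ℝ) • (a + b) : E), (0 : Δ)) := by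
      simp
    rw [h3, map_neg, smul_sub, smul_smul, I_mul_I]
    simp only [smul_neg, sub_neg_eq_add, neg_smul, one_smul]
    abel
  have hF' : AnalyticAt ℂ F (C (w, w, δ)) := by rw [hCd (w, δ)]; exact hF
  refine ⟨fun x => F (C x), AnalyticAt.comp_eq hF'.restrictScalars (C.analyticAt _) rfl, ?_, ?_⟩
  · filter_upwards [C.continuous.continuousAt.eventually hF'.eventually_analyticAt] with q hq a b
    have hd : HasFDerivAt (fun x => F (C x)) (((fderiv ℂ F (C q)).restrictScalars ℝ).comp C) q :=
      (hq.differentiableAt.hasFDerivAt.restrictScalars ℝ).comp q C.hasFDerivAt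
    rw [hd.fderiv]
    simp [hCI]
  · have hc : ContinuousAt e (w, δ) := e.continuous.continuousAt
    filter_upwards [hc.eventually hFf] with x hx
    rw [hCd, hx, e.symm_apply_apply]

end Complexification

section Orbit

variable {X : Type*} [NormedAddCommGroup X] [NormedSpace ℝ X] {T : Submodule ℝ X}

/-- The action of a word: each letter `τ` acts by `v ↦ σ v + τ`. -/
def wordAct (σ : X → X) : List T → X → X
  | [], v => v
  | τ :: l, v => σ (wordAct σ l v) + τ

/-- All points met while a word acts on `v` lie in `U`. -/
def WordGood (σ : X → X) (U : Set X) : List T → X → Prop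
  | [], v => v ∈ U
  | τ :: l, v => WordGood σ U l v ∧ σ (wordAct σ l v) + τ ∈ U

/-- The directions reached by varying the letters of a word and the initial point along `B`. -/
def wordSpan (σ : X → X) : List T → X → Submodule ℝ X → Submodule ℝ X
  | [], _, B => B
  | _ :: l, v, B =>
    (wordSpan σ l v B).map (fderiv ℝ σ (wordAct σ l v) : X →ₗ[ℝ] X) ⊔ T

/-- A word undoing the action of a given one, when `σ` is an involution. -/
def wordInv : List T → List T
  | [] => []
  | τ :: l => wordInv l ++ [0, -τ, 0]

/-- `σ` is an analytic involution of the open set `U`. -/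
structure IsAnalyticInvolution (σ : X → X) (U : Set X) : Prop where
  isOpen : IsOpen U
  analytic : AnalyticOnNhd ℝ σ U
  mapsTo : ∀ x ∈ U, σ x ∈ U
  invol : ∀ x ∈ U, σ (σ x) = x

variable {σ : X → X} {U : Set X}

theorem WordGood.act_mem {l : List T} {v : X} (h : WordGood σ U l v) : wordAct σ l v ∈ U := by
  cases l with
  | nil => exact h
  | cons τ l => exact h.2

theorem WordGood.start_mem {l : List T} {v : X} (h : WordGood σ U l v) : v ∈ U := by
  induction l with
  | nil => exact h
  | cons τ l ih => exact ih h.1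

theorem wordAct_append (l₁ l₂ : List T) (v : X) :
    wordAct σ (l₁ ++ l₂) v = wordAct σ l₁ (wordAct σ l₂ v) := by
  induction l₁ with
  | nil => rfl
  | cons τ l ih => simp [wordAct, ih]

theorem wordGood_append {l₁ l₂ : List T} {v : X} :
    WordGood σ U (l₁ ++ l₂) v ↔ WordGood σ U l₂ v ∧ WordGood σ U l₁ (wordAct σ l₂ v) := by
  induction l₁ with
  | nil => exact ⟨fun h => ⟨h, h.act_mem⟩, fun h => h.1⟩
  | cons τ l ih => simp [WordGood, ih, wordAct_append, and_assoc]

theorem wordSpan_append (l₁ l₂ : List T) (v : X) (B : Submodule ℝ X) :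
    wordSpan σ (l₁ ++ l₂) v B = wordSpan σ l₁ (wordAct σ l₂ v) (wordSpan σ l₂ v B) := by
  induction l₁ with
  | nil => rfl
  | cons τ l ih => simp [wordSpan, ih, wordAct_append]

theorem wordSpan_mono (l : List T) (v : X) {B C : Submodule ℝ X} (h : B ≤ C) :
    wordSpan σ l v B ≤ wordSpan σ l v C := by
  induction l with
  | nil => exact h
  | cons τ l ih => exact sup_le_sup_right (Submodule.map_mono ih) _

namespace IsAnalyticInvolution

theorem good_inv (hσ : IsAnalyticInvolution σ U) {l : List T} {v : X} (h : WordGood σ U l v) :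
    WordGood σ U (wordInv l) (wordAct σ l v) ∧ wordAct σ (wordInv l) (wordAct σ l v) = v := by
  induction l with
  | nil => exact ⟨h, rfl⟩
  | cons τ l ih =>
    obtain ⟨h1, h2⟩ := h
    set x := wordAct σ l v with hx
    have hxU : x ∈ U := h1.act_mem
    have e1 : σ (σ (σ x + τ)) = σ x + τ := hσ.invol _ h2
    have e3 : wordAct σ [0, -τ, 0] (σ x + τ) = x := by
      simp [wordAct, e1, hσ.invol x hxU]
    have g3 : WordGood σ U [0, -τ, 0] (σ x + τ) := by
      simp [wordAct, WordGood, e1, hσ.invol x hxU, h2, hxU, hσ.mapsTo _ h2, hσ.mapsTo _ hxU]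
    change WordGood σ U (wordInv l ++ [0, -τ, 0]) (σ x + τ) ∧
      wordAct σ (wordInv l ++ [0, -τ, 0]) (σ x + τ) = v
    rw [wordGood_append, wordAct_append, e3]
    exact ⟨⟨g3, (ih h1).1⟩, (ih h1).2⟩

theorem fderiv_injective (hσ : IsAnalyticInvolution σ U) {x : X} (hx : x ∈ U) : Function.Injective (fderiv ℝ σ x) := by
  have h1 : HasFDerivAt (fun y => σ (σ y)) ((fderiv ℝ σ (σ x)).comp (fderiv ℝ σ x)) x :=
    ((hσ.analytic _ (hσ.mapsTo x hx)).differentiableAt.hasFDerivAt).comp x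
      (hσ.analytic x hx).differentiableAt.hasFDerivAt
  have h2 := h1.unique ((hasFDerivAt_id x).congr_of_eventuallyEq
    (Filter.eventually_of_mem (hσ.isOpen.mem_nhds hx) hσ.invol))
  intro a b hab
  have ha := DFunLike.congr_fun h2 a
  have hb := DFunLike.congr_fun h2 b
  simp only [ContinuousLinearMap.comp_apply, ContinuousLinearMap.id_apply] at ha hb
  rw [← ha, ← hb, hab]

theorem act_analyticAt (hσ : IsAnalyticInvolution σ U) {P : Type*} [NormedAddCommGroup P] [NormedSpace ℝ P] {fs : List (P → T)}
    {ψ : P → X} {t : P} (hfs : ∀ f ∈ fs, AnalyticAt ℝ f t) (hψ : AnalyticAt ℝ ψ t)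
    (hg : WordGood σ U (fs.map (· t)) (ψ t)) :
    AnalyticAt ℝ (fun s => wordAct σ (fs.map (· s)) (ψ s)) t ∧
      ∀ᶠ s in 𝓝 t, WordGood σ U (fs.map (· s)) (ψ s) := by
  induction fs with
  | nil => exact ⟨hψ, hψ.continuousAt.eventually (hσ.isOpen.mem_nhds hg)⟩
  | cons f fs ih =>
    obtain ⟨a1, a2⟩ := ih (fun f hf => hfs f (List.mem_cons_of_mem _ hf)) hg.1
    have a3 : AnalyticAt ℝ (fun s => σ (wordAct σ (fs.map (· s)) (ψ s)) + (f s : X)) t :=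
      (AnalyticAt.comp_eq (hσ.analytic _ hg.1.act_mem) a1 rfl).add
        (AnalyticAt.clm_const_apply T.subtypeL (hfs f List.mem_cons_self))
    refine ⟨a3, ?_⟩
    filter_upwards [a2, a3.continuousAt.eventually (hσ.isOpen.mem_nhds hg.2)] with s h1 h2
    exact ⟨h1, h2⟩

theorem act_analyticAt_right (hσ : IsAnalyticInvolution σ U) {l : List T} {v : X} (hg : WordGood σ U l v) :
    AnalyticAt ℝ (wordAct σ l) v ∧ ∀ᶠ x in 𝓝 v, WordGood σ U l x := by
  have := hσ.act_analyticAt (P := X) (fs := l.map fun τ _ => τ) (ψ := id) (t := v)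
    (by simp only [List.mem_map]; rintro f ⟨τ, -, rfl⟩; exact analyticAt_const) analyticAt_id
    (by simpa [Function.comp_def] using hg)
  simpa [Function.comp_def] using this

theorem range_le_wordSpan (hσ : IsAnalyticInvolution σ U) {P : Type*} [NormedAddCommGroup P] [NormedSpace ℝ P]
    {fs : List (P → T)} {ψ : P → X} {t : P} (hfs : ∀ f ∈ fs, AnalyticAt ℝ f t)
    (hψ : AnalyticAt ℝ ψ t) (hg : WordGood σ U (fs.map (· t)) (ψ t)) :
    (fderiv ℝ (fun s => wordAct σ (fs.map (· s)) (ψ s)) t : P →ₗ[ℝ] X).range ≤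
      wordSpan σ (fs.map (· t)) (ψ t) (fderiv ℝ ψ t : P →ₗ[ℝ] X).range := by
  induction fs with
  | nil => exact le_rfl
  | cons f fs ih =>
    have hfs' := fun f hf => hfs f (List.mem_cons_of_mem _ hf)
    have a1 := (hσ.act_analyticAt hfs' hψ hg.1).1
    have hd : HasFDerivAt (fun s => σ (wordAct σ (fs.map (· s)) (ψ s)) + (f s : X))
        ((fderiv ℝ σ (wordAct σ (fs.map (· t)) (ψ t))).comp
          (fderiv ℝ (fun s => wordAct σ (fs.map (· s)) (ψ s)) t) +
            T.subtypeL.comp (fderiv ℝ f t)) t :=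
      ((hσ.analytic _ hg.1.act_mem).differentiableAt.hasFDerivAt.comp t
        a1.differentiableAt.hasFDerivAt).add (T.subtypeL.hasFDerivAt.comp t
          (hfs f List.mem_cons_self).differentiableAt.hasFDerivAt)
    have : fderiv ℝ (fun s => wordAct σ ((f :: fs).map (· s)) (ψ s)) t = _ := hd.fderiv
    rw [this]
    rintro _ ⟨w, rfl⟩
    refine Submodule.add_mem_sup (Submodule.mem_map_of_mem (ih hfs' hg.1 ⟨w, rfl⟩)) ?_
    exact (fderiv ℝ f t w).2

theorem map_fderiv_act_le_wordSpan (hσ : IsAnalyticInvolution σ U) {l : List T} {v : X} (hg : WordGood σ U l v)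
    (B : Submodule ℝ X) :
    B.map (fderiv ℝ (wordAct σ l) v : X →ₗ[ℝ] X) ≤ wordSpan σ l v B := by
  induction l with
  | nil =>
    have : fderiv ℝ (wordAct σ ([] : List T)) v = ContinuousLinearMap.id ℝ X := fderiv_id
    rw [this]; simp [wordSpan]
  | cons τ l ih =>
    have a1 := (hσ.act_analyticAt_right hg.1).1
    have hd : HasFDerivAt (fun s => σ (wordAct σ l s) + (τ : X))
        ((fderiv ℝ σ (wordAct σ l v)).comp (fderiv ℝ (wordAct σ l) v)) v :=
      ((hσ.analytic _ hg.1.act_mem).differentiableAt.hasFDerivAt.comp v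
        a1.differentiableAt.hasFDerivAt).add_const _
    have : fderiv ℝ (wordAct σ (τ :: l)) v = _ := hd.fderiv
    rw [this]
    refine le_trans ?_ le_sup_left
    rintro _ ⟨w, hw, rfl⟩
    exact Submodule.mem_map_of_mem (ih hg.1 (Submodule.mem_map_of_mem hw))

theorem finrank_le_wordSpan (hσ : IsAnalyticInvolution σ U) [FiniteDimensional ℝ X] {l : List T} {v : X} (hg : WordGood σ U l v)
    (B : Submodule ℝ X) : Module.finrank ℝ B ≤ Module.finrank ℝ (wordSpan σ l v B) := by
  induction l with
  | nil => exact le_rfl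
  | cons τ l ih =>
    refine (ih hg.1).trans ?_
    rw [(Submodule.equivMapOfInjective (fderiv ℝ σ (wordAct σ l v) : X →ₗ[ℝ] X)
      (hσ.fderiv_injective hg.1.act_mem) (wordSpan σ l v B)).finrank_eq]
    exact Submodule.finrank_mono le_sup_left

end IsAnalyticInvolution

end Orbit

section Orbit

universe u

variable {X : Type u} [NormedAddCommGroup X] [NormedSpace ℝ X] {T : Submodule ℝ X}
  {σ : X → X} {U : Set X}

theorem wordSpan_invariant {J : X →L[ℝ] X} (hJT : ∀ τ ∈ T, J τ ∈ T)
    (hJ : ∀ x ∈ U, ∀ v, fderiv ℝ σ x (J v) = -J (fderiv ℝ σ x v)) {l : List T} {v : X}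
    (hg : WordGood σ U l v) : ∀ w ∈ wordSpan σ l v ⊥, J w ∈ wordSpan σ l v ⊥ := by
  induction l with
  | nil =>
    intro w hw
    rw [(Submodule.mem_bot ℝ).1 hw, map_zero]
    exact zero_mem _
  | cons τ l ih =>
    intro w hw
    obtain ⟨_, ⟨a, ha, rfl⟩, b, hb, rfl⟩ := Submodule.mem_sup.1 hw
    rw [map_add]
    refine Submodule.add_mem_sup ⟨-J a, neg_mem (ih hg.1 a ha), ?_⟩ (hJT b hb)
    have := hJ _ hg.1.act_mem a
    simp [this]

namespace IsAnalyticInvolution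

theorem exists_family (hσ : IsAnalyticInvolution σ U) [FiniteDimensional ℝ X] {l : List T} {v : X}
    (hg : WordGood σ U l v) :
    ∃ (P : Type u) (_ : NormedAddCommGroup P) (_ : NormedSpace ℝ P) (_ : FiniteDimensional ℝ P)
      (fs : List (P → T)) (t₀ : P), (∀ f ∈ fs, ∀ t, AnalyticAt ℝ f t) ∧ fs.map (· t₀) = l ∧
      wordSpan σ l v ⊥ ≤
        (fderiv ℝ (fun s => wordAct σ (fs.map (· s)) v) t₀ : P →ₗ[ℝ] X).range := by
  induction l with
  | nil =>
    exact ⟨PUnit, inferInstance, inferInstance, inferInstance, [], PUnit.unit, by simp, rfl, bot_le⟩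
  | cons τ l ih =>
    obtain ⟨P, _, _, _, fs, t₀, h1, h2, h3⟩ := ih hg.1
    have hg1 : WordGood σ U (fs.map (· t₀)) v := by rw [h2]; exact hg.1
    have a1 := (hσ.act_analyticAt (fun f hf => h1 f hf t₀) (analyticAt_const (v := v)) hg1).1
    refine ⟨P × T, inferInstance, inferInstance, inferInstance,
      Prod.snd :: fs.map (fun f t => f t.1), (t₀, τ), ?_, ?_, ?_⟩
    · intro f hf t
      rcases List.mem_cons.1 hf with rfl | hf
      · exact analyticAt_snd
      · obtain ⟨f', hf', rfl⟩ := List.mem_map.1 hf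
        exact (h1 f' hf' t.1).comp_eq analyticAt_fst rfl
    · simp [Function.comp_def, h2]
    · have he : (fun s : P × T => wordAct σ ((Prod.snd :: fs.map (fun f (t : P × T) => f t.1)).map
          (· s)) v) = fun s => σ (wordAct σ (fs.map (· s.1)) v) + (s.2 : X) := by
        funext s
        simp [wordAct, Function.comp_def]
      have hd : HasFDerivAt (fun s : P × T => σ (wordAct σ (fs.map (· s.1)) v) + (s.2 : X))
          (((fderiv ℝ σ (wordAct σ (fs.map (· t₀)) v)).comp
            (fderiv ℝ (fun s => wordAct σ (fs.map (· s)) v) t₀)).comp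
              (ContinuousLinearMap.fst ℝ P T) + T.subtypeL.comp (ContinuousLinearMap.snd ℝ P T))
          (t₀, τ) := by
        have b1 := (hσ.analytic _ hg1.act_mem).differentiableAt.hasFDerivAt.comp t₀
          a1.differentiableAt.hasFDerivAt
        exact (HasFDerivAt.comp (t₀, τ) b1 hasFDerivAt_fst).add
          (T.subtypeL.hasFDerivAt.comp (t₀, τ) hasFDerivAt_snd)
      rw [he, hd.fderiv]
      refine sup_le ?_ ?_
      · rintro _ ⟨w, hw, rfl⟩
        obtain ⟨w', rfl⟩ := h3 hw
        exact ⟨(w', 0), by simp [h2]⟩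
      · intro w hw
        exact ⟨(0, ⟨w, hw⟩), by simp⟩

theorem exists_maximal_loop (hσ : IsAnalyticInvolution σ U) [FiniteDimensional ℝ X] {o : X}
    (ho : o ∈ U) : ∃ L : List T, WordGood σ U L o ∧ wordAct σ L o = o ∧
      (∀ᶠ x in 𝓝 o, wordAct σ L x = x) ∧
      (∀ l : List T, WordGood σ U l o →
        Module.finrank ℝ (wordSpan σ l o ⊥) ≤ Module.finrank ℝ (wordSpan σ L o ⊥)) ∧
      ∀ l : List T, WordGood σ U l o → wordAct σ l o = o →
        wordSpan σ l o ⊥ ≤ wordSpan σ L o ⊥ := by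
  let S : Set ℕ := {k | ∃ l : List T, WordGood σ U l o ∧ k = Module.finrank ℝ (wordSpan σ l o ⊥)}
  have hne : S.Nonempty := ⟨_, [], ho, rfl⟩
  have hbdd : BddAbove S := ⟨Module.finrank ℝ X, by
    rintro k ⟨l, -, rfl⟩
    exact Submodule.finrank_le _⟩
  obtain ⟨l', hl', hk'⟩ := Nat.sSup_mem hne hbdd
  have hmax : ∀ l : List T, WordGood σ U l o →
      Module.finrank ℝ (wordSpan σ l o ⊥) ≤ Module.finrank ℝ (wordSpan σ l' o ⊥) := fun l hl => by
    rw [← hk']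
    exact le_csSup hbdd ⟨l, hl, rfl⟩
  have hi := hσ.good_inv hl'
  have hact : wordAct σ (wordInv l' ++ l') o = o := by rw [wordAct_append]; exact hi.2
  have hgood : WordGood σ U (wordInv l' ++ l') o := wordGood_append.2 ⟨hl', hi.1⟩
  have hmax' : ∀ l : List T, WordGood σ U l o → Module.finrank ℝ (wordSpan σ l o ⊥) ≤
      Module.finrank ℝ (wordSpan σ (wordInv l' ++ l') o ⊥) := fun l hl => by
    refine (hmax l hl).trans ?_
    rw [wordSpan_append]
    exact hσ.finrank_le_wordSpan hi.1 _
  have hid : ∀ᶠ x in 𝓝 o, wordAct σ (wordInv l' ++ l') x = x := by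
    filter_upwards [(hσ.act_analyticAt_right hl').2] with x hx
    rw [wordAct_append]
    exact (hσ.good_inv hx).2
  refine ⟨wordInv l' ++ l', hgood, hact, hid, hmax', fun l hl hlo => ?_⟩
  set L := wordInv l' ++ l'
  have h1 : wordSpan σ (L ++ l) o ⊥ = wordSpan σ L o (wordSpan σ l o ⊥) := by
    rw [wordSpan_append, hlo]
  have h2 : wordSpan σ L o ⊥ ≤ wordSpan σ (L ++ l) o ⊥ := h1 ▸ wordSpan_mono _ _ bot_le
  have h3 := Submodule.eq_of_le_of_finrank_le h2
    (hmax' _ (wordGood_append.2 ⟨hl, by rw [hlo]; exact hgood⟩))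
  rw [h3, h1]
  have h4 := hσ.map_fderiv_act_le_wordSpan hgood (wordSpan σ l o ⊥)
  have h5 : fderiv ℝ (wordAct σ L) o = ContinuousLinearMap.id ℝ X :=
    ((hasFDerivAt_id o).congr_of_eventuallyEq hid).fderiv
  rw [h5] at h4
  simpa using h4

end IsAnalyticInvolution

end Orbit

section Orbit

universe u

variable {X : Type u} [NormedAddCommGroup X] [NormedSpace ℝ X] {T : Submodule ℝ X}
  {σ : X → X} {U : Set X}

/-- Linearization of an analytic involution at a fixed point. -/
theorem IsAnalyticInvolution.exists_linearization (hσ : IsAnalyticInvolution σ U)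
    [CompleteSpace X] {o : X} (ho : o ∈ U) (hσo : σ o = o) :
    ∃ φ φi : X → X, AnalyticAt ℝ φ o ∧ φ o = 0 ∧ fderiv ℝ φ o = ContinuousLinearMap.id ℝ X ∧
      (∀ x ∈ U, φ (σ x) = fderiv ℝ σ o (φ x)) ∧ AnalyticAt ℝ φi 0 ∧ φi 0 = o ∧
      (∀ᶠ x in 𝓝 o, φi (φ x) = x) ∧ (∀ v, fderiv ℝ σ o (fderiv ℝ σ o v) = v) := by
  obtain ⟨A, hA⟩ : ∃ A, A = fderiv ℝ σ o := ⟨_, rfl⟩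
  have hAA : ∀ v, A (A v) = v := by
    have hd := (hσ.analytic o ho).differentiableAt.hasFDerivAt
    rw [← hA] at hd
    have h1 : HasFDerivAt (fun y => σ (σ y)) (A.comp A) o := by
      refine HasFDerivAt.comp o ?_ hd
      rw [hσo]; exact hd
    have h2 := h1.unique ((hasFDerivAt_id o).congr_of_eventuallyEq
      (Filter.eventually_of_mem (hσ.isOpen.mem_nhds ho) hσ.invol))
    exact fun v => DFunLike.congr_fun h2 v
  let φ : X → X := fun x => (1 / 2 : ℝ) • ((x - o) + A (σ x - o))
  have hφ : AnalyticAt ℝ φ o := by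
    have h1 : AnalyticAt ℝ (fun x => A (σ x - o)) o :=
      AnalyticAt.clm_const_apply A ((hσ.analytic o ho).sub analyticAt_const)
    exact analyticAt_const.smul ((analyticAt_id.sub analyticAt_const).add h1)
  have hφo : φ o = 0 := by simp [φ, hσo]
  have hφd : fderiv ℝ φ o = ContinuousLinearMap.id ℝ X := by
    have hd := (hσ.analytic o ho).differentiableAt.hasFDerivAt
    rw [← hA] at hd
    have h1 : HasFDerivAt φ ((1 / 2 : ℝ) • (ContinuousLinearMap.id ℝ X + A.comp A)) o :=
      (((hasFDerivAt_id o).sub_const o).add (A.hasFDerivAt.comp o (hd.sub_const o))).const_smul _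
    rw [h1.fderiv]
    ext v
    simp only [_root_.smul_apply, _root_.add_apply,
      ContinuousLinearMap.id_apply, ContinuousLinearMap.comp_apply, hAA]
    rw [← two_smul ℝ v, smul_smul]; norm_num
  obtain ⟨φi, h1, h2, h3, -⟩ := hφ.exists_local_inverse (ContinuousLinearEquiv.refl ℝ X) (by
    rw [hφd]; rfl)
  rw [hφo] at h1 h2
  refine ⟨φ, φi, hφ, hφo, hφd, ?_, h1, h2, h3, by rw [← hA]; exact hAA⟩
  intro x hx
  rw [← hA]
  simp only [φ, hσ.invol x hx, map_smul, map_add, hAA]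
  rw [add_comm]

/-- Fixed points of `σ` in a set parametrized equivariantly by `h`. -/
theorem IsAnalyticInvolution.exists_fixed_chart (hσ : IsAnalyticInvolution σ U)
    (T V₀ : Submodule ℝ X) [FiniteDimensional ℝ X] {o : X} {A : X →L[ℝ] X}
    {φ φi : X → X} {h : V₀ → X} {P₀ : X →L[ℝ] V₀}
    (hφd : fderiv ℝ φ o = ContinuousLinearMap.id ℝ X)
    (hφo : φ o = 0) (hφ : AnalyticAt ℝ φ o)
    (hφσ : ∀ x ∈ U, φ (σ x) = A (φ x)) (hφi : AnalyticAt ℝ φi 0) (hφi0 : φi 0 = o)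
    (hφinv : ∀ᶠ x in 𝓝 o, φi (φ x) = x) (hAA : ∀ v, A (A v) = v)
    (hP₀A : ∀ x, (P₀ (A x) : X) = A (P₀ x)) (hh : AnalyticAt ℝ h 0) (hh0 : h 0 = 0)
    (hhd : ∀ v : V₀, fderiv ℝ h 0 v = v)
    (hN : ∀ᶠ y in 𝓝 (0 : V₀), P₀ (h y) = y ∧ ∃ n ∈ U, h y = φ n ∧ φi (φ (σ n)) = σ n ∧
      (∀ᶠ x in 𝓝 n, φi (φ x) = x) ∧ AnalyticAt ℝ φ n ∧ ∀ᶠ τ : T × T in 𝓝 0,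
        φ (σ (n + τ.2) + τ.1) = h (P₀ (φ (σ (n + τ.2) + τ.1)))) :
    ∃ W : Submodule ℝ X, (∀ w, w ∈ W ↔ w ∈ V₀ ∧ A w = w) ∧
      ∃ g : W → X, AnalyticAt ℝ g 0 ∧ g 0 = o ∧ (∀ w, fderiv ℝ g 0 w = w) ∧
        ∀ᶠ w in 𝓝 0, σ (g w) = g w ∧
          ∀ τ ∈ T, ∃ w', fderiv ℝ g w w' = τ + fderiv ℝ σ (g w) τ := by
  have := FiniteDimensional.complete ℝ X
  let W : Submodule ℝ X := V₀ ⊓ ((A : X →ₗ[ℝ] X) - LinearMap.id).ker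
  have hW : ∀ w, w ∈ W ↔ w ∈ V₀ ∧ A w = w := by
    intro w
    simp [W, Submodule.mem_inf, LinearMap.mem_ker, sub_eq_zero]
  obtain ⟨ι, hι⟩ : ∃ ι : W →L[ℝ] V₀, ∀ w, (ι w : X) = w :=
    ⟨W.subtypeL.codRestrict V₀ fun w => ((hW w).1 w.2).1, fun _ => rfl⟩
  let g : W → X := fun w => φi (h (ι w))
  have hhι : AnalyticAt ℝ (fun w => h (ι w)) 0 :=
    hh.comp_eq (AnalyticAt.clm_const_apply ι analyticAt_id) (by simp)
  refine ⟨W, hW, g, hφi.comp_eq hhι (by simp [hh0]), by simp [g, hh0, hφi0], ?_, ?_⟩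
  · intro w
    have h1 : HasFDerivAt φi (ContinuousLinearMap.id ℝ X) 0 := by
      have e1 : HasFDerivAt (fun x => φi (φ x)) ((fderiv ℝ φi 0).comp (fderiv ℝ φ o)) o := by
        refine HasFDerivAt.comp o ?_ hφ.differentiableAt.hasFDerivAt
        rw [hφo]; exact hφi.differentiableAt.hasFDerivAt
      have e2 := e1.unique ((hasFDerivAt_id o).congr_of_eventuallyEq hφinv)
      rw [hφd, ContinuousLinearMap.comp_id] at e2
      rw [← e2]; exact hφi.differentiableAt.hasFDerivAt
    have h2 : HasFDerivAt (fun w => h (ι w)) ((fderiv ℝ h 0).comp ι) 0 := by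
      refine HasFDerivAt.comp 0 ?_ ι.hasFDerivAt
      rw [map_zero]; exact hh.differentiableAt.hasFDerivAt
    have h3 : HasFDerivAt g ((ContinuousLinearMap.id ℝ X).comp ((fderiv ℝ h 0).comp ι)) 0 := by
      refine HasFDerivAt.comp 0 ?_ h2
      rw [map_zero, hh0]; exact h1
    rw [h3.fderiv]
    simp [hhd, hι]
  · have hι0 : Filter.Tendsto ι (𝓝 0) (𝓝 0) := by simpa using ι.continuous.tendsto 0
    have hφi' : ∀ᶠ y in 𝓝 (0 : V₀), AnalyticAt ℝ φi (h y) :=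
      hh.continuousAt.eventually (by rw [hh0]; exact hφi.eventually_analyticAt)
    filter_upwards [hι0.eventually hN, hι0.eventually hφi', hι0.eventually hh.eventually_analyticAt]
      with w ⟨hPh, n, hnU, hn, hσinv, hinv, hφn, hτ⟩ hφiw hhw
    have hyA : A (ι w : X) = ι w := by rw [hι]; exact ((hW w).1 w.2).2
    have hgn : g w = n := by simp only [g]; rw [hn, hinv.self_of_nhds]
    have hAφ : φ (σ n) = φ n := by
      have e1 := hτ.self_of_nhds
      simp only [Prod.snd_zero, Prod.fst_zero, Submodule.coe_zero, add_zero] at e1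
      have e2 : P₀ (φ (σ n)) = ι w := by
        apply Subtype.ext
        rw [hφσ n hnU, hP₀A, ← hn, hPh, hyA]
      rw [e1, e2, hn]
    have hσn : σ n = n := by rw [← hσinv, hAφ, hinv.self_of_nhds]
    refine ⟨by rw [hgn, hσn], fun τ hτT => ?_⟩
    rw [hgn]
    have hdσ := (hσ.analytic n hnU).differentiableAt.hasFDerivAt
    have hdφ := hφn.differentiableAt.hasFDerivAt
    have hdh := hhw.differentiableAt.hasFDerivAt
    have hPn : P₀ (φ n) = ι w := by rw [← hn, hPh]
    -- differentiate an identity `φ ∘ k = h ∘ P₀ ∘ φ ∘ k` on `T`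
    have key : ∀ (k : T → X) (K : T →L[ℝ] X), HasFDerivAt k K 0 → k 0 = n →
        (∀ᶠ τ in 𝓝 (0 : T), φ (k τ) = h (P₀ (φ (k τ)))) →
        ∀ τ, fderiv ℝ h (ι w) (P₀ (fderiv ℝ φ n (K τ))) = fderiv ℝ φ n (K τ) := by
      intro k K hk hk0 he τ
      have e1 : HasFDerivAt (fun τ => φ (k τ)) ((fderiv ℝ φ n).comp K) 0 :=
        HasFDerivAt.comp 0 (by rw [hk0]; exact hdφ) hk
      have e2 : HasFDerivAt (fun τ => P₀ (φ (k τ))) (P₀.comp ((fderiv ℝ φ n).comp K)) 0 :=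
        P₀.hasFDerivAt.comp 0 e1
      have e3 : HasFDerivAt (fun τ => h (P₀ (φ (k τ))))
          ((fderiv ℝ h (ι w)).comp (P₀.comp ((fderiv ℝ φ n).comp K))) 0 :=
        HasFDerivAt.comp 0 (by rw [hk0, hPn]; exact hdh) e2
      have e4 := (e3.congr_of_eventuallyEq he).unique e1
      exact DFunLike.congr_fun e4 τ
    have k1 := key (fun τ => n + τ) T.subtypeL (T.subtypeL.hasFDerivAt.const_add n) (by simp) (by
      have := (continuous_id.prodMk continuous_const : Continuous fun τ : T => (τ, (0 : T))).tendsto 0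
      filter_upwards [this.eventually hτ] with τ e
      simpa [hσn] using e) ⟨τ, hτT⟩
    have k2 := key (fun τ => σ (n + τ)) ((fderiv ℝ σ n).comp T.subtypeL)
      (HasFDerivAt.comp 0 (by simpa using hdσ) (T.subtypeL.hasFDerivAt.const_add n))
      (by simp [hσn]) (by
      have := (continuous_const.prodMk continuous_id : Continuous fun τ : T => ((0 : T), τ)).tendsto 0
      filter_upwards [this.eventually hτ] with τ e
      simpa using e) ⟨τ, hτT⟩
    simp only [Submodule.subtypeL_apply, ContinuousLinearMap.comp_apply] at k1 k2
    have hDA : ∀ x, fderiv ℝ φ n (fderiv ℝ σ n x) = A (fderiv ℝ φ n x) := by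
      have e1 : HasFDerivAt (fun x => φ (σ x)) ((fderiv ℝ φ n).comp (fderiv ℝ σ n)) n :=
        HasFDerivAt.comp n (by rw [hσn]; exact hdφ) hdσ
      have e2 : HasFDerivAt (fun x => A (φ x)) (A.comp (fderiv ℝ φ n)) n := A.hasFDerivAt.comp n hdφ
      have e3 := e1.unique (e2.congr_of_eventuallyEq
        (Filter.eventually_of_mem (hσ.isOpen.mem_nhds hnU) hφσ))
      exact fun x => DFunLike.congr_fun e3 x
    obtain ⟨v, hv⟩ : ∃ v, v = fderiv ℝ φ n (τ + fderiv ℝ σ n τ) := ⟨_, rfl⟩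
    have hAv : A v = v := by
      rw [hv, map_add, hDA, map_add, hAA, add_comm]
    have hPv : (P₀ v : X) ∈ W := (hW _).2 ⟨(P₀ v).2, by rw [← hP₀A, hAv]⟩
    refine ⟨⟨P₀ v, hPv⟩, ?_⟩
    have h2 : HasFDerivAt (fun w => h (ι w)) ((fderiv ℝ h (ι w)).comp ι) w :=
      HasFDerivAt.comp w hdh ι.hasFDerivAt
    have h3 : HasFDerivAt g ((fderiv ℝ φi (h (ι w))).comp ((fderiv ℝ h (ι w)).comp ι)) w :=
      HasFDerivAt.comp w hφiw.differentiableAt.hasFDerivAt h2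
    have h4 : ι ⟨P₀ v, hPv⟩ = P₀ v := Subtype.ext (hι _)
    have h5 : fderiv ℝ h (ι w) (P₀ v) = v := by
      rw [hv, map_add, map_add, map_add, k1, k2]
    have h6 : ∀ x, fderiv ℝ φi (h (ι w)) (fderiv ℝ φ n x) = x := by
      have e1 : HasFDerivAt (fun x => φi (φ x)) ((fderiv ℝ φi (h (ι w))).comp (fderiv ℝ φ n)) n :=
        HasFDerivAt.comp n (by rw [← hn]; exact hφiw.differentiableAt.hasFDerivAt) hdφ
      exact fun x => DFunLike.congr_fun
        (e1.unique ((hasFDerivAt_id n).congr_of_eventuallyEq hinv)) x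
    rw [h3.fderiv, ContinuousLinearMap.comp_apply, ContinuousLinearMap.comp_apply, h4, h5, hv, h6]

/-- The orbit of a fixed point `o` of an analytic involution `σ` under the moves `v ↦ σ v + τ`,
`τ ∈ T`: a family of words whose derivative fills a space `V₀`, and a parametrization `g` of the
fixed points of `σ` in the orbit. -/
theorem IsAnalyticInvolution.exists_orbit (hσ : IsAnalyticInvolution σ U) (T : Submodule ℝ X)
    [FiniteDimensional ℝ X] {o : X} (ho : o ∈ U) (hσo : σ o = o) : ∃ V₀ : Submodule ℝ X,
    (∀ J : X →L[ℝ] X, (∀ τ ∈ T, J τ ∈ T) →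
      (∀ x ∈ U, ∀ v, fderiv ℝ σ x (J v) = -J (fderiv ℝ σ x v)) → ∀ v ∈ V₀, J v ∈ V₀) ∧
    (∃ (P : Type u) (_ : NormedAddCommGroup P) (_ : NormedSpace ℝ P) (_ : FiniteDimensional ℝ P)
      (fs : List (P → T)) (t₀ : P), (∀ f ∈ fs, ∀ t, AnalyticAt ℝ f t) ∧
      WordGood σ U (fs.map (· t₀)) o ∧ wordAct σ (fs.map (· t₀)) o = o ∧
      (fderiv ℝ (fun s => wordAct σ (fs.map (· s)) o) t₀ : P →ₗ[ℝ] X).range = V₀) ∧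
    ∃ W : Submodule ℝ X, (∀ w, w ∈ W ↔ w ∈ V₀ ∧ fderiv ℝ σ o w = w) ∧
      ∃ g : W → X, AnalyticAt ℝ g 0 ∧ g 0 = o ∧ (∀ w, fderiv ℝ g 0 w = w) ∧
        ∀ᶠ w in 𝓝 0, σ (g w) = g w ∧
          ∀ τ ∈ T, ∃ w', fderiv ℝ g w w' = τ + fderiv ℝ σ (g w) τ := by
  have := FiniteDimensional.complete ℝ X
  obtain ⟨L, hLg, hLo, hLid, hLmax, hLloop⟩ := hσ.exists_maximal_loop (T := T) ho
  obtain ⟨P, _, _, _, fs, t₀, hfs, hfsL, hspan⟩ := hσ.exists_family hLg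
  set V₀ := wordSpan σ L o ⊥ with hV₀
  have hgood₀ : WordGood σ U (fs.map (· t₀)) o := by rw [hfsL]; exact hLg
  let ψ : P → X := fun s => wordAct σ (fs.map (· s)) o
  have hψ₀ : ψ t₀ = o := by simp only [ψ, hfsL, hLo]
  obtain ⟨hψ, hψg⟩ := hσ.act_analyticAt (fun f hf => hfs f hf t₀) (analyticAt_const (v := o)) hgood₀
  change AnalyticAt ℝ ψ t₀ at hψ
  have hfin : ∀ {Q : Type u} [NormedAddCommGroup Q] [NormedSpace ℝ Q] {hs : List (Q → T)} {t : Q},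
      (∀ f ∈ hs, ∀ t, AnalyticAt ℝ f t) → WordGood σ U (hs.map (· t)) o →
      (fderiv ℝ (fun s => wordAct σ (hs.map (· s)) o) t : Q →ₗ[ℝ] X).range ≤
        wordSpan σ (hs.map (· t)) o ⊥ := by
    intro Q _ _ hs t h1 h2
    refine (hσ.range_le_wordSpan (fun f hf => h1 f hf t) (analyticAt_const (v := o)) h2).trans ?_
    rw [fderiv_const_apply]
    exact wordSpan_mono _ _ (by simp)
  have hrange : (fderiv ℝ ψ t₀ : P →ₗ[ℝ] X).range = V₀ := by
    refine le_antisymm ?_ hspan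
    have := hfin hfs hgood₀
    rwa [hfsL] at this
  refine ⟨V₀, fun J hJT hJ => wordSpan_invariant hJT hJ hLg, ⟨P, inferInstance, inferInstance,
    inferInstance, fs, t₀, hfs, hgood₀, hψ₀, hrange⟩, ?_⟩
  obtain ⟨φ, φi, hφ, hφo, hφd, hφσ, hφi, hφi0, hφinv, hAA⟩ := hσ.exists_linearization ho hσo
  obtain ⟨A, hA⟩ : ∃ A, A = fderiv ℝ σ o := ⟨_, rfl⟩
  rw [← hA] at hAA hφσ ⊢
  have hAV : ∀ v ∈ V₀, A v ∈ V₀ := by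
    intro v hv
    have h1 := hLloop (0 :: L) ⟨hLg, by simp [hLo, hσo, ho]⟩ (by simp [wordAct, hLo, hσo])
    refine h1 (Submodule.mem_sup_left ?_)
    rw [hLo, ← hA]
    exact Submodule.mem_map_of_mem hv
  -- an equivariant projection
  obtain ⟨P₀, hP₀, hP₀A⟩ : ∃ P₀ : X →L[ℝ] V₀, (∀ v : V₀, P₀ v = v) ∧
      ∀ x, (P₀ (A x) : X) = A (P₀ x) := by
    obtain ⟨Q, hQ⟩ := exists_continuous_projection ℝ V₀
    let A' : V₀ →L[ℝ] V₀ := (A.comp V₀.subtypeL).codRestrict V₀ fun v => hAV v v.2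
    have hA' : ∀ v, (A' v : X) = A v := fun v => rfl
    refine ⟨(1 / 2 : ℝ) • (Q + A'.comp (Q.comp A)), fun v => ?_, fun x => ?_⟩
    · ext
      have h1 : Q (A v) = A' v := hQ (A' v)
      simp only [_root_.smul_apply, _root_.add_apply, ContinuousLinearMap.comp_apply, h1, hQ,
        Submodule.coe_smul, Submodule.coe_add, hA', hAA]
      rw [← two_smul ℝ (v : X), smul_smul]; norm_num
    · simp only [_root_.smul_apply, _root_.add_apply, ContinuousLinearMap.comp_apply,
        Submodule.coe_smul, Submodule.coe_add, hA', hAA, map_smul, map_add]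
      rw [add_comm]
  -- the large family
  let hs : List (P × T × T × P → T) := fs.map (fun f t => f t.1) ++
    ([fun t => t.2.1, fun t => t.2.2.1, fun _ => 0] ++ fs.map fun f t => f t.2.2.2)
  let Ψ : P × T × T × P → X := fun s => wordAct σ (hs.map (· s)) o
  have hΨ : ∀ s, Ψ s = wordAct σ (fs.map (· s.1))
      (σ (σ (σ (ψ s.2.2.2)) + s.2.2.1) + s.2.1) := by
    intro s
    simp only [Ψ, hs, List.map_append, wordAct_append, List.map_map, Function.comp_def]
    simp [wordAct, ψ]
  have hhs : ∀ f ∈ hs, ∀ t, AnalyticAt ℝ f t := by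
    intro f hf t
    simp only [hs, List.mem_append, List.mem_map, List.mem_cons, List.not_mem_nil, or_false] at hf
    rcases hf with ⟨f', hf', rfl⟩ | (rfl | rfl | rfl) | ⟨f', hf', rfl⟩
    · exact (hfs f' hf' t.1).comp_eq analyticAt_fst rfl
    · fun_prop
    · fun_prop
    · exact analyticAt_const
    · refine (hfs f' hf' t.2.2.2).comp_eq ?_ rfl
      fun_prop
  let a : P × T × T × P := (t₀, 0, 0, t₀)
  have hsa : hs.map (· a) = L ++ ([0, 0, 0] ++ L) := by
    simp [hs, a, Function.comp_def, hfsL]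
  have hΨa : Ψ a = o := by simp [hΨ, a, hψ₀, hσo, hfsL, hLo]
  have hgooda : WordGood σ U (hs.map (· a)) o := by
    rw [hsa, wordGood_append, wordGood_append, wordAct_append, hLo]
    simp [WordGood, wordAct, hσo, ho, hLg]
  obtain ⟨hΨan, hΨg⟩ := hσ.act_analyticAt (fun f hf => hhs f hf a) (analyticAt_const (v := o)) hgooda
  change AnalyticAt ℝ Ψ a at hΨan
  have hΨt : ∀ t, Ψ (t, 0, 0, t₀) = ψ t := by
    intro t
    simp [hΨ, hψ₀, hσo, ψ]
  have hf : AnalyticAt ℝ (fun s => φ (Ψ s)) a := hφ.comp_eq hΨan hΨa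
  have hfd : fderiv ℝ (fun s => φ (Ψ s)) a = fderiv ℝ Ψ a := by
    have h1 : HasFDerivAt φ (ContinuousLinearMap.id ℝ X) (Ψ a) := by
      rw [hΨa, ← hφd]; exact hφ.differentiableAt.hasFDerivAt
    have h2 : HasFDerivAt (fun s => φ (Ψ s)) ((ContinuousLinearMap.id ℝ X).comp (fderiv ℝ Ψ a)) a :=
      h1.comp a hΨan.differentiableAt.hasFDerivAt
    rw [h2.fderiv, ContinuousLinearMap.id_comp]
  have hΨrange : (fderiv ℝ Ψ a : (P × T × T × P) →ₗ[ℝ] X).range = V₀ := by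
    apply le_antisymm
    · refine (hfin hhs hgooda).trans ?_
      refine hLloop _ hgooda ?_
      exact hΨa
    · rw [← hrange]
      rintro _ ⟨w, rfl⟩
      refine ⟨(w, 0, 0, 0), ?_⟩
      have hi : HasFDerivAt (fun t : P => ((t, 0, 0, t₀) : P × T × T × P))
          (ContinuousLinearMap.inl ℝ P (T × T × P)) t₀ :=
        (hasFDerivAt_id t₀).prodMk (hasFDerivAt_const _ _)
      have h1 : HasFDerivAt (fun t => Ψ (t, 0, 0, t₀))
          ((fderiv ℝ Ψ a).comp (ContinuousLinearMap.inl ℝ P (T × T × P))) t₀ :=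
        HasFDerivAt.comp t₀ (g := Ψ) (f := fun t : P => ((t, 0, 0, t₀) : P × T × T × P))
          hΨan.differentiableAt.hasFDerivAt hi
      simp only [hΨt] at h1
      have h2 := h1.fderiv
      change fderiv ℝ Ψ a (w, 0, 0, 0) = fderiv ℝ ψ t₀ w
      rw [show fderiv ℝ ψ t₀ = _ from h2]
      rfl
  have hrank : ∀ {Q : Type u} [NormedAddCommGroup Q] [NormedSpace ℝ Q] {ks : List (Q → T)} {a : Q},
      (∀ f ∈ ks, ∀ t, AnalyticAt ℝ f t) → WordGood σ U (ks.map (· a)) o →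
      wordAct σ (ks.map (· a)) o = o →
      ∀ᶠ t in 𝓝 a, Module.finrank ℝ
        (fderiv ℝ (fun s => φ (wordAct σ (ks.map (· s)) o)) t : Q →ₗ[ℝ] X).range ≤
          Module.finrank ℝ V₀ := by
    intro Q _ _ ks a h1 h2 h3
    obtain ⟨b1, b2⟩ := hσ.act_analyticAt (fun f hf => h1 f hf a) (analyticAt_const (v := o)) h2
    have b3 : ∀ᶠ t in 𝓝 a, AnalyticAt ℝ φ (wordAct σ (ks.map (· t)) o) :=
      b1.continuousAt.eventually (by simp only [h3]; exact hφ.eventually_analyticAt)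
    filter_upwards [b2, b3, b1.eventually_analyticAt] with t c1 c2 c3
    have c4 : HasFDerivAt (fun s => φ (wordAct σ (ks.map (· s)) o)) _ t :=
      c2.differentiableAt.hasFDerivAt.comp t c3.differentiableAt.hasFDerivAt
    rw [c4.fderiv]
    refine le_trans ?_ (hLmax _ c1)
    rw [ContinuousLinearMap.toLinearMap_comp, LinearMap.range_comp]
    exact (Submodule.finrank_map_le _ _).trans (Submodule.finrank_mono (hfin h1 c1))
  obtain ⟨h, hh, hhf, hPh⟩ := hf.exists_factor_of_rank_le V₀ (by rw [hfd, hΨrange])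
    (hrank hhs hgooda hΨa) P₀ hP₀
  simp only [hΨa, hφo, map_zero] at hh hPh
  have hh0 : h 0 = 0 := by
    have := hhf.self_of_nhds
    simpa [hΨa, hφo] using this.symm
  refine hσ.exists_fixed_chart T V₀ hφd hφo hφ hφσ hφi hφi0 hφinv hAA hP₀A hh hh0 ?_ ?_
  · intro v
    obtain ⟨x, hx⟩ : (v : X) ∈ (fderiv ℝ Ψ a : (P × T × T × P) →ₗ[ℝ] X).range := by
      rw [hΨrange]; exact v.2
    have e1 := hf.differentiableAt.hasFDerivAt
    have e2 : HasFDerivAt (fun s => P₀ (φ (Ψ s))) (P₀.comp (fderiv ℝ (fun s => φ (Ψ s)) a)) a :=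
      P₀.hasFDerivAt.comp a e1
    have e3 : HasFDerivAt (fun s => h (P₀ (φ (Ψ s))))
        ((fderiv ℝ h 0).comp (P₀.comp (fderiv ℝ (fun s => φ (Ψ s)) a))) a :=
      HasFDerivAt.comp a (by rw [hΨa, hφo, map_zero]; exact hh.differentiableAt.hasFDerivAt) e2
    have e4 := DFunLike.congr_fun ((e3.congr_of_eventuallyEq hhf).unique e1) x
    have hx' : fderiv ℝ (fun s => φ (Ψ s)) a x = v := by rw [hfd]; exact hx
    simp only [ContinuousLinearMap.comp_apply, hx', hP₀] at e4
    exact e4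
  -- parameters at which everything is under control
  obtain ⟨O, hO⟩ : ∃ O : Set P, O = {t | Ψ (t, 0, 0, t₀) = ψ t ∧
      φ (ψ t) = h (P₀ (φ (ψ t))) ∧ ψ t ∈ U ∧ φi (φ (σ (ψ t))) = σ (ψ t) ∧
      (∀ᶠ x in 𝓝 (ψ t), φi (φ x) = x) ∧ AnalyticAt ℝ φ (ψ t) ∧ ∀ᶠ τ : T × T in 𝓝 0,
        φ (σ (ψ t + τ.2) + τ.1) = h (P₀ (φ (σ (ψ t + τ.2) + τ.1)))} := ⟨_, rfl⟩
  have hOn : O ∈ 𝓝 t₀ := by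
    have hψt : Filter.Tendsto ψ (𝓝 t₀) (𝓝 o) := by
      have := hψ.continuousAt.tendsto; rwa [hψ₀] at this
    have hσt : Filter.Tendsto σ (𝓝 o) (𝓝 o) := by
      have := (hσ.analytic o ho).continuousAt.tendsto; rwa [hσo] at this
    have c1 : ∀ᶠ t in 𝓝 t₀, φ (Ψ (t, 0, 0, t₀)) = h (P₀ (φ (Ψ (t, 0, 0, t₀)))) := by
      have : Filter.Tendsto (fun t : P => ((t, 0, 0, t₀) : P × T × T × P)) (𝓝 t₀) (𝓝 a) :=
        (continuous_id.prodMk continuous_const).tendsto t₀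
      exact this.eventually hhf
    have hz : Filter.Tendsto (fun x : P × T × T => σ (ψ x.1 + x.2.2) + x.2.1)
        (𝓝 (t₀, 0, 0)) (𝓝 o) := by
      have d1 : Filter.Tendsto (fun x : P × T × T => ψ x.1 + (x.2.2 : X))
          (𝓝 (t₀, 0, 0)) (𝓝 (o + ((0 : T) : X))) := by
        refine Filter.Tendsto.add (hψt.comp (continuous_fst.tendsto _)) ?_
        exact (continuous_subtype_val.comp (continuous_snd.comp continuous_snd)).tendsto
          (t₀, (0 : T), (0 : T))
      rw [Submodule.coe_zero, add_zero] at d1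
      have d2 : Filter.Tendsto (fun x : P × T × T => σ (ψ x.1 + x.2.2) + (x.2.1 : X))
          (𝓝 (t₀, 0, 0)) (𝓝 (o + ((0 : T) : X))) := by
        refine Filter.Tendsto.add (hσt.comp d1) ?_
        exact (continuous_subtype_val.comp (continuous_fst.comp continuous_snd)).tendsto
          (t₀, (0 : T), (0 : T))
      rwa [Submodule.coe_zero, add_zero] at d2
    have c2 : ∀ᶠ x : P × T × T in 𝓝 (t₀, 0, 0),
        Ψ (t₀, x.2.1, x.2.2, x.1) = σ (ψ x.1 + x.2.2) + x.2.1 := by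
      have d1 : ∀ᶠ x : P × T × T in 𝓝 (t₀, 0, 0), ψ x.1 ∈ U :=
        (hψt.comp (continuous_fst.tendsto _)).eventually (hσ.isOpen.mem_nhds ho)
      filter_upwards [d1, hz.eventually hLid] with x e1 e2
      rw [hΨ]
      simp only [hfsL]
      rw [hσ.invol _ e1, e2]
    have c3 : ∀ᶠ x : P × T × T in 𝓝 (t₀, 0, 0), φ (Ψ (t₀, x.2.1, x.2.2, x.1)) =
        h (P₀ (φ (Ψ (t₀, x.2.1, x.2.2, x.1)))) := by
      have : Filter.Tendsto (fun x : P × T × T => ((t₀, x.2.1, x.2.2, x.1) : P × T × T × P))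
          (𝓝 (t₀, 0, 0)) (𝓝 a) :=
        (by fun_prop : Continuous fun x : P × T × T =>
          ((t₀, x.2.1, x.2.2, x.1) : P × T × T × P)).tendsto (t₀, (0 : T), (0 : T))
      exact this.eventually hhf
    have c4 := (c2.and c3).mono (fun x hx => show φ (σ (ψ x.1 + x.2.2) + x.2.1) =
        h (P₀ (φ (σ (ψ x.1 + x.2.2) + x.2.1))) by rw [← hx.1]; exact hx.2)
    rw [nhds_prod_eq] at c4
    rw [hO]
    filter_upwards [c1, hψt.eventually (hσ.isOpen.mem_nhds ho),
      hψt.eventually (hσt.eventually hφinv), hψt.eventually hφinv.eventually_nhds,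
      hψt.eventually hφ.eventually_analyticAt, c4.curry] with t e1 e2 e3 e4 e5 e6
    exact ⟨hΨt t, by rw [hΨt] at e1; exact e1, e2, e3, e4, e5, e6⟩
  have hfψ : AnalyticAt ℝ (fun t => φ (ψ t)) t₀ := hφ.comp_eq hψ hψ₀
  classical
  let f₁ : P → X := fun t => if t ∈ O then φ (ψ t) else 0
  have hf₁e : f₁ =ᶠ[𝓝 t₀] fun t => φ (ψ t) := by
    filter_upwards [hOn] with t ht
    simp [f₁, ht]
  have hf₁ : AnalyticAt ℝ f₁ t₀ := hfψ.congr hf₁e.symm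
  have hfd₁ : fderiv ℝ f₁ t₀ = fderiv ℝ ψ t₀ := by
    rw [hf₁e.fderiv_eq]
    have h2 : HasFDerivAt (fun s => φ (ψ s)) ((ContinuousLinearMap.id ℝ X).comp (fderiv ℝ ψ t₀))
        t₀ := by
      refine HasFDerivAt.comp t₀ ?_ hψ.differentiableAt.hasFDerivAt
      rw [hψ₀, ← hφd]; exact hφ.differentiableAt.hasFDerivAt
    rw [h2.fderiv, ContinuousLinearMap.id_comp]
  have hf₁0 : f₁ t₀ = 0 := by
    rw [hf₁e.self_of_nhds]; simp only [hψ₀, hφo]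
  obtain ⟨k, -, -, hk⟩ := hf₁.exists_factor_of_rank_le V₀ (by rw [hfd₁, hrange]) (by
      filter_upwards [hrank hfs hgood₀ hψ₀, hf₁e.fderiv (𝕜 := ℝ)] with t e1 e2
      rw [e2]; exact e1) P₀ hP₀
  rw [hf₁0, map_zero] at hk
  filter_upwards [hk, hPh] with y hy hPy
  obtain ⟨hky, t, hkt⟩ := hy
  obtain ⟨s, hsO, hs⟩ : ∃ s ∈ O, k y = φ (ψ s) := by
    by_cases ht : t ∈ O
    · exact ⟨t, ht, by rw [hkt]; simp [f₁, ht]⟩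
    · refine ⟨t₀, mem_of_mem_nhds hOn, ?_⟩
      rw [hkt, hψ₀, hφo]; simp [f₁, ht]
  rw [hO] at hsO
  obtain ⟨-, e1, e2, e3, e4, e5, e6⟩ := hsO
  refine ⟨hPy.1, ψ s, e2, ?_, e3, e4, e5, e6⟩
  rw [e1, ← hs, hky]

end Orbit

section Wirtinger

variable {N : ℕ}

theorem Cn.eq_sum_cbasis (v : Cn N) : v = ∑ j, v j • cbasis j 1 := by
  ext i
  simp [cbasis, Finset.sum_apply, Pi.single_apply]

theorem cbasis_I (j : Fin N) : cbasis j I = I • cbasis j 1 := by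
  ext i
  simp [cbasis]

/-- A real-linear map commuting with multiplication by `I` is determined by its values on the
standard basis. -/
theorem apply_eq_sum_cbasis {F : Type*} [NormedAddCommGroup F] [NormedSpace ℂ F]
    (A : Cn N →L[ℝ] F) (hA : ∀ v, A (I • v) = I • A v) (v : Cn N) :
    A v = ∑ j, v j • A (cbasis j 1) := by
  have h1 : ∀ (z : ℂ) (w : Cn N), A (z • w) = z • A w := by
    intro z w
    have : z • w = z.re • w + z.im • (I • w) := by
      conv_lhs => rw [← Complex.re_add_im z]
      rw [add_smul, mul_smul, Complex.coe_smul, Complex.coe_smul]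
    rw [this, map_add, map_smul, map_smul, hA]
    conv_rhs => rw [← Complex.re_add_im z]
    rw [add_smul, mul_smul, Complex.coe_smul, Complex.coe_smul]
  conv_lhs => rw [Cn.eq_sum_cbasis v]
  rw [map_sum]
  exact Finset.sum_congr rfl fun j _ => h1 _ _

/-- The Wirtinger gradient in terms of a sesqui-holomorphic extension. -/
theorem wirtD_eq_of_diag {ρ : Cn N → ℝ} {w : Cn N} {A : Cn N × Cn N →L[ℝ] ℂ}
    (hA : ∀ a b, A (I • a, -(I • b)) = I * A (a, b)) (hρ : ∀ v, (fderiv ℝ ρ w v : ℂ) = A (v, v))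
    (j : Fin N) : wirtD ρ w j = A (cbasis j 1, 0) := by
  have h1 : ∀ v, A (v, v) = A (v, 0) + A (0, v) := fun v => by rw [← map_add]; simp
  have h2 : ∀ v, A (I • v, 0) = I * A (v, 0) := fun v => by simpa using hA v 0
  have h3 : ∀ v, A (0, I • v) = -(I * A (0, v)) := fun v => by
    have h4 := hA 0 v
    have h5 : ((I • (0 : Cn N), -(I • v)) : Cn N × Cn N) = -(0, I • v) := by simp
    rw [h5, map_neg] at h4
    rw [← h4, neg_neg]
  rw [wirtD, hρ, hρ, h1, h1 (cbasis j I), cbasis_I, h2, h3]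
  linear_combination (1 / 2 * A (0, cbasis j 1) - 1 / 2 * A (cbasis j 1, 0)) * I_sq

/-- The value of a real-linear form on `z` in terms of a sesqui-holomorphic extension. -/
theorem hasFDerivAt_diag {F : Type*} [NormedAddCommGroup F] [NormedSpace ℝ F]
    {E : Type*} [NormedAddCommGroup E] [NormedSpace ℝ E] {r : E × E → F} {z : E}
    (hr : DifferentiableAt ℝ r (z, z)) :
    HasFDerivAt (fun x => r (x, x))
      ((fderiv ℝ r (z, z)).comp ((ContinuousLinearMap.id ℝ E).prod (ContinuousLinearMap.id ℝ E)))
      z :=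
  HasFDerivAt.comp z (g := r) (f := fun x : E => (x, x)) hr.hasFDerivAt
    ((hasFDerivAt_id z).prodMk (hasFDerivAt_id z))

/-- A hermitian sesqui-holomorphic extension of a real-analytic function. -/
theorem AnalyticAt.exists_hermitian_extension {ρ : Cn N → ℝ} {p : Cn N} (hρ : AnalyticAt ℝ ρ p) :
    ∃ r : Cn N × Cn N → ℂ, AnalyticAt ℝ r (p, p) ∧
      (∀ᶠ q in 𝓝 (p, p), ∀ a b, fderiv ℝ r q (I • a, -(I • b)) = I * fderiv ℝ r q (a, b)) ∧
      (∀ x y, r (y, x) = (starRingEnd ℂ) (r (x, y))) ∧ ∀ᶠ z in 𝓝 p, r (z, z) = ρ z := by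
  have h1 : AnalyticAt ℝ (fun x : Cn N × ℝ => ρ x.1) (p, 0) := hρ.comp_eq analyticAt_fst rfl
  obtain ⟨R, hR, hRc, hRd⟩ := h1.exists_sesqui_extension
  obtain ⟨ι, hι⟩ : ∃ ι : Cn N × Cn N →L[ℝ] Cn N × Cn N × ℝ, ∀ x, ι x = (x.1, x.2, 0) :=
    ⟨(ContinuousLinearMap.fst ℝ _ _).prod ((ContinuousLinearMap.snd ℝ _ _).prod 0), fun _ => rfl⟩
  obtain ⟨sw, hsw⟩ : ∃ sw : Cn N × Cn N →L[ℝ] Cn N × Cn N, ∀ x, sw x = (x.2, x.1) :=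
    ⟨(ContinuousLinearMap.snd ℝ _ _).prod (ContinuousLinearMap.fst ℝ _ _), fun _ => rfl⟩
  have hιp : ι (p, p) = (p, p, 0) := hι _
  have hswp : sw (p, p) = (p, p) := hsw _
  let cj : ℂ →L[ℝ] ℂ := Complex.conjCLE
  have hcj : ∀ z, cj z = (starRingEnd ℂ) z := fun _ => rfl
  let u : Cn N × Cn N → ℂ := fun x => R (ι x)
  have hu : AnalyticAt ℝ u (p, p) := hR.comp_eq (ι.analyticAt _) hιp
  have huc : ∀ᶠ q in 𝓝 (p, p), ∀ a b, fderiv ℝ u q (I • a, -(I • b)) =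
      I * fderiv ℝ u q (a, b) := by
    have c1 : Filter.Tendsto ι (𝓝 (p, p)) (𝓝 (p, p, 0)) := by
      have := ι.continuous.tendsto (p, p); rwa [hιp] at this
    filter_upwards [c1.eventually hRc, c1.eventually hR.eventually_analyticAt] with q e1 e2 a b
    have e3 : HasFDerivAt u ((fderiv ℝ R (ι q)).comp ι) q :=
      HasFDerivAt.comp q e2.differentiableAt.hasFDerivAt ι.hasFDerivAt
    rw [e3.fderiv]
    simp only [ContinuousLinearMap.comp_apply, hι (I • a, -(I • b)), hι (a, b)]
    exact e1 a b
  let r : Cn N × Cn N → ℂ := fun x => (1 / 2 : ℂ) * (u x + cj (u (sw x)))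
  have hus : AnalyticAt ℝ (fun x => cj (u (sw x))) (p, p) :=
    AnalyticAt.clm_const_apply cj (hu.comp_eq (sw.analyticAt _) hswp)
  have hcsw : Filter.Tendsto sw (𝓝 (p, p)) (𝓝 (p, p)) := by
    have := sw.continuous.tendsto (p, p); rwa [hswp] at this
  refine ⟨r, analyticAt_const.mul (hu.add hus), ?_, fun x y => ?_, ?_⟩
  · filter_upwards [huc, hcsw.eventually huc, hu.eventually_analyticAt,
      hcsw.eventually hu.eventually_analyticAt] with q e1 e2 e3 e4 a b
    have d1 : HasFDerivAt (fun x => cj (u (sw x))) (cj.comp ((fderiv ℝ u (sw q)).comp sw)) q :=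
      cj.hasFDerivAt.comp q (HasFDerivAt.comp q e4.differentiableAt.hasFDerivAt sw.hasFDerivAt)
    have d2 : HasFDerivAt r ((1 / 2 : ℂ) • (fderiv ℝ u q + cj.comp ((fderiv ℝ u (sw q)).comp sw)))
        q := (e3.differentiableAt.hasFDerivAt.add d1).const_mul _
    rw [d2.fderiv]
    have d3 : fderiv ℝ u (sw q) (-(I • b), I • a) = -(I * fderiv ℝ u (sw q) (b, a)) := by
      rw [← e2 b a, ← map_neg]; simp
    have d4 : sw (I • a, -(I • b)) = (-(I • b), I • a) := hsw _
    have d5 : sw (a, b) = (b, a) := hsw _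
    simp only [_root_.smul_apply, _root_.add_apply, ContinuousLinearMap.comp_apply, d4, d5, e1,
      d3, hcj, map_neg, map_mul, conj_I, smul_eq_mul]
    ring
  · simp only [r, hsw, hcj, map_mul, map_add, Complex.conj_conj]
    have : (starRingEnd ℂ) (1 / 2) = 1 / 2 := by
      rw [map_div₀, map_one, Complex.conj_ofNat]
    rw [this, add_comm]
  · have c1 : Filter.Tendsto (fun z : Cn N => (z, (0 : ℝ))) (𝓝 p) (𝓝 (p, 0)) :=
      (by fun_prop : Continuous fun z : Cn N => (z, (0 : ℝ))).tendsto p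
    filter_upwards [c1.eventually hRd] with z hz
    simp only [r, u, hsw, hι, hcj]
    rw [hz, Complex.conj_ofReal]
    ring

theorem surjective_of_linearIndependent_rows {d : ℕ} {f : Fin d → Fin N → ℂ}
    (hf : LinearIndependent ℂ f) (w : Fin d → ℂ) : ∃ v : Cn N, ∀ k, ∑ j, v j * f k j = w k := by
  have h1 : (Matrix.of f).rank = d := by
    have := LinearIndependent.rank_matrix (M := Matrix.of f) hf
    simpa using this
  have h2 : LinearMap.range (Matrix.of f).mulVecLin = ⊤ := by
    apply Submodule.eq_top_of_finrank_eq
    rw [Module.finrank_fin_fun]; exact h1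
  obtain ⟨v, hv⟩ := LinearMap.range_eq_top.1 h2 w
  refine ⟨WithLp.toLp 2 v, fun k => ?_⟩
  rw [← hv]
  simp [Matrix.mulVec, dotProduct, mul_comm]

end Wirtinger

section Segre

variable {N d q : ℕ}

/-- Solved form `y = c (x, s)`, `s = κ (y - p)`, of the complexified equation `r (y, x) = 0` of a
generic submanifold `M`. -/
structure SegreEq (M : Set (Cn N)) (p : Cn N) (κ : Cn N →L[ℂ] Cn q)
    (r : Cn N × Cn N → Fin d → ℂ) (c : Cn N × Cn q → Cn N) : Prop where
  dim : d + q = N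
  r_an : AnalyticAt ℝ r (p, p)
  r_base : r (p, p) = 0
  r_cr : ∀ᶠ x in 𝓝 (p, p), ∀ a b, fderiv ℝ r x (I • a, -(I • b)) = I • fderiv ℝ r x (a, b)
  r_symm : ∀ x y k, r (y, x) k = (starRingEnd ℂ) (r (x, y) k)
  mem_iff : ∀ᶠ z in 𝓝 p, (z ∈ M ↔ r (z, z) = 0)
  inj : ∀ᶠ x in 𝓝 (p, p), ∀ v, fderiv ℝ r x (v, 0) = 0 → κ v = 0 → v = 0
  surj : ∀ᶠ x in 𝓝 (p, p), ∀ w s, ∃ v, fderiv ℝ r x (v, 0) = w ∧ κ v = s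
  c_an : AnalyticAt ℝ c (p, 0)
  c_base : c (p, 0) = p
  c_eq : ∀ᶠ x in 𝓝 (p, (0 : Cn q)), r (c x, x.1) = 0 ∧ κ (c x - p) = x.2
  c_unique : ∀ᶠ x in 𝓝 (p, p), r x = 0 → c (x.2, κ (x.1 - p)) = x.1
  c_cr : ∀ᶠ x in 𝓝 (p, (0 : Cn q)), ∀ a b,
    fderiv ℝ c x (-(I • a), I • b) = I • fderiv ℝ c x (a, b)

theorem exists_complementary_projection {F : Type*} [NormedAddCommGroup F] [NormedSpace ℂ F]
    (hF : Module.finrank ℂ F = d) (Θ : Cn N →L[ℂ] F) (hΘ : ∀ w, ∃ v, Θ v = w) :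
    ∃ (q : ℕ) (κ : Cn N →L[ℂ] Cn q), d + q = N ∧ ∀ v, Θ v = 0 → κ v = 0 → v = 0 := by
  let K := (Θ : Cn N →ₗ[ℂ] F).ker
  obtain ⟨P, hP⟩ := exists_continuous_projection ℂ K
  have e : K ≃L[ℂ] Cn (Module.finrank ℂ K) := ContinuousLinearEquiv.ofFinrankEq (by simp)
  refine ⟨Module.finrank ℂ K, (e : K →L[ℂ] _).comp P, ?_, fun v h1 h2 => ?_⟩
  · have h1 := (Θ : Cn N →ₗ[ℂ] F).finrank_range_add_finrank_ker
    rw [LinearMap.range_eq_top.2 hΘ, finrank_top, hF] at h1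
    simpa using h1
  · have h3 : e (P v) = 0 := h2
    rw [map_eq_zero_iff e e.injective] at h3
    have h4 : P v = ⟨v, h1⟩ := hP ⟨v, h1⟩
    rw [h4] at h3
    exact congrArg Subtype.val h3

theorem IsGenericAt.exists_segreEq {M : Set (Cn N)} {p : Cn N} (hM : IsGenericAt M d p) :
    ∃ (q : ℕ) (κ : Cn N →L[ℂ] Cn q) (r : Cn N × Cn N → Fin d → ℂ) (c : Cn N × Cn q → Cn N),
      SegreEq M p κ r c := by
  obtain ⟨hpM, U, ρ, hU, hpU, hρ, hMU, hind⟩ := hM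
  choose r hr hrc hrs hrd using fun k => (hρ k p hpU).exists_hermitian_extension
  let r' : Cn N × Cn N → Fin d → ℂ := fun x k => r k x
  have hr' : AnalyticAt ℝ r' (p, p) := AnalyticAt.pi hr
  have hrd' : ∀ᶠ z in 𝓝 p, ∀ k, r k (z, z) = ρ z k := Filter.eventually_all.2 hrd
  have hmem : ∀ᶠ z in 𝓝 p, (z ∈ M ↔ r' (z, z) = 0) := by
    filter_upwards [hrd', hU.mem_nhds hpU] with z h1 h2
    have h3 : z ∈ M ↔ z ∈ M ∩ U := ⟨fun h => ⟨h, h2⟩, fun h => h.1⟩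
    rw [h3, hMU]
    constructor
    · rintro ⟨-, h⟩
      funext k
      simp [r', h1, h]
    · intro h
      refine ⟨h2, fun k => ?_⟩
      have := congrFun h k
      simp only [r', h1, Pi.zero_apply] at this
      exact_mod_cast this
  have hbase : r' (p, p) = 0 := hmem.self_of_nhds.1 hpM
  have hcr : ∀ᶠ x in 𝓝 (p, p), ∀ a b,
      fderiv ℝ r' x (I • a, -(I • b)) = I • fderiv ℝ r' x (a, b) := by
    filter_upwards [Filter.eventually_all.2 hrc, Filter.eventually_all.2
      fun k => (hr k).eventually_analyticAt] with x h1 h2 a b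
    have h3 : HasFDerivAt r' (ContinuousLinearMap.pi fun k => fderiv ℝ (r k) x) x :=
      hasFDerivAt_pi.2 fun k => (h2 k).differentiableAt.hasFDerivAt
    rw [h3.fderiv]
    funext k
    exact h1 k a b
  have hcr1 : ∀ᶠ x in 𝓝 (p, p), ∀ a,
      fderiv ℝ r' x (I • a, 0) = I • fderiv ℝ r' x (a, 0) := by
    filter_upwards [hcr] with x h a
    simpa using h a 0
  have hcr2 : ∀ᶠ x in 𝓝 (p, p), ∀ b,
      fderiv ℝ r' x (0, I • b) = -(I • fderiv ℝ r' x (0, b)) := by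
    filter_upwards [hcr] with x h b
    rw [← h 0 b, ← map_neg]; simp
  -- the holomorphic derivative at the base point
  have hwd : ∀ k j, wirtD (fun z => ρ z k) p j = fderiv ℝ (r k) (p, p) (cbasis j 1, 0) := by
    intro k j
    refine wirtD_eq_of_diag (fun a b => (hrc k).self_of_nhds a b) (fun v => ?_) j
    have h1 := hasFDerivAt_diag (hr k).differentiableAt
    have h2 : HasFDerivAt (fun z => ((ρ z k : ℝ) : ℂ))
        (Complex.ofRealCLM.comp (fderiv ℝ (fun z => ρ z k) p)) p :=
      Complex.ofRealCLM.hasFDerivAt.comp p (hρ k p hpU).differentiableAt.hasFDerivAt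
    have h3 := (h1.congr_of_eventuallyEq ((hrd k).mono fun z hz => hz.symm)).unique h2
    exact (DFunLike.congr_fun h3 v).symm
  obtain ⟨Θ, hΘ⟩ : ∃ Θ : Cn N →L[ℂ] (Fin d → ℂ), ∀ v, Θ v = fderiv ℝ r' (p, p) (v, 0) := by
    have hc := hcr1.self_of_nhds
    refine ⟨LinearMap.toContinuousLinearMap ⟨⟨fun v => fderiv ℝ r' (p, p) (v, 0), fun x y => ?_⟩,
      fun z w => ?_⟩, fun v => rfl⟩
    · rw [← map_add]; simp
    · have : ((z • w, 0) : Cn N × Cn N) = z.re • (w, 0) + z.im • (I • w, 0) := by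
        ext1
        · change z • w = z.re • w + z.im • (I • w)
          conv_lhs => rw [← Complex.re_add_im z]
          rw [add_smul, mul_smul, Complex.coe_smul, Complex.coe_smul]
        · simp
      change fderiv ℝ r' (p, p) (z • w, 0) = z • fderiv ℝ r' (p, p) (w, 0)
      rw [this, map_add, map_smul, map_smul, hc]
      conv_rhs => rw [← Complex.re_add_im z]
      rw [add_smul, mul_smul, Complex.coe_smul, Complex.coe_smul]
  have hr'k : ∀ v k, fderiv ℝ r' (p, p) v k = fderiv ℝ (r k) (p, p) v := by
    intro v k
    have h3 : HasFDerivAt r' (ContinuousLinearMap.pi fun k => fderiv ℝ (r k) (p, p)) (p, p) :=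
      hasFDerivAt_pi.2 fun k => (hr k).differentiableAt.hasFDerivAt
    rw [h3.fderiv]; rfl
  have hΘs : ∀ w, ∃ v, Θ v = w := by
    intro w
    obtain ⟨v, hv⟩ := surjective_of_linearIndependent_rows (hind p ⟨hpM, hpU⟩) w
    refine ⟨v, ?_⟩
    funext k
    rw [← hv k]
    conv_lhs => rw [Cn.eq_sum_cbasis v, map_sum, Finset.sum_apply]
    refine Finset.sum_congr rfl fun j _ => ?_
    rw [map_smul, Pi.smul_apply, hΘ, hr'k, hwd, smul_eq_mul]
  obtain ⟨q, κ, hdim, hκ⟩ := exists_complementary_projection (Module.finrank_fin_fun ℂ) Θ hΘs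
  -- the real-linear isomorphism `(D₁ r, κ)`
  let κr : Cn N →L[ℝ] Cn q := κ.restrictScalars ℝ
  have hκr : ∀ v, κr v = κ v := fun _ => rfl
  let Ξ : Cn N × Cn N → Cn N →L[ℝ] (Fin d → ℂ) × Cn q := fun x =>
    ((fderiv ℝ r' x).comp (ContinuousLinearMap.inl ℝ _ _)).prod κr
  have hΞc : ContinuousAt Ξ (p, p) := by
    have h1 : ContinuousAt (fun x => (fderiv ℝ r' x).comp
        (ContinuousLinearMap.inl ℝ (Cn N) (Cn N))) (p, p) := by
      have h2 : ContinuousAt (fun x => fderiv ℝ r' x) (p, p) := hr'.fderiv.continuousAt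
      fun_prop
    have h2 : ContinuousAt (fun x : Cn N × Cn N => ((fderiv ℝ r' x).comp
        (ContinuousLinearMap.inl ℝ (Cn N) (Cn N)), κr)) (p, p) := h1.prodMk continuousAt_const
    have h3 : Continuous fun L : (Cn N →L[ℝ] (Fin d → ℂ)) × (Cn N →L[ℝ] Cn q) => L.1.prod L.2 :=
      (ContinuousLinearMap.prodₗᵢ (𝕜 := ℝ) ℝ).continuous
    exact h3.continuousAt.comp h2
  have hfr : Module.finrank ℝ (Cn N) = Module.finrank ℝ ((Fin d → ℂ) × Cn q) := by
    rw [finrank_real_of_complex, Module.finrank_prod, finrank_real_of_complex (Fin d → ℂ),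
      finrank_real_of_complex (Cn q)]
    simp only [finrank_euclideanSpace, Fintype.card_fin, Module.finrank_fin_fun]
    omega
  have hΞi : ∀ᶠ x in 𝓝 (p, p), Function.Injective (Ξ x) := by
    refine hΞc.eventually (ContinuousLinearMap.isOpen_injective.mem_nhds ?_)
    refine (injective_iff_map_eq_zero _).2 fun v hv => ?_
    have h1 : fderiv ℝ r' (p, p) (v, 0) = 0 := congrArg Prod.fst hv
    have h2 : κ v = 0 := congrArg Prod.snd hv
    exact hκ v (by rw [hΘ, h1]) h2
  have hinj : ∀ᶠ x in 𝓝 (p, p), ∀ v, fderiv ℝ r' x (v, 0) = 0 → κ v = 0 → v = 0 := by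
    filter_upwards [hΞi] with x hx v h1 h2
    apply hx
    rw [map_zero]
    exact Prod.ext h1 h2
  have hsurj : ∀ᶠ x in 𝓝 (p, p), ∀ w s, ∃ v, fderiv ℝ r' x (v, 0) = w ∧ κ v = s := by
    filter_upwards [hΞi] with x hx w s
    have h1 : Function.Injective (Ξ x : Cn N →ₗ[ℝ] (Fin d → ℂ) × Cn q) := hx
    rw [LinearMap.injective_iff_surjective_of_finrank_eq_finrank hfr] at h1
    obtain ⟨v, hv⟩ := h1 (w, s)
    exact ⟨v, congrArg Prod.fst hv, congrArg Prod.snd hv⟩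
  -- the implicit function
  let g : Cn N × (Cn N × Cn q) → (Fin d → ℂ) × Cn q := fun y =>
    (r' (y.1, y.2.1), κr (y.1 - p) - y.2.2)
  have hg : AnalyticAt ℝ g (p, (p, 0)) := by
    have h1 : AnalyticAt ℝ (fun y : Cn N × (Cn N × Cn q) => r' (y.1, y.2.1)) (p, (p, 0)) :=
      hr'.comp_eq (f := fun y : Cn N × (Cn N × Cn q) => (y.1, y.2.1)) (by fun_prop) rfl
    have h2 : AnalyticAt ℝ (fun y : Cn N × (Cn N × Cn q) => κr (y.1 - p) - y.2.2) (p, (p, 0)) :=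
      (AnalyticAt.clm_const_apply κr (by fun_prop)).sub (by fun_prop)
    exact h1.prod h2
  obtain ⟨c, hc, hc0, hceq, hcu⟩ := hg.exists_implicit (by simp [g, hbase]) (by
    intro v hv
    have h1 : HasFDerivAt (fun y : Cn N => g (y, (p, 0))) ((fderiv ℝ g (p, (p, 0))).comp
        (ContinuousLinearMap.inl ℝ _ _)) p :=
      HasFDerivAt.comp p (g := g) (f := fun y : Cn N => (y, ((p, 0) : Cn N × Cn q)))
        hg.differentiableAt.hasFDerivAt ((hasFDerivAt_id p).prodMk (hasFDerivAt_const _ _))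
    have h2 : HasFDerivAt (fun y : Cn N => g (y, (p, 0))) (Ξ (p, p)) p := by
      have h3 : HasFDerivAt (fun y : Cn N => r' (y, p)) ((fderiv ℝ r' (p, p)).comp
          (ContinuousLinearMap.inl ℝ _ _)) p :=
        HasFDerivAt.comp p (g := r') (f := fun y : Cn N => (y, p))
          hr'.differentiableAt.hasFDerivAt ((hasFDerivAt_id p).prodMk (hasFDerivAt_const _ _))
      have h4 : HasFDerivAt (fun y : Cn N => κr (y - p) - 0) κr p :=
        ((κr.hasFDerivAt.comp p ((hasFDerivAt_id p).sub_const p))).sub_const 0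
      exact h3.prodMk h4
    have h3 : Ξ (p, p) v = 0 := by
      rw [← h1.unique h2]; exact hv
    exact hinj.self_of_nhds v (congrArg Prod.fst h3) (congrArg Prod.snd h3)) hfr
  have hceq' : ∀ᶠ x in 𝓝 (p, (0 : Cn q)), r' (c x, x.1) = 0 ∧ κ (c x - p) = x.2 := by
    filter_upwards [hceq] with x hx
    exact ⟨congrArg Prod.fst hx, sub_eq_zero.1 (congrArg Prod.snd hx)⟩
  refine ⟨q, κ, r', c, hdim, hr', hbase, hcr, fun x y k => hrs k x y, hmem, hinj, hsurj, hc, hc0,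
    hceq', ?_, ?_⟩
  · have h1 : Filter.Tendsto (fun x : Cn N × Cn N => (x.1, (x.2, κ (x.1 - p)))) (𝓝 (p, p))
        (𝓝 (p, (p, 0))) := by
      have := (by fun_prop : Continuous fun x : Cn N × Cn N =>
        (x.1, (x.2, κ (x.1 - p)))).tendsto (p, p)
      simpa using this
    filter_upwards [h1.eventually hcu] with x hx hrx
    refine (hx ?_).symm
    simp [g, hrx, hκr]
  · have h1 : Filter.Tendsto (fun x : Cn N × Cn q => (c x, x.1)) (𝓝 (p, 0)) (𝓝 (p, p)) := by
      have := hc.continuousAt.prodMk (continuousAt_fst (p := (p, (0 : Cn q))))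
      have := this.tendsto
      rwa [hc0] at this
    filter_upwards [h1.eventually hcr1, h1.eventually hcr2, h1.eventually hinj,
      h1.eventually hr'.eventually_analyticAt, hceq'.eventually_nhds, hc.eventually_analyticAt]
      with x e1 e2 e3 e4 e5 e6 a b
    have d1 : HasFDerivAt (fun x : Cn N × Cn q => r' (c x, x.1)) ((fderiv ℝ r' (c x, x.1)).comp
        ((fderiv ℝ c x).prod (ContinuousLinearMap.fst ℝ _ _))) x :=
      HasFDerivAt.comp x (g := r') (f := fun x : Cn N × Cn q => (c x, x.1))
        e4.differentiableAt.hasFDerivAt (e6.differentiableAt.hasFDerivAt.prodMk hasFDerivAt_fst)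
    have d2 := d1.unique ((hasFDerivAt_const (0 : Fin d → ℂ) x).congr_of_eventuallyEq
      (e5.mono fun y hy => hy.1))
    have d3 : ∀ a b, fderiv ℝ r' (c x, x.1) (fderiv ℝ c x (a, b), 0) =
        -fderiv ℝ r' (c x, x.1) (0, a) := by
      intro a b
      have := DFunLike.congr_fun d2 (a, b)
      simp only [ContinuousLinearMap.comp_apply, ContinuousLinearMap.prod_apply,
        ContinuousLinearMap.coe_fst', _root_.zero_apply] at this
      rw [eq_neg_iff_add_eq_zero, ← map_add, ← this]
      simp
    have d4 : HasFDerivAt (fun x : Cn N × Cn q => κr (c x - p)) (κr.comp (fderiv ℝ c x)) x :=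
      κr.hasFDerivAt.comp x (e6.differentiableAt.hasFDerivAt.sub_const p)
    have d5 := d4.unique (hasFDerivAt_snd.congr_of_eventuallyEq (e5.mono fun y hy => hy.2))
    have d6 : ∀ a b, κ (fderiv ℝ c x (a, b)) = b := fun a b => DFunLike.congr_fun d5 (a, b)
    refine sub_eq_zero.1 (e3 _ ?_ ?_)
    · have d7 : ((fderiv ℝ c x (-(I • a), I • b) - I • fderiv ℝ c x (a, b), 0) : Cn N × Cn N) =
          (fderiv ℝ c x (-(I • a), I • b), 0) - (I • fderiv ℝ c x (a, b), 0) := by simp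
      have d8 : ((0, -(I • a)) : Cn N × Cn N) = -(0, I • a) := by simp
      rw [d7, map_sub, e1, d3, d3, d8, map_neg, e2]
      simp
    · rw [map_sub, map_smul, d6, d6, sub_self]

end Segre

section Sesqui

variable {n k : ℕ}

/-- Real-analytic functions near `y₀` which are holomorphic in the first and antiholomorphic in the
second variable. -/
def IsSesquiAt (u : Cn n × Cn k → ℂ) (y₀ : Cn n × Cn k) : Prop :=
  AnalyticAt ℝ u y₀ ∧
    ∀ᶠ y in 𝓝 y₀, ∀ a b, fderiv ℝ u y (I • a, -(I • b)) = I * fderiv ℝ u y (a, b)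

theorem IsSesquiAt.eventually {u : Cn n × Cn k → ℂ} {y₀ : Cn n × Cn k} (h : IsSesquiAt u y₀) :
    ∀ᶠ y in 𝓝 y₀, IsSesquiAt u y := by
  filter_upwards [h.1.eventually_analyticAt, h.2.eventually_nhds] with y h1 h2
  exact ⟨h1, h2⟩

theorem isSesquiAt_const (z : ℂ) (y₀ : Cn n × Cn k) : IsSesquiAt (fun _ => z) y₀ :=
  ⟨analyticAt_const, by simp⟩

theorem IsSesquiAt.add {u v : Cn n × Cn k → ℂ} {y₀ : Cn n × Cn k} (hu : IsSesquiAt u y₀)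
    (hv : IsSesquiAt v y₀) : IsSesquiAt (fun y => u y + v y) y₀ := by
  refine ⟨hu.1.add hv.1, ?_⟩
  filter_upwards [hu.2, hv.2, hu.1.eventually_analyticAt, hv.1.eventually_analyticAt]
    with y h1 h2 h3 h4 a b
  have := (h3.differentiableAt.hasFDerivAt.add h4.differentiableAt.hasFDerivAt).fderiv
  have h5 : fderiv ℝ (fun y => u y + v y) y = fderiv ℝ u y + fderiv ℝ v y := this
  rw [h5, _root_.add_apply, _root_.add_apply, h1, h2]
  ring

theorem IsSesquiAt.mul {u v : Cn n × Cn k → ℂ} {y₀ : Cn n × Cn k} (hu : IsSesquiAt u y₀)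
    (hv : IsSesquiAt v y₀) : IsSesquiAt (fun y => u y * v y) y₀ := by
  refine ⟨hu.1.mul hv.1, ?_⟩
  filter_upwards [hu.2, hv.2, hu.1.eventually_analyticAt, hv.1.eventually_analyticAt]
    with y h1 h2 h3 h4 a b
  have := (h3.differentiableAt.hasFDerivAt.mul h4.differentiableAt.hasFDerivAt).fderiv
  have h5 : fderiv ℝ (fun y => u y * v y) y = u y • fderiv ℝ v y + v y • fderiv ℝ u y := this
  rw [h5]
  simp only [_root_.add_apply, _root_.smul_apply, h1, h2, smul_eq_mul]
  ring

theorem IsSesquiAt.sum {ι : Type*} (s : Finset ι) {u : ι → Cn n × Cn k → ℂ} {y₀ : Cn n × Cn k}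
    (hu : ∀ i ∈ s, IsSesquiAt (u i) y₀) : IsSesquiAt (fun y => ∑ i ∈ s, u i y) y₀ := by
  classical
  induction s using Finset.induction_on with
  | empty => simpa using isSesquiAt_const 0 y₀
  | insert i s hi ih =>
    simp only [Finset.sum_insert hi]
    exact (hu i (Finset.mem_insert_self i s)).add
      (ih fun j hj => hu j (Finset.mem_insert_of_mem hj))

theorem fderiv_fderiv_apply_comm {E F : Type*} [NormedAddCommGroup E] [NormedSpace ℝ E]
    [NormedAddCommGroup F] [NormedSpace ℝ F] [CompleteSpace F] {u : E → F} {y : E}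
    (hu : AnalyticAt ℝ u y) (v w : E) :
    fderiv ℝ (fun x => fderiv ℝ u x v) y w = fderiv ℝ (fun x => fderiv ℝ u x w) y v := by
  have h1 : ∀ v w, fderiv ℝ (fun x => fderiv ℝ u x v) y w = fderiv ℝ (fderiv ℝ u) y w v := by
    intro v w
    have : HasFDerivAt (fun x => fderiv ℝ u x v)
        ((ContinuousLinearMap.apply ℝ F v).comp (fderiv ℝ (fderiv ℝ u) y)) y :=
      (ContinuousLinearMap.apply ℝ F v).hasFDerivAt.comp y
        hu.fderiv.differentiableAt.hasFDerivAt
    rw [this.fderiv]; rfl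
  rw [h1, h1]
  exact (hu.contDiffAt (n := 2)).isSymmSndFDerivAt (by simp) w v

theorem IsSesquiAt.fderiv_apply {u : Cn n × Cn k → ℂ} {y₀ : Cn n × Cn k} (hu : IsSesquiAt u y₀)
    (v : Cn n × Cn k) : IsSesquiAt (fun y => fderiv ℝ u y v) y₀ := by
  refine ⟨hu.1.fderiv_apply_const v, ?_⟩
  filter_upwards [hu.1.eventually_analyticAt, hu.2.eventually_nhds] with y h1 h2 a b
  rw [fderiv_fderiv_apply_comm h1 v, fderiv_fderiv_apply_comm h1 v]
  have h3 : (fun x => fderiv ℝ u x (I • a, -(I • b))) =ᶠ[𝓝 y] fun x => I * fderiv ℝ u x (a, b) := by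
    filter_upwards [h2] with x hx using hx a b
  rw [h3.fderiv_eq]
  have h4 : HasFDerivAt (fun x => I * fderiv ℝ u x (a, b))
      (I • fderiv ℝ (fun x => fderiv ℝ u x (a, b)) y) y :=
    (h1.fderiv_apply_const (a, b)).differentiableAt.hasFDerivAt.const_mul I
  rw [h4.fderiv]; rfl

theorem IsSesquiAt.congr {u v : Cn n × Cn k → ℂ} {y₀ : Cn n × Cn k} (hu : IsSesquiAt u y₀)
    (h : u =ᶠ[𝓝 y₀] v) : IsSesquiAt v y₀ := by
  refine ⟨hu.1.congr h, ?_⟩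
  filter_upwards [hu.2, h.eventually_nhds] with y h1 h2 a b
  have h2 : u =ᶠ[𝓝 y] v := h2
  rw [← h2.fderiv_eq]
  exact h1 a b

/-- Values of a sesqui-holomorphic derivative. -/
theorem sesqui_apply_snd {A : Cn n × Cn k →L[ℝ] ℂ}
    (hA : ∀ a b, A (I • a, -(I • b)) = I * A (a, b)) (b : Cn k) :
    A (0, b) = ∑ j, (starRingEnd ℂ) (b j) * A (0, cbasis j 1) := by
  let B : Cn k →L[ℝ] ℂ := (Complex.conjCLE : ℂ →L[ℝ] ℂ).comp
    (A.comp (ContinuousLinearMap.inr ℝ _ _))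
  have hB : ∀ v, B v = (starRingEnd ℂ) (A (0, v)) := fun _ => rfl
  have h1 : ∀ v, A (0, I • v) = -(I * A (0, v)) := fun v => by
    rw [← hA 0 v, ← map_neg]; simp
  have h2 := apply_eq_sum_cbasis B (fun v => by rw [hB, hB, h1]; simp) b
  have h3 := congrArg (starRingEnd ℂ) h2
  rw [hB, Complex.conj_conj, map_sum] at h3
  rw [h3]
  refine Finset.sum_congr rfl fun j _ => ?_
  rw [smul_eq_mul, map_mul, hB, Complex.conj_conj]

theorem sum_conj_mul_wirtDBar (A : Cn n →L[ℝ] ℂ) (V : Cn n) :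
    ∑ j, (starRingEnd ℂ) (V j) * ((1 / 2 : ℂ) * (A (cbasis j 1) + I * A (cbasis j I))) =
      (1 / 2 : ℂ) * (A V + I * A (I • V)) := by
  let B : Cn n × Cn n →L[ℝ] ℂ := (1 / 2 : ℂ) • (A.comp (ContinuousLinearMap.snd ℝ _ _) +
    I • A.comp ((I • ContinuousLinearMap.id ℂ (Cn n)).restrictScalars ℝ ∘L
      (ContinuousLinearMap.snd ℝ _ _)) + A.comp (ContinuousLinearMap.fst ℝ _ _) -
    I • A.comp ((I • ContinuousLinearMap.id ℂ (Cn n)).restrictScalars ℝ ∘L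
      (ContinuousLinearMap.fst ℝ _ _)))
  have hB : ∀ a b, B (a, b) = (1 / 2 : ℂ) * (A b + I * A (I • b) + A a - I * A (I • a)) :=
    fun _ _ => rfl
  have h2 : ∀ v : Cn n, A (I • I • v) = -A v := fun v => by
    rw [smul_smul, I_mul_I, neg_one_smul, map_neg]
  have h1 := sesqui_apply_snd (A := B) (fun a b => by
    rw [hB, hB, smul_neg, map_neg, map_neg, h2, h2]
    linear_combination (1 / 2 * A (I • a) - 1 / 2 * A (I • b)) * I_sq) V
  simp only [hB, smul_zero, map_zero, mul_zero, add_zero, sub_zero] at h1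
  rw [h1]
  refine Finset.sum_congr rfl fun j _ => ?_
  rw [cbasis_I]

/-- A complex-valued real-analytic function extends sesqui-holomorphically off the diagonal. -/
theorem AnalyticAt.exists_isSesquiAt {g : Cn n → ℂ} {p : Cn n} (hg : AnalyticAt ℝ g p) :
    ∃ U : Cn n × Cn n → ℂ, IsSesquiAt U (p, p) ∧ ∀ᶠ z in 𝓝 p, U (z, z) = g z := by
  have h1 : AnalyticAt ℝ (fun z => (g z).re) p := AnalyticAt.clm_const_apply Complex.reCLM hg
  have h2 : AnalyticAt ℝ (fun z => (g z).im) p := AnalyticAt.clm_const_apply Complex.imCLM hg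
  obtain ⟨u, hu, huc, -, hud⟩ := h1.exists_hermitian_extension
  obtain ⟨v, hv, hvc, -, hvd⟩ := h2.exists_hermitian_extension
  refine ⟨fun y => u y + I * v y, IsSesquiAt.add ⟨hu, huc⟩
    ((isSesquiAt_const I _).mul ⟨hv, hvc⟩), ?_⟩
  filter_upwards [hud, hvd] with z e1 e2
  rw [e1, e2, mul_comm]
  exact Complex.re_add_im _

end Sesqui

namespace SegreEq

variable {N d q : ℕ} {M : Set (Cn N)} {p : Cn N} {κ : Cn N →L[ℂ] Cn q}
  {r : Cn N × Cn N → Fin d → ℂ} {c : Cn N × Cn q → Cn N}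

theorem tendsto_diag (_h : SegreEq M p κ r c) :
    Filter.Tendsto (fun z => (z, κ (z - p))) (𝓝 p) (𝓝 (p, 0)) := by
  have := (by fun_prop : Continuous fun z : Cn N => (z, κ (z - p))).tendsto p
  simpa using this

theorem tendsto_dup (p : Cn N) : Filter.Tendsto (fun z => (z, z)) (𝓝 p) (𝓝 (p, p)) :=
  (by fun_prop : Continuous fun z : Cn N => (z, z)).tendsto p

theorem hasFDerivAt_diag (κ : Cn N →L[ℂ] Cn q) (p z : Cn N) :
    HasFDerivAt (fun z => (z, κ (z - p)))
      ((ContinuousLinearMap.id ℝ (Cn N)).prod (κ.restrictScalars ℝ)) z :=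
  (hasFDerivAt_id z).prodMk
    ((κ.restrictScalars ℝ).hasFDerivAt.comp z ((hasFDerivAt_id z).sub_const p))

theorem analyticAt_diag (κ : Cn N →L[ℂ] Cn q) (p z : Cn N) :
    AnalyticAt ℝ (fun z => (z, κ (z - p))) z :=
  analyticAt_id.prod (AnalyticAt.clm_const_apply (κ.restrictScalars ℝ) (by fun_prop))

theorem c_diag (h : SegreEq M p κ r c) : ∀ᶠ z in 𝓝 p, z ∈ M → c (z, κ (z - p)) = z := by
  filter_upwards [(tendsto_dup p).eventually h.c_unique, h.mem_iff] with z h1 h2 hz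
  exact h1 (h2.1 hz)

theorem tendsto_c_fst (h : SegreEq M p κ r c) :
    Filter.Tendsto (fun x : Cn N × Cn q => (c x, x.1)) (𝓝 (p, 0)) (𝓝 (p, p)) := by
  have := (h.c_an.continuousAt.prodMk (continuousAt_fst (p := (p, (0 : Cn q))))).tendsto
  rwa [h.c_base] at this

theorem fderiv_c (h : SegreEq M p κ r c) : ∀ᶠ x in 𝓝 (p, (0 : Cn q)), AnalyticAt ℝ c x ∧
    ∀ a b, fderiv ℝ r (c x, x.1) (fderiv ℝ c x (a, b), a) = 0 ∧ κ (fderiv ℝ c x (a, b)) = b := by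
  filter_upwards [h.tendsto_c_fst.eventually h.r_an.eventually_analyticAt, h.c_eq.eventually_nhds,
    h.c_an.eventually_analyticAt] with x e4 e5 e6
  refine ⟨e6, fun a b => ⟨?_, ?_⟩⟩
  · have d1 : HasFDerivAt (fun x : Cn N × Cn q => r (c x, x.1)) ((fderiv ℝ r (c x, x.1)).comp
        ((fderiv ℝ c x).prod (ContinuousLinearMap.fst ℝ _ _))) x :=
      HasFDerivAt.comp x (g := r) (f := fun x : Cn N × Cn q => (c x, x.1))
        e4.differentiableAt.hasFDerivAt (e6.differentiableAt.hasFDerivAt.prodMk hasFDerivAt_fst)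
    have d2 := d1.unique ((hasFDerivAt_const (0 : Fin d → ℂ) x).congr_of_eventuallyEq
      (e5.mono fun y hy => hy.1))
    exact DFunLike.congr_fun d2 (a, b)
  · have d4 : HasFDerivAt (fun x : Cn N × Cn q => (κ.restrictScalars ℝ) (c x - p))
        ((κ.restrictScalars ℝ).comp (fderiv ℝ c x)) x :=
      (κ.restrictScalars ℝ).hasFDerivAt.comp x (e6.differentiableAt.hasFDerivAt.sub_const p)
    have d5 := d4.unique (hasFDerivAt_snd.congr_of_eventuallyEq (e5.mono fun y hy => hy.2))
    exact DFunLike.congr_fun d5 (a, b)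

theorem fderiv_r_diag (h : SegreEq M p κ r c) : ∀ᶠ z in 𝓝 p, ∀ v k,
    fderiv ℝ r (z, z) (v, v) k = ((2 * (fderiv ℝ r (z, z) (v, 0) k).re : ℝ) : ℂ) := by
  filter_upwards [(tendsto_dup p).eventually h.r_an.eventually_analyticAt] with z hz v k
  obtain ⟨sw, hsw⟩ : ∃ sw : Cn N × Cn N →L[ℝ] Cn N × Cn N, ∀ x, sw x = (x.2, x.1) :=
    ⟨(ContinuousLinearMap.snd ℝ _ _).prod (ContinuousLinearMap.fst ℝ _ _), fun _ => rfl⟩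
  obtain ⟨cj, hcj⟩ : ∃ cj : (Fin d → ℂ) →L[ℝ] ℂ, ∀ w, cj w = (starRingEnd ℂ) (w k) :=
    ⟨(Complex.conjCLE : ℂ →L[ℝ] ℂ).comp (ContinuousLinearMap.proj k), fun _ => rfl⟩
  have d1 : HasFDerivAt (fun x => cj (r x)) (cj.comp (fderiv ℝ r (z, z))) (z, z) :=
    cj.hasFDerivAt.comp _ hz.differentiableAt.hasFDerivAt
  have hz' : HasFDerivAt r (fderiv ℝ r (z, z)) (sw (z, z)) := by
    rw [hsw]; exact hz.differentiableAt.hasFDerivAt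
  have d2 : HasFDerivAt (fun x => r (sw x) k) ((ContinuousLinearMap.proj k :
      (Fin d → ℂ) →L[ℝ] ℂ).comp ((fderiv ℝ r (z, z)).comp sw)) (z, z) :=
    (ContinuousLinearMap.proj k : (Fin d → ℂ) →L[ℝ] ℂ).hasFDerivAt.comp (z, z)
      (HasFDerivAt.comp (z, z) hz' sw.hasFDerivAt)
  have d3 : (fun x => r (sw x) k) = fun x => cj (r x) := by
    funext x; rw [hsw, hcj, h.r_symm]
  rw [d3] at d2
  have d4 := DFunLike.congr_fun (d2.unique d1) (v, 0)
  simp only [ContinuousLinearMap.comp_apply, hsw, hcj, ContinuousLinearMap.proj_apply] at d4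
  have d5 : ((v, v) : Cn N × Cn N) = (v, 0) + (0, v) := by simp
  rw [d5, map_add, Pi.add_apply, d4, Complex.add_conj]

/-- A function vanishing on `M` has vanishing derivative along `M`. -/
theorem tangent (h : SegreEq M p κ r c) {F : Type*} [NormedAddCommGroup F] [NormedSpace ℝ F]
    {g : Cn N → F} (hg : ∀ᶠ z in 𝓝 p, DifferentiableAt ℝ g z) (h0 : ∀ᶠ z in 𝓝 p, z ∈ M → g z = 0) :
    ∀ᶠ z in 𝓝 p, z ∈ M → ∀ v, fderiv ℝ r (z, z) (v, v) = 0 → fderiv ℝ g z v = 0 := by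
  obtain ⟨re, hre⟩ : ∃ re : (Fin d → ℂ) →L[ℝ] (Fin d → ℝ), ∀ w k, re w k = (w k).re :=
    ⟨ContinuousLinearMap.pi fun k => Complex.reCLM.comp (ContinuousLinearMap.proj k),
      fun _ _ => rfl⟩
  filter_upwards [hg, h0.eventually_nhds, h.fderiv_r_diag,
    (tendsto_dup p).eventually h.r_an.eventually_analyticAt, h.mem_iff.eventually_nhds,
    (tendsto_dup p).eventually h.surj] with z e1 e2 e3 e4 e5 e6 hz v hv
  let f : Cn N → Fin d → ℝ := fun x => re (r (x, x))
  have hf : AnalyticAt ℝ f z := AnalyticAt.clm_const_apply re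
    (e4.comp_eq (f := fun x : Cn N => (x, x)) (by fun_prop) rfl)
  have hfd : HasFDerivAt f (re.comp ((fderiv ℝ r (z, z)).comp
      ((ContinuousLinearMap.id ℝ (Cn N)).prod (ContinuousLinearMap.id ℝ (Cn N))))) z :=
    re.hasFDerivAt.comp z (_root_.hasFDerivAt_diag e4.differentiableAt)
  have hfz : f z = 0 := by
    have : r (z, z) = 0 := e5.self_of_nhds.1 hz
    simp only [f, this, map_zero]
  refine AnalyticAt.fderiv_eq_zero_of_level hf (fun w => ?_) e1 ?_ ?_
  · obtain ⟨u, hu, -⟩ := e6 (fun k => ((w k / 2 : ℝ) : ℂ)) 0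
    refine ⟨u, ?_⟩
    rw [hfd.fderiv]
    funext k
    change re (fderiv ℝ r (z, z) (u, u)) k = w k
    rw [hre, e3, hu]
    simp only [Complex.ofReal_re]
    ring
  · filter_upwards [e2, e5] with x h1 h2 h3
    refine h1 (h2.2 ?_)
    rw [hfz] at h3
    funext k
    have h4 : (r (x, x) k).re = 0 := by rw [← hre]; exact congrFun h3 k
    have h5 : (r (x, x) k).im = 0 := by
      have := congrArg Complex.im (h.r_symm x x k)
      rw [Complex.conj_im] at this
      linarith
    exact Complex.ext h4 h5
  · rw [hfd.fderiv]
    change re (fderiv ℝ r (z, z) (v, v)) = 0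
    rw [hv, map_zero]

theorem complexTangent (h : SegreEq M p κ r c) : ∀ᶠ z in 𝓝 p, z ∈ M →
    (∀ u, fderiv ℝ r (z, z) (u, 0) = 0 → fderiv ℝ c (z, κ (z - p)) (0, κ u) = u) ∧
    ∀ e, fderiv ℝ r (z, z) (fderiv ℝ c (z, κ (z - p)) (0, e), 0) = 0 := by
  filter_upwards [h.c_diag, h.tendsto_diag.eventually h.fderiv_c,
    (tendsto_dup p).eventually h.inj] with z e1 e2 e3 hz
  have h2 : ∀ e, fderiv ℝ r (z, z) (fderiv ℝ c (z, κ (z - p)) (0, e), 0) = 0 := by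
    intro e
    have := (e2.2 0 e).1
    simpa only [e1 hz] using this
  refine ⟨fun u hu => sub_eq_zero.1 (e3 _ ?_ ?_), h2⟩
  · have d7 : ((fderiv ℝ c (z, κ (z - p)) (0, κ u) - u, 0) : Cn N × Cn N) =
        (fderiv ℝ c (z, κ (z - p)) (0, κ u), 0) - (u, 0) := by simp
    rw [d7, map_sub, h2, hu, sub_zero]
  · rw [map_sub, (e2.2 0 (κ u)).2, sub_self]

theorem fderiv_r_I (h : SegreEq M p κ r c) : ∀ᶠ z in 𝓝 p, ∀ v,
    fderiv ℝ r (z, z) (I • v, 0) = I • fderiv ℝ r (z, z) (v, 0) := by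
  filter_upwards [(tendsto_dup p).eventually h.r_cr] with z h1 v
  simpa using h1 v 0

theorem tangent_of_complexTangent (h : SegreEq M p κ r c) : ∀ᶠ z in 𝓝 p, ∀ u,
    fderiv ℝ r (z, z) (u, 0) = 0 → fderiv ℝ r (z, z) (u, u) = 0 ∧
      fderiv ℝ r (z, z) (I • u, I • u) = 0 := by
  filter_upwards [h.fderiv_r_diag, h.fderiv_r_I] with z h1 h2 u hu
  constructor
  · funext k; rw [h1, hu]; simp
  · funext k; rw [h1, h2, hu]; simp

/-- Every vector is `u + I • v` with `u`, `v` tangent to `M`. -/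
theorem exists_tangent_add (h : SegreEq M p κ r c) : ∀ᶠ z in 𝓝 p, ∀ w : Cn N,
    ∃ u v : Cn N, w = u + I • v ∧ fderiv ℝ r (z, z) (u, u) = 0 ∧
      fderiv ℝ r (z, z) (v, v) = 0 := by
  filter_upwards [h.fderiv_r_diag, h.fderiv_r_I, (tendsto_dup p).eventually h.surj]
    with z h1 h2 h3 w
  obtain ⟨u, hu, -⟩ := h3 (fun k => (((fderiv ℝ r (z, z) (w, 0) k).im : ℝ) : ℂ) * I) 0
  refine ⟨u, I • (u - w), ?_, ?_, ?_⟩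
  · rw [smul_smul, I_mul_I, neg_one_smul]; abel
  · funext k
    rw [h1, hu]; simp
  · have d7 : ((u - w, 0) : Cn N × Cn N) = (u, 0) - (w, 0) := by simp
    funext k
    rw [h1, h2, d7, map_sub, hu]
    simp

theorem eventually_hasFDerivAt_lift (h : SegreEq M p κ r c) {F : Type*} [NormedAddCommGroup F]
    [NormedSpace ℝ F] [CompleteSpace F] {u : Cn N × Cn q → F} (hu : AnalyticAt ℝ u (p, 0)) : ∀ᶠ z in 𝓝 p,
    HasFDerivAt (fun z => u (z, κ (z - p))) ((fderiv ℝ u (z, κ (z - p))).comp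
      ((ContinuousLinearMap.id ℝ (Cn N)).prod (κ.restrictScalars ℝ))) z := by
  filter_upwards [h.tendsto_diag.eventually hu.eventually_analyticAt] with z hz
  exact HasFDerivAt.comp z hz.differentiableAt.hasFDerivAt (hasFDerivAt_diag κ p z)

/-- A sesqui-holomorphic function is determined by its values on `M`. -/
theorem eventually_eq_zero (h : SegreEq M p κ r c) (hp : p ∈ M) {u : Cn N × Cn q → ℂ}
    (hu : IsSesquiAt u (p, 0)) (h0 : ∀ᶠ z in 𝓝 p, z ∈ M → u (z, κ (z - p)) = 0) :
    ∀ᶠ x in 𝓝 (p, (0 : Cn q)), u x = 0 := by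
  refine eventually_eq_zero_of_fderiv_stable (𝕜 := ℝ) (fun u : Cn N × Cn q → ℂ => IsSesquiAt u (p, 0) ∧
    ∀ᶠ z in 𝓝 p, z ∈ M → u (z, κ (z - p)) = 0) ?_ ?_ ⟨hu, h0⟩
  · rintro u ⟨hu, h0⟩
    refine ⟨hu.1, ?_⟩
    simpa using h0.self_of_nhds hp
  · rintro u ⟨hu, h0⟩ w
    refine ⟨hu.fderiv_apply w, ?_⟩
    have hl := h.eventually_hasFDerivAt_lift hu.1
    have ht := h.tangent (hl.mono fun z hz => hz.differentiableAt) h0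
    filter_upwards [hl, ht, h.tangent_of_complexTangent, h.exists_tangent_add, h.complexTangent,
      h.tendsto_diag.eventually hu.2, h.tendsto_diag.eventually h.fderiv_c]
      with z e1 e2 e3 e4 e5 e6 e7 hz
    set A := fderiv ℝ u (z, κ (z - p)) with hA
    have k1 : ∀ v, fderiv ℝ r (z, z) (v, v) = 0 → A (v, κ v) = 0 := by
      intro v hv
      have := e2 hz v hv
      rwa [e1.fderiv] at this
    have k2 : ∀ e, A (0, e) = 0 := by
      intro e
      set v := fderiv ℝ c (z, κ (z - p)) (0, e) with hv
      have hv1 := (e5 hz).2 e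
      have hv2 : κ v = e := (e7.2 0 e).2
      obtain ⟨t1, t2⟩ := e3 _ hv1
      have t3 := k1 v t1
      have t4 := k1 _ t2
      rw [hv2] at t3
      rw [map_smul, hv2] at t4
      have t5 := e6 v (-e)
      rw [smul_neg, neg_neg, t4] at t5
      have t6 : A (v, -e) = 0 := by
        rcases mul_eq_zero.1 t5.symm with t | t
        · exact absurd t I_ne_zero
        · exact t
      have t7 : ((0, e) : Cn N × Cn q) = (1 / 2 : ℝ) • ((v, e) - (v, -e)) := by
        ext1
        · simp
        · change e = (1 / 2 : ℝ) • (e - -e)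
          rw [sub_neg_eq_add, ← two_smul ℝ e, smul_smul]; norm_num
      rw [t7, map_smul, map_sub, t3, t6]; simp
    have k3 : ∀ a, A (a, 0) = 0 := by
      intro a
      obtain ⟨v1, v2, rfl, t1, t2⟩ := e4 a
      have t3 : ∀ v, fderiv ℝ r (z, z) (v, v) = 0 → A (v, 0) = 0 := by
        intro v hv
        have t4 : ((v, 0) : Cn N × Cn q) = (v, κ v) - (0, κ v) := by simp
        rw [t4, map_sub, k1 v hv, k2, sub_zero]
      have t5 := e6 v2 0
      rw [smul_zero, neg_zero, t3 _ t2] at t5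
      have t6 : ((v1 + I • v2, 0) : Cn N × Cn q) = (v1, 0) + (I • v2, 0) := by simp
      rw [t6, map_add, t3 _ t1, t5]; simp
    have k4 : w = (w.1, 0) + (0, w.2) := by simp
    change A w = 0
    rw [k4, map_add, k3, k2, add_zero]

end SegreEq

/-- `u` is a sesqui-holomorphic function restricting to the real-analytic function `g` on `M`. -/
structure IsLift {N q : ℕ} (M : Set (Cn N)) (p : Cn N) (κ : Cn N →L[ℂ] Cn q)
    (u : Cn N × Cn q → ℂ) (g : Cn N → ℂ) : Prop where
  sesqui : IsSesquiAt u (p, 0)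
  an : AnalyticAt ℝ g p
  eq : ∀ᶠ z in 𝓝 p, z ∈ M → g z = u (z, κ (z - p))

theorem CRVectorField.apply_eq {N : ℕ} {M : Set (Cn N)} {p : Cn N} (L : CRVectorField M p)
    (g : Cn N → ℂ) (z : Cn N) : L.apply g z = (1 / 2 : ℂ) *
      (fderiv ℝ g z (WithLp.toLp 2 fun j => (starRingEnd ℂ) (L.coeff z j)) +
        I * fderiv ℝ g z (I • WithLp.toLp 2 fun j => (starRingEnd ℂ) (L.coeff z j))) := by
  rw [← sum_conj_mul_wirtDBar]
  simp only [CRVectorField.apply, wirtDBar, Complex.conj_conj]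

theorem AnalyticAt.cn_apply {E : Type*} [NormedAddCommGroup E] [NormedSpace ℝ E] {N : ℕ}
    {g : E → Cn N} {x : E} (hg : AnalyticAt ℝ g x) (j : Fin N) :
    AnalyticAt ℝ (fun z => g z j) x :=
  AnalyticAt.clm_const_apply ((EuclideanSpace.proj j : Cn N →L[ℂ] ℂ).restrictScalars ℝ) hg

theorem AnalyticAt.conj {E : Type*} [NormedAddCommGroup E] [NormedSpace ℝ E]
    {g : E → ℂ} {x : E} (hg : AnalyticAt ℝ g x) :
    AnalyticAt ℝ (fun z => (starRingEnd ℂ) (g z)) x :=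
  AnalyticAt.clm_const_apply (Complex.conjCLE : ℂ →L[ℝ] ℂ) hg

theorem CRVectorField.apply_analyticAt {N : ℕ} {M : Set (Cn N)} {p : Cn N} (L : CRVectorField M p)
    {g : Cn N → ℂ} (hg : AnalyticAt ℝ g p) : AnalyticAt ℝ (L.apply g) p := by
  have h1 : ∀ j, AnalyticAt ℝ (fun z => L.coeff z j * wirtDBar g z j) p := fun j =>
    (L.analytic j p L.mem).mul (analyticAt_const.mul
      ((hg.fderiv_apply_const _).add (analyticAt_const.mul (hg.fderiv_apply_const _))))
  have := Finset.univ.analyticAt_fun_sum (f := fun j z => L.coeff z j * wirtDBar g z j)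
    (fun j _ => h1 j)
  exact this

/-- A CR vector field kills functions vanishing on `M`. -/
theorem CRVectorField.apply_eq_zero {N : ℕ} {M : Set (Cn N)} {p : Cn N} (L : CRVectorField M p)
    {g : Cn N → ℂ} (hg : AnalyticAt ℝ g p) (h0 : ∀ᶠ z in 𝓝 p, z ∈ M → g z = 0) :
    ∀ᶠ z in 𝓝 p, z ∈ M → L.apply g z = 0 := by
  have key : ∀ A : ℂ →L[ℝ] ℝ, ∀ᶠ z in 𝓝 p, z ∈ M →
      (∑ j, L.coeff z j * wirtDBarR (fun z => A (g z)) z j) = 0 := by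
    intro A
    have h1 : AnalyticAt ℝ (fun z => A (g z)) p := AnalyticAt.clm_const_apply A hg
    obtain ⟨U, hU, hUo, hpU⟩ := eventually_nhds_iff.1 (h1.eventually_analyticAt.and h0)
    obtain ⟨V, hV, hpV, h2⟩ := L.tangent (fun z => A (g z)) U hUo hpU (fun z hz => (hU z hz).1)
      (fun z hz => by rw [(hU z hz.2).2 hz.1, map_zero])
    filter_upwards [hV.mem_nhds hpV] with z hz hzM using h2 z ⟨hzM, hz⟩
  filter_upwards [key Complex.reCLM, key Complex.imCLM, hg.eventually_analyticAt]
    with z h1 h2 h3 hz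
  have d : ∀ (A : ℂ →L[ℝ] ℝ) v, fderiv ℝ (fun z => A (g z)) z v = A (fderiv ℝ g z v) := by
    intro A v
    have : HasFDerivAt (fun z => A (g z)) (A.comp (fderiv ℝ g z)) z :=
      A.hasFDerivAt.comp z h3.differentiableAt.hasFDerivAt
    rw [this.fderiv]; rfl
  have h4 : L.apply g z = (∑ j, L.coeff z j * wirtDBarR (fun z => Complex.reCLM (g z)) z j) +
      I * ∑ j, L.coeff z j * wirtDBarR (fun z => Complex.imCLM (g z)) z j := by
    rw [Finset.mul_sum, ← Finset.sum_add_distrib]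
    refine Finset.sum_congr rfl fun j _ => ?_
    simp only [wirtDBar, wirtDBarR, d]
    simp only [Complex.reCLM_apply, Complex.imCLM_apply]
    conv_lhs => rw [← Complex.re_add_im (fderiv ℝ g z (cbasis j 1)),
      ← Complex.re_add_im (fderiv ℝ g z (cbasis j I))]
    ring
  rw [h4, h1 hz, h2 hz]; simp

namespace SegreEq

variable {N d q : ℕ} {M : Set (Cn N)} {p : Cn N} {κ : Cn N →L[ℂ] Cn q}
  {r : Cn N × Cn N → Fin d → ℂ} {c : Cn N × Cn q → Cn N}

theorem tendsto_fst_c (h : SegreEq M p κ r c) :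
    Filter.Tendsto (fun x : Cn N × Cn q => (x.1, c x)) (𝓝 (p, 0)) (𝓝 (p, p)) := by
  have := ((continuousAt_fst (p := (p, (0 : Cn q)))).prodMk h.c_an.continuousAt).tendsto
  rwa [h.c_base] at this

theorem isSesquiAt_comp (h : SegreEq M p κ r c) {U : Cn N × Cn N → ℂ} (hU : IsSesquiAt U (p, p)) :
    IsSesquiAt (fun x => U (x.1, c x)) (p, (0 : Cn q)) := by
  refine ⟨hU.1.comp_eq (analyticAt_fst.prod h.c_an) (by simp [h.c_base]), ?_⟩
  filter_upwards [h.c_cr, h.c_an.eventually_analyticAt, h.tendsto_fst_c.eventually hU.2,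
    h.tendsto_fst_c.eventually hU.1.eventually_analyticAt] with x h1 h2 h3 h4 a b
  have d1 : HasFDerivAt (fun x : Cn N × Cn q => U (x.1, c x)) ((fderiv ℝ U (x.1, c x)).comp
      ((ContinuousLinearMap.fst ℝ _ _).prod (fderiv ℝ c x))) x :=
    HasFDerivAt.comp x (g := U) (f := fun x : Cn N × Cn q => (x.1, c x))
      h4.differentiableAt.hasFDerivAt (hasFDerivAt_fst.prodMk h2.differentiableAt.hasFDerivAt)
  rw [d1.fderiv]
  change fderiv ℝ U (x.1, c x) (I • a, fderiv ℝ c x (I • a, -(I • b))) =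
    I * fderiv ℝ U (x.1, c x) (a, fderiv ℝ c x (a, b))
  have h5 : fderiv ℝ c x (I • a, -(I • b)) = -(I • fderiv ℝ c x (a, b)) := by
    rw [← h1 a b, ← map_neg]; simp
  rw [h5, h3]

theorem exists_isLift (h : SegreEq M p κ r c) {g : Cn N → ℂ} (hg : AnalyticAt ℝ g p) :
    ∃ u, IsLift M p κ u g := by
  obtain ⟨U, hU, hUg⟩ := hg.exists_isSesquiAt
  refine ⟨_, h.isSesquiAt_comp hU, hg, ?_⟩
  filter_upwards [hUg, h.c_diag] with z h1 h2 hz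
  simp only [h2 hz, h1]

theorem apply_isLift (h : SegreEq M p κ r c) (L : CRVectorField M p) {u : Cn N × Cn q → ℂ}
    {g : Cn N → ℂ} (hu : IsLift M p κ u g) : ∀ᶠ z in 𝓝 p, z ∈ M →
      L.apply g z = fderiv ℝ u (z, κ (z - p))
        (0, κ (WithLp.toLp 2 fun j => (starRingEnd ℂ) (L.coeff z j))) := by
  have hl := h.eventually_hasFDerivAt_lift hu.sesqui.1
  have ha : AnalyticAt ℝ (fun z => u (z, κ (z - p))) p :=
    hu.sesqui.1.comp_eq (analyticAt_diag κ p p) (by simp)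
  have h0 := L.apply_eq_zero (hu.an.sub ha) (hu.eq.mono fun z hz hzM => by
    simp [hz hzM])
  filter_upwards [h0, hl, hu.an.eventually_analyticAt, ha.eventually_analyticAt,
    h.tendsto_diag.eventually hu.sesqui.2] with z h1 h2 h3 h4 h5 hz
  have h6 := h1 hz
  have h7 : fderiv ℝ (g - fun z => u (z, κ (z - p))) z = fderiv ℝ g z -
      (fderiv ℝ u (z, κ (z - p))).comp
        ((ContinuousLinearMap.id ℝ (Cn N)).prod (κ.restrictScalars ℝ)) :=
    (h3.differentiableAt.hasFDerivAt.sub h2).fderiv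
  rw [CRVectorField.apply_eq, h7] at h6
  rw [CRVectorField.apply_eq]
  set V : Cn N := WithLp.toLp 2 fun j => (starRingEnd ℂ) (L.coeff z j)
  set A := fderiv ℝ u (z, κ (z - p))
  change (1 / 2 : ℂ) * (fderiv ℝ g z V - A (V, κ V) + I * (fderiv ℝ g z (I • V) -
    A (I • V, κ (I • V)))) = 0 at h6
  have h8 := h5 V (-κ V)
  rw [smul_neg, neg_neg, ← map_smul] at h8
  have h9 : A (0, κ V) = (1 / 2 : ℂ) * (A (V, κ V) - A (V, -κ V)) := by
    have t7 : ((V, κ V) : Cn N × Cn q) - (V, -κ V) = (2 : ℝ) • (0, κ V) := by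
      ext1
      · simp
      · change κ V - -κ V = (2 : ℝ) • κ V
        rw [sub_neg_eq_add, ← two_smul ℝ (κ V)]
    rw [← map_sub, t7, map_smul]
    simp
  rw [h8] at h6
  rw [h9]
  linear_combination h6 + 1 / 2 * A (V, -κ V) * I_sq

/-- The CR vector field of `M` differentiating lifts in the direction `e`. -/
theorem exists_frame (h : SegreEq M p κ r c) (e : Cn q) : ∃ L : CRVectorField M p,
    ∀ u g, IsLift M p κ u g → IsLift M p κ (fun x => fderiv ℝ u x (0, e)) (L.apply g) := by
  let V : Cn N → Cn N := fun z => fderiv ℝ c (z, κ (z - p)) (0, e)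
  have hV : AnalyticAt ℝ V p :=
    (h.c_an.fderiv_apply_const (0, e)).comp_eq (analyticAt_diag κ p p) (by simp)
  obtain ⟨D, hD, hDo, hpD⟩ := eventually_nhds_iff.1 hV.eventually_analyticAt
  let L : CRVectorField M p :=
    { coeff := fun z j => (starRingEnd ℂ) (V z j)
      dom := D
      isOpen := hDo
      mem := hpD
      analytic := fun j z hz => ((hD z hz).cn_apply j).conj
      tangent := by
        intro f U hU hpU hf hf0
        have h1 := h.tangent (g := f) (by
          filter_upwards [hU.mem_nhds hpU] with z hz using (hf z hz).differentiableAt) (by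
          filter_upwards [hU.mem_nhds hpU] with z hz hzM using hf0 z ⟨hzM, hz⟩)
        have h2 : ∀ᶠ z in 𝓝 p, z ∈ M →
            (∑ j, (starRingEnd ℂ) (V z j) * wirtDBarR f z j) = 0 := by
          filter_upwards [h1, h.complexTangent, h.tangent_of_complexTangent] with z e1 e2 e3 hz
          have e4 := (e2 hz).2 e
          obtain ⟨e5, e6⟩ := e3 _ e4
          have e7 := sum_conj_mul_wirtDBar (Complex.ofRealCLM.comp (fderiv ℝ f z)) (V z)
          change (∑ j, (starRingEnd ℂ) (V z j) * wirtDBarR f z j) = (1 / 2 : ℂ) *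
            ((fderiv ℝ f z (V z) : ℂ) + I * (fderiv ℝ f z (I • V z) : ℂ)) at e7
          rw [e7, e1 hz _ e5, e1 hz _ e6]; simp
        obtain ⟨W, hW, hWo, hpW⟩ := eventually_nhds_iff.1 h2
        exact ⟨W, hWo, hpW, fun z hz => hW z hz.2 hz.1⟩ }
  refine ⟨L, fun u g hu => ⟨hu.sesqui.fderiv_apply _, L.apply_analyticAt hu.an, ?_⟩⟩
  filter_upwards [h.apply_isLift L hu, h.tendsto_diag.eventually h.fderiv_c] with z e1 e2 hz
  rw [e1 hz]
  have e3 : (WithLp.toLp 2 fun j => (starRingEnd ℂ) (L.coeff z j) : Cn N) = V z := by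
    ext j; simp [L]
  rw [e3, (e2.2 0 e).2]

theorem exists_apply_isLift (h : SegreEq M p κ r c) (L : CRVectorField M p) :
    ∃ a : Fin q → Cn N × Cn q → ℂ, (∀ j, IsSesquiAt (a j) (p, 0)) ∧ ∀ u g, IsLift M p κ u g →
      IsLift M p κ (fun x => ∑ j, a j x * fderiv ℝ u x (0, cbasis j 1)) (L.apply g) := by
  let V : Cn N → Cn N := fun z => WithLp.toLp 2 fun j => (starRingEnd ℂ) (L.coeff z j)
  have hV : AnalyticAt ℝ V p := by
    have h1 : AnalyticAt ℝ (fun z => fun j => (starRingEnd ℂ) (L.coeff z j)) p :=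
      AnalyticAt.pi fun j => (L.analytic j p L.mem).conj
    exact AnalyticAt.clm_const_apply
      ((PiLp.continuousLinearEquiv 2 ℝ fun _ : Fin N => ℂ).symm : (Fin N → ℂ) →L[ℝ] Cn N) h1
  have h1 : ∀ j, AnalyticAt ℝ (fun z => (starRingEnd ℂ) (κ (V z) j)) p := fun j =>
    (AnalyticAt.cn_apply (AnalyticAt.clm_const_apply (κ.restrictScalars ℝ) hV) j).conj
  choose a ha using fun j => h.exists_isLift (h1 j)
  refine ⟨a, fun j => (ha j).sesqui, fun u g hu => ⟨IsSesquiAt.sum _ fun j _ =>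
    (ha j).sesqui.mul (hu.sesqui.fderiv_apply _), L.apply_analyticAt hu.an, ?_⟩⟩
  filter_upwards [h.apply_isLift L hu, h.tendsto_diag.eventually hu.sesqui.2,
    Filter.eventually_all.2 fun j => (ha j).eq] with z e1 e2 e3 hz
  rw [e1 hz, sesqui_apply_snd e2]
  exact Finset.sum_congr rfl fun j _ => by rw [← e3 j hz]

end SegreEq

section Conormal

variable {n d : ℕ}

theorem AnalyticAt.matrix_det {E : Type*} [NormedAddCommGroup E] [NormedSpace ℝ E]
    {G : E → Matrix (Fin d) (Fin d) ℂ} {w : E} (hG : ∀ i j, AnalyticAt ℝ (fun x => G x i j) w) :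
    AnalyticAt ℝ (fun x => (G x).det) w := by
  simp only [Matrix.det_apply]
  refine Finset.univ.analyticAt_fun_sum (f := fun (σ : Equiv.Perm (Fin d)) x =>
    Equiv.Perm.sign σ • ∏ i, G x (σ i) i) fun σ _ => ?_
  have h1 : AnalyticAt ℝ (fun x => ∏ i, G x (σ i) i) w :=
    Finset.univ.analyticAt_fun_prod (f := fun i x => G x (σ i) i) fun i _ => hG _ _
  have h2 : ∀ z : ℂ, Equiv.Perm.sign σ • z = ((Equiv.Perm.sign σ : ℤ) : ℂ) * z := fun z => by
    rw [Units.smul_def, zsmul_eq_mul]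
  simp only [h2]
  exact analyticAt_const.mul h1

theorem AnalyticAt.matrix_adjugate {E : Type*} [NormedAddCommGroup E] [NormedSpace ℝ E]
    {G : E → Matrix (Fin d) (Fin d) ℂ} {w : E} (hG : ∀ i j, AnalyticAt ℝ (fun x => G x i j) w)
    (i j : Fin d) : AnalyticAt ℝ (fun x => (G x).adjugate i j) w := by
  simp only [Matrix.adjugate_apply]
  refine AnalyticAt.matrix_det fun a b => ?_
  by_cases h : a = j
  · subst h; simpa using analyticAt_const
  · simpa [Matrix.updateRow_ne h] using hG a b

theorem sum_wirtD_mul (f : Cn n → ℝ) (w v : Cn n) : ∑ j, wirtD f w j * v j =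
    (1 / 2 : ℂ) * ((fderiv ℝ f w v : ℂ) - I * (fderiv ℝ f w (I • v) : ℂ)) := by
  have h1 := congrArg (starRingEnd ℂ)
    (sum_conj_mul_wirtDBar (Complex.ofRealCLM.comp (fderiv ℝ f w)) v)
  have h2 : ∀ z : ℝ, (starRingEnd ℂ) (z : ℂ) = z := Complex.conj_ofReal
  have h3 : (starRingEnd ℂ) (1 / 2) = 1 / 2 := by rw [map_div₀, map_one, Complex.conj_ofNat]
  simp only [map_sum, map_mul, map_add, Complex.conj_conj, ContinuousLinearMap.comp_apply,
    Complex.ofRealCLM_apply, h2, conj_I, h3] at h1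
  rw [sub_eq_add_neg, ← neg_mul, ← h1]
  refine Finset.sum_congr rfl fun j _ => ?_
  rw [wirtD]; ring

theorem AnalyticAt.wirtD_apply {f : Cn n → ℝ} {w : Cn n} (hf : AnalyticAt ℝ f w) (j : Fin n) :
    AnalyticAt ℝ (fun x => wirtD f x j) w := by
  have h1 : ∀ v, AnalyticAt ℝ (fun x => ((fderiv ℝ f x v : ℝ) : ℂ)) w := fun v =>
    AnalyticAt.clm_const_apply Complex.ofRealCLM (hf.fderiv_apply_const v)
  exact analyticAt_const.mul ((h1 _).sub (analyticAt_const.mul (h1 _)))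

/-- On a generic submanifold, the complex gradient of a function vanishing on it is an analytic
combination of the complex gradients of the defining functions. -/
theorem exists_wirtD_eq_sum {M' : Set (Cn n)} {p' : Cn n} {ρ : Fin d → Cn n → ℝ}
    (hρ : ∀ k, AnalyticAt ℝ (ρ k) p') (hM : ∀ᶠ w in 𝓝 p', w ∈ M' ↔ ∀ k, ρ k w = 0)
    (hind : LinearIndependent ℂ fun k => wirtD (ρ k) p') {f : Cn n → ℝ} (hf : AnalyticAt ℝ f p')
    (hf0 : ∀ᶠ w in 𝓝 p', w ∈ M' → f w = 0) :
    ∃ a : Fin d → Cn n → ℂ, (∀ k, AnalyticAt ℝ (a k) p') ∧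
      ∀ᶠ w in 𝓝 p', w ∈ M' → ∀ j, wirtD f w j = ∑ k, a k w * wirtD (ρ k) w j := by
  choose b hb using fun m : Fin d => surjective_of_linearIndependent_rows hind (Pi.single m 1)
  let Θ : Fin d → Cn n → Cn n → ℂ := fun k w v => ∑ j, wirtD (ρ k) w j * v j
  let θ : Cn n → Cn n → ℂ := fun w v => ∑ j, wirtD f w j * v j
  let G : Cn n → Matrix (Fin d) (Fin d) ℂ := fun w => Matrix.of fun l m => Θ l w (b m)
  have hΘ : ∀ k v, AnalyticAt ℝ (fun w => Θ k w v) p' := fun k v =>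
    Finset.univ.analyticAt_fun_sum (f := fun j w => wirtD (ρ k) w j * v j) fun j _ =>
      ((hρ k).wirtD_apply j).mul analyticAt_const
  have hθ : ∀ v, AnalyticAt ℝ (fun w => θ w v) p' := fun v =>
    Finset.univ.analyticAt_fun_sum (f := fun j w => wirtD f w j * v j) fun j _ =>
      (hf.wirtD_apply j).mul analyticAt_const
  have hG : ∀ i j, AnalyticAt ℝ (fun w => G w i j) p' := fun i j => hΘ i (b j)
  have hG1 : G p' = 1 := by
    ext l m
    change Θ l p' (b m) = _
    have h1 := hb m l
    rw [Matrix.one_apply, ← Pi.single_apply, Pi.single_comm]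
    simp only [Θ]
    rw [Pi.single_comm, ← h1]
    exact Finset.sum_congr rfl fun j _ => mul_comm _ _
  have hdet : ∀ᶠ w in 𝓝 p', (G w).det ≠ 0 :=
    (AnalyticAt.matrix_det hG).continuousAt.eventually_ne (by rw [hG1]; simp)
  refine ⟨fun k w => ∑ m, θ w (b m) * ((G w).det⁻¹ * (G w).adjugate m k), fun k => ?_, ?_⟩
  · exact Finset.univ.analyticAt_fun_sum (f := fun m w =>
      θ w (b m) * ((G w).det⁻¹ * (G w).adjugate m k)) fun m _ =>
      (hθ (b m)).mul (((AnalyticAt.matrix_det hG).inv (by rw [hG1]; simp)).mul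
        (AnalyticAt.matrix_adjugate hG m k))
  let P : Cn n → Fin d → ℝ := fun w k => ρ k w
  have hP : AnalyticAt ℝ P p' := AnalyticAt.pi hρ
  filter_upwards [hdet, hP.eventually_analyticAt, hf.eventually_analyticAt, hM.eventually_nhds,
    hf0.eventually_nhds] with w e1 e2 e3 e4 e5 hw
  have hPd : ∀ v k, fderiv ℝ P w v k = fderiv ℝ (ρ k) w v := by
    intro v k
    have h1 : HasFDerivAt (ρ k) ((ContinuousLinearMap.proj k : (Fin d → ℝ) →L[ℝ] ℝ).comp
        (fderiv ℝ P w)) w :=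
      (ContinuousLinearMap.proj k : (Fin d → ℝ) →L[ℝ] ℝ).hasFDerivAt.comp w
        e2.differentiableAt.hasFDerivAt
    rw [h1.fderiv]; rfl
  have hΘadd : ∀ k (u v : Cn n), Θ k w (u - v) = Θ k w u - Θ k w v := by
    intro k u v
    simp only [Θ, PiLp.sub_apply, mul_sub, Finset.sum_sub_distrib]
  have hΘsum : ∀ k (x : Fin d → ℂ), Θ k w (∑ m, x m • b m) = ∑ m, G w k m * x m := by
    intro k x
    simp only [Θ, G, Matrix.of_apply, WithLp.ofLp_sum, Finset.sum_apply, WithLp.ofLp_smul,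
      Pi.smul_apply, smul_eq_mul, Finset.mul_sum, Finset.sum_mul]
    rw [Finset.sum_comm]
    exact Finset.sum_congr rfl fun _ _ => Finset.sum_congr rfl fun _ _ => by ring
  have hinv : ∀ x : Fin d → ℂ, ∀ k,
      ∑ m, G w k m * ∑ l, (G w).det⁻¹ * (G w).adjugate m l * x l = x k := by
    intro x k
    have h1 : (G w * ((G w).det⁻¹ • (G w).adjugate)).mulVec x k = x k := by
      rw [Matrix.mul_smul, Matrix.mul_adjugate, smul_smul, inv_mul_cancel₀ e1, one_smul,
        Matrix.one_mulVec]
    rw [← Matrix.mulVec_mulVec] at h1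
    exact h1
  have hker : ∀ u, (∀ k, Θ k w u = 0) → θ w u = 0 := by
    intro u hu
    have h1 : ∀ k, fderiv ℝ (ρ k) w u = 0 ∧ fderiv ℝ (ρ k) w (I • u) = 0 := by
      intro k
      have h2 := hu k
      simp only [Θ] at h2
      rw [sum_wirtD_mul] at h2
      have h3 : ((fderiv ℝ (ρ k) w u : ℂ) - I * (fderiv ℝ (ρ k) w (I • u) : ℂ)) = 0 := by
        simpa using h2
      have h4 := congrArg Complex.re h3
      have h5 := congrArg Complex.im h3
      simp at h4 h5
      exact ⟨h4, h5⟩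
    have hsurj : ∀ x, ∃ v, fderiv ℝ P w v = x := by
      intro x
      let v : Cn n := ∑ m, (∑ l, (G w).det⁻¹ * (G w).adjugate m l * (x l : ℂ)) • b m
      refine ⟨(2 : ℝ)⁻¹ • v, ?_⟩
      have h2 : ∀ k, Θ k w v = x k := by
        intro k
        rw [hΘsum, hinv (fun l => (x l : ℂ))]
      funext k
      have h3 := h2 k
      simp only [Θ] at h3
      rw [sum_wirtD_mul] at h3
      have h4 := congrArg Complex.re h3
      have h5 : fderiv ℝ (ρ k) w v = 2 * x k := by
        simp at h4
        linarith
      rw [hPd, map_smul, h5, smul_eq_mul]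
      ring
    have hv : ∀ v, (∀ k, fderiv ℝ (ρ k) w v = 0) → fderiv ℝ f w v = 0 := by
      intro v hv
      refine AnalyticAt.fderiv_eq_zero_of_level e2 hsurj e3.differentiableAt ?_
        (funext fun k => by rw [hPd, hv k]; rfl)
      filter_upwards [e4, e5] with x h2 h3 h4
      refine h3 (h2.2 fun k => ?_)
      have h6 := congrFun h4 k
      rw [show ρ k x = P x k from rfl, h6]
      exact (e4.self_of_nhds.1 hw) k
    simp only [θ]
    rw [sum_wirtD_mul, hv u fun k => (h1 k).1, hv _ fun k => (h1 k).2]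
    simp
  intro j
  have hθsub : ∀ u v : Cn n, θ w (u - v) = θ w u - θ w v := by
    intro u v
    simp only [θ, PiLp.sub_apply, mul_sub, Finset.sum_sub_distrib]
  have hθsum : ∀ x : Fin d → ℂ, θ w (∑ m, x m • b m) = ∑ m, θ w (b m) * x m := by
    intro x
    simp only [θ, WithLp.ofLp_sum, Finset.sum_apply, WithLp.ofLp_smul,
      Pi.smul_apply, smul_eq_mul, Finset.mul_sum, Finset.sum_mul]
    rw [Finset.sum_comm]
    exact Finset.sum_congr rfl fun _ _ => Finset.sum_congr rfl fun _ _ => by ring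
  have hj : ∀ g : Cn n → ℝ, ∑ i, wirtD g w i * (cbasis j 1 : Cn n) i = wirtD g w j := by
    intro g
    simp [cbasis]
  let x : Fin d → ℂ := fun m =>
    ∑ l, (G w).det⁻¹ * (G w).adjugate m l * Θ l w (cbasis j 1)
  have h1 := hker (cbasis j 1 - ∑ m, x m • b m) fun k => by
    rw [hΘadd, hΘsum, hinv (fun l => Θ l w (cbasis j 1)), sub_self]
  rw [hθsub, hθsum, sub_eq_zero] at h1
  rw [show θ w (cbasis j 1) = wirtD f w j from hj f] at h1
  rw [h1]
  simp only [x, Finset.mul_sum, Finset.sum_mul]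
  rw [Finset.sum_comm]
  refine Finset.sum_congr rfl fun k _ => Finset.sum_congr rfl fun m _ => ?_
  rw [show Θ k w (cbasis j 1) = wirtD (ρ k) w j from hj (ρ k)]
  ring

end Conormal

section Vanishing

variable {N q : ℕ}

/-- Iterated derivatives of `u` in the second variable. -/
def sDeriv (es : List (Cn q)) (u : Cn N × Cn q → ℂ) : Cn N × Cn q → ℂ :=
  es.foldl (fun u e x => fderiv ℝ u x (0, e)) u

/-- All derivatives of `u` in the second variable of order at most `n` vanish at `o`. -/
def SVanish (o : Cn N × Cn q) : ℕ → (Cn N × Cn q → ℂ) → Prop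
  | 0, u => u o = 0
  | n + 1, u => u o = 0 ∧ ∀ e, SVanish o n fun x => fderiv ℝ u x (0, e)

variable {o : Cn N × Cn q}

theorem SVanish.apply {n : ℕ} {u : Cn N × Cn q → ℂ} (h : SVanish o n u) : u o = 0 := by
  cases n with
  | zero => exact h
  | succ n => exact h.1

theorem sVanish_of_sDeriv {n : ℕ} {u : Cn N × Cn q → ℂ}
    (h : ∀ es : List (Cn q), es.length ≤ n → sDeriv es u o = 0) : SVanish o n u := by
  induction n generalizing u with
  | zero => exact h [] le_rfl
  | succ n ih =>
    exact ⟨h [] (by simp), fun e => ih fun es hes => h (e :: es) (by simpa using hes)⟩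

theorem SVanish.of_succ {n : ℕ} {u : Cn N × Cn q → ℂ} (h : SVanish o (n + 1) u) :
    SVanish o n u := by
  induction n generalizing u with
  | zero => exact h.1
  | succ n ih => exact ⟨h.1, fun e => ih (h.2 e)⟩

theorem SVanish.congr {n : ℕ} {u v : Cn N × Cn q → ℂ} (h : SVanish o n u) (huv : u =ᶠ[𝓝 o] v) :
    SVanish o n v := by
  induction n generalizing u v with
  | zero => rw [SVanish, ← huv.self_of_nhds]; exact h
  | succ n ih =>
    refine ⟨by rw [← huv.self_of_nhds]; exact h.1, fun e => ih (h.2 e) ?_⟩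
    filter_upwards [huv.eventually_nhds] with x hx
    rw [Filter.EventuallyEq.fderiv_eq hx]

theorem SVanish.add {n : ℕ} {u v : Cn N × Cn q → ℂ} (hu : AnalyticAt ℝ u o) (hv : AnalyticAt ℝ v o)
    (h : SVanish o n u) (h' : SVanish o n v) : SVanish o n fun x => u x + v x := by
  induction n generalizing u v with
  | zero => rw [SVanish] at *; rw [h, h', add_zero]
  | succ n ih =>
    refine ⟨by simp only [h.1, h'.1, add_zero], fun e =>
      (ih (hu.fderiv_apply_const _) (hv.fderiv_apply_const _) (h.2 e) (h'.2 e)).congr ?_⟩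
    filter_upwards [hu.eventually_analyticAt, hv.eventually_analyticAt] with x h1 h2
    have : fderiv ℝ (fun x => u x + v x) x = fderiv ℝ u x + fderiv ℝ v x :=
      (h1.differentiableAt.hasFDerivAt.add h2.differentiableAt.hasFDerivAt).fderiv
    rw [this]; rfl

theorem SVanish.mul_left {n : ℕ} {a u : Cn N × Cn q → ℂ} (ha : AnalyticAt ℝ a o)
    (hu : AnalyticAt ℝ u o) (h : SVanish o n u) : SVanish o n fun x => a x * u x := by
  induction n generalizing a u with
  | zero => rw [SVanish] at *; rw [h, mul_zero]
  | succ n ih =>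
    refine ⟨by simp only [h.1, mul_zero], fun e => ?_⟩
    have h1 := ih ha (hu.fderiv_apply_const (0, e)) (h.2 e)
    have h2 := ih (ha.fderiv_apply_const (0, e)) hu h.of_succ
    refine (SVanish.add (ha.mul (hu.fderiv_apply_const (0, e)))
      ((ha.fderiv_apply_const (0, e)).mul hu) h1 h2).congr ?_
    filter_upwards [ha.eventually_analyticAt, hu.eventually_analyticAt] with x h1 h2
    have : fderiv ℝ (fun x => a x * u x) x = a x • fderiv ℝ u x + u x • fderiv ℝ a x :=
      (h1.differentiableAt.hasFDerivAt.mul h2.differentiableAt.hasFDerivAt).fderiv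
    rw [this]
    simp only [_root_.add_apply, _root_.smul_apply, smul_eq_mul, Pi.mul_apply]
    ring

theorem sVanish_zero (n : ℕ) : SVanish o n fun _ => (0 : ℂ) := by
  induction n with
  | zero => rfl
  | succ n ih => exact ⟨rfl, fun e => by simpa using ih⟩

theorem SVanish.sum {ι : Type*} (s : Finset ι) {n : ℕ} {u : ι → Cn N × Cn q → ℂ}
    (hu : ∀ i ∈ s, AnalyticAt ℝ (u i) o) (h : ∀ i ∈ s, SVanish o n (u i)) :
    SVanish o n fun x => ∑ i ∈ s, u i x := by
  classical
  induction s using Finset.induction_on with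
  | empty => simpa using sVanish_zero n
  | insert i s hi ih =>
    simp only [Finset.sum_insert hi]
    have h1 : ∀ j ∈ s, AnalyticAt ℝ (u j) o := fun j hj => hu j (Finset.mem_insert_of_mem hj)
    exact (h i (Finset.mem_insert_self i s)).add (hu i (Finset.mem_insert_self i s))
      (s.analyticAt_fun_sum h1) (ih h1 fun j hj => h j (Finset.mem_insert_of_mem hj))

theorem sDeriv_analyticAt {u : Cn N × Cn q → ℂ} (hu : AnalyticAt ℝ u o) (es : List (Cn q)) :
    AnalyticAt ℝ (sDeriv es u) o := by
  induction es generalizing u with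
  | nil => exact hu
  | cons e es ih => exact ih (hu.fderiv_apply_const (0, e))

theorem sDeriv_congr {u v : Cn N × Cn q → ℂ} (h : u =ᶠ[𝓝 o] v) (es : List (Cn q)) :
    sDeriv es u =ᶠ[𝓝 o] sDeriv es v := by
  induction es generalizing u v with
  | nil => exact h
  | cons e es ih =>
    refine ih ?_
    filter_upwards [h.eventually_nhds] with x hx
    rw [Filter.EventuallyEq.fderiv_eq hx]

theorem sDeriv_sum {ι : Type*} (s : Finset ι) (φ : ι → ℂ) {u : ι → Cn N × Cn q → ℂ}
    (hu : ∀ i ∈ s, AnalyticAt ℝ (u i) o) (es : List (Cn q)) :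
    sDeriv es (fun x => ∑ i ∈ s, φ i * u i x) =ᶠ[𝓝 o] fun x => ∑ i ∈ s, φ i * sDeriv es (u i) x := by
  induction es generalizing u with
  | nil => exact Filter.EventuallyEq.rfl
  | cons e es ih =>
    refine (sDeriv_congr ?_ es).trans (ih fun i hi => (hu i hi).fderiv_apply_const (0, e))
    filter_upwards [(Filter.eventually_all_finset s).2 fun i hi => (hu i hi).eventually_analyticAt]
      with x hx
    have h1 : HasFDerivAt (fun x => ∑ i ∈ s, φ i * u i x) (∑ i ∈ s, φ i • fderiv ℝ (u i) x) x :=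
      HasFDerivAt.fun_sum fun i hi => (hx i hi).differentiableAt.hasFDerivAt.const_mul (φ i)
    rw [h1.fderiv]
    simp [_root_.sum_apply]

end Vanishing

section FinNondeg

variable {N N' d d' q ℓ : ℕ} {M : Set (Cn N)} {p : Cn N} {κ : Cn N →L[ℂ] Cn q}
  {r : Cn N × Cn N → Fin d → ℂ} {c : Cn N × Cn q → Cn N}

theorem IsLift.apply_base {u : Cn N × Cn q → ℂ} {g : Cn N → ℂ} (h : IsLift M p κ u g)
    (hp : p ∈ M) : g p = u (p, 0) := by
  have := h.eq.self_of_nhds hp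
  simpa using this

theorem SegreEq.exists_frame_list (h : SegreEq M p κ r c) (es : List (Cn q)) :
    ∃ Ls : List (CRVectorField M p), Ls.length = es.length ∧ ∀ u g, IsLift M p κ u g →
      IsLift M p κ (sDeriv es u) (CRApplyList Ls g) := by
  choose L hL using h.exists_frame
  refine ⟨(es.map L).reverse, by simp, fun u g hu => ?_⟩
  rw [CRApplyList, List.foldr_reverse, List.foldl_map]
  induction es generalizing u g with
  | nil => exact hu
  | cons e es ih => exact ih _ _ (hL e _ _ hu)

theorem SegreEq.exists_apply_list (h : SegreEq M p κ r c) (Ls : List (CRVectorField M p)) {n : ℕ}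
    (hn : Ls.length ≤ n) {u : Cn N × Cn q → ℂ} {g : Cn N → ℂ} (hu : IsLift M p κ u g)
    (hv : SVanish (p, 0) n u) :
    ∃ u', IsLift M p κ u' (CRApplyList Ls g) ∧ SVanish (p, 0) (n - Ls.length) u' := by
  induction Ls with
  | nil => exact ⟨u, hu, hv⟩
  | cons L Ls ih =>
    obtain ⟨u', h1, h2⟩ := ih (by simp at hn; omega)
    obtain ⟨a, ha, h3⟩ := h.exists_apply_isLift L
    refine ⟨_, h3 _ _ h1, ?_⟩
    obtain ⟨m, hm⟩ : ∃ m, n - Ls.length = m + 1 := ⟨n - Ls.length - 1, by simp at hn; omega⟩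
    have h4 : n - (L :: Ls).length = m := by simp; omega
    rw [h4]
    rw [hm] at h2
    have h5 : ∀ j : Fin q, AnalyticAt ℝ (fun x => fderiv ℝ u' x (0, cbasis j 1)) (p, 0) :=
      fun j => h1.sesqui.1.fderiv_apply_const _
    exact SVanish.sum _ (fun j _ => (ha j).1.mul (h5 j))
      fun j _ => SVanish.mul_left (ha j).1 (h5 j) (h2.2 _)

theorem CRApplyList_analyticAt (Ls : List (CRVectorField M p)) {g : Cn N → ℂ}
    (hg : AnalyticAt ℝ g p) : AnalyticAt ℝ (CRApplyList Ls g) p := by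
  induction Ls with
  | nil => exact hg
  | cons L Ls ih => exact L.apply_analyticAt ih

theorem CRApplyList_sum (Ls : List (CRVectorField M p)) {ι : Type*} (s : Finset ι) (φ : ι → ℂ)
    {g : ι → Cn N → ℂ} (hg : ∀ i ∈ s, AnalyticAt ℝ (g i) p) :
    CRApplyList Ls (fun z => ∑ i ∈ s, φ i * g i z) =ᶠ[𝓝 p]
      fun z => ∑ i ∈ s, φ i * CRApplyList Ls (g i) z := by
  induction Ls with
  | nil => exact Filter.EventuallyEq.rfl
  | cons L Ls ih =>
    filter_upwards [ih.eventually_nhds, (Filter.eventually_all_finset s).2 fun i hi =>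
      (CRApplyList_analyticAt Ls (hg i hi)).eventually_analyticAt] with z h1 h2
    have h3 : HasFDerivAt (fun z => ∑ i ∈ s, φ i * CRApplyList Ls (g i) z)
        (∑ i ∈ s, φ i • fderiv ℝ (CRApplyList Ls (g i)) z) z :=
      HasFDerivAt.fun_sum fun i hi => (h2 i hi).differentiableAt.hasFDerivAt.const_mul (φ i)
    have h4 : fderiv ℝ (CRApplyList Ls fun z => ∑ i ∈ s, φ i * g i z) z =
        ∑ i ∈ s, φ i • fderiv ℝ (CRApplyList Ls (g i)) z := by
      rw [Filter.EventuallyEq.fderiv_eq h1, h3.fderiv]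
    change L.apply (CRApplyList Ls fun z => ∑ i ∈ s, φ i * g i z) z =
      ∑ i ∈ s, φ i * L.apply (CRApplyList Ls (g i)) z
    simp only [CRVectorField.apply_eq, h4, _root_.sum_apply, _root_.smul_apply, smul_eq_mul,
      Finset.mul_sum, ← Finset.sum_add_distrib]
    exact Finset.sum_congr rfl fun i _ => by ring

/-- Finite nondegeneracy in terms of lifts of the complex gradients. -/
theorem SegreEq.finNondeg_iff (h : SegreEq M p κ r c) (hp : p ∈ M) {M' : Set (Cn N')}
    {p' : Cn N'} {ρ : Fin d' → Cn N' → ℝ} (hρ : ∀ k, AnalyticAt ℝ (ρ k) p')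
    (hM' : ∀ᶠ w in 𝓝 p', w ∈ M' ↔ ∀ k, ρ k w = 0)
    (hind : LinearIndependent ℂ fun k => wirtD (ρ k) p') {H : Cn N → Cn N'}
    (hH : AnalyticAt ℝ H p) (hHp : H p = p') (hHM : ∀ᶠ z in 𝓝 p, z ∈ M → H z ∈ M')
    {u : Fin d' → Fin N' → Cn N × Cn q → ℂ}
    (hu : ∀ k j, IsLift M p κ (u k j) fun z => wirtD (ρ k) (H z) j) :
    FinNondeg M p M' ℓ H ↔ Submodule.span ℂ {v : Fin N' → ℂ | ∃ (es : List (Cn q)) (k : Fin d'),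
      es.length ≤ ℓ ∧ v = fun j => sDeriv es (u k j) (p, 0)} = ⊤ := by
  constructor
  · intro hF
    by_contra hne
    obtain ⟨f, hf0, hf⟩ := Submodule.exists_dual_map_eq_bot_of_lt_top (lt_top_iff_ne_top.2 hne)
      inferInstance
    have hfs : ∀ v ∈ {v : Fin N' → ℂ | ∃ (es : List (Cn q)) (k : Fin d'),
        es.length ≤ ℓ ∧ v = fun j => sDeriv es (u k j) (p, 0)}, f v = 0 := fun v hv => by
      have : f v ∈ Submodule.map f _ := Submodule.mem_map_of_mem (Submodule.subset_span hv)
      rwa [hf, Submodule.mem_bot] at this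
    let φ : Fin N' → ℂ := fun j => f (Pi.single j 1)
    have hfφ : ∀ v : Fin N' → ℂ, f v = ∑ j, φ j * v j := by
      intro v
      conv_lhs => rw [pi_eq_sum_univ' v, map_sum]
      refine Finset.sum_congr rfl fun j _ => ?_
      rw [map_smul, smul_eq_mul, mul_comm]
    have hvan : ∀ k, SVanish (p, 0) ℓ fun x => ∑ j, φ j * u k j x := by
      intro k
      refine sVanish_of_sDeriv fun es hes => ?_
      rw [(sDeriv_sum Finset.univ φ (fun j _ => (hu k j).sesqui.1) es).self_of_nhds]
      refine (hfφ _).symm.trans ?_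
      exact hfs _ ⟨es, k, hes, rfl⟩
    have hkill : ∀ v ∈ { v : Fin N' → ℂ | ∃ (Ls : List (CRVectorField M p)) (ρ' : Cn N' → ℝ)
        (U' : Set (Cn N')), Ls.length ≤ ℓ ∧ IsOpen U' ∧ H p ∈ U' ∧ AnalyticOnNhd ℝ ρ' U' ∧
        (∀ w ∈ M' ∩ U', ρ' w = 0) ∧
        v = fun j => CRApplyList Ls (fun z => wirtD ρ' (H z) j) p }, f v = 0 := by
      rintro v ⟨Ls, ρ', U', hLs, hU', hpU', hρ', hρ0, rfl⟩
      rw [hHp] at hpU'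
      obtain ⟨a, ha, hsum⟩ := exists_wirtD_eq_sum hρ hM' hind (hρ' p' hpU') (by
        filter_upwards [hU'.mem_nhds hpU'] with w hw hwM using hρ0 w ⟨hwM, hw⟩)
      have haH : ∀ k, AnalyticAt ℝ (fun z => a k (H z)) p := fun k =>
        (ha k).comp_eq hH hHp
      have hgH : ∀ j, AnalyticAt ℝ (fun z => wirtD ρ' (H z) j) p := fun j =>
        ((hρ' p' hpU').wirtD_apply j).comp_eq hH hHp
      choose b hb using fun k => h.exists_isLift (haH k)
      have hl : IsLift M p κ (fun x => ∑ k, b k x * ∑ j, φ j * u k j x)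
          (fun z => ∑ j, φ j * wirtD ρ' (H z) j) := by
        refine ⟨IsSesquiAt.sum _ fun k _ => (hb k).sesqui.mul (IsSesquiAt.sum _ fun j _ =>
          (isSesquiAt_const _ _).mul (hu k j).sesqui), Finset.univ.analyticAt_fun_sum
          (f := fun j z => φ j * wirtD ρ' (H z) j) fun j _ => analyticAt_const.mul (hgH j), ?_⟩
        have hHt : Filter.Tendsto H (𝓝 p) (𝓝 p') := hHp ▸ hH.continuousAt
        filter_upwards [hHM, hHt.eventually hsum, Filter.eventually_all.2 fun k => (hb k).eq,
          Filter.eventually_all.2 fun k => Filter.eventually_all.2 fun j => (hu k j).eq]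
          with z e1 e2 e3 e4 hz
        simp only [e2 (e1 hz), Finset.mul_sum]
        rw [Finset.sum_comm]
        refine Finset.sum_congr rfl fun k _ => Finset.sum_congr rfl fun j _ => ?_
        rw [← e3 k hz, ← e4 k j hz]
        ring
      have hlv : SVanish (p, 0) ℓ fun x => ∑ k, b k x * ∑ j, φ j * u k j x := by
        have h1 : ∀ k, AnalyticAt ℝ (fun x => ∑ j, φ j * u k j x) (p, 0) := fun k =>
          Finset.univ.analyticAt_fun_sum (f := fun j x => φ j * u k j x) fun j _ =>
            analyticAt_const.mul (hu k j).sesqui.1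
        exact SVanish.sum _ (fun k _ => (hb k).sesqui.1.mul (h1 k))
          fun k _ => SVanish.mul_left (hb k).sesqui.1 (h1 k) (hvan k)
      obtain ⟨u', h1, h2⟩ := h.exists_apply_list Ls hLs hl hlv
      have h3 := h1.apply_base hp
      rw [h2.apply, (CRApplyList_sum Ls Finset.univ φ fun j _ => hgH j).self_of_nhds] at h3
      rw [hfφ]
      exact h3
    have hle : Submodule.span ℂ _ ≤ LinearMap.ker f := Submodule.span_le.2 fun v hv =>
      LinearMap.mem_ker.2 (hkill v hv)
    rw [FinNondeg] at hF
    rw [hF, top_le_iff, LinearMap.ker_eq_top] at hle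
    exact hf0 hle
  · intro hs
    rw [FinNondeg, eq_top_iff, ← hs]
    refine Submodule.span_mono ?_
    rintro v ⟨es, k, hes, rfl⟩
    obtain ⟨Ls, hLs, hL⟩ := h.exists_frame_list es
    obtain ⟨U', hU', hU'o, hpU'⟩ := eventually_nhds_iff.1 ((hρ k).eventually_analyticAt.and hM')
    refine ⟨Ls, ρ k, U', hLs ▸ hes, hU'o, by rwa [hHp], fun w hw => (hU' w hw).1,
      fun w hw => ((hU' w hw.2).2.1 hw.1) k, ?_⟩
    funext j
    exact ((hL _ _ (hu k j)).apply_base hp).symm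

end FinNondeg

section Immersion

variable {W E : Type*} [NormedAddCommGroup W] [NormedSpace ℝ W] [FiniteDimensional ℝ W]
  [NormedAddCommGroup E] [NormedSpace ℝ E] [FiniteDimensional ℝ E]

/-- A small piece of the image of an immersion is a submanifold. -/
theorem AnalyticAt.exists_submanifold {f : W → E} {a : W} (hf : AnalyticAt ℝ f a)
    (hinj : ∀ v, fderiv ℝ f a v = 0 → v = 0) {𝒱 : Set W} (h𝒱 : 𝒱 ∈ 𝓝 a) :
    ∃ S : Set E, f a ∈ S ∧ (∀ x ∈ S, IsRASubmanifoldAt S x (Module.finrank ℝ W)) ∧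
      ∀ x ∈ S, ∃ w ∈ 𝒱, f w = x ∧ ∀ v, fderiv ℝ f w v ∈ tangentConeAt ℝ S x := by
  have := FiniteDimensional.complete ℝ E
  have := FiniteDimensional.complete ℝ W
  have hker : (fderiv ℝ f a : W →ₗ[ℝ] E).ker = ⊥ :=
    LinearMap.ker_eq_bot'.2 hinj
  obtain ⟨L', hL'⟩ := (fderiv ℝ f a : W →ₗ[ℝ] E).exists_leftInverse_of_injective hker
  obtain ⟨L, hL⟩ : ∃ L : E →L[ℝ] W, ∀ v, L (fderiv ℝ f a v) = v :=
    ⟨L'.toContinuousLinearMap, fun v => LinearMap.congr_fun hL' v⟩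
  have hG : AnalyticAt ℝ (fun w => L (f w - f a)) a :=
    AnalyticAt.clm_const_apply L (by fun_prop)
  have hdG : HasFDerivAt (fun w => L (f w - f a)) (L.comp (fderiv ℝ f a)) a :=
    L.hasFDerivAt.comp a (hf.differentiableAt.hasFDerivAt.sub_const (f a))
  obtain ⟨χ, hχ, hχ0, hχl, hχr⟩ := hG.exists_local_inverse_of_injective
    (fun v hv => by rw [hdG.fderiv] at hv; simpa [hL] using hv) rfl
  let K := (L : E →ₗ[ℝ] W).ker
  obtain ⟨P, hP⟩ := exists_continuous_projection ℝ K
  have hdimK : Module.finrank ℝ W + Module.finrank ℝ K = Module.finrank ℝ E := by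
    have h1 := (L : E →ₗ[ℝ] W).finrank_range_add_finrank_ker
    rwa [LinearMap.range_eq_top.2 fun v => ⟨_, hL v⟩, finrank_top] at h1
  let eK : K ≃L[ℝ] (Fin (Module.finrank ℝ K) → ℝ) :=
    ContinuousLinearEquiv.ofFinrankEq (by simp)
  obtain ⟨Q, hQ⟩ : ∃ Q : E →L[ℝ] (Fin (Module.finrank ℝ K) → ℝ), ∀ v, Q v = eK (P v) :=
    ⟨(eK : K →L[ℝ] _).comp P, fun _ => rfl⟩
  have hQ0 : ∀ v, L v = 0 → Q v = 0 → v = 0 := by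
    intro v h1 h2
    rw [hQ, map_eq_zero_iff eK eK.injective] at h2
    have h3 : P v = ⟨v, h1⟩ := hP ⟨v, h1⟩
    rw [h3] at h2
    exact congrArg Subtype.val h2
  have hQs : ∀ y, ∃ v, L v = 0 ∧ Q v = y := fun y => by
    refine ⟨(eK.symm y : K), (eK.symm y).2, ?_⟩
    rw [hQ, hP]; simp
  have hLan : ∀ z, AnalyticAt ℝ (fun z => L (z - f a)) z := fun z =>
    AnalyticAt.clm_const_apply L (by fun_prop)
  have hχ0' : χ (L (f a - f a)) = a := hχ0
  have hcomp : AnalyticAt ℝ (fun z => χ (L (z - f a))) (f a) :=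
    AnalyticAt.comp_eq hχ (hLan (f a)) rfl
  let F : E → E := fun z => f (χ (L (z - f a)))
  have hF : AnalyticAt ℝ F (f a) := AnalyticAt.comp_eq hf hcomp hχ0'
  let φ : E → Fin (Module.finrank ℝ K) → ℝ := fun z => Q (z - F z)
  have hφ : AnalyticAt ℝ φ (f a) := AnalyticAt.clm_const_apply Q (by fun_prop)
  have hLt : Filter.Tendsto (fun z => L (z - f a)) (𝓝 (f a)) (𝓝 (L (f a - f a))) :=
    (hLan (f a)).continuousAt
  have hct : Filter.Tendsto (fun z => χ (L (z - f a))) (𝓝 (f a)) (𝓝 a) := by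
    simpa only [ContinuousAt, hχ0'] using hcomp.continuousAt
  have hLF : ∀ᶠ z in 𝓝 (f a), L (z - F z) = 0 := by
    filter_upwards [hLt.eventually hχr] with z hz
    have : z - F z = (z - f a) - (F z - f a) := by abel
    rw [this, map_sub]
    exact sub_eq_zero.2 hz.symm
  obtain ⟨𝒲, h𝒲, h𝒲o, ha𝒲⟩ : ∃ 𝒲 : Set W, (∀ w ∈ 𝒲, w ∈ 𝒱 ∧ χ (L (f w - f a)) = w ∧
      AnalyticAt ℝ f w) ∧ IsOpen 𝒲 ∧ a ∈ 𝒲 := by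
    obtain ⟨𝒲, h1, h2, h3⟩ := eventually_nhds_iff.1
      ((Filter.eventually_of_mem h𝒱 fun w hw => hw).and (hχl.and hf.eventually_analyticAt))
    exact ⟨𝒲, h1, h2, h3⟩
  obtain ⟨U, hU, hUo, haU⟩ := eventually_nhds_iff.1 ((hct.eventually (h𝒲o.mem_nhds ha𝒲)).and
    (hLF.and hφ.eventually_analyticAt))
  have hFa : F (f a) = f a := congrArg f hχ0'
  have hmemS : ∀ z ∈ U, φ z = 0 → F z = z := fun z hz h0 =>
    (sub_eq_zero.1 (hQ0 _ (hU z hz).2.1 h0)).symm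
  refine ⟨{z | z ∈ U ∧ φ z = 0}, ⟨haU, ?_⟩, ?_, ?_⟩
  · simp only [φ, hFa, sub_self, map_zero]
  · rintro x ⟨hx, hx0⟩
    refine ⟨Module.finrank ℝ K, U, φ, hUo, hx, hdimK, fun k z hz => ?_, ?_, ?_⟩
    · exact AnalyticAt.clm_const_apply (ContinuousLinearMap.proj k :
        (Fin (Module.finrank ℝ K) → ℝ) →L[ℝ] ℝ) (hU z hz).2.2
    · ext z
      simp only [Set.mem_inter_iff, Set.mem_ofPred_eq]
      exact ⟨fun h => ⟨h.2, fun k => congrFun h.1.2 k⟩, fun h => ⟨⟨h.1, funext h.2⟩, h.1⟩⟩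
    · rintro z ⟨⟨hz, -⟩, -⟩
      have hsurj : ∀ y, ∃ v, fderiv ℝ φ z v = y := by
        intro y
        obtain ⟨v, hv1, hv2⟩ := hQs y
        refine ⟨v, ?_⟩
        have hl : HasDerivAt (fun t : ℝ => φ (z + t • v)) (fderiv ℝ φ z v) 0 := by
          have h1 : HasFDerivAt φ (fderiv ℝ φ z) (z + (0 : ℝ) • v) := by
            simpa using (hU z hz).2.2.differentiableAt.hasFDerivAt
          have h2 : HasDerivAt (fun t : ℝ => z + t • v) v 0 := by
            simpa using ((hasDerivAt_id (0 : ℝ)).smul_const v).const_add z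
          exact HasFDerivAt.comp_hasDerivAt (l := φ) (f := fun t : ℝ => z + t • v) (0 : ℝ) h1 h2
        have hr : HasDerivAt (fun t : ℝ => φ (z + t • v)) (Q v) 0 := by
          have : (fun t : ℝ => φ (z + t • v)) = fun t : ℝ => φ z + t • Q v := by
            funext t
            have h3 : L (z + t • v - f a) = L (z - f a) := by
              simp [map_sub, map_add, hv1]
            simp only [φ, F, h3]
            rw [← map_smul, ← map_add]
            congr 1
            abel
          rw [this]
          simpa using ((hasDerivAt_id (0 : ℝ)).smul_const (Q v)).const_add (φ z)
        rw [hl.unique hr, hv2]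
      have hcomp : ∀ k, fderiv ℝ (fun z => φ z k) z =
          (ContinuousLinearMap.proj k).comp (fderiv ℝ φ z) := fun k =>
        (((ContinuousLinearMap.proj k :
          (Fin (Module.finrank ℝ K) → ℝ) →L[ℝ] ℝ).hasFDerivAt).comp z
          (hU z hz).2.2.differentiableAt.hasFDerivAt).fderiv
      rw [Fintype.linearIndependent_iff]
      intro g hg k
      obtain ⟨v, hv⟩ := hsurj (Pi.single k 1)
      have := DFunLike.congr_fun hg v
      simpa [hcomp, hv, Pi.single_apply] using this
  · rintro x ⟨hx, hx0⟩
    have hw := (hU x hx).1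
    refine ⟨χ (L (x - f a)), (h𝒲 _ hw).1, hmemS x hx hx0, fun v => ?_⟩
    set w := χ (L (x - f a)) with hwdef
    have hfw : f w = x := hmemS x hx hx0
    have hfan := (h𝒲 _ hw).2.2
    have hev : ∀ᶠ w' in 𝓝 w, f w' ∈ {z | z ∈ U ∧ φ z = 0} := by
      have h1 : ∀ᶠ w' in 𝓝 w, f w' ∈ U :=
        hfan.continuousAt.eventually (hUo.mem_nhds (by rwa [hfw]))
      filter_upwards [h1, h𝒲o.mem_nhds hw] with w' h2 h3
      refine ⟨h2, ?_⟩
      simp only [φ, F, (h𝒲 _ h3).2.1, sub_self, map_zero]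
    obtain ⟨𝒪, h𝒪, h𝒪o, hw𝒪⟩ := eventually_nhds_iff.1 hev
    have h5 := (hfan.differentiableAt.hasFDerivAt.hasFDerivWithinAt (s := 𝒪)).mapsTo_tangent_cone
      (show v ∈ tangentConeAt ℝ 𝒪 w by
        rw [tangentConeAt_of_mem_nhds (h𝒪o.mem_nhds hw𝒪)]; trivial)
    rw [hfw] at h5
    exact tangentConeAt_mono (by rintro _ ⟨y, hy, rfl⟩; exact h𝒪 y hy) h5

end Immersion

namespace SegreEq

variable {N d q : ℕ} {M : Set (Cn N)} {p : Cn N} {κ : Cn N →L[ℂ] Cn q}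
  {r : Cn N × Cn N → Fin d → ℂ} {c : Cn N × Cn q → Cn N}

/-- The reflection `(x, s) ↦ (c (x, s), κ (x - p))` on pairs of points, the second in the Segre
variety of the first. -/
def refl (κ : Cn N →L[ℂ] Cn q) (p : Cn N) (c : Cn N × Cn q → Cn N) (x : Cn N × Cn q) :
    Cn N × Cn q := (c x, κ (x.1 - p))

theorem analyticAt_refl {x : Cn N × Cn q} (hc : AnalyticAt ℝ c x) :
    AnalyticAt ℝ (refl κ p c) x :=
  hc.prod (AnalyticAt.clm_const_apply (κ.restrictScalars ℝ) (by fun_prop))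

theorem fderiv_refl {x : Cn N × Cn q} (hc : AnalyticAt ℝ c x) (v : Cn N × Cn q) :
    fderiv ℝ (refl κ p c) x v = (fderiv ℝ c x v, κ v.1) := by
  have h : HasFDerivAt (refl κ p c) ((fderiv ℝ c x).prod
      ((κ.restrictScalars ℝ).comp (ContinuousLinearMap.fst ℝ (Cn N) (Cn q)))) x :=
    hc.differentiableAt.hasFDerivAt.prodMk
      ((κ.restrictScalars ℝ).hasFDerivAt.comp x (hasFDerivAt_fst.sub_const p))
  rw [h.fderiv]; rfl

theorem refl_base (h : SegreEq M p κ r c) : refl κ p c (p, 0) = (p, 0) := by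
  simp [refl, h.c_base]

theorem exists_involution (h : SegreEq M p κ r c) {𝒰 : Set (Cn N × Cn q)}
    (h𝒰 : 𝒰 ∈ 𝓝 (p, (0 : Cn q))) : ∃ U ⊆ 𝒰, IsAnalyticInvolution (refl κ p c) U ∧
      (p, 0) ∈ U ∧ ∀ x ∈ U, AnalyticAt ℝ c x ∧
        ∀ v, fderiv ℝ c x (-(I • v.1), I • v.2) = I • fderiv ℝ c x v := by
  have hinv : ∀ᶠ x in 𝓝 (p, (0 : Cn q)), refl κ p c (refl κ p c x) = x := by
    have h1 : Filter.Tendsto (fun x : Cn N × Cn q => (x.1, c x)) (𝓝 (p, 0)) (𝓝 (p, p)) := by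
      have := ((continuousAt_fst (p := (p, (0 : Cn q)))).prodMk h.c_an.continuousAt).tendsto
      rwa [h.c_base] at this
    filter_upwards [h1.eventually h.c_unique, h.c_eq] with x h2 h3
    have h4 : r (x.1, c x) = 0 := by
      funext k
      rw [h.r_symm, h3.1]; simp
    exact Prod.ext (h2 h4) h3.2
  obtain ⟨G, hG, hGo, hpG⟩ := eventually_nhds_iff.1 ((Filter.eventually_of_mem h𝒰
    fun _ hx => hx).and (hinv.and (h.c_an.eventually_analyticAt.and h.c_cr)))
  have hcont : ContinuousOn (refl κ p c) G := fun x hx =>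
    (analyticAt_refl (hG x hx).2.2.1).continuousAt.continuousWithinAt
  refine ⟨G ∩ refl κ p c ⁻¹' G, fun x hx => (hG x hx.1).1, ⟨hcont.isOpen_inter_preimage hGo hGo,
    fun x hx => analyticAt_refl (hG x hx.1).2.2.1, fun x hx => ⟨hx.2, ?_⟩,
    fun x hx => (hG x hx.1).2.1⟩, ⟨hpG, ?_⟩, fun x hx => ⟨(hG x hx.1).2.2.1,
      fun v => (hG x hx.1).2.2.2 v.1 v.2⟩⟩
  · rw [Set.mem_preimage, (hG x hx.1).2.1]; exact hx.1
  · rw [Set.mem_preimage, h.refl_base]; exact hpG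

theorem tangentSpaceAt_le (h : SegreEq M p κ r c) : ∀ᶠ z in 𝓝 p, z ∈ M →
    ∀ v ∈ tangentSpaceAt M z, fderiv ℝ r (z, z) (v, v) = 0 := by
  filter_upwards [h.mem_iff.eventually_nhds, (tendsto_dup p).eventually h.r_an.eventually_analyticAt]
    with z h1 h2 hz v hv
  have hd : HasFDerivAt (fun z => r (z, z)) ((fderiv ℝ r (z, z)).comp
      ((ContinuousLinearMap.id ℝ (Cn N)).prod (ContinuousLinearMap.id ℝ (Cn N)))) z :=
    HasFDerivAt.comp z (g := r) (f := fun z => (z, z)) h2.differentiableAt.hasFDerivAt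
      ((hasFDerivAt_id z).prodMk (hasFDerivAt_id z))
  induction hv using Submodule.span_induction with
  | mem v hv =>
    obtain ⟨O, hO, hOo, hzO⟩ := eventually_nhds_iff.1 h1
    have hv' : v ∈ tangentConeAt ℝ (M ∩ O) z := by
      rwa [tangentConeAt_inter_nhds (hOo.mem_nhds hzO)]
    have h3 := hd.hasFDerivWithinAt.mapsTo_tangent_cone hv'
    have h4 : (fun z => r (z, z)) '' (M ∩ O) ⊆ {0} := by
      rintro _ ⟨y, hy, rfl⟩
      exact (hO y hy.2).1 hy.1
    have h5 := tangentConeAt_mono h4 h3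
    have h6 : r (z, z) = 0 := (hO z hzO).1 hz
    have h7 : tangentConeAt ℝ ({0} : Set (Fin d → ℂ)) (r (z, z)) ⊆ {0} :=
      tangentConeAt_subset_zero (by
        rw [h6, AccPt, nhdsWithin, inf_assoc, Filter.inf_principal]
        simp)
    exact h7 h5
  | zero => exact (fderiv ℝ r (z, z)).map_zero
  | add a b _ _ ha hb =>
    have : ((a + b, a + b) : Cn N × Cn N) = (a, a) + (b, b) := rfl
    rw [this, map_add, ha, hb, add_zero]
  | smul t a _ ha =>
    have : ((t • a, t • a) : Cn N × Cn N) = t • (a, a) := rfl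
    rw [this, map_smul, ha, smul_zero]

theorem fderiv_r_eq_zero (h : SegreEq M p κ r c) : ∀ᶠ z in 𝓝 p, ∀ u,
    fderiv ℝ r (z, z) (u, u) = 0 → fderiv ℝ r (z, z) (I • u, I • u) = 0 →
      fderiv ℝ r (z, z) (u, 0) = 0 := by
  filter_upwards [h.fderiv_r_diag, h.fderiv_r_I] with z h1 h2 u h3 h4
  funext k
  have h5 := congrFun h3 k
  have h6 := congrFun h4 k
  rw [h1] at h5 h6
  rw [h2] at h6
  simp only [Pi.smul_apply, smul_eq_mul, Pi.zero_apply, ofReal_eq_zero, mul_eq_zero,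
    OfNat.ofNat_ne_zero, false_or, mul_re, I_re, I_im, zero_mul, one_mul, zero_sub,
    neg_eq_zero] at h5 h6
  exact Complex.ext h5 h6

/-- The tangent space of `M` at `p` has dimension at most `2 N - d`. -/
theorem finrank_tangent_le (h : SegreEq M p κ r c) {K : Submodule ℝ (Cn N)}
    (hK : ∀ v ∈ K, fderiv ℝ r (p, p) (v, v) = 0) (hKd : 2 * N - d ≤ Module.finrank ℝ K) :
    ∀ v, fderiv ℝ r (p, p) (v, v) = 0 → v ∈ K := by
  obtain ⟨re, hre⟩ : ∃ re : (Fin d → ℂ) →ₗ[ℝ] (Fin d → ℝ), ∀ w k, re w k = (w k).re :=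
    ⟨LinearMap.pi fun k => Complex.reLm.comp (LinearMap.proj k), fun _ _ => rfl⟩
  obtain ⟨A, hA⟩ : ∃ A : Cn N →ₗ[ℝ] (Fin d → ℝ), ∀ v, A v = re (fderiv ℝ r (p, p) (v, 0)) :=
    ⟨re ∘ₗ (fderiv ℝ r (p, p) : Cn N × Cn N →ₗ[ℝ] _) ∘ₗ LinearMap.inl ℝ _ _, fun _ => rfl⟩
  have hker : ∀ v, A v = 0 ↔ fderiv ℝ r (p, p) (v, v) = 0 := by
    intro v
    rw [hA, funext_iff, funext_iff]
    refine forall_congr' fun k => ?_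
    rw [h.fderiv_r_diag.self_of_nhds, hre]
    simp
  have hsurj : A.range = ⊤ := by
    refine LinearMap.range_eq_top.2 fun y => ?_
    obtain ⟨v, hv, -⟩ := h.surj.self_of_nhds (fun k => (y k : ℂ)) 0
    exact ⟨v, by rw [hA, hv]; funext k; simp [hre]⟩
  have hdim := A.finrank_range_add_finrank_ker
  rw [hsurj, finrank_top, Module.finrank_fin_fun, finrank_real_of_complex,
    finrank_euclideanSpace_fin] at hdim
  have hle : K ≤ A.ker := fun v hv => (hker v).2 (hK v hv)
  have heq := Submodule.eq_of_le_of_finrank_le hle (by omega)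
  intro v hv
  rw [heq]
  exact (hker v).2 hv

/-- Maps `z ↦ Y z` obtained by iterating the relation "`Y z` lies on the Segre variety of `Y' z`",
starting from the constant `p`. -/
inductive Reach (κ : Cn N →L[ℂ] Cn q) (p : Cn N) (c : Cn N × Cn q → Cn N)
    (𝒰 : Set (Cn N × Cn q)) : (Cn N → Cn N) → Prop
  | base : Reach κ p c 𝒰 fun _ => p
  | step {Y Y' : Cn N → Cn N} : Reach κ p c 𝒰 Y → AnalyticAt ℝ Y p → AnalyticAt ℝ Y' p →
      (∀ᶠ z in 𝓝 p, (Y' z, κ (Y z - p)) ∈ 𝒰 ∧ c (Y' z, κ (Y z - p)) = Y z) → Reach κ p c 𝒰 Y'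

theorem reach_wordAct {T : Submodule ℝ (Cn N × Cn q)} (hT : ∀ τ ∈ T, τ.1 = 0)
    {U : Set (Cn N × Cn q)} (hσ : IsAnalyticInvolution (refl κ p c) U) {P : Type*}
    [NormedAddCommGroup P] [NormedSpace ℝ P] {fs : List (P → T)} {t : Cn N → P}
    (ht : AnalyticAt ℝ t p) (hfs : ∀ f ∈ fs, ∀ t, AnalyticAt ℝ f t)
    (hg : WordGood (refl κ p c) U (fs.map (· (t p))) (p, 0)) :
    Reach κ p c U fun z => (wordAct (refl κ p c) (fs.map (· (t z))) (p, 0)).1 := by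
  induction fs with
  | nil => exact Reach.base
  | cons f fs ih =>
    have hfs' : ∀ f ∈ fs, ∀ t, AnalyticAt ℝ f t := fun f hf => hfs f (List.mem_cons_of_mem _ hf)
    have han : ∀ {gs : List (P → T)}, (∀ f ∈ gs, ∀ t, AnalyticAt ℝ f t) →
        WordGood (refl κ p c) U (gs.map (· (t p))) (p, 0) →
        AnalyticAt ℝ (fun z => (wordAct (refl κ p c) (gs.map (· (t z))) (p, 0)).1) p ∧
        ∀ᶠ z in 𝓝 p, WordGood (refl κ p c) U (gs.map (· (t z))) (p, 0) := by
      intro gs h1 h2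
      have h3 := hσ.act_analyticAt (fun f hf => h1 f hf (t p)) (analyticAt_const (v := (p, (0 : Cn q)))) h2
      exact ⟨(AnalyticAt.comp_eq h3.1 ht rfl).fst_comp, ht.continuousAt.eventually h3.2⟩
    refine Reach.step (ih hfs' hg.1) (han hfs' hg.1).1 (han hfs hg).1 ?_
    filter_upwards [(han hfs' hg.1).2] with z hz
    set x := wordAct (refl κ p c) (fs.map (· (t z))) (p, 0) with hx
    have hxU : x ∈ U := hz.act_mem
    have h1 : (wordAct (refl κ p c) ((f :: fs).map (· (t z))) (p, 0)).1 = c x := by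
      change (refl κ p c x + (f (t z) : Cn N × Cn q)).1 = c x
      rw [Prod.fst_add, hT _ (f (t z)).2, add_zero]; rfl
    rw [h1]
    exact ⟨hσ.mapsTo x hxU, congrArg Prod.fst (hσ.invol x hxU)⟩

theorem Reach.mono {U V : Set (Cn N × Cn q)} (hUV : U ⊆ V) {Y : Cn N → Cn N}
    (hY : Reach κ p c U Y) : Reach κ p c V Y := by
  induction hY with
  | base => exact Reach.base
  | step _ h1 h2 h3 ih => exact Reach.step ih h1 h2 (h3.mono fun z hz => ⟨hUV hz.1, hz.2⟩)

/-- Minimality: iterated Segre varieties fill a neighbourhood of `p`. -/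
theorem exists_reach (h : SegreEq M p κ r c) (hmin : IsMinimalAt M d p)
    {𝒰 : Set (Cn N × Cn q)} (h𝒰 : 𝒰 ∈ 𝓝 (p, (0 : Cn q))) :
    ∃ Y, Reach κ p c 𝒰 Y ∧ ∀ᶠ z in 𝓝 p, Y z = z := by
  obtain ⟨U, hU𝒰, hσ, hoU, hc⟩ := h.exists_involution h𝒰
  let T : Submodule ℝ (Cn N × Cn q) := (LinearMap.fst ℝ (Cn N) (Cn q)).ker
  have hT : ∀ τ ∈ T, τ.1 = 0 := fun τ hτ => hτ
  obtain ⟨V₀, hJ, ⟨P, _, _, _, fs, t₀, hfs, hgood, hact, hrange⟩, W, hW, g, hg, hg0, hdg, hgW⟩ :=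
    hσ.exists_orbit T hoU h.refl_base
  obtain ⟨J, hJdef⟩ : ∃ J : Cn N × Cn q →L[ℝ] Cn N × Cn q, ∀ v, J v = (-(I • v.1), I • v.2) := by
    obtain ⟨A, hA⟩ : ∃ A : Cn N →L[ℝ] Cn N, ∀ v, A v = -(I • v) :=
      ⟨-(I • ContinuousLinearMap.id ℝ (Cn N)), fun _ => rfl⟩
    obtain ⟨B, hB⟩ : ∃ B : Cn q →L[ℝ] Cn q, ∀ v, B v = I • v :=
      ⟨I • ContinuousLinearMap.id ℝ (Cn q), fun _ => rfl⟩
    exact ⟨A.prodMap B, fun v => Prod.ext (hA v.1) (hB v.2)⟩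
  have hJV := hJ J (fun τ hτ => by
      change (J τ).1 = 0
      rw [hJdef, hT τ hτ]; simp)
    (fun x hx v => by
      rw [fderiv_refl (hc x hx).1, fderiv_refl (hc x hx).1, hJdef, hJdef, (hc x hx).2]
      refine Prod.ext ?_ ?_ <;> simp)
  -- the orbit as a submanifold of `M`
  have hg1 : AnalyticAt ℝ (fun w => (g w).1) 0 := hg.fst_comp
  have hg1d : ∀ᶠ w in 𝓝 (0 : W), ∀ v, fderiv ℝ (fun w => (g w).1) w v = (fderiv ℝ g w v).1 := by
    filter_upwards [hg.eventually_analyticAt] with w hw v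
    have : HasFDerivAt (fun w => (g w).1) ((ContinuousLinearMap.fst ℝ _ _).comp (fderiv ℝ g w)) w :=
      HasFDerivAt.comp w hasFDerivAt_fst hw.differentiableAt.hasFDerivAt
    rw [this.fderiv]; rfl
  have hWκ : ∀ w ∈ W, w.2 = κ w.1 := fun w hw => by
    have := ((hW w).1 hw).2
    rw [fderiv_refl (hc _ hoU).1] at this
    exact (congrArg Prod.snd this).symm
  have hd0 : ∀ v : W, fderiv ℝ (fun w => (g w).1) 0 v = (v : Cn N × Cn q).1 := fun v => by
    rw [hg1d.self_of_nhds, hdg]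
  have hinj : ∀ v : W, fderiv ℝ (fun w => (g w).1) 0 v = 0 → v = 0 := fun v hv => by
    rw [hd0] at hv
    refine Subtype.ext (Prod.ext hv ?_)
    rw [hWκ v v.2, hv]; simp
  have hgt : Filter.Tendsto (fun w => (g w).1) (𝓝 0) (𝓝 p) := by
    have := hg1.continuousAt.tendsto
    simpa only [hg0] using this
  have hrdup : ∀ᶠ x in 𝓝 (p, (0 : Cn q)), r (c x, x.1) = 0 := h.c_eq.mono fun x hx => hx.1
  have hgt' : Filter.Tendsto g (𝓝 0) (𝓝 (p, 0)) := by
    have := hg.continuousAt.tendsto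
    rwa [hg0] at this
  have hgM : ∀ᶠ w in 𝓝 (0 : W), (g w).1 ∈ M ∧ g w = ((g w).1, κ ((g w).1 - p)) := by
    filter_upwards [hgW, hgt'.eventually hrdup, hgt.eventually h.mem_iff] with w h1 h2 h3
    have h4 : c (g w) = (g w).1 := congrArg Prod.fst h1.1
    have h5 : κ ((g w).1 - p) = (g w).2 := congrArg Prod.snd h1.1
    rw [h4] at h2
    exact ⟨h3.2 h2, Prod.ext rfl h5.symm⟩
  have htan : ∀ᶠ w in 𝓝 (0 : W), ∀ u ∈ tangentSpaceAt M (g w).1 ⊓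
      (tangentSpaceAt M (g w).1).map mulI, ∃ v, fderiv ℝ (fun w => (g w).1) w v = u := by
    filter_upwards [hgM, hgW, hg1d, hgt.eventually h.tangentSpaceAt_le,
      hgt.eventually h.fderiv_r_eq_zero, hgt.eventually h.complexTangent,
      hgt'.eventually (h.c_an.eventually_analyticAt), hgt.eventually h.fderiv_r_I]
      with w h1 h2 h3 h4 h5 h6 h7 h8 u hu
    obtain ⟨hu1, v, hv, rfl⟩ := hu
    have hvI : mulI v = I • v := rfl
    rw [hvI] at hu1 ⊢
    have h9 : fderiv ℝ r ((g w).1, (g w).1) (I • v, 0) = 0 := by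
      rw [h8, h5 v (h4 h1.1 v hv) (h4 h1.1 _ hu1), smul_zero]
    obtain ⟨w', hw'⟩ := h2.2 (0, κ (I • v)) rfl
    refine ⟨w', ?_⟩
    rw [h3, hw', fderiv_refl h7, Prod.fst_add, zero_add]
    change fderiv ℝ c (g w) (0, κ (I • v)) = I • v
    rw [h1.2]
    exact (h6 h1.1).1 _ h9
  obtain ⟨S, hpS, hSm, hSt⟩ := hg1.exists_submanifold hinj
    (Filter.inter_mem hgM htan)
  have hdim : 2 * N - d ≤ Module.finrank ℝ W := by
    by_contra hlt
    refine hmin ⟨S, Module.finrank ℝ W, ?_, ?_, not_le.1 hlt, hSm, ?_⟩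
    · intro x hx
      obtain ⟨w, hw, rfl, -⟩ := hSt x hx
      exact hw.1.1
    · simpa only [hg0] using hpS
    · intro x hx u hu
      obtain ⟨w, hw, rfl, hv⟩ := hSt x hx
      obtain ⟨v, rfl⟩ := hw.2 u hu
      exact Submodule.subset_span (hv v)
  -- the orbit is open in `M`
  have hTp : ∀ v, fderiv ℝ r (p, p) (v, v) = 0 →
      v ∈ W.map (LinearMap.fst ℝ (Cn N) (Cn q)) := by
    refine h.finrank_tangent_le ?_ ?_
    · rintro _ ⟨w, hw, rfl⟩
      have h1 : HasFDerivAt (fun w => r ((g w).1, (g w).1)) ((fderiv ℝ r (p, p)).comp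
          ((fderiv ℝ (fun w => (g w).1) 0).prod (fderiv ℝ (fun w => (g w).1) 0))) (0 : W) :=
        HasFDerivAt.comp (0 : W) (g := r) (f := fun w => ((g w).1, (g w).1))
          (by simpa only [hg0] using h.r_an.differentiableAt.hasFDerivAt)
          (hg1.differentiableAt.hasFDerivAt.prodMk hg1.differentiableAt.hasFDerivAt)
      have h2 := h1.unique ((hasFDerivAt_const (0 : Fin d → ℂ) (0 : W)).congr_of_eventuallyEq (by
        filter_upwards [hgM, hgt.eventually h.mem_iff] with w h3 h4
        exact h4.1 h3.1))
      have h3 := DFunLike.congr_fun h2 ⟨w, hw⟩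
      change fderiv ℝ r (p, p) (fderiv ℝ (fun w => (g w).1) 0 ⟨w, hw⟩,
        fderiv ℝ (fun w => (g w).1) 0 ⟨w, hw⟩) = 0 at h3
      rwa [hd0] at h3
    · refine hdim.trans (le_of_eq ?_)
      rw [← LinearMap.range_domRestrict]
      refine (LinearMap.finrank_range_of_inj fun a b hab => ?_).symm
      refine sub_eq_zero.1 (hinj _ ?_)
      rw [hd0]
      exact sub_eq_zero.2 hab
  have hsurj : ∀ w : Cn N, ∃ v ∈ V₀, v.1 = w := by
    have h1 : ∀ v, fderiv ℝ r (p, p) (v, v) = 0 → ∃ v' ∈ V₀, v'.1 = v := fun v hv => by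
      obtain ⟨w, hw, rfl⟩ := hTp v hv
      exact ⟨w, ((hW w).1 hw).1, rfl⟩
    intro w
    obtain ⟨u, v, rfl, hu, hv⟩ := h.exists_tangent_add.self_of_nhds w
    obtain ⟨u', hu', rfl⟩ := h1 u hu
    obtain ⟨v', hv', rfl⟩ := h1 v hv
    refine ⟨u' - J v', sub_mem hu' (hJV v' hv'), ?_⟩
    rw [hJdef]; simp
  obtain ⟨hψ, -⟩ := hσ.act_analyticAt (fun f hf => hfs f hf t₀)
    (analyticAt_const (v := (p, (0 : Cn q)))) hgood
  obtain ⟨t, ht, htp, htz⟩ := hψ.fst_comp.exists_local_section (fun w => by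
    obtain ⟨v, hv, rfl⟩ := hsurj w
    rw [← hrange] at hv
    obtain ⟨s, rfl⟩ := hv
    refine ⟨s, ?_⟩
    have : HasFDerivAt (fun s => (wordAct (refl κ p c) (fs.map (· s)) (p, 0)).1)
      ((ContinuousLinearMap.fst ℝ _ _).comp (fderiv ℝ (fun s => wordAct (refl κ p c) (fs.map (· s))
        (p, 0)) t₀)) t₀ :=
      HasFDerivAt.comp t₀ hasFDerivAt_fst hψ.differentiableAt.hasFDerivAt
    rw [this.fderiv]; rfl)
  simp only [hact] at ht htp htz
  exact ⟨_, (reach_wordAct hT hσ ht hfs (by rwa [htp])).mono hU𝒰, htz⟩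

end SegreEq

section Jets

theorem AnalyticAt.clm_comp_of {X E F G : Type*} [NormedAddCommGroup X] [NormedSpace ℝ X]
    [NormedAddCommGroup E] [NormedSpace ℝ E] [NormedAddCommGroup F] [NormedSpace ℝ F]
    [NormedAddCommGroup G] [NormedSpace ℝ G] {A : X → F →L[ℝ] G} {B : X → E →L[ℝ] F} {x : X}
    (hA : AnalyticAt ℝ A x) (hB : AnalyticAt ℝ B x) :
    AnalyticAt ℝ (fun x => (A x).comp (B x)) x :=
  ((ContinuousLinearMap.compL ℝ E F G).analyticAt_bilinear (A x, B x)).comp₂ hA hB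

variable {E E' : Type*} {Q A J G : Type*} [NormedAddCommGroup Q] [NormedSpace ℝ Q]
  [NormedAddCommGroup A] [NormedSpace ℝ A] [NormedAddCommGroup J] [NormedSpace ℝ J]
  [NormedAddCommGroup G] [NormedSpace ℝ G]

/-- Near `t₀` the quantity `φ π H a` is an analytic function of `π`, `a` and the value at `c a` of
the differential expression `j H`, for all maps `H` subject to the condition `𝒜 π H a`. -/
def JetRepr (c : A → E) (j : (E → E') → E → J) (𝒜 : Q → (E → E') → A → Prop)
    (φ : Q → (E → E') → A → G) (t₀ : Q × A × J) : Prop :=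
  ∃ Φ : Q × A × J → G, AnalyticAt ℝ Φ t₀ ∧ ∀ᶠ t in 𝓝 t₀, ∀ H, 𝒜 t.1 H t.2.1 →
    j H (c t.2.1) = t.2.2 → φ t.1 H t.2.1 = Φ t

variable {c : A → E} {j : (E → E') → E → J} {𝒜 : Q → (E → E') → A → Prop}
  {φ : Q → (E → E') → A → G}

theorem JetRepr.clm {G' : Type*} [NormedAddCommGroup G'] [NormedSpace ℝ G'] {t₀ : Q × A × J}
    (h : JetRepr c j 𝒜 φ t₀) (L : G →L[ℝ] G') :
    JetRepr c j 𝒜 (fun π H a => L (φ π H a)) t₀ := by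
  obtain ⟨Φ, h1, h2⟩ := h
  refine ⟨fun t => L (Φ t), AnalyticAt.clm_const_apply L h1, ?_⟩
  filter_upwards [h2] with t ht H h3 h4
  exact congrArg L (ht H h3 h4)

theorem JetRepr.prodMk {G' : Type*} [NormedAddCommGroup G'] [NormedSpace ℝ G'] {t₀ : Q × A × J}
    {φ' : Q → (E → E') → A → G'} (h : JetRepr c j 𝒜 φ t₀) (h' : JetRepr c j 𝒜 φ' t₀) :
    JetRepr c j 𝒜 (fun π H a => (φ π H a, φ' π H a)) t₀ := by
  obtain ⟨Φ, h1, h2⟩ := h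
  obtain ⟨Φ', h1', h2'⟩ := h'
  refine ⟨fun t => (Φ t, Φ' t), h1.prod h1', ?_⟩
  filter_upwards [h2, h2'] with t ht ht' H h3 h4
  exact Prod.ext (ht H h3 h4) (ht' H h3 h4)

theorem JetRepr.congr {t₀ : Q × A × J} {φ' : Q → (E → E') → A → G} (h : JetRepr c j 𝒜 φ t₀)
    (h' : ∀ π H a, 𝒜 π H a → φ' π H a = φ π H a) : JetRepr c j 𝒜 φ' t₀ := by
  obtain ⟨Φ, h1, h2⟩ := h
  refine ⟨Φ, h1, ?_⟩
  filter_upwards [h2] with t ht H h3 h4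
  rw [h' _ _ _ h3, ht H h3 h4]

theorem JetRepr.of_truncation {J' : Type*} [NormedAddCommGroup J'] [NormedSpace ℝ J']
    {j' : (E → E') → E → J'} (L : J' →L[ℝ] J) (hL : ∀ H x, L (j' H x) = j H x) {t₀ : Q × A × J'}
    (h : JetRepr c j 𝒜 φ (t₀.1, t₀.2.1, L t₀.2.2)) : JetRepr c j' 𝒜 φ t₀ := by
  obtain ⟨Φ, h1, h2⟩ := h
  have hm : AnalyticAt ℝ (fun t : Q × A × J' => (t.1, t.2.1, L t.2.2)) t₀ :=
    AnalyticAt.prod (by fun_prop) (AnalyticAt.prod (by fun_prop)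
      (AnalyticAt.clm_const_apply L (by fun_prop)))
  refine ⟨fun t => Φ (t.1, t.2.1, L t.2.2), AnalyticAt.comp_eq h1 hm rfl, ?_⟩
  filter_upwards [hm.continuousAt.eventually h2] with t ht H h3 h4
  exact ht H h3 (by rw [← hL, h4])

variable [NormedAddCommGroup E] [NormedSpace ℝ E] [NormedAddCommGroup E'] [NormedSpace ℝ E']

/-- The derivative in `a` is expressed through the prolonged differential expression. -/
theorem JetRepr.prolong [CompleteSpace G] [CompleteSpace E] {t₀ : Q × A × J × (E →L[ℝ] J)}
    (hc : AnalyticAt ℝ c t₀.2.1)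
    (hj : ∀ H x, AnalyticAt ℝ H x → AnalyticAt ℝ (j H) x)
    (h𝒜 : ∀ π H a, 𝒜 π H a → AnalyticAt ℝ H (c a) ∧ ∀ᶠ a' in 𝓝 a, 𝒜 π H a')
    (h : JetRepr c j 𝒜 φ (t₀.1, t₀.2.1, t₀.2.2.1)) :
    JetRepr c (fun H x => (j H x, fderiv ℝ (j H) x)) 𝒜 (fun π H a => fderiv ℝ (φ π H) a) t₀ := by
  obtain ⟨Φ, h1, h2⟩ := h
  let tr : Q × A × J × (E →L[ℝ] J) → Q × A × J := fun t => (t.1, t.2.1, t.2.2.1)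
  have htr : AnalyticAt ℝ tr t₀ :=
    AnalyticAt.prod (by fun_prop) (AnalyticAt.prod (by fun_prop) (by fun_prop))
  obtain ⟨P, hP⟩ : ∃ P : (A →L[ℝ] A) × (A →L[ℝ] J) →L[ℝ] (A →L[ℝ] Q × A × J), ∀ x v,
      P x v = (0, x.1 v, x.2 v) := by
    refine ⟨(ContinuousLinearMap.compL ℝ A A (Q × A × J) ((ContinuousLinearMap.inr ℝ Q (A × J)).comp
      (ContinuousLinearMap.inl ℝ A J))).comp (ContinuousLinearMap.fst ℝ _ _) +
      (ContinuousLinearMap.compL ℝ A J (Q × A × J) ((ContinuousLinearMap.inr ℝ Q (A × J)).comp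
      (ContinuousLinearMap.inr ℝ A J))).comp (ContinuousLinearMap.snd ℝ _ _), fun x v => ?_⟩
    simp
  have hcd : AnalyticAt ℝ (fun t : Q × A × J × (E →L[ℝ] J) => fderiv ℝ c t.2.1) t₀ :=
    AnalyticAt.comp_eq hc.fderiv (by fun_prop : AnalyticAt ℝ (fun t : Q × A × J × (E →L[ℝ] J) =>
      t.2.1) t₀) rfl
  refine ⟨fun t => (fderiv ℝ Φ (tr t)).comp
    (P (ContinuousLinearMap.id ℝ A, t.2.2.2.comp (fderiv ℝ c t.2.1))), ?_, ?_⟩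
  · refine AnalyticAt.clm_comp_of (AnalyticAt.comp_eq h1.fderiv htr rfl)
      (AnalyticAt.clm_const_apply P (analyticAt_const.prod (AnalyticAt.clm_comp_of
        (by fun_prop) hcd)))
  · have hc' : ∀ᶠ t : Q × A × J × (E →L[ℝ] J) in 𝓝 t₀, AnalyticAt ℝ c t.2.1 :=
      (by fun_prop : ContinuousAt (fun t : Q × A × J × (E →L[ℝ] J) => t.2.1) t₀).eventually
        hc.eventually_analyticAt
    filter_upwards [htr.continuousAt.eventually h2.eventually_nhds,
      htr.continuousAt.eventually h1.eventually_analyticAt, hc'] with t e1 e2 e3 H h3 h4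
    have h5 : j H (c t.2.1) = t.2.2.1 := congrArg Prod.fst h4
    have h6 : fderiv ℝ (j H) (c t.2.1) = t.2.2.2 := congrArg Prod.snd h4
    obtain ⟨hH, hev⟩ := h𝒜 _ _ _ h3
    have hjH := hj H _ hH
    let γ : A → Q × A × J := fun a => (t.1, a, j H (c a))
    have hγ0 : γ t.2.1 = tr t := by simp only [γ, h5, tr]
    have hγd : HasFDerivAt γ (P (ContinuousLinearMap.id ℝ A,
        t.2.2.2.comp (fderiv ℝ c t.2.1))) t.2.1 := by
      have h7 : HasFDerivAt (fun a => j H (c a)) (t.2.2.2.comp (fderiv ℝ c t.2.1)) t.2.1 := by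
        rw [← h6]
        exact HasFDerivAt.comp t.2.1 hjH.differentiableAt.hasFDerivAt
          e3.differentiableAt.hasFDerivAt
      have h8 := (hasFDerivAt_const t.1 t.2.1).prodMk ((hasFDerivAt_id t.2.1).prodMk h7)
      refine h8.congr_fderiv ?_
      ext v
      · simp [hP]
      · simp [hP]
      · simp [hP]
    have hΦγ : HasFDerivAt (fun a => Φ (γ a)) ((fderiv ℝ Φ (tr t)).comp
        (P (ContinuousLinearMap.id ℝ A, t.2.2.2.comp (fderiv ℝ c t.2.1)))) t.2.1 :=
      HasFDerivAt.comp t.2.1 (by rw [hγ0]; exact e2.differentiableAt.hasFDerivAt) hγd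
    have hγt : Filter.Tendsto γ (𝓝 t.2.1) (𝓝 (tr t)) := by
      rw [← hγ0]; exact hγd.continuousAt
    refine (hΦγ.congr_of_eventuallyEq ?_).fderiv
    filter_upwards [hev, hγt.eventually e1] with a e4 e5
    exact e5 H e4 rfl

end Jets

/-- A finite-dimensional normed space, bundled. -/
structure FDSpace : Type 1 where
  V : Type
  [group : NormedAddCommGroup V]
  [space : NormedSpace ℝ V]
  [finite : FiniteDimensional ℝ V]

attribute [instance] FDSpace.group FDSpace.space FDSpace.finite

section JetSpaces

variable {E E' : Type} [NormedAddCommGroup E] [NormedSpace ℝ E] [FiniteDimensional ℝ E]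
  [NormedAddCommGroup E'] [NormedSpace ℝ E'] [FiniteDimensional ℝ E']

/-- The space of (non-symmetrized) jets of order `K` of maps `E → E'`. -/
def jetSpace (E E' : Type) [NormedAddCommGroup E] [NormedSpace ℝ E] [FiniteDimensional ℝ E]
    [NormedAddCommGroup E'] [NormedSpace ℝ E'] [FiniteDimensional ℝ E'] : ℕ → FDSpace
  | 0 => ⟨E'⟩
  | K + 1 => ⟨(jetSpace E E' K).V × (E →L[ℝ] (jetSpace E E' K).V)⟩

/-- The jet of order `K` of a map. -/
def jet : ∀ K : ℕ, (E → E') → E → (jetSpace E E' K).V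
  | 0, H => H
  | K + 1, H => fun x => (jet K H x, fderiv ℝ (jet K H) x)

theorem AnalyticAt.jet (K : ℕ) {H : E → E'} {x : E} (hH : AnalyticAt ℝ H x) :
    AnalyticAt ℝ (jet K H) x := by
  have := FiniteDimensional.complete ℝ E
  induction K with
  | zero => exact hH
  | succ K ih =>
    have := FiniteDimensional.complete ℝ (jetSpace E E' K).V
    exact ih.prod ih.fderiv

theorem exists_jet_truncation {K K' : ℕ} (hK : K ≤ K') :
    ∃ L : (jetSpace E E' K').V →L[ℝ] (jetSpace E E' K).V, ∀ (H : E → E') x,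
      L (jet K' H x) = jet K H x := by
  induction hK with
  | refl => exact ⟨ContinuousLinearMap.id ℝ _, fun _ _ => rfl⟩
  | step _ ih =>
    obtain ⟨L, hL⟩ := ih
    exact ⟨L.comp (ContinuousLinearMap.fst ℝ _ _), fun H x => hL H x⟩

end JetSpaces

section DirectionalDerivatives

variable {X Y : Type*} [NormedAddCommGroup X] [NormedSpace ℝ X] [NormedAddCommGroup Y]
  [NormedSpace ℝ Y]

/-- Iterated directional derivatives. -/
def dirD (vs : List X) (u : X → ℂ) : X → ℂ := vs.foldl (fun u v x => fderiv ℝ u x v) u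

theorem dirD_analyticAt {u : X → ℂ} {x : X} (hu : AnalyticAt ℝ u x) (vs : List X) :
    AnalyticAt ℝ (dirD vs u) x := by
  induction vs generalizing u with
  | nil => exact hu
  | cons v vs ih => exact ih (hu.fderiv_apply_const v)

theorem dirD_congr {u v : X → ℂ} {x : X} (h : u =ᶠ[𝓝 x] v) (vs : List X) :
    dirD vs u =ᶠ[𝓝 x] dirD vs v := by
  induction vs generalizing u v with
  | nil => exact h
  | cons e es ih =>
    refine ih ?_
    filter_upwards [h.eventually_nhds] with x hx
    rw [Filter.EventuallyEq.fderiv_eq hx]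

theorem fderiv_dirD {u : X → ℂ} {x : X} (hu : AnalyticAt ℝ u x) (vs : List X) (v : X) :
    fderiv ℝ (dirD vs u) x v = dirD vs (fun y => fderiv ℝ u y v) x := by
  induction vs generalizing u with
  | nil => rfl
  | cons e es ih =>
    refine (ih (hu.fderiv_apply_const e)).trans ((dirD_congr ?_ es).self_of_nhds)
    filter_upwards [hu.eventually_analyticAt] with y hy
    exact fderiv_fderiv_apply_comm hy e v

theorem dirD_comp_affine {u : Y → ℂ} {ι : X → Y} {L : X →L[ℝ] Y} (hι : ∀ x, HasFDerivAt ι L x)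
    {x : X} (hu : AnalyticAt ℝ u (ι x)) (vs : List X) :
    dirD vs (fun x => u (ι x)) =ᶠ[𝓝 x] fun x => dirD (vs.map L) u (ι x) := by
  induction vs generalizing u with
  | nil => exact Filter.EventuallyEq.rfl
  | cons v vs ih =>
    refine (dirD_congr ?_ vs).trans (ih (hu.fderiv_apply_const (L v)))
    filter_upwards [(hι x).continuousAt.eventually hu.eventually_analyticAt] with y hy
    have h1 : HasFDerivAt (fun x => u (ι x)) ((fderiv ℝ u (ι y)).comp L) y :=
      HasFDerivAt.comp y hy.differentiableAt.hasFDerivAt (hι y)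
    rw [h1.fderiv]; rfl

variable {N q : ℕ}

theorem sDeriv_eq_dirD (es : List (Cn q)) (u : Cn N × Cn q → ℂ) :
    sDeriv es u = dirD (es.map fun e => (0, e)) u := by
  rw [dirD, List.foldl_map]; rfl

theorem hasFDerivAt_inr_affine (y : Y) (x : X) :
    HasFDerivAt (fun x : X => (y, x)) (ContinuousLinearMap.inr ℝ Y X) x :=
  hasFDerivAt_prodMk_right y x

theorem sDeriv_slice {T : Type*} [NormedAddCommGroup T] [NormedSpace ℝ T]
    {S : T × (Cn N × Cn q) → ℂ} {t : T} {a : Cn N × Cn q} (hS : AnalyticAt ℝ S (t, a))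
    (es : List (Cn q)) :
    sDeriv es (fun a => S (t, a)) a = dirD (es.map fun e => (0, (0, e))) S (t, a) := by
  rw [sDeriv_eq_dirD, (dirD_comp_affine (hasFDerivAt_inr_affine t) hS _).self_of_nhds, List.map_map]
  rfl

theorem sDeriv_eq_of_slice {u v : Cn N × Cn q → ℂ} {a : Cn N × Cn q} (hu : AnalyticAt ℝ u a)
    (hv : AnalyticAt ℝ v a) (h : ∀ᶠ s in 𝓝 a.2, u (a.1, s) = v (a.1, s)) (es : List (Cn q)) :
    sDeriv es u a = sDeriv es v a := by
  have h1 : ∀ {u : Cn N × Cn q → ℂ}, AnalyticAt ℝ u a →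
      dirD es (fun s => u (a.1, s)) a.2 = sDeriv es u a := fun {u} hu => by
    rw [sDeriv_eq_dirD, (dirD_comp_affine (x := a.2) (hasFDerivAt_inr_affine a.1) hu
      _).self_of_nhds]
    rfl
  rw [← h1 hu, ← h1 hv]
  exact (dirD_congr h es).self_of_nhds

end DirectionalDerivatives

section SDerivJets

variable {N q : ℕ} {E' Δ : Type} [NormedAddCommGroup E'] [NormedSpace ℝ E']
  [FiniteDimensional ℝ E'] [NormedAddCommGroup Δ] [NormedSpace ℝ Δ]

/-- Derivatives in the second variable of `f (w, H (c a), δ)` are functions of the jet of `H`. -/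
theorem sDeriv_jetRepr {c : Cn N × Cn q → Cn N} {f : E' × E' × Δ → ℂ} {w : E'} {δ : Δ}
    {H₀ : Cn N → E'} {a₀ : Cn N × Cn q} (hc : AnalyticAt ℝ c a₀)
    (hf : AnalyticAt ℝ f (w, H₀ (c a₀), δ)) (es : List (Cn q)) :
    JetRepr c (jet es.length) (fun (_ : E' × Δ) H a => AnalyticAt ℝ H (c a) ∧ AnalyticAt ℝ c a)
      (fun π H a => sDeriv es (fun a => f (π.1, H (c a), π.2)) a)
      ((w, δ), a₀, jet es.length H₀ (c a₀)) := by
  induction es using List.reverseRecOn with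
  | nil =>
    refine ⟨fun t => f (t.1.1, t.2.2, t.1.2), AnalyticAt.comp_eq hf
      (AnalyticAt.prod (by fun_prop) (AnalyticAt.prod ?_ (by fun_prop))) rfl,
      Filter.Eventually.of_forall fun t H _ h2 => ?_⟩
    · exact analyticAt_snd.snd_comp
    · change f (t.1.1, H (c t.2.1), t.1.2) = _
      have h3 : H (c t.2.1) = t.2.2 := h2
      rw [h3]
  | append_singleton es e ih =>
    have h1 : (es ++ [e]).length = es.length + 1 := by simp
    rw [h1]
    have hco : CompleteSpace (Cn N) := inferInstance
    have h2 := JetRepr.prolong (E := Cn N) (t₀ := ((w, δ), a₀, jet es.length H₀ (c a₀),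
      fderiv ℝ (jet es.length H₀) (c a₀))) hc (fun H x hH => hH.jet es.length)
      (fun π H a h => ⟨h.1, ?_⟩) ih
    · obtain ⟨ev, hev⟩ : ∃ ev : ((Cn N × Cn q) →L[ℝ] ℂ) →L[ℝ] ℂ, ∀ L, ev L = L (0, e) :=
        ⟨ContinuousLinearMap.apply ℝ ℂ _, fun _ => rfl⟩
      refine JetRepr.congr (h2.clm ev) fun π H a _ => ?_
      rw [hev, sDeriv, List.foldl_append]
      rfl
    · filter_upwards [h.2.continuousAt.eventually h.1.eventually_analyticAt,
        h.2.eventually_analyticAt] with a' e1 e2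
      exact ⟨e1, e2⟩

/-- A spanning set of `ℂⁿ` contains a basis, and the dual equations determine a vector. -/
theorem exists_rows_of_span_eq_top {n : ℕ} {s : Set (Fin n → ℂ)} (hs : Submodule.span ℂ s = ⊤) :
    ∃ v : Fin n → Fin n → ℂ, (∀ i, v i ∈ s) ∧ Matrix.det (Matrix.of v) ≠ 0 := by
  let b := Module.Basis.ofSpan hs.ge
  have hb : Set.range b ⊆ s := Module.Basis.ofSpan_subset hs.ge
  have e := b.indexEquiv (Pi.basisFun ℂ (Fin n))
  refine ⟨fun i => b (e.symm i), fun i => hb ⟨_, rfl⟩, ?_⟩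
  have h1 : LinearIndependent ℂ (Matrix.of fun i => b (e.symm i)).row :=
    b.linearIndependent.comp _ e.symm.injective
  rw [Matrix.linearIndependent_rows_iff_isUnit] at h1
  exact ((Matrix.isUnit_iff_isUnit_det _).1 h1).ne_zero

end SDerivJets

section Reflection

variable {N N' q d' ℓ : ℕ} {Δ : Type} [NormedAddCommGroup Δ] [NormedSpace ℝ Δ]

/-- The derivative in `w` of a derivative in the second variable of `f (w, H (c a), δ)`. -/
theorem fderiv_sDeriv_param [CompleteSpace Δ] {f : Cn N' × Cn N' × Δ → ℂ} {c : Cn N × Cn q → Cn N}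
    {o : Cn N × Cn q} {w : Cn N'} {δ : Δ} {H : Cn N → Cn N'} (hc : AnalyticAt ℝ c o)
    (hf : AnalyticAt ℝ f (w, H (c o), δ)) (hH : AnalyticAt ℝ H (c o))
    (hfc : ∀ᶠ t in 𝓝 (w, H (c o), δ), ∀ v, fderiv ℝ f t (I • v, 0, 0) = I * fderiv ℝ f t (v, 0, 0))
    (es : List (Cn q)) (v : Cn N') :
    fderiv ℝ (fun w => sDeriv es (fun a => f (w, H (c a), δ)) o) w v =
      ∑ j, v j * sDeriv es (fun a => fderiv ℝ f (w, H (c a), δ) (cbasis j 1, 0, 0)) o := by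
  have hHc : AnalyticAt ℝ (fun a => H (c a)) o := AnalyticAt.comp_eq hH hc rfl
  let γ : Cn N' × (Cn N × Cn q) → Cn N' × Cn N' × Δ := fun x => (x.1, H (c x.2), δ)
  have hγ : AnalyticAt ℝ γ (w, o) := analyticAt_fst.prod
    ((AnalyticAt.comp_eq hHc analyticAt_snd rfl).prod analyticAt_const)
  have hS : AnalyticAt ℝ (fun x => f (γ x)) (w, o) := AnalyticAt.comp_eq hf hγ rfl
  have hev : ∀ᶠ w' in 𝓝 w, AnalyticAt ℝ (fun x => f (γ x)) (w', o) :=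
    (by fun_prop : ContinuousAt (fun w' : Cn N' => (w', o)) w).eventually hS.eventually_analyticAt
  have h1 : (fun w => sDeriv es (fun a => f (w, H (c a), δ)) o) =ᶠ[𝓝 w]
      fun w' => dirD (es.map fun e => (0, (0, e))) (fun x => f (γ x)) (w', o) := by
    filter_upwards [hev] with w' hw'
    exact sDeriv_slice hw' es
  have h2 : HasFDerivAt (fun w' => dirD (es.map fun e => (0, (0, e))) (fun x => f (γ x)) (w', o))
      ((fderiv ℝ (dirD (es.map fun e => (0, (0, e))) (fun x => f (γ x))) (w, o)).comp
        (ContinuousLinearMap.inl ℝ _ _)) w :=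
    HasFDerivAt.comp w (f := fun w' => (w', o))
      (dirD_analyticAt hS _).differentiableAt.hasFDerivAt (hasFDerivAt_prodMk_left w o)
  have h3 : ∀ᶠ x in 𝓝 (w, o), AnalyticAt ℝ f (γ x) :=
    hγ.continuousAt.eventually hf.eventually_analyticAt
  have h4 : ∀ᶠ x in 𝓝 (w, o), ∀ v, fderiv ℝ (fun x => f (γ x)) x (v, 0) =
      fderiv ℝ f (γ x) (v, 0, 0) := by
    filter_upwards [h3, hγ.eventually_analyticAt] with x e1 e2 v
    have h5 : HasFDerivAt (fun x => f (γ x)) ((fderiv ℝ f (γ x)).comp (fderiv ℝ γ x)) x :=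
      HasFDerivAt.comp x e1.differentiableAt.hasFDerivAt e2.differentiableAt.hasFDerivAt
    have h6 : HasFDerivAt (fun w' => γ (w', x.2)) ((fderiv ℝ γ x).comp
        (ContinuousLinearMap.inl ℝ _ _)) x.1 :=
      HasFDerivAt.comp x.1 (f := fun w' => (w', x.2)) (g := γ)
        e2.differentiableAt.hasFDerivAt (hasFDerivAt_prodMk_left x.1 x.2)
    have h7 : HasFDerivAt (fun w' => γ (w', x.2)) (ContinuousLinearMap.inl ℝ _ (Cn N' × Δ)) x.1 :=
      hasFDerivAt_prodMk_left x.1 (H (c x.2), δ)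
    have h8 := congrArg (fun L => L v) (h6.unique h7)
    simp only [ContinuousLinearMap.comp_apply, ContinuousLinearMap.inl_apply] at h8
    rw [h5.fderiv, ContinuousLinearMap.comp_apply, h8]
    rfl
  have h5 : AnalyticAt ℝ (fun x => fderiv ℝ (fun x => f (γ x)) x (v, 0)) (w, o) :=
    hS.fderiv_apply_const _
  rw [h1.fderiv_eq, h2.fderiv, ContinuousLinearMap.comp_apply, ContinuousLinearMap.inl_apply,
    fderiv_dirD hS, ← sDeriv_slice h5 es]
  have htail : Filter.Tendsto (fun a : Cn N × Cn q => (w, a)) (𝓝 o) (𝓝 (w, o)) :=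
    (by fun_prop : ContinuousAt (fun a : Cn N × Cn q => (w, a)) o)
  have h9 : AnalyticAt ℝ (fun a => (w, H (c a), δ)) o :=
    analyticAt_const.prod (hHc.prod analyticAt_const)
  refine Eq.trans (sDeriv_congr ?_ es).self_of_nhds (sDeriv_sum Finset.univ v.ofLp (fun j _ =>
    AnalyticAt.comp_eq (hf.fderiv_apply_const (cbasis j 1, 0, 0)) h9 rfl) es).self_of_nhds
  filter_upwards [htail.eventually h4, h9.continuousAt.eventually hfc] with a e1 e2
  rw [e1]
  obtain ⟨B, hB⟩ : ∃ B : Cn N' →L[ℝ] ℂ, ∀ v, B v = fderiv ℝ f (w, H (c a), δ) (v, 0, 0) :=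
    ⟨(fderiv ℝ f (w, H (c a), δ)).comp (ContinuousLinearMap.inl ℝ _ _), fun _ => rfl⟩
  have h10 := apply_eq_sum_cbasis B (fun v => by rw [hB, hB, e2]; rfl) v
  simp only [hB, smul_eq_mul] at h10
  exact h10

/-- The reflection identity: along the Segre family a solution is determined by a jet. -/
theorem exists_reflection [FiniteDimensional ℝ Δ] {c : Cn N × Cn q → Cn N} {p : Cn N} {p' : Cn N'}
    {δ₀ : Δ}
    {R : Fin d' → Cn N' × Cn N' × Δ → ℂ} {H₀ : Cn N → Cn N'}
    (hc : AnalyticAt ℝ c (p, 0)) (hcp : c (p, 0) = p)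
    (hR : ∀ k, AnalyticAt ℝ (R k) (p', p', δ₀))
    (hRc : ∀ k, ∀ᶠ t in 𝓝 (p', p', δ₀), ∀ v,
      fderiv ℝ (R k) t (I • v, 0, 0) = I * fderiv ℝ (R k) t (v, 0, 0))
    (hH₀ : AnalyticAt ℝ H₀ p) (hH₀p : H₀ p = p')
    (hz : ∀ᶠ a in 𝓝 (p, 0), ∀ k, R k (H₀ a.1, H₀ (c a), δ₀) = 0)
    {es : Fin N' → List (Cn q)} {k : Fin N' → Fin d'} (hes : ∀ i, (es i).length ≤ ℓ)
    (hdet : Matrix.det (Matrix.of fun i j => sDeriv (es i) (fun a =>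
      fderiv ℝ (R (k i)) (H₀ a.1, H₀ (c a), δ₀) (cbasis j 1, 0, 0)) (p, 0)) ≠ 0) :
    ∃ 𝒪 ∈ 𝓝 p', ∃ (𝒩 : Set (Δ × (Cn N × Cn q) × (jetSpace (Cn N) (Cn N') ℓ).V)) (Φ : _ → Cn N'),
      IsOpen 𝒩 ∧ (δ₀, (p, 0), jet ℓ H₀ p) ∈ 𝒩 ∧ AnalyticOnNhd ℝ Φ 𝒩 ∧
      ∀ δ H a, (δ, a, jet ℓ H (c a)) ∈ 𝒩 → AnalyticAt ℝ H (c a) → AnalyticAt ℝ c a → H a.1 ∈ 𝒪 →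
        (∀ᶠ a' in 𝓝 a, ∀ k, R k (H a'.1, H (c a'), δ) = 0) → H a.1 = Φ (δ, a, jet ℓ H (c a)) := by
  have hcompl : CompleteSpace Δ := FiniteDimensional.complete ℝ Δ
  set o : Cn N × Cn q := (p, 0)
  have hHc : AnalyticAt ℝ H₀ (c o) := by rw [hcp]; exact hH₀
  have hb : (p', H₀ (c o), δ₀) = (p', p', δ₀) := by rw [hcp, hH₀p]
  have hR' : ∀ k, AnalyticAt ℝ (R k) (p', H₀ (c o), δ₀) := fun k => by rw [hb]; exact hR k
  have key : ∀ i, JetRepr c (jet ℓ)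
      (fun (_ : Cn N' × Δ) H a => AnalyticAt ℝ H (c a) ∧ AnalyticAt ℝ c a)
      (fun π H a => sDeriv (es i) (fun a => R (k i) (π.1, H (c a), π.2)) a)
      ((p', δ₀), o, jet ℓ H₀ (c o)) := fun i => by
    obtain ⟨L, hL⟩ := exists_jet_truncation (E := Cn N) (E' := Cn N') (hes i)
    refine JetRepr.of_truncation L hL ?_
    simp only [hL]
    exact sDeriv_jetRepr hc (hR' (k i)) (es i)
  choose Φ hΦ hΦe using key
  obtain ⟨T, hT⟩ := exists_jet_truncation (E := Cn N) (E' := Cn N') (Nat.zero_le ℓ)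
  let y₀ : Δ × (Cn N × Cn q) × (jetSpace (Cn N) (Cn N') ℓ).V := (δ₀, o, jet ℓ H₀ (c o))
  let σ : Cn N' × Δ × (Cn N × Cn q) × (jetSpace (Cn N) (Cn N') ℓ).V → (Cn N' × Δ) × (Cn N × Cn q) × (jetSpace (Cn N) (Cn N') ℓ).V :=
    fun x => ((x.1, x.2.1), x.2.2.1, x.2.2.2)
  have hσ : AnalyticAt ℝ σ (p', y₀) :=
    AnalyticAt.prod (by fun_prop) (AnalyticAt.prod (by fun_prop) (by fun_prop))
  let g : Cn N' × Δ × (Cn N × Cn q) × (jetSpace (Cn N) (Cn N') ℓ).V → Fin N' → ℂ := fun x i => Φ i (σ x)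
  have hgi : ∀ i, AnalyticAt ℝ (fun x => Φ i (σ x)) (p', y₀) := fun i =>
    AnalyticAt.comp_eq (hΦ i) hσ rfl
  have hg : AnalyticAt ℝ g (p', y₀) := analyticAt_pi_iff.2 hgi
  have hg0 : ∀ i, ∀ᶠ w in 𝓝 p', Φ i (σ (w, y₀)) =
      sDeriv (es i) (fun a => R (k i) (w, H₀ (c a), δ₀)) o := fun i => by
    have h1 : ContinuousAt (fun w => σ (w, y₀)) p' :=
      ContinuousAt.comp (g := σ) hσ.continuousAt (by fun_prop)
    filter_upwards [h1.eventually (hΦe i)] with w hw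
    exact (hw H₀ ⟨hHc, hc⟩ rfl).symm
  have hfix : ∀ k, AnalyticAt ℝ (fun a => R k (p', H₀ (c a), δ₀)) o := fun k =>
    AnalyticAt.comp_eq (hR' k) (analyticAt_const.prod
      ((AnalyticAt.comp_eq hHc hc rfl).prod analyticAt_const)) rfl
  have hslice : Filter.Tendsto (fun s : Cn q => (p, s)) (𝓝 0) (𝓝 o) :=
    (by fun_prop : ContinuousAt (fun s : Cn q => (p, s)) 0)
  have h0 : g (p', y₀) = 0 := by
    funext i
    refine (hg0 i).self_of_nhds.trans ?_
    rw [sDeriv_eq_of_slice (v := fun _ => 0) (hfix (k i)) analyticAt_const]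
    · have h := sDeriv_sum (o := o) (∅ : Finset ℕ) 0 (u := fun _ _ => 0) (by simp) (es i)
      simpa using h.self_of_nhds
    · filter_upwards [hslice.eventually hz] with s hs
      have := hs (k i)
      rwa [hH₀p] at this
  have hinj : ∀ v, fderiv ℝ g (p', y₀) (v, 0) = 0 → v = 0 := fun v hv => by
    have h1 : ∀ i, ∑ j, v j * sDeriv (es i) (fun a =>
        fderiv ℝ (R (k i)) (p', H₀ (c a), δ₀) (cbasis j 1, 0, 0)) o = 0 := fun i => by
      rw [← fderiv_sDeriv_param hc (hR' (k i)) hHc (by rw [hb]; exact hRc (k i)) (es i) v,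
        ← Filter.EventuallyEq.fderiv_eq (hg0 i)]
      have h2 : HasFDerivAt (fun w => Φ i (σ (w, y₀)))
          ((fderiv ℝ (fun x => Φ i (σ x)) (p', y₀)).comp (ContinuousLinearMap.inl ℝ _ _)) p' :=
        HasFDerivAt.comp p' (f := fun w' => (w', y₀)) (g := fun x => Φ i (σ x))
          (hgi i).differentiableAt.hasFDerivAt (hasFDerivAt_prodMk_left p' y₀)
      rw [h2.fderiv]
      have h3 := congrFun hv i
      rw [fderiv_pi (fun i => (hgi i).differentiableAt)] at h3
      exact h3
    have h2 : Matrix.mulVec (Matrix.of fun i j => sDeriv (es i) (fun a =>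
        fderiv ℝ (R (k i)) (H₀ a.1, H₀ (c a), δ₀) (cbasis j 1, 0, 0)) o) v.ofLp = 0 := by
      funext i
      rw [Matrix.mulVec, dotProduct, Pi.zero_apply, ← h1 i]
      refine Finset.sum_congr rfl fun j _ => ?_
      rw [mul_comm, Matrix.of_apply]
      congr 1
      have hHc' : AnalyticAt ℝ (fun a => H₀ (c a)) o := AnalyticAt.comp_eq hHc hc rfl
      have hfd := (hR (k i)).fderiv_apply_const (cbasis j 1, 0, 0)
      refine sDeriv_eq_of_slice ?_ ?_ (Filter.Eventually.of_forall fun s => ?_) _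
      · exact AnalyticAt.comp_eq hfd ((AnalyticAt.comp_eq hH₀ analyticAt_fst rfl).prod
          (hHc'.prod analyticAt_const)) (by rw [← hb]; simp [o, hH₀p])
      · exact AnalyticAt.comp_eq hfd (analyticAt_const.prod
          (hHc'.prod analyticAt_const)) hb
      · simp only [o, hH₀p]
    have h3 := Matrix.eq_zero_of_mulVec_eq_zero hdet h2
    ext j
    exact congrFun h3 j
  have hdim : Module.finrank ℝ (Cn N') = Module.finrank ℝ (Fin N' → ℂ) := by
    rw [finrank_real_of_complex, finrank_real_of_complex, finrank_euclideanSpace_fin,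
      Module.finrank_fin_fun]
  obtain ⟨Ψ, hΨ, -, -, hΨu⟩ := hg.exists_implicit h0 hinj hdim
  have hτ : ContinuousAt (fun x : Cn N' × Δ × (Cn N × Cn q) × (jetSpace (Cn N) (Cn N') ℓ).V => (x.1, (T x.2.2.2 : Cn N'), x.2.1)) (p', y₀) := by
    refine ContinuousAt.prodMk (by fun_prop) (ContinuousAt.prodMk ?_ (by fun_prop))
    exact ContinuousAt.comp (g := T) T.continuous.continuousAt (by fun_prop)
  have hτ0 : (fun x : Cn N' × Δ × (Cn N × Cn q) × (jetSpace (Cn N) (Cn N') ℓ).V => (x.1, (T x.2.2.2 : Cn N'), x.2.1)) (p', y₀)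
      = (p', H₀ (c o), δ₀) := by
    have : (T (jet ℓ H₀ (c o)) : Cn N') = H₀ (c o) := hT H₀ (c o)
    exact congrArg (fun t : Cn N' => (p', t, δ₀)) this
  have hRan : ∀ᶠ x in 𝓝 (p', y₀), ∀ k, AnalyticAt ℝ (R k) (x.1, (T x.2.2.2 : Cn N'), x.2.1) := by
    refine Filter.eventually_all.2 fun k => ?_
    refine hτ.eventually ?_
    rw [hτ0]
    exact (hR' k).eventually_analyticAt
  have hall := hΨu.and (hRan.and (Filter.eventually_all.2 fun i =>
    hσ.continuousAt.eventually (hΦe i)))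
  obtain ⟨𝒪, h𝒪, 𝒩, h𝒩, hsub⟩ := Filter.mem_prod_iff.1 (nhds_prod_eq (x := p') (y := y₀) ▸ hall)
  have h𝒩' : 𝒩 ∩ {y | AnalyticAt ℝ Ψ y} ∈ 𝓝 y₀ := Filter.inter_mem h𝒩 hΨ.eventually_analyticAt
  refine ⟨𝒪, h𝒪, interior (𝒩 ∩ {y | AnalyticAt ℝ Ψ y}), Ψ, isOpen_interior, ?_,
    fun y hy => (interior_subset hy).2, ?_⟩
  · have := mem_interior_iff_mem_nhds.2 h𝒩'
    simpa only [y₀, hcp] using this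
  · intro δ H a hmem hHa hca hHO hzero
    obtain ⟨e1, e2, e3⟩ := hsub (Set.mk_mem_prod hHO (interior_subset hmem).1)
    refine e1 (funext fun i => ?_)
    refine ((e3 i) H ⟨hHa, hca⟩ rfl).symm.trans ?_
    have h1 := e2 (k i)
    simp only at h1
    have h2 : (T (jet ℓ H (c a)) : Cn N') = H (c a) := hT H (c a)
    rw [h2] at h1
    have h3 : AnalyticAt ℝ (fun a' => R (k i) (H a.1, H (c a'), δ)) a :=
      AnalyticAt.comp_eq h1 (analyticAt_const.prod
        ((AnalyticAt.comp_eq hHa hca rfl).prod analyticAt_const)) rfl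
    change sDeriv (es i) (fun a' => R (k i) (H a.1, H (c a'), δ)) a = 0
    rw [sDeriv_eq_of_slice (v := fun _ => 0) h3 analyticAt_const]
    · have h := sDeriv_sum (o := a) (∅ : Finset ℕ) 0 (u := fun _ _ => 0) (by simp) (es i)
      simpa using h.self_of_nhds
    · have h4 : Filter.Tendsto (fun s : Cn q => (a.1, s)) (𝓝 a.2) (𝓝 a) :=
        (by fun_prop : ContinuousAt (fun s : Cn q => (a.1, s)) a.2)
      filter_upwards [h4.eventually hzero] with s hs
      exact hs (k i)

end Reflection

section ReflectionJets

variable {N N' q ℓ : ℕ} {Δ : Type} [NormedAddCommGroup Δ] [NormedSpace ℝ Δ]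

/-- `H` is analytic on `B` and satisfies the reflection identity given by `Φ` on `𝒰`. -/
def ReflAdm (c : Cn N × Cn q → Cn N) (𝒰 : Set (Cn N × Cn q)) (B : Set (Cn N))
    (𝒩 : Set (Δ × (Cn N × Cn q) × (jetSpace (Cn N) (Cn N') ℓ).V))
    (Φ : Δ × (Cn N × Cn q) × (jetSpace (Cn N) (Cn N') ℓ).V → Cn N') (δ : Δ)
    (H : Cn N → Cn N') : Prop :=
  AnalyticOnNhd ℝ H B ∧
    ∀ a ∈ 𝒰, (δ, a, jet ℓ H (c a)) ∈ 𝒩 → H a.1 = Φ (δ, a, jet ℓ H (c a))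

variable {c : Cn N × Cn q → Cn N} {𝒰 : Set (Cn N × Cn q)} {B : Set (Cn N)}
  {𝒩 : Set (Δ × (Cn N × Cn q) × (jetSpace (Cn N) (Cn N') ℓ).V)}
  {Φ : Δ × (Cn N × Cn q) × (jetSpace (Cn N) (Cn N') ℓ).V → Cn N'}

/-- The jets of a solution at `a.1` are analytic functions of its higher jets at `c a`. -/
theorem jetRepr_of_reflection (h𝒰 : IsOpen 𝒰)
    (hc : ∀ a ∈ 𝒰, AnalyticAt ℝ c a ∧ c a ∈ B ∧ a.1 ∈ B) (h𝒩 : IsOpen 𝒩)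
    (hΦ : AnalyticOnNhd ℝ Φ 𝒩) (K : ℕ) {δ : Δ} {a : Cn N × Cn q} {H₁ : Cn N → Cn N'}
    (ha : a ∈ 𝒰) (hmem : (δ, a, jet ℓ H₁ (c a)) ∈ 𝒩) :
    JetRepr c (jet (ℓ + K)) (fun δ H a => a ∈ 𝒰 ∧ ReflAdm c 𝒰 B 𝒩 Φ δ H)
      (fun _ H a => jet K H a.1) (δ, a, jet (ℓ + K) H₁ (c a)) := by
  induction K with
  | zero =>
    refine ⟨Φ, hΦ _ hmem, ?_⟩
    filter_upwards [h𝒩.mem_nhds hmem] with t ht H h1 h2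
    obtain ⟨δ, a, l⟩ := t
    change jet ℓ H (c a) = l at h2
    subst h2
    exact h1.2.2 a h1.1 ht
  | succ K ih =>
    have h0 := FiniteDimensional.complete ℝ (jetSpace (Cn N) (Cn N') K).V
    have h1 := JetRepr.prolong (E := Cn N) (t₀ := (δ, a, jet (ℓ + K) H₁ (c a),
      fderiv ℝ (jet (ℓ + K) H₁) (c a))) (hc a ha).1 (fun H x hH => hH.jet (ℓ + K))
      (fun π H a h => ⟨h.2.1 _ (hc a h.1).2.1, ?_⟩) ih
    · obtain ⟨ev, hev⟩ : ∃ ev : ((Cn N × Cn q) →L[ℝ] (jetSpace (Cn N) (Cn N') K).V) →L[ℝ]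
          (Cn N →L[ℝ] (jetSpace (Cn N) (Cn N') K).V), ∀ L, ev L =
          L.comp (ContinuousLinearMap.inl ℝ _ _) :=
        ⟨(ContinuousLinearMap.compL ℝ _ _ _).flip (ContinuousLinearMap.inl ℝ _ _), fun _ => rfl⟩
      have h2 := JetRepr.of_truncation (j' := jet (ℓ + (K + 1)))
        (t₀ := (δ, a, jet (ℓ + (K + 1)) H₁ (c a))) (ContinuousLinearMap.fst ℝ _ _)
        (fun H x => rfl) ih
      refine JetRepr.congr (h2.prodMk (h1.clm ev)) fun δ H a h => ?_
      refine Prod.ext rfl ?_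
      have h3 : AnalyticAt ℝ (jet K H) a.1 := (h.2.1 _ (hc a h.1).2.2).jet K
      have h4 : HasFDerivAt (fun a : Cn N × Cn q => jet K H a.1) ((fderiv ℝ (jet K H) a.1).comp
          (ContinuousLinearMap.fst ℝ _ _)) a :=
        HasFDerivAt.comp a h3.differentiableAt.hasFDerivAt hasFDerivAt_fst
      change fderiv ℝ (jet K H) a.1 = ev _
      rw [hev, h4.fderiv]
      ext v
      simp
    · filter_upwards [h𝒰.mem_nhds h.1] with a' ha'
      exact ⟨ha', h.2⟩

/-- Jets along the points reached from `p` are analytic functions of a jet at `p`. -/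
theorem SegreEq.Reach.jetRepr {κ : Cn N →L[ℂ] Cn q} {p : Cn N} {δ₀ : Δ} {H₀ : Cn N → Cn N'}
    (h𝒰 : IsOpen 𝒰)
    (hc : ∀ a ∈ 𝒰, AnalyticAt ℝ c a ∧ c a ∈ B ∧ a.1 ∈ B) (h𝒩 : IsOpen 𝒩)
    (hΦ : AnalyticOnNhd ℝ Φ 𝒩) (h₀ : ReflAdm c 𝒰 B 𝒩 Φ δ₀ H₀)
    (h𝒰𝒩 : ∀ a ∈ 𝒰, (δ₀, a, jet ℓ H₀ (c a)) ∈ 𝒩) {Y : Cn N → Cn N}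
    (hY : SegreEq.Reach κ p c 𝒰 Y) (K : ℕ) :
    ∃ K', JetRepr (fun _ : Cn N => p) (jet K') (fun δ H _ => ReflAdm c 𝒰 B 𝒩 Φ δ H)
      (fun _ H z => jet K H (Y z)) (δ₀, p, jet K' H₀ p) := by
  induction hY generalizing K with
  | base =>
    exact ⟨K, fun t => t.2.2, by fun_prop, Filter.Eventually.of_forall fun t H _ h => h⟩
  | @step Y Y' hY hYa hYa' hev ih =>
    obtain ⟨K', Ψ, hΨ, hΨe⟩ := ih (ℓ + K)
    let α : Cn N → Cn N × Cn q := fun z => (Y' z, κ (Y z - p))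
    have hα : AnalyticAt ℝ α p := by
      refine hYa'.prod ?_
      exact AnalyticAt.clm_const_apply (κ.restrictScalars ℝ) (hYa.sub analyticAt_const)
    obtain ⟨hαp, hcp⟩ := hev.self_of_nhds
    obtain ⟨Θ, hΘ, hΘe⟩ := jetRepr_of_reflection h𝒰 hc h𝒩 hΦ K hαp (h𝒰𝒩 _ hαp)
    have hb : Ψ (δ₀, p, jet K' H₀ p) = jet (ℓ + K) H₀ (c (α p)) := by
      rw [hcp]
      exact (hΨe.self_of_nhds H₀ h₀ rfl).symm
    let τ : Δ × Cn N × (jetSpace (Cn N) (Cn N') K').V →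
        Δ × (Cn N × Cn q) × (jetSpace (Cn N) (Cn N') (ℓ + K)).V := fun t => (t.1, α t.2.1, Ψ t)
    have hτ : AnalyticAt ℝ τ (δ₀, p, jet K' H₀ p) :=
      AnalyticAt.prod (by fun_prop) (AnalyticAt.prod (AnalyticAt.comp_eq hα (by fun_prop) rfl) hΨ)
    have hτ0 : τ (δ₀, p, jet K' H₀ p) = (δ₀, α p, jet (ℓ + K) H₀ (c (α p))) := by
      simp only [τ, hb]
    refine ⟨K', fun t => Θ (τ t), AnalyticAt.comp_eq hΘ hτ hτ0, ?_⟩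
    have hz : Filter.Tendsto (fun t : Δ × Cn N × (jetSpace (Cn N) (Cn N') K').V => t.2.1)
        (𝓝 (δ₀, p, jet K' H₀ p)) (𝓝 p) :=
      (by fun_prop : ContinuousAt (fun t : Δ × Cn N × (jetSpace (Cn N) (Cn N') K').V => t.2.1)
        (δ₀, p, jet K' H₀ p))
    have hτt : Filter.Tendsto τ (𝓝 (δ₀, p, jet K' H₀ p))
        (𝓝 (δ₀, α p, jet (ℓ + K) H₀ (c (α p)))) := hτ0 ▸ hτ.continuousAt
    filter_upwards [hz.eventually hev, hτt.eventually hΘe, hΨe] with t e1 e2 e3 H h1 h2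
    refine e2 H ⟨e1.1, h1⟩ ?_
    change jet (ℓ + K) H (c (Y' t.2.1, κ (Y t.2.1 - p))) = Ψ t
    rw [e1.2]
    exact e3 H h1 h2

end ReflectionJets

section DefiningFunctionExtension

variable {N N' m d dM q ℓ : ℕ} {p' : Cn N'}

/-- `R` extends the defining functions of a deformation to pairs of points, holomorphically in the
first and antiholomorphically in the second one. -/
structure DefExt (D : Deformation N' m d p') (R : Fin d → Cn N' × Cn N' × Rm m → ℂ)
    (𝒪 : Set (Cn N')) (𝒟 : Set (Rm m)) : Prop where
  isOpen_fst : IsOpen 𝒪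
  isOpen_snd : IsOpen 𝒟
  subset_fst : 𝒪 ⊆ D.U'
  subset_snd : 𝒟 ⊆ D.W
  base : p' ∈ 𝒪
  an : ∀ k, ∀ w ∈ 𝒪, ∀ w' ∈ 𝒪, ∀ δ ∈ 𝒟, AnalyticAt ℝ (R k) (w, w', δ)
  cr : ∀ k, ∀ w ∈ 𝒪, ∀ w' ∈ 𝒪, ∀ δ ∈ 𝒟, ∀ a b, fderiv ℝ (R k) (w, w', δ) (I • a, -(I • b), 0) =
    I * fderiv ℝ (R k) (w, w', δ) (a, b, 0)
  diag : ∀ k, ∀ w ∈ 𝒪, ∀ δ ∈ 𝒟, R k (w, w, δ) = D.ρ w δ k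

theorem Deformation.exists_defExt (D : Deformation N' m d p') {δ₀ : Rm m} (hδ₀ : δ₀ ∈ D.W) :
    ∃ R 𝒪 𝒟, δ₀ ∈ 𝒟 ∧ DefExt D R 𝒪 𝒟 := by
  have h1 : ∀ k, AnalyticAt ℝ (fun x : Cn N' × Rm m => D.ρ x.1 x.2 k) (p', δ₀) := fun k =>
    D.analytic_ρ k _ ⟨D.basept_mem, hδ₀⟩
  choose R hR hRc hRd using fun k => (h1 k).exists_sesqui_extension
  have e1 := Filter.eventually_all.2 fun k => (hR k).eventually_analyticAt.and (hRc k)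
  have e2 := Filter.eventually_all.2 hRd
  rw [nhds_prod_eq, nhds_prod_eq] at e1
  rw [nhds_prod_eq] at e2
  obtain ⟨A, hA, T, hT, hAT⟩ := Filter.mem_prod_iff.1 e1
  obtain ⟨B, hB, C, hC, hBC⟩ := Filter.mem_prod_iff.1 hT
  obtain ⟨A', hA', C', hC', hAC⟩ := Filter.mem_prod_iff.1 e2
  have hO : A ∩ B ∩ A' ∩ D.U' ∈ 𝓝 p' := Filter.inter_mem (Filter.inter_mem
    (Filter.inter_mem hA hB) hA') (D.isOpen_U'.mem_nhds D.basept_mem)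
  have hD : C ∩ C' ∩ D.W ∈ 𝓝 δ₀ := Filter.inter_mem (Filter.inter_mem hC hC')
    (D.isOpen_W.mem_nhds hδ₀)
  have hsub : ∀ w ∈ interior (A ∩ B ∩ A' ∩ D.U'), ∀ w' ∈ interior (A ∩ B ∩ A' ∩ D.U'),
      ∀ δ ∈ interior (C ∩ C' ∩ D.W), ∀ k, AnalyticAt ℝ (R k) (w, w', δ) ∧
      ∀ a b, fderiv ℝ (R k) (w, w', δ) (I • a, -(I • b), 0) =
        I * fderiv ℝ (R k) (w, w', δ) (a, b, 0) := fun w hw w' hw' δ hδ =>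
    hAT (Set.mk_mem_prod (interior_subset hw).1.1.1
      (hBC (Set.mk_mem_prod (interior_subset hw').1.1.2 (interior_subset hδ).1.1)))
  exact ⟨R, interior (A ∩ B ∩ A' ∩ D.U'), interior (C ∩ C' ∩ D.W), mem_interior_iff_mem_nhds.2 hD,
    isOpen_interior, isOpen_interior, fun w hw => (interior_subset hw).2,
    fun w hw => (interior_subset hw).2, mem_interior_iff_mem_nhds.2 hO,
    fun k w hw w' hw' δ hδ => (hsub w hw w' hw' δ hδ k).1,
    fun k w hw w' hw' δ hδ => (hsub w hw w' hw' δ hδ k).2,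
    fun k w hw δ hδ => hAC (Set.mk_mem_prod (interior_subset hw).1.2 (interior_subset hδ).1.2) k⟩

/-- Sesquiholomorphy is preserved under a holomorphic change of both variables. -/
theorem IsSesquiAt.comp_holomorphic {S : Cn N' × Cn N' → ℂ} {H : Cn N → Cn N'} {p : Cn N}
    (hS : IsSesquiAt S (H p, H p)) (hH : AnalyticAt ℂ H p) :
    IsSesquiAt (fun x : Cn N × Cn N => S (H x.1, H x.2)) (p, p) := by
  have hHr : AnalyticAt ℝ H p := hH.restrictScalars
  have hg : AnalyticAt ℝ (fun x : Cn N × Cn N => (H x.1, H x.2)) (p, p) :=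
    (AnalyticAt.comp_eq hHr analyticAt_fst rfl).prod (AnalyticAt.comp_eq hHr analyticAt_snd rfl)
  refine ⟨AnalyticAt.comp_eq hS.1 hg rfl, ?_⟩
  have e1 := (continuousAt_fst (p := (p, p))).eventually hH.eventually_analyticAt
  have e2 := (continuousAt_snd (p := (p, p))).eventually hH.eventually_analyticAt
  filter_upwards [hg.continuousAt.eventually hS.2,
    hg.continuousAt.eventually hS.1.eventually_analyticAt, e1, e2] with x h1 h2 h3 h4 a b
  have d1 : HasFDerivAt (fun x : Cn N × Cn N => H x.1)
      (((fderiv ℂ H x.1).restrictScalars ℝ).comp (ContinuousLinearMap.fst ℝ _ _)) x :=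
    HasFDerivAt.comp x (h3.differentiableAt.hasFDerivAt.restrictScalars ℝ) hasFDerivAt_fst
  have d2 : HasFDerivAt (fun x : Cn N × Cn N => H x.2)
      (((fderiv ℂ H x.2).restrictScalars ℝ).comp (ContinuousLinearMap.snd ℝ _ _)) x :=
    HasFDerivAt.comp x (h4.differentiableAt.hasFDerivAt.restrictScalars ℝ) hasFDerivAt_snd
  have d3 : HasFDerivAt (fun x : Cn N × Cn N => S (H x.1, H x.2)) _ x :=
    HasFDerivAt.comp x (g := S) (f := fun x : Cn N × Cn N => (H x.1, H x.2))
      h2.differentiableAt.hasFDerivAt (d1.prodMk d2)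
  rw [d3.fderiv]
  have h5 := h1 (fderiv ℂ H x.1 a) (fderiv ℂ H x.2 b)
  simpa [map_neg, map_smul] using h5

namespace DefExt

variable {D : Deformation N' m d p'} {R : Fin d → Cn N' × Cn N' × Rm m → ℂ} {𝒪 : Set (Cn N')}
  {𝒟 : Set (Rm m)}

theorem fderiv_slice (hE : DefExt D R 𝒪 𝒟) (k : Fin d) {w w' : Cn N'} (hw : w ∈ 𝒪) (hw' : w' ∈ 𝒪)
    {δ : Rm m} (hδ : δ ∈ 𝒟) (a b : Cn N') :
    fderiv ℝ (fun y : Cn N' × Cn N' => R k (y.1, y.2, δ)) (w, w') (a, b) =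
      fderiv ℝ (R k) (w, w', δ) (a, b, 0) := by
  have h1 : HasFDerivAt (fun y : Cn N' × Cn N' => (y.1, y.2, δ))
      ((ContinuousLinearMap.fst ℝ _ _).prod ((ContinuousLinearMap.snd ℝ _ _).prod 0)) (w, w') :=
    hasFDerivAt_fst.prodMk (hasFDerivAt_snd.prodMk (hasFDerivAt_const _ _))
  have h2 : HasFDerivAt (fun y : Cn N' × Cn N' => R k (y.1, y.2, δ)) _ (w, w') :=
    HasFDerivAt.comp (w, w') (g := R k) (f := fun y : Cn N' × Cn N' => (y.1, y.2, δ))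
      (hE.an k w hw w' hw' δ hδ).differentiableAt.hasFDerivAt h1
  rw [h2.fderiv]
  rfl

theorem isSesquiAt (hE : DefExt D R 𝒪 𝒟) (k : Fin d) {w w' : Cn N'} (hw : w ∈ 𝒪) (hw' : w' ∈ 𝒪)
    {δ : Rm m} (hδ : δ ∈ 𝒟) : IsSesquiAt (fun y : Cn N' × Cn N' => R k (y.1, y.2, δ)) (w, w') := by
  refine ⟨AnalyticAt.comp_eq (hE.an k w hw w' hw' δ hδ) (AnalyticAt.prod (by fun_prop)
    (AnalyticAt.prod (by fun_prop) (by fun_prop))) rfl, ?_⟩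
  filter_upwards [(hE.isOpen_fst.prod hE.isOpen_fst).mem_nhds (Set.mk_mem_prod hw hw')]
    with y hy a b
  rw [show y = (y.1, y.2) from rfl, hE.fderiv_slice k hy.1 hy.2 hδ, hE.fderiv_slice k hy.1 hy.2 hδ]
  exact hE.cr k _ hy.1 _ hy.2 _ hδ a b

theorem wirtD_eq (hE : DefExt D R 𝒪 𝒟) (k : Fin d) {w : Cn N'} (hw : w ∈ 𝒪) {δ : Rm m}
    (hδ : δ ∈ 𝒟) (j : Fin N') : wirtD (fun w => D.ρ w δ k) w j =
      fderiv ℝ (R k) (w, w, δ) (cbasis j 1, 0, 0) := by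
  rw [← hE.fderiv_slice k hw hw hδ]
  refine wirtD_eq_of_diag (hE.isSesquiAt k hw hw hδ).2.self_of_nhds (fun v => ?_) j
  have h1 := hasFDerivAt_diag (hE.isSesquiAt k hw hw hδ).1.differentiableAt
  have h2 : DifferentiableAt ℝ (fun w => D.ρ w δ k) w :=
    (AnalyticAt.comp_eq (g := fun x : Cn N' × Rm m => D.ρ x.1 x.2 k) (f := fun w => (w, δ))
      (D.analytic_ρ k _ ⟨hE.subset_fst hw, hE.subset_snd hδ⟩)
      (analyticAt_id.prod analyticAt_const) rfl).differentiableAt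
  have h3 : HasFDerivAt (fun w => (D.ρ w δ k : ℂ)) (Complex.ofRealCLM.comp
      (fderiv ℝ (fun w => D.ρ w δ k) w)) w :=
    HasFDerivAt.comp w (g := Complex.ofRealCLM) Complex.ofRealCLM.hasFDerivAt h2.hasFDerivAt
  have h4 : (fun w => R k (w, w, δ)) =ᶠ[𝓝 w] fun w => (D.ρ w δ k : ℂ) := by
    filter_upwards [hE.isOpen_fst.mem_nhds hw] with y hy
    exact hE.diag k y hy δ hδ
  have h5 := (h3.congr_of_eventuallyEq h4).unique h1
  exact congrArg (fun L => L v) h5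

variable {M : Set (Cn N)} {p : Cn N} {κ : Cn N →L[ℂ] Cn q}
  {r : Cn N × Cn N → Fin dM → ℂ} {c : Cn N × Cn q → Cn N} {H : Cn N → Cn N'} {δ : Rm m}

theorem isLift (hE : DefExt D R 𝒪 𝒟) (h : SegreEq M p κ r c) (hδ : δ ∈ 𝒟) (hH : AnalyticAt ℂ H p)
    (hHp : H p = p') (k : Fin d) (j : Fin N') :
    IsLift M p κ (fun a => fderiv ℝ (R k) (H a.1, H (c a), δ) (cbasis j 1, 0, 0))
      fun z => wirtD (fun w => D.ρ w δ k) (H z) j := by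
  have hO := hE.base
  have hHr : AnalyticAt ℝ H p := hH.restrictScalars
  have hmem : ∀ᶠ z in 𝓝 p, H z ∈ 𝒪 :=
    hHr.continuousAt.eventually (hE.isOpen_fst.mem_nhds (by rw [hHp]; exact hO))
  have h1 := ((hE.isSesquiAt k hO hO hδ).fderiv_apply (cbasis j 1, 0))
  rw [← hHp] at h1
  have h2 := h.isSesquiAt_comp (h1.comp_holomorphic hH)
  have hfst : Filter.Tendsto (fun a : Cn N × Cn q => a.1) (𝓝 (p, 0)) (𝓝 p) :=
    continuousAt_fst
  have hct : Filter.Tendsto c (𝓝 (p, 0)) (𝓝 p) := by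
    have := h.c_an.continuousAt.tendsto
    rwa [h.c_base] at this
  refine ⟨h2.congr ?_, ?_, ?_⟩
  · filter_upwards [hfst.eventually hmem, hct.eventually hmem] with a e1 e2
    exact hE.fderiv_slice k e1 e2 hδ _ _
  · refine AnalyticAt.comp_eq (g := fun w => wirtD (fun w => D.ρ w δ k) w j)
      (AnalyticAt.wirtD_apply ?_ j) hHr hHp
    exact AnalyticAt.comp_eq (g := fun x : Cn N' × Rm m => D.ρ x.1 x.2 k) (f := fun w => (w, δ))
      (D.analytic_ρ k _ ⟨D.basept_mem, hE.subset_snd hδ⟩)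
      (analyticAt_id.prod analyticAt_const) rfl
  · filter_upwards [hmem, h.c_diag] with z e1 e2 hz
    rw [hE.wirtD_eq k e1 hδ, e2 hz]

theorem eventually_eq_zero (hE : DefExt D R 𝒪 𝒟) (h : SegreEq M p κ r c) (hp : p ∈ M)
    (hδ : δ ∈ 𝒟) (hH : AnalyticAt ℂ H p) (hHp : H p = p')
    (hHM : ∀ᶠ z in 𝓝 p, z ∈ M → H z ∈ D.Mfib δ) :
    ∀ᶠ a in 𝓝 (p, 0), ∀ k, R k (H a.1, H (c a), δ) = 0 := by
  have hO := hE.base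
  refine Filter.eventually_all.2 fun k => ?_
  have h1 := hE.isSesquiAt k hO hO hδ
  rw [← hHp] at h1
  refine h.eventually_eq_zero hp (h.isSesquiAt_comp (h1.comp_holomorphic hH)) ?_
  have hmem : ∀ᶠ z in 𝓝 p, H z ∈ 𝒪 :=
    hH.continuousAt.eventually (hE.isOpen_fst.mem_nhds (by rw [hHp]; exact hO))
  filter_upwards [hmem, h.c_diag, hHM] with z e1 e2 e3 hz
  simp only [e2 hz]
  rw [hE.diag k _ e1 _ hδ, (e3 hz).2 k, Complex.ofReal_zero]

theorem finNondeg_iff (hE : DefExt D R 𝒪 𝒟) (h : SegreEq M p κ r c) (hp : p ∈ M)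
    (hδ : δ ∈ 𝒟) (hδX : δ ∈ D.X) (hH : AnalyticAt ℂ H p) (hHp : H p = p')
    (hHM : ∀ᶠ z in 𝓝 p, z ∈ M → H z ∈ D.Mfib δ) :
    FinNondeg M p (D.Mfib δ) ℓ H ↔ Submodule.span ℂ {v : Fin N' → ℂ |
      ∃ (es : List (Cn q)) (k : Fin d), es.length ≤ ℓ ∧ v = fun j => sDeriv es (fun a =>
        fderiv ℝ (R k) (H a.1, H (c a), δ) (cbasis j 1, 0, 0)) (p, 0)} = ⊤ := by
  refine h.finNondeg_iff hp (p' := p') (ρ := fun k w => D.ρ w δ k) (fun k => ?_) ?_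
    (D.generic δ hδX p' D.basept_mem (D.basept δ (D.X_subset_W hδX))) hH.restrictScalars hHp hHM
    (fun k j => hE.isLift h hδ hH hHp k j)
  · exact AnalyticAt.comp_eq (g := fun x : Cn N' × Rm m => D.ρ x.1 x.2 k) (f := fun w => (w, δ))
      (D.analytic_ρ k _ ⟨D.basept_mem, hE.subset_snd hδ⟩)
      (analyticAt_id.prod analyticAt_const) rfl
  · filter_upwards [D.isOpen_U'.mem_nhds D.basept_mem] with w hw
    exact ⟨fun h => h.2, fun h => ⟨hw, h⟩⟩

end DefExt

end DefiningFunctionExtension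

section LocalData

variable {N N' m d dM q ℓ : ℕ} {p' : Cn N'}

theorem span_eq_top_of_det_ne_zero {n : ℕ} {s : Set (Fin n → ℂ)} {v : Fin n → Fin n → ℂ}
    (hv : ∀ i, v i ∈ s) (hdet : Matrix.det (Matrix.of v) ≠ 0) : Submodule.span ℂ s = ⊤ := by
  have h1 : LinearIndependent ℂ (Matrix.of v).row :=
    Matrix.linearIndependent_rows_iff_isUnit.2 ((Matrix.isUnit_iff_isUnit_det _).2 hdet.isUnit)
  have h2 : Submodule.span ℂ (Set.range v) = ⊤ :=
    h1.span_eq_top_of_card_eq_finrank' (by simp)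
  exact top_le_iff.1 (h2 ▸ Submodule.span_mono (Set.range_subset_iff.2 hv))

/-- The nondegeneracy determinant is stable under perturbation of the parameters. -/
theorem DefExt.eventually_det_ne_zero {D : Deformation N' m d p'}
    {R : Fin d → Cn N' × Cn N' × Rm m → ℂ} {𝒪 : Set (Cn N')} {𝒟 : Set (Rm m)}
    (hE : DefExt D R 𝒪 𝒟) {c : Cn N × Cn q → Cn N} {p : Cn N} (hc : AnalyticAt ℝ c (p, 0))
    (hcp : c (p, 0) = p) {J : Type*} [NormedAddCommGroup J] [NormedSpace ℝ J]
    {Ψ : Rm m × Cn N × J → Cn N'} {δ₀ : Rm m} (hδ₀ : δ₀ ∈ 𝒟) {l₀ : J}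
    (hΨ : AnalyticAt ℝ Ψ (δ₀, p, l₀)) (hΨ0 : Ψ (δ₀, p, l₀) = p')
    {es : Fin N' → List (Cn q)} {k : Fin N' → Fin d}
    (hdet : Matrix.det (Matrix.of fun i j => sDeriv (es i) (fun a => fderiv ℝ (R (k i))
      (Ψ (δ₀, a.1, l₀), Ψ (δ₀, c a, l₀), δ₀) (cbasis j 1, 0, 0)) (p, 0)) ≠ 0) :
    ∀ᶠ t in 𝓝 (δ₀, l₀), Matrix.det (Matrix.of fun i j => sDeriv (es i) (fun a => fderiv ℝ (R (k i))
      (Ψ (t.1, a.1, t.2), Ψ (t.1, c a, t.2), t.1) (cbasis j 1, 0, 0)) (p, 0)) ≠ 0 := by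
  let G : Fin N' → Fin N' → (Rm m × J) × (Cn N × Cn q) → ℂ := fun i j x =>
    fderiv ℝ (R (k i)) (Ψ (x.1.1, x.2.1, x.1.2), Ψ (x.1.1, c x.2, x.1.2), x.1.1) (cbasis j 1, 0, 0)
  have hc2 : AnalyticAt ℝ (fun x : (Rm m × J) × (Cn N × Cn q) => c x.2) ((δ₀, l₀), (p, 0)) :=
    AnalyticAt.comp_eq hc analyticAt_snd rfl
  have hG : ∀ i j, AnalyticAt ℝ (G i j) ((δ₀, l₀), (p, 0)) := fun i j => by
    refine AnalyticAt.comp_eq ((hE.an (k i) p' hE.base p' hE.base δ₀ hδ₀).fderiv_apply_const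
      (cbasis j 1, 0, 0)) (AnalyticAt.prod (AnalyticAt.comp_eq hΨ (AnalyticAt.prod (by fun_prop)
      (AnalyticAt.prod (by fun_prop) (by fun_prop))) rfl) (AnalyticAt.prod (AnalyticAt.comp_eq hΨ
      (AnalyticAt.prod (by fun_prop) (AnalyticAt.prod hc2 (by fun_prop))) ?_) (by fun_prop))) ?_
    · simp only [hcp]
    · simp only [hcp, hΨ0]
  have htend : Filter.Tendsto (fun t : Rm m × J => (t, ((p, 0) : Cn N × Cn q))) (𝓝 (δ₀, l₀))
      (𝓝 ((δ₀, l₀), (p, 0))) :=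
    (by fun_prop : ContinuousAt (fun t : Rm m × J => (t, ((p, 0) : Cn N × Cn q))) (δ₀, l₀))
  have hev : ∀ᶠ t in 𝓝 (δ₀, l₀), ∀ i j, AnalyticAt ℝ (G i j) (t, (p, 0)) :=
    Filter.eventually_all.2 fun i => Filter.eventually_all.2 fun j =>
      htend.eventually (hG i j).eventually_analyticAt
  have heq : ∀ᶠ t in 𝓝 (δ₀, l₀), Matrix.det (Matrix.of fun i j => sDeriv (es i)
      (fun a => fderiv ℝ (R (k i)) (Ψ (t.1, a.1, t.2), Ψ (t.1, c a, t.2), t.1)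
        (cbasis j 1, 0, 0)) (p, 0)) = Matrix.det (Matrix.of fun i j =>
      dirD ((es i).map fun e => (0, (0, e))) (G i j) (t, (p, 0))) := by
    filter_upwards [hev] with t ht
    congr 1
    ext i j
    exact sDeriv_slice (ht i j) (es i)
  have hcont : ContinuousAt (fun t => Matrix.det (Matrix.of fun i j =>
      dirD ((es i).map fun e => (0, (0, e))) (G i j) (t, (p, 0)))) (δ₀, l₀) := by
    have : ContinuousAt (fun t => Matrix.of fun i j =>
        dirD ((es i).map fun e => (0, (0, e))) (G i j) (t, (p, 0))) (δ₀, l₀) :=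
      continuousAt_pi.2 fun i => continuousAt_pi.2 fun j =>
        ContinuousAt.comp_of_eq (g := dirD ((es i).map fun e => (0, (0, e))) (G i j))
          (dirD_analyticAt (hG i j) _).continuousAt htend rfl
    exact ContinuousAt.comp (g := Matrix.det) (continuous_id.matrix_det.continuousAt) this
  have h0 := heq.self_of_nhds
  simp only at h0
  rw [h0] at hdet
  filter_upwards [heq, hcont.eventually_ne hdet] with t e1 e2
  rw [e1]
  exact e2

end LocalData

section LocalData

variable {N N' m d dM q ℓ : ℕ} {p' : Cn N'}

/-- An analytic family `Ψ (δ, ·, l)` of maps near `p` which are finitely nondegenerate as soon as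
they are holomorphic and map `M` into `M'_δ`. -/
structure JetParam (M : Set (Cn N)) (p : Cn N) (D : Deformation N' m d p') (ℓ : ℕ) {J : Type}
    [NormedAddCommGroup J] [NormedSpace ℝ J] (Ψ : Rm m × Cn N × J → Cn N') (𝒯 : Set (Rm m × J))
    (β : ℝ) : Prop where
  isOpen : IsOpen 𝒯
  pos : 0 < β
  subset_W : ∀ t ∈ 𝒯, t.1 ∈ D.W
  an : ∀ t ∈ 𝒯, ∀ z ∈ Metric.ball p β, AnalyticAt ℝ Ψ (t.1, z, t.2)
  mem : ∀ t ∈ 𝒯, ∀ z ∈ Metric.ball p β, Ψ (t.1, z, t.2) ∈ D.U'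
  nondeg : ∀ t ∈ 𝒯, t.1 ∈ D.X → AnalyticAt ℂ (fun z => Ψ (t.1, z, t.2)) p →
    Ψ (t.1, p, t.2) = p' → (∀ᶠ z in 𝓝 p, z ∈ M → Ψ (t.1, z, t.2) ∈ D.Mfib t.1) →
    FinNondeg M p (D.Mfib t.1) ℓ fun z => Ψ (t.1, z, t.2)

/-- Solutions close to a given one are captured by a family depending on a jet at `p`. -/
theorem exists_jetParam {M : Set (Cn N)} {p : Cn N} (hM : IsGenericAt M dM p)
    (hmin : IsMinimalAt M dM p) (D : Deformation N' m d p') {δ₀ : Rm m} (hδ₀ : δ₀ ∈ D.X)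
    {ϱ : ℝ} (hϱ : 0 < ϱ) {H₀ : Cn N → Cn N'} (hH₀ : AnalyticOnNhd ℂ H₀ (Metric.ball p ϱ))
    (hH₀p : H₀ p = p') (hH₀M : ∀ᶠ z in 𝓝 p, z ∈ M → H₀ z ∈ D.Mfib δ₀)
    (hfin : FinNondeg M p (D.Mfib δ₀) ℓ H₀) :
    ∃ (K : ℕ) (Ψ : Rm m × Cn N × (jetSpace (Cn N) (Cn N') K).V → Cn N')
      (𝒯 : Set (Rm m × (jetSpace (Cn N) (Cn N') K).V)) (β η : ℝ), JetParam M p D ℓ Ψ 𝒯 β ∧ 0 < η ∧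
      ∀ δ H, AnalyticOnNhd ℂ H (Metric.ball p ϱ) → H p = p' →
        (∀ᶠ z in 𝓝 p, z ∈ M → H z ∈ D.Mfib δ) → dist δ δ₀ < η →
        (∀ x ∈ Metric.closedBall p (ϱ / 2), dist (H x) (H₀ x) < η) →
        dist (jet K H p) (jet K H₀ p) < η →
        (δ, jet K H p) ∈ 𝒯 ∧ ∀ z ∈ Metric.ball p β, H z = Ψ (δ, z, jet K H p) := by
  have hp : p ∈ M := hM.1
  obtain ⟨q, κ, r, c, h⟩ := hM.exists_segreEq
  obtain ⟨R, 𝒪₁, 𝒟, hδ𝒟, hE⟩ := D.exists_defExt (D.X_subset_W hδ₀)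
  have hpb : p ∈ Metric.ball p ϱ := Metric.mem_ball_self hϱ
  have hz := hE.eventually_eq_zero h hp hδ𝒟 (hH₀ p hpb) hH₀p hH₀M
  have hspan := (hE.finNondeg_iff h hp hδ𝒟 hδ₀ (hH₀ p hpb) hH₀p hH₀M).1 hfin
  obtain ⟨v, hv, hdet⟩ := exists_rows_of_span_eq_top hspan
  choose es k hes hvi using hv
  obtain rfl : v = fun i j => sDeriv (es i) (fun a =>
      fderiv ℝ (R (k i)) (H₀ a.1, H₀ (c a), δ₀) (cbasis j 1, 0, 0)) (p, 0) := funext hvi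
  have hH₀r : AnalyticAt ℝ H₀ p := (hH₀ p hpb).restrictScalars
  obtain ⟨𝒪₂, h𝒪₂, 𝒩, Φ, h𝒩, hmem𝒩, hΦ, hrefl⟩ := exists_reflection (ℓ := ℓ) h.c_an h.c_base
    (fun k => hE.an k p' hE.base p' hE.base δ₀ hδ𝒟) (fun k => by
      filter_upwards [(hE.isOpen_fst.prod (hE.isOpen_fst.prod hE.isOpen_snd)).mem_nhds
        (Set.mk_mem_prod hE.base (Set.mk_mem_prod hE.base hδ𝒟))] with t ht v
      have := hE.cr k _ ht.1 _ ht.2.1 _ ht.2.2 v 0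
      simpa using this) hH₀r hH₀p hz hes hdet
  obtain ⟨e, he, hball⟩ := Metric.mem_nhds_iff.1
    (Filter.inter_mem (hE.isOpen_fst.mem_nhds hE.base) h𝒪₂)
  obtain ⟨s, hs, hsball⟩ := Metric.mem_nhds_iff.1 (hH₀r.continuousAt.preimage_mem_nhds
    (Metric.ball_mem_nhds _ (half_pos he)))
  rw [hH₀p] at hsball
  let ϱ' := min s (ϱ / 2)
  have hϱ' : 0 < ϱ' := lt_min hs (half_pos hϱ)
  let B := Metric.ball p ϱ'
  have hBϱ : B ⊆ Metric.ball p ϱ := Metric.ball_subset_ball ((min_le_right _ _).trans (by linarith))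
  have hBc : B ⊆ Metric.closedBall p (ϱ / 2) :=
    (Metric.ball_subset_ball (min_le_right _ _)).trans Metric.ball_subset_closedBall
  have hB : B ∈ 𝓝 p := Metric.ball_mem_nhds p hϱ'
  have hct : Filter.Tendsto c (𝓝 (p, 0)) (𝓝 p) := by
    have := h.c_an.continuousAt.tendsto
    rwa [h.c_base] at this
  have hfst : Filter.Tendsto (fun a : Cn N × Cn q => a.1) (𝓝 (p, 0)) (𝓝 p) := continuousAt_fst
  have hjc : Filter.Tendsto (fun a => (δ₀, a, jet ℓ H₀ (c a))) (𝓝 (p, 0))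
      (𝓝 (δ₀, (p, 0), jet ℓ H₀ p)) :=
    tendsto_const_nhds.prodMk_nhds (Filter.tendsto_id.prodMk_nhds
      ((hH₀r.jet ℓ).continuousAt.tendsto.comp hct))
  obtain ⟨τ, hτ, hτball⟩ := Metric.mem_nhds_iff.1 (h.c_an.eventually_analyticAt.and
    ((hct.eventually hB).and ((hfst.eventually hB).and (hjc.eventually (h𝒩.mem_nhds hmem𝒩)))))
  let 𝒰 : Set (Cn N × Cn q) := Metric.ball (p, 0) τ
  have h𝒰o : ((p, 0) : Cn N × Cn q) ∈ 𝒰 := Metric.mem_ball_self hτ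
  have hc𝒰 : ∀ a ∈ 𝒰, AnalyticAt ℝ c a ∧ c a ∈ B ∧ a.1 ∈ B := fun a ha =>
    ⟨(hτball ha).1, (hτball ha).2.1, (hτball ha).2.2.1⟩
  have hadm : ∀ δ ∈ 𝒟, ∀ H : Cn N → Cn N', AnalyticOnNhd ℂ H (Metric.ball p ϱ) → H p = p' →
      (∀ᶠ z in 𝓝 p, z ∈ M → H z ∈ D.Mfib δ) → (∀ x ∈ B, H x ∈ 𝒪₁ ∩ 𝒪₂) →
      ReflAdm c 𝒰 B 𝒩 Φ δ H := fun δ hδ H hH hHp hHM hHO => by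
    have hHr : AnalyticOnNhd ℝ H B := fun x hx => (hH x (hBϱ hx)).restrictScalars
    refine ⟨hHr, fun a ha hmem => ?_⟩
    refine hrefl δ H a hmem (hHr _ (hc𝒰 a ha).2.1) (hc𝒰 a ha).1 (hHO _ (hc𝒰 a ha).2.2).2 ?_
    refine Filter.eventually_all.2 fun k => ?_
    have hz' := hE.eventually_eq_zero h hp hδ (hH p hpb) hHp hHM
    have han : AnalyticOnNhd ℝ (fun a => R k (H a.1, H (c a), δ)) 𝒰 := fun a ha => by
      obtain ⟨h1, h2, h3⟩ := hc𝒰 a ha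
      exact AnalyticAt.comp_eq (hE.an k _ (hHO _ h3).1 _ (hHO _ h2).1 δ hδ)
        ((AnalyticAt.comp_eq (hHr _ h3) analyticAt_fst rfl).prod
          ((AnalyticAt.comp_eq (hHr _ h2) h1 rfl).prod analyticAt_const)) rfl
    have hzero := han.eqOn_zero_of_preconnected_of_eventuallyEq_zero
      (convex_ball _ _).isPreconnected h𝒰o (hz'.mono fun a ha => ha k)
    filter_upwards [Metric.isOpen_ball.mem_nhds ha] with a' ha'
    exact hzero ha'
  have hclose : ∀ H : Cn N → Cn N', (∀ x ∈ Metric.closedBall p (ϱ / 2), dist (H x) (H₀ x) < e / 2) →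
      ∀ x ∈ B, H x ∈ 𝒪₁ ∩ 𝒪₂ := fun H hH x hx => by
    refine hball (Metric.mem_ball.2 ?_)
    have h1 : dist (H₀ x) p' < e / 2 :=
      hsball (Metric.ball_subset_ball (min_le_left _ _) hx)
    have := dist_triangle (H x) (H₀ x) p'
    linarith [hH x (hBc hx)]
  have hadm₀ : ReflAdm c 𝒰 B 𝒩 Φ δ₀ H₀ := hadm δ₀ hδ𝒟 H₀ hH₀ hH₀p hH₀M
    (hclose H₀ fun x _ => by rw [dist_self]; exact half_pos he)
  obtain ⟨Y, hY, hYz⟩ := h.exists_reach hmin (Metric.isOpen_ball.mem_nhds h𝒰o)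
  obtain ⟨K, Ψ, hΨ, hΨe⟩ := hY.jetRepr Metric.isOpen_ball hc𝒰 h𝒩 hΦ hadm₀
    (fun a ha => (hτball ha).2.2.2) 0
  set l₀ := jet K H₀ p with hl₀
  have hcap : ∀ᶠ t in 𝓝 (δ₀, p, l₀), ∀ H, ReflAdm c 𝒰 B 𝒩 Φ t.1 H → jet K H p = t.2.2 →
      H t.2.1 = Ψ t := by
    have : Filter.Tendsto (fun t : Rm m × Cn N × (jetSpace (Cn N) (Cn N') K).V => t.2.1)
      (𝓝 (δ₀, p, l₀)) (𝓝 p) :=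
      (by fun_prop : ContinuousAt (fun t : Rm m × Cn N × (jetSpace (Cn N) (Cn N') K).V => t.2.1)
        (δ₀, p, l₀))
    filter_upwards [hΨe, this.eventually hYz] with t e1 e2 H h1 h2
    have h3 : H (Y t.2.1) = Ψ t := e1 H h1 h2
    rwa [e2] at h3
  have hΨ0 : Ψ (δ₀, p, l₀) = p' := by rw [← hcap.self_of_nhds H₀ hadm₀ rfl]; exact hH₀p
  have hΨH₀ : ∀ᶠ z in 𝓝 p, Ψ (δ₀, z, l₀) = H₀ z := by
    have : Filter.Tendsto (fun z : Cn N => (δ₀, z, l₀)) (𝓝 p) (𝓝 (δ₀, p, l₀)) :=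
      (by fun_prop : ContinuousAt (fun z : Cn N => (δ₀, z, l₀)) p)
    filter_upwards [this.eventually hcap] with z hz
    exact (hz H₀ hadm₀ rfl).symm
  have hdet' : Matrix.det (Matrix.of fun i j => sDeriv (es i) (fun a => fderiv ℝ (R (k i))
      (Ψ (δ₀, a.1, l₀), Ψ (δ₀, c a, l₀), δ₀) (cbasis j 1, 0, 0)) (p, 0)) ≠ 0 := by
    convert hdet using 3
    funext i j
    refine (sDeriv_congr ?_ (es i)).self_of_nhds
    filter_upwards [hfst.eventually hΨH₀, hct.eventually hΨH₀] with a e1 e2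
    rw [e1, e2]
  have hdetev := hE.eventually_det_ne_zero h.c_an h.c_base hδ𝒟 hΨ hΨ0 hdet'
  have hΨt : Filter.Tendsto Ψ (𝓝 (δ₀, p, l₀)) (𝓝 p') := hΨ0 ▸ hΨ.continuousAt.tendsto
  have hall := hΨ.eventually_analyticAt.and ((hΨt.eventually
    (D.isOpen_U'.mem_nhds D.basept_mem)).and hcap)
  have hswap : Filter.Tendsto (fun x : (Rm m × (jetSpace (Cn N) (Cn N') K).V) × Cn N =>
      (x.1.1, x.2, x.1.2)) (𝓝 ((δ₀, l₀), p)) (𝓝 (δ₀, p, l₀)) :=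
    (by fun_prop : ContinuousAt (fun x : (Rm m × (jetSpace (Cn N) (Cn N') K).V) × Cn N =>
      (x.1.1, x.2, x.1.2)) ((δ₀, l₀), p))
  have hall' := hswap.eventually hall
  rw [nhds_prod_eq] at hall'
  obtain ⟨T, hT, B', hB', hTB⟩ := Filter.mem_prod_iff.1 hall'
  obtain ⟨β, hβ, hβB⟩ := Metric.mem_nhds_iff.1 hB'
  have h𝒟 : ∀ᶠ t : Rm m × (jetSpace (Cn N) (Cn N') K).V in 𝓝 (δ₀, l₀), t.1 ∈ 𝒟 :=
    (continuousAt_fst (p := (δ₀, l₀))).eventually (hE.isOpen_snd.mem_nhds hδ𝒟)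
  have h𝒯 := Filter.inter_mem hT (hdetev.and h𝒟)
  obtain ⟨η, hη, hη𝒯⟩ := Metric.mem_nhds_iff.1 h𝒯
  have hsub := fun (t) (ht : t ∈ Metric.ball (δ₀, l₀) η) (z) (hz : z ∈ Metric.ball p β) =>
    hTB (Set.mk_mem_prod (hη𝒯 ht).1 (hβB hz))
  refine ⟨K, Ψ, Metric.ball (δ₀, l₀) η, β, min η (e / 2), ⟨Metric.isOpen_ball, hβ,
    fun t ht => hE.subset_snd (hη𝒯 ht).2.2, fun t ht z hz => (hsub t ht z hz).1,
    fun t ht z hz => (hsub t ht z hz).2.1, fun t ht hX hhol hΨp hΨM => ?_⟩,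
    lt_min hη (half_pos he), ?_⟩
  · exact (hE.finNondeg_iff h hp (hη𝒯 ht).2.2 hX hhol hΨp hΨM).2
      (span_eq_top_of_det_ne_zero (fun i => ⟨es i, k i, hes i, rfl⟩) (hη𝒯 ht).2.1)
  · intro δ H hH hHp hHM hd hdH hdj
    have hmem : (δ, jet K H p) ∈ Metric.ball (δ₀, l₀) η := Metric.mem_ball.2 (by
      rw [Prod.dist_eq]
      exact max_lt (hd.trans_le (min_le_left _ _)) (hdj.trans_le (min_le_left _ _)))
    exact ⟨hmem, fun z hz => (hsub _ hmem z hz).2.2 H (hadm δ (hη𝒯 hmem).2.2 H hH hHp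
      hHM (hclose H fun x hx => (hdH x hx).trans_le (min_le_right _ _))) rfl⟩

end LocalData

section SeveralVariables

theorem continuous_torusKernel {n : ℕ} {f : (Fin n → ℂ) → ℂ} {c w : Fin n → ℂ} {R : ℝ}
    (hR : 0 < R) (hf : ∀ z, (∀ i, z i ∈ Metric.closedBall (c i) R) → ContinuousAt f z)
    (hw : ∀ i, w i ∈ Metric.ball (c i) R) :
    Continuous fun θ : Fin n → ℝ => (∏ i, (torusMap c (fun _ => R) θ i - w i)⁻¹) *
      f (torusMap c (fun _ => R) θ) := by
  have hdist : ∀ θ i, dist (torusMap c (fun _ => R) θ i) (c i) = R := fun θ i => by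
    simp [torusMap, dist_eq_norm, abs_of_pos hR]
  have hT : Continuous (torusMap c fun _ => R) := by unfold torusMap; fun_prop
  refine Continuous.mul (continuous_finsetProd _ fun i _ => Continuous.inv₀ (by fun_prop)
    fun θ h => ?_) (continuous_iff_continuousAt.2 fun θ =>
      ContinuousAt.comp (hf _ fun i => (hdist θ i).le) hT.continuousAt)
  have h1 := hw i
  rw [← sub_eq_zero.1 h, Metric.mem_ball, hdist] at h1
  exact lt_irrefl _ h1

/-- The Cauchy integral formula on a polydisc. -/
theorem torusIntegral_cauchy {n : ℕ} {f : (Fin n → ℂ) → ℂ} {c w : Fin n → ℂ} {R : ℝ} (hR : 0 < R)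
    (hf : ∀ z, (∀ i, z i ∈ Metric.closedBall (c i) R) → DifferentiableAt ℂ f z)
    (hw : ∀ i, w i ∈ Metric.ball (c i) R) :
    torusIntegral (fun ζ => (∏ i, (ζ i - w i)⁻¹) * f ζ) c (fun _ => R)
      = (2 * Real.pi * I) ^ n * f w := by
  induction n with
  | zero => rw [torusIntegral_dim0]; simp [Subsingleton.elim c w]
  | succ n ih =>
    rw [torusIntegral_succ ((continuous_torusKernel hR (fun z hz => (hf z hz).continuousAt)
      hw).continuousOn.integrableOn_compact isCompact_Icc)]
    have h1 : Set.EqOn (fun x => torusIntegral (fun y => (∏ i, ((Fin.cons x y : Fin (n + 1) → ℂ) i -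
        w i)⁻¹) * f (Fin.cons x y)) (c ∘ Fin.succ) ((fun _ => R) ∘ Fin.succ))
        (fun x => (x - w 0)⁻¹ • ((2 * Real.pi * I) ^ n * f (Fin.cons x (w ∘ Fin.succ))))
        (Metric.sphere (c 0) R) := fun x hx => by
      have := ih (f := fun y => (x - w 0)⁻¹ * f (Fin.cons x y)) (c := c ∘ Fin.succ)
        (w := w ∘ Fin.succ) (fun z hz => ?_) fun i => hw _
      · simp only [Fin.prod_univ_succ, Fin.cons_zero, Fin.cons_succ, smul_eq_mul]
        refine Eq.trans ?_ (this.trans (by ring))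
        congr 1
        funext y
        simp only [Function.comp_apply]
        ring
      · refine DifferentiableAt.const_mul ?_ _
        refine DifferentiableAt.comp z (hf _ ?_) ?_
        · exact Fin.cases hx.le hz
        · refine differentiableAt_pi.2 (Fin.cases ?_ fun i => ?_)
          · simp
          · simp only [Fin.cons_succ]; fun_prop
    rw [circleIntegral.integral_congr hR.le h1]
    have hd : ∀ x ∈ Metric.closedBall (c 0) R, DifferentiableAt ℂ
        (fun x => (2 * Real.pi * I) ^ n * f (Fin.cons x (w ∘ Fin.succ))) x := fun x hx => by
      refine DifferentiableAt.const_mul ?_ _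
      refine DifferentiableAt.comp x (hf _ ?_) ?_
      · exact Fin.cases hx fun i => Metric.ball_subset_closedBall (hw i.succ)
      · refine differentiableAt_pi.2 (Fin.cases ?_ fun i => ?_)
        · simp
        · simp
    rw [circleIntegral_sub_inv_smul_of_differentiable_on_off_countable Set.countable_empty (hw 0)
      (fun x hx => (hd x hx).continuousAt.continuousWithinAt)
      fun x hx => hd x (Metric.ball_subset_closedBall hx.1)]
    have : (Fin.cons (w 0) (w ∘ Fin.succ) : Fin (n + 1) → ℂ) = w := Fin.cons_self_tail w
    rw [this, smul_eq_mul]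
    ring

/-- A function of several complex variables which is differentiable near a point is analytic. -/
theorem analyticAt_of_eventually_differentiableAt {n : ℕ} {f : (Fin n → ℂ) → ℂ} {c : Fin n → ℂ}
    (hf : ∀ᶠ z in 𝓝 c, DifferentiableAt ℂ f z) : AnalyticAt ℂ f c := by
  obtain ⟨R, hR, hball⟩ := Metric.nhds_basis_closedBall.mem_iff.1 hf
  have hf' : ∀ z : Fin n → ℂ, (∀ i, z i ∈ Metric.closedBall (c i) R) → DifferentiableAt ℂ f z :=
    fun z hz => hball ((dist_pi_le_iff hR.le).2 hz)
  let T := Set.Icc (0 : Fin n → ℝ) fun _ => 2 * Real.pi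
  have hdist : ∀ θ i, dist (torusMap c (fun _ => R) θ i) (c i) = R := fun θ i => by
    simp [torusMap, dist_eq_norm, abs_of_pos hR]
  have hTc : Continuous (torusMap c fun _ => R) := by unfold torusMap; fun_prop
  let k : C(T, ℂ) := ⟨fun θ => (∏ i, (R * exp (θ.1 i * I) * I : ℂ)) *
    f (torusMap c (fun _ => R) θ), by
      refine Continuous.mul (continuous_finsetProd _ fun i _ => by
        have : Continuous fun θ : T => (θ.1 i : ℂ) :=
          continuous_ofReal.comp ((continuous_apply i).comp continuous_subtype_val)
        exact (continuous_const.mul (continuous_exp.comp (this.mul continuous_const))).mul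
          continuous_const) (continuous_iff_continuousAt.2 fun θ => ?_)
      exact ContinuousAt.comp (hf' _ fun i => (hdist θ i).le).continuousAt
        (hTc.comp continuous_subtype_val).continuousAt⟩
  let ζ : Fin n → C(T, ℂ) := fun i => ⟨fun θ => torusMap c (fun _ => R) θ i, by fun_prop⟩
  let μ : MeasureTheory.Measure T := MeasureTheory.Measure.comap Subtype.val MeasureTheory.volume
  have hfin : MeasureTheory.IsFiniteMeasure μ := ⟨by
    rw [comap_subtype_coe_apply measurableSet_Icc, Set.image_univ, Subtype.range_coe]
    exact measure_Icc_lt_top⟩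
  obtain ⟨L, hL⟩ : ∃ L : C(T, ℂ) →L[ℂ] ℂ, ∀ h, L h = ∫ θ, h θ ∂μ := by
    have hInt : ∀ h : C(T, ℂ), MeasureTheory.Integrable h μ := fun h =>
      h.continuous.integrable_of_hasCompactSupport (HasCompactSupport.of_compactSpace _)
    refine ⟨LinearMap.mkContinuous ⟨⟨fun h => ∫ θ, h θ ∂μ, fun g h => ?_⟩, fun a h => ?_⟩
      (μ.real (Set.univ : Set T)) fun h => ?_, fun h => rfl⟩
    · exact MeasureTheory.integral_add (hInt g) (hInt h)
    · exact MeasureTheory.integral_const_mul a h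
    · exact (MeasureTheory.norm_integral_le_of_norm_le_const
        (Filter.Eventually.of_forall h.norm_coe_le_norm)).trans (mul_comm _ _).le
  have hun : ∀ w : Fin n → ℂ, (∀ i, w i ∈ Metric.ball (c i) R) → ∀ i,
      IsUnit (ζ i - algebraMap ℂ C(T, ℂ) (w i)) := fun w hw i => by
    refine (ContinuousMap.isUnit_iff_forall_ne_zero _).2 fun θ h => ?_
    have h1 := hw i
    have h2 : torusMap c (fun _ => R) θ i - w i = 0 := h
    rw [← sub_eq_zero.1 h2, Metric.mem_ball, hdist] at h1
    exact lt_irrefl _ h1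
  have hA : AnalyticAt ℂ (fun w : Fin n → ℂ => (2 * Real.pi * I : ℂ)⁻¹ ^ n *
      L (k * ∏ i, Ring.inverse (ζ i - algebraMap ℂ C(T, ℂ) (w i)))) c := by
    refine analyticAt_const.mul (AnalyticAt.clm_const_apply L (analyticAt_const.mul
      (Finset.univ.analyticAt_fun_prod fun i _ => ?_)))
    refine AnalyticAt.comp_eq (analyticOnNhd_inverse _
      (hun c (fun i => Metric.mem_ball_self hR) i)) (analyticAt_const.sub ?_) rfl
    exact AnalyticAt.clm_const_apply (Algebra.linearMap ℂ C(T, ℂ)).toContinuousLinearMap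
      ((ContinuousLinearMap.proj (R := ℂ) (φ := fun _ : Fin n => ℂ) i).analyticAt c)
  refine hA.congr ?_
  filter_upwards [Metric.ball_mem_nhds c hR] with w hw
  have hw' : ∀ i, w i ∈ Metric.ball (c i) R := (dist_pi_lt_iff hR).1 hw
  have h0 : (2 * Real.pi * I : ℂ) ≠ 0 := by simp [Real.pi_ne_zero]
  rw [inv_pow, inv_mul_eq_iff_eq_mul₀ (pow_ne_zero _ h0), ← torusIntegral_cauchy hR hf' hw', hL,
    torusIntegral, ← MeasureTheory.integral_subtype_comap measurableSet_Icc]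
  refine MeasureTheory.integral_congr_ae (Filter.Eventually.of_forall fun θ => ?_)
  have hinv : ∀ i, Ring.inverse (ζ i - algebraMap ℂ C(T, ℂ) (w i)) θ =
      (torusMap c (fun _ => R) θ i - w i)⁻¹ := fun i => by
    refine eq_inv_of_mul_eq_one_left ?_
    exact congrArg (fun h : C(T, ℂ) => h θ) (Ring.inverse_mul_cancel _ (hun w hw' i))
  simp only [ContinuousMap.mul_apply, ContinuousMap.prod_apply, hinv, smul_eq_mul]
  rw [show k θ = (∏ i, (R * exp (θ.1 i * I) * I : ℂ)) * f (torusMap c (fun _ => R) θ) from rfl]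
  ring

/-- A map on an open subset of `ℂ^n` which is complex differentiable is analytic. -/
theorem DifferentiableOn.analyticOnNhd_euclidean {n n' : ℕ} {f : Cn n → Cn n'} {s : Set (Cn n)}
    (hf : DifferentiableOn ℂ f s) (hs : IsOpen s) : AnalyticOnNhd ℂ f s := fun x hx => by
  let e := EuclideanSpace.equiv (Fin n) ℂ
  let e' := EuclideanSpace.equiv (Fin n') ℂ
  have h1 : AnalyticAt ℂ (fun y i => e' (f (e.symm y)) i) (e x) := by
    refine AnalyticAt.pi fun i => analyticAt_of_eventually_differentiableAt ?_
    have hc : Filter.Tendsto e.symm (𝓝 (e x)) (𝓝 x) := by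
      simpa using e.symm.continuous.tendsto (e x)
    filter_upwards [hc.eventually (hs.mem_nhds hx)] with y hy
    have h2 : DifferentiableAt ℂ (fun y => e' (f (e.symm y))) y :=
      e'.differentiableAt.comp y
        (DifferentiableAt.comp y (hf.differentiableAt (hs.mem_nhds hy)) e.symm.differentiableAt)
    exact differentiableAt_pi.1 h2 i
  have h2 := AnalyticAt.clm_const_apply (e'.symm : (Fin n' → ℂ) →L[ℂ] Cn n')
    (AnalyticAt.comp_eq h1 ((e : Cn n →L[ℂ] (Fin n → ℂ)).analyticAt x) rfl)
  refine h2.congr (Filter.Eventually.of_forall fun y => ?_)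
  change e'.symm (e' (f (e.symm (e y)))) = f y
  simp

end SeveralVariables

section Charts

variable {E : Type*} [NormedAddCommGroup E] [NormedSpace ℝ E]

theorem surjective_of_linearIndependent_functionals {c : ℕ} {φ : Fin c → E →L[ℝ] ℝ}
    (hφ : LinearIndependent ℝ φ) (w : Fin c → ℝ) : ∃ v, ∀ k, φ k v = w k := by
  let L : E →ₗ[ℝ] Fin c → ℝ := LinearMap.pi fun k => (φ k : E →ₗ[ℝ] ℝ)
  suffices h : L.range = ⊤ by
    obtain ⟨v, hv⟩ := LinearMap.range_eq_top.1 h w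
    exact ⟨v, fun k => congrFun hv k⟩
  by_contra hne
  obtain ⟨f, hf0, hf⟩ := Submodule.exists_le_ker_of_lt_top _ (lt_top_iff_ne_top.2 hne)
  refine hf0 (LinearMap.pi_ext' fun k => LinearMap.ext_ring ?_)
  have hsum : ∀ u : Fin c → ℝ, f u = ∑ k, u k * f (Pi.single k 1) := fun u => by
    conv_lhs => rw [pi_eq_sum_univ' u, map_sum]
    simp
  have := Fintype.linearIndependent_iff.1 hφ (fun k => f (Pi.single k 1)) (by
    ext v
    have h1 : f (L v) = 0 := hf (LinearMap.mem_range_self L v)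
    rw [hsum] at h1
    rw [_root_.sum_apply, _root_.zero_apply, ← h1]
    exact Finset.sum_congr rfl fun k _ => by rw [_root_.smul_apply, smul_eq_mul, mul_comm]; rfl) k
  simpa using this

/-- A real-analytic submanifold has local analytic coordinates. -/
theorem IsRASubmanifoldAt.exists_chart [FiniteDimensional ℝ E] {S : Set E} {q : E} {k : ℕ}
    (h : IsRASubmanifoldAt S q k) (hq : q ∈ S) :
    ∃ (r : ℕ) (θ : (Fin r → ℝ) → E) (χ : E → Fin r → ℝ), AnalyticAt ℝ θ 0 ∧ θ 0 = q ∧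
      (∀ x, AnalyticAt ℝ χ x) ∧ (∀ᶠ u in 𝓝 0, θ u ∈ S ∧ χ (θ u) = u) ∧
      ∀ᶠ x in 𝓝 q, x ∈ S → θ (χ x) = x := by
  obtain ⟨c, U, ρ, hU, hqU, -, hρ, hSU, hind⟩ := h
  have hmem : ∀ x ∈ U, x ∈ S ↔ ρ x = 0 := fun x hx => by
    have : x ∈ S ∩ U ↔ x ∈ U ∧ ∀ k, ρ x k = 0 := by rw [hSU]; rfl
    rw [funext_iff]
    exact ⟨fun h => (this.1 ⟨h, hx⟩).2, fun h => (this.2 ⟨hx, h⟩).1⟩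
  have hρq : ρ q = 0 := (hmem q hqU).1 hq
  have han : AnalyticAt ℝ ρ q := AnalyticAt.pi fun k => hρ k q hqU
  have hfd : ∀ v k, fderiv ℝ ρ q v k = fderiv ℝ (fun z => ρ z k) q v := fun v k => by
    rw [fderiv_apply han.differentiableAt k]; rfl
  obtain ⟨Q, hQ⟩ := exists_continuous_projection ℝ (fderiv ℝ ρ q : E →ₗ[ℝ] Fin c → ℝ).ker
  obtain ⟨φ, h1, h2, h3, h4⟩ := han.exists_level_chart (fun w => by
    obtain ⟨v, hv⟩ := surjective_of_linearIndependent_functionals (hind q ⟨hq, hqU⟩) w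
    exact ⟨v, funext fun k => (hfd v k).trans (hv k)⟩) (fun v => Iff.rfl) Q hQ
  let e := (Module.finBasis ℝ (fderiv ℝ ρ q : E →ₗ[ℝ] Fin c → ℝ).ker).equivFun.toContinuousLinearEquiv
  have he0 : Filter.Tendsto e.symm (𝓝 0) (𝓝 0) := by
    simpa using e.symm.continuous.tendsto 0
  have hθ : AnalyticAt ℝ (fun u => φ (e.symm u)) 0 :=
    AnalyticAt.comp_eq h1 (e.symm.toContinuousLinearMap.analyticAt 0) (map_zero _)
  have hθ0 : φ (e.symm 0) = q := by rw [map_zero, h2]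
  have hθt : Filter.Tendsto (fun u => φ (e.symm u)) (𝓝 0) (𝓝 q) := by
    have := hθ.continuousAt.tendsto
    rwa [hθ0] at this
  refine ⟨_, fun u => φ (e.symm u), fun x => e (Q (x - q)), hθ, hθ0, fun x => ?_, ?_, ?_⟩
  · exact AnalyticAt.clm_const_apply e.toContinuousLinearMap (AnalyticAt.clm_const_apply Q (by fun_prop))
  · filter_upwards [he0.eventually h3, hθt.eventually (hU.mem_nhds hqU)] with u hu hu'
    exact ⟨(hmem _ hu').2 (hu.1.trans hρq), by rw [hu.2]; simp⟩
  · filter_upwards [h4, hU.mem_nhds hqU] with x hx hxU hxS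
    simpa using hx (((hmem x hxU).1 hxS).trans hρq.symm)

end Charts

theorem exists_countable_dist_cover {ι Y : Type*} [PseudoMetricSpace Y] [SecondCountableTopology Y]
    (f : ι → Y) {η : ι → ℝ} (hη : ∀ i, 0 < η i) :
    ∃ t : Set ι, t.Countable ∧ ∀ x, ∃ y ∈ t, dist (f x) (f y) < η y := by
  let _ : TopologicalSpace ι := TopologicalSpace.induced f inferInstance
  have : SecondCountableTopology ι := TopologicalSpace.secondCountableTopology_induced ι Y f
  obtain ⟨t, ht, hcov⟩ := TopologicalSpace.countable_cover_nhds
    (f := fun y : ι => f ⁻¹' Metric.ball (f y) (η y)) fun y =>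
      continuous_induced_dom.continuousAt.preimage_mem_nhds (Metric.ball_mem_nhds _ (hη y))
  refine ⟨t, ht, fun x => ?_⟩
  have hx : x ∈ ⋃ y ∈ t, f ⁻¹' Metric.ball (f y) (η y) := by rw [hcov]; trivial
  obtain ⟨y, hy, hxy⟩ := Set.mem_iUnion₂.1 hx
  exact ⟨y, hy, hxy⟩

theorem differentiableAt_complex_of_fderiv_I {n n' : ℕ} {f : Cn n → Cn n'} {z : Cn n}
    (hf : DifferentiableAt ℝ f z) (hI : ∀ v, fderiv ℝ f z (I • v) = I • fderiv ℝ f z v) :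
    DifferentiableAt ℂ f z := by
  refine (differentiableAt_iff_restrictScalars ℝ hf).2
    ⟨⟨⟨⟨fderiv ℝ f z, map_add _⟩, fun a v => ?_⟩, (fderiv ℝ f z).continuous⟩, rfl⟩
  change fderiv ℝ f z (a • v) = a • fderiv ℝ f z v
  have h1 : ∀ {k : ℕ} (v : Cn k), a • v = a.re • v + a.im • (I • v) := fun v => by
    ext i
    simp only [PiLp.add_apply, PiLp.smul_apply, smul_eq_mul, real_smul]
    linear_combination (-(v i)) * re_add_im a
  rw [h1, map_add, map_smul, map_smul, hI, ← h1]

section Solutions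

variable {N N' m d dM ℓ : ℕ} {p' : Cn N'}

/-- `H` is holomorphic near `p`, preserves the base points and maps `M` into `M'_δ`. -/
structure IsSolutionOn (M : Set (Cn N)) (p : Cn N) (D : Deformation N' m d p') (β : ℝ) (δ : Rm m)
    (H : Cn N → Cn N') : Prop where
  holo : DifferentiableOn ℂ H (Metric.ball p β)
  base : H p = p'
  maps : ∀ z ∈ M ∩ Metric.ball p β, H z ∈ D.Mfib δ

theorem IsSolutionOn.mono {M : Set (Cn N)} {p : Cn N} {D : Deformation N' m d p'} {β β' : ℝ}
    {δ : Rm m} {H : Cn N → Cn N'} (h : IsSolutionOn M p D β δ H) (hβ : β' ≤ β) :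
    IsSolutionOn M p D β' δ H :=
  ⟨h.holo.mono (Metric.ball_subset_ball hβ), h.base,
    fun z hz => h.maps z ⟨hz.1, Metric.ball_subset_ball hβ hz.2⟩⟩

theorem IsSolutionOn.congr {M : Set (Cn N)} {p : Cn N} {D : Deformation N' m d p'} {β : ℝ}
    {δ : Rm m} {H H' : Cn N → Cn N'} (h : IsSolutionOn M p D β δ H) (hβ : 0 < β)
    (e : ∀ z ∈ Metric.ball p β, H z = H' z) : IsSolutionOn M p D β δ H' :=
  ⟨h.holo.congr fun z hz => (e z hz).symm, by rw [← e p (Metric.mem_ball_self hβ), h.base],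
    fun z hz => by rw [← e z hz.2]; exact h.maps z hz⟩

theorem IsSolutionOn.eventually {M : Set (Cn N)} {p : Cn N} {D : Deformation N' m d p'} {β : ℝ}
    {δ : Rm m} {H : Cn N → Cn N'} (h : IsSolutionOn M p D β δ H) (hβ : 0 < β) :
    ∀ᶠ z in 𝓝 p, z ∈ M → H z ∈ D.Mfib δ := by
  filter_upwards [Metric.ball_mem_nhds p hβ] with z hz hzM
  exact h.maps z ⟨hzM, hz⟩

theorem JetParam.mono {M : Set (Cn N)} {p : Cn N} {D : Deformation N' m d p'} {J : Type}
    [NormedAddCommGroup J] [NormedSpace ℝ J] {Ψ : Rm m × Cn N × J → Cn N'} {𝒯 : Set (Rm m × J)}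
    {β β' : ℝ} (h : JetParam M p D ℓ Ψ 𝒯 β) (hβ : β' ≤ β) (hpos : 0 < β') :
    JetParam M p D ℓ Ψ 𝒯 β' :=
  ⟨h.isOpen, hpos, h.subset_W, fun t ht z hz => h.an t ht z (Metric.ball_subset_ball hβ hz),
    fun t ht z hz => h.mem t ht z (Metric.ball_subset_ball hβ hz), h.nondeg⟩

/-- The parameters admitting a nondegenerate solution are captured by countably many analytic
families. -/
theorem exists_countable_jetParam {M : Set (Cn N)} {p : Cn N} (hM : IsGenericAt M dM p)
    (hmin : IsMinimalAt M dM p) (D : Deformation N' m d p') :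
    ∃ 𝒜 : Set (Set (Rm m)), 𝒜.Countable ∧ DefLocus M p D ℓ ⊆ ⋃₀ 𝒜 ∧ ∀ A ∈ 𝒜,
      ∃ (K : ℕ) (Ψ : Rm m × Cn N × (jetSpace (Cn N) (Cn N') K).V → Cn N')
        (𝒯 : Set (Rm m × (jetSpace (Cn N) (Cn N') K).V)) (β : ℝ), JetParam M p D ℓ Ψ 𝒯 β ∧
        ∀ δ ∈ A, ∃ l, (δ, l) ∈ 𝒯 ∧ IsSolutionOn M p D β δ fun z => Ψ (δ, z, l) := by
  have hsol : ∀ δ : DefLocus M p D ℓ, ∃ (n : ℕ) (H : Cn N → Cn N'),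
      IsSolutionOn M p D (1 / (n + 1)) δ H ∧ FinNondeg M p (D.Mfib δ) ℓ H := by
    rintro ⟨δ, hδX, Ω, H, hΩ, hpΩ, hH, hHp, hHM, hfin⟩
    obtain ⟨s, hs, hball⟩ := Metric.isOpen_iff.1 hΩ p hpΩ
    obtain ⟨n, hn⟩ := exists_nat_one_div_lt hs
    have hsub := (Metric.ball_subset_ball hn.le).trans hball
    exact ⟨n, H, ⟨hH.mono hsub, hHp, fun z hz => hHM z ⟨hz.1, hsub hz.2⟩⟩, hfin⟩
  choose n H hH hfin using hsol
  have hϱ : ∀ n : ℕ, (0 : ℝ) < 1 / (n + 1) := fun n => Nat.one_div_pos_of_nat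
  have hHan : ∀ δ, AnalyticOnNhd ℂ (H δ) (Metric.ball p (1 / (n δ + 1))) := fun δ =>
    (hH δ).holo.analyticOnNhd_euclidean Metric.isOpen_ball
  choose K Ψ 𝒯 β η hJ hη hcap using fun δ : DefLocus M p D ℓ => exists_jetParam hM hmin D
    δ.2.1 (hϱ (n δ)) (hHan δ) (hH δ).base ((hH δ).eventually (hϱ _)) (hfin δ)
  let A : DefLocus M p D ℓ → Set (Rm m) := fun i => {δ | ∃ l, (δ, l) ∈ 𝒯 i ∧
    IsSolutionOn M p D (min (β i) (1 / (n i + 1))) δ fun z => Ψ i (δ, z, l)}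
  have hcover : ∀ a : ℕ × ℕ, ∃ t : Set (DefLocus M p D ℓ), t.Countable ∧ ∀ δ, n δ = a.1 →
      K δ = a.2 → ∃ i ∈ t, (δ : Rm m) ∈ A i := by
    rintro ⟨n₀, K₀⟩
    let ι := {δ : DefLocus M p D ℓ // n δ = n₀ ∧ K δ = K₀}
    have hc : ∀ δ : ι, Continuous fun x : Metric.closedBall p (1 / (n₀ + 1) / 2 : ℝ) =>
        H δ.1 x.1 := fun δ => by
      refine continuousOn_iff_continuous_domRestrict.1 fun x hx => ?_
      refine ((hHan δ.1 x ?_).continuousAt).continuousWithinAt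
      rw [δ.2.1]
      exact Metric.closedBall_subset_ball (half_lt_self (hϱ n₀)) hx
    have hproper := FiniteDimensional.proper ℝ (jetSpace (Cn N) (Cn N') K₀).V
    obtain ⟨t, ht, htc⟩ := exists_countable_dist_cover (fun δ : ι => ((δ.1 : Rm m),
      (⟨_, hc δ⟩ : C(Metric.closedBall p (1 / (n₀ + 1) / 2 : ℝ), Cn N')), jet K₀ (H δ.1) p))
      (η := fun δ => η δ.1) fun δ => hη _
    refine ⟨Subtype.val '' t, ht.image _, fun δ h1 h2 => ?_⟩
    obtain ⟨⟨i, hi1, hi2⟩, hit, hd⟩ := htc ⟨δ, h1, h2⟩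
    dsimp only at h1 h2
    subst hi1 hi2
    rw [Prod.dist_eq, max_lt_iff, Prod.dist_eq, max_lt_iff] at hd
    obtain ⟨hd1, hd2, hd3⟩ := hd
    have hanδ := hHan δ
    have hsolδ := hH δ
    rw [h1] at hanδ hsolδ
    obtain ⟨hmem, heq⟩ := hcap i δ (H δ) hanδ hsolδ.base (hsolδ.eventually (hϱ _)) hd1
      (fun x hx => (ContinuousMap.dist_apply_le_dist (⟨x, hx⟩ : Metric.closedBall p _)).trans_lt hd2)
      hd3
    exact ⟨i, ⟨_, hit, rfl⟩, _, hmem, (hsolδ.mono (min_le_right _ _)).congr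
      (lt_min (hJ i).pos (hϱ _)) fun z hz => heq z (Metric.ball_subset_ball (min_le_left _ _) hz)⟩
  choose t ht htc using hcover
  refine ⟨⋃ a, A '' t a, Set.countable_iUnion fun a => (ht a).image _, fun δ hδ => ?_, ?_⟩
  · obtain ⟨i, hi, hiA⟩ := htc (n ⟨δ, hδ⟩, K ⟨δ, hδ⟩) ⟨δ, hδ⟩ rfl rfl
    exact ⟨A i, Set.mem_iUnion.2 ⟨_, i, hi, rfl⟩, hiA⟩
  · intro B hB
    obtain ⟨a, i, -, rfl⟩ := Set.mem_iUnion.1 hB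
    exact ⟨K i, Ψ i, 𝒯 i, _, (hJ i).mono (min_le_left _ _) (lt_min (hJ i).pos (hϱ _)),
      fun δ hδ => hδ⟩

end Solutions

section Selection

variable {N N' m d dM ℓ : ℕ} {p' : Cn N'}

theorem JetParam.fderiv_slice {M : Set (Cn N)} {p : Cn N} {D : Deformation N' m d p'} {J : Type}
    [NormedAddCommGroup J] [NormedSpace ℝ J] {Ψ : Rm m × Cn N × J → Cn N'} {𝒯 : Set (Rm m × J)}
    {β : ℝ} (h : JetParam M p D ℓ Ψ 𝒯 β) {t : Rm m × J} (ht : t ∈ 𝒯) {z : Cn N}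
    (hz : z ∈ Metric.ball p β) :
    HasFDerivAt (fun z => Ψ (t.1, z, t.2)) ((fderiv ℝ Ψ (t.1, z, t.2)).comp
      ((0 : Cn N →L[ℝ] Rm m).prod ((ContinuousLinearMap.id ℝ (Cn N)).prod 0))) z :=
  HasFDerivAt.comp z (g := Ψ) (f := fun z => (t.1, z, t.2))
    (h.an t ht z hz).differentiableAt.hasFDerivAt
    ((hasFDerivAt_const t.1 z).prodMk ((hasFDerivAt_id z).prodMk (hasFDerivAt_const t.2 z)))

/-- Solutions within an analytic family are characterized by analytic equations. -/
theorem JetParam.isSolutionOn_iff {M : Set (Cn N)} {p : Cn N} {D : Deformation N' m d p'} {J : Type}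
    [NormedAddCommGroup J] [NormedSpace ℝ J] {Ψ : Rm m × Cn N × J → Cn N'} {𝒯 : Set (Rm m × J)}
    {β : ℝ} (h : JetParam M p D ℓ Ψ 𝒯 β) {t : Rm m × J} (ht : t ∈ 𝒯) :
    IsSolutionOn M p D β t.1 (fun z => Ψ (t.1, z, t.2)) ↔
      (∀ z ∈ Metric.ball p β, ∀ v, fderiv ℝ Ψ (t.1, z, t.2) (0, I • v, 0) -
        I • fderiv ℝ Ψ (t.1, z, t.2) (0, v, 0) = 0) ∧ Ψ (t.1, p, t.2) - p' = 0 ∧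
      ∀ z ∈ M ∩ Metric.ball p β, ∀ k, D.ρ (Ψ (t.1, z, t.2)) t.1 k = 0 := by
  have hfd : ∀ z ∈ Metric.ball p β, ∀ v, fderiv ℝ (fun z => Ψ (t.1, z, t.2)) z v =
      fderiv ℝ Ψ (t.1, z, t.2) (0, v, 0) := fun z hz v => by
    rw [(h.fderiv_slice ht hz).fderiv]; rfl
  constructor
  · rintro ⟨h1, h2, h3⟩
    refine ⟨fun z hz v => ?_, sub_eq_zero.2 h2, fun z hz => (h3 z hz).2⟩
    have hd := h1.differentiableAt (Metric.isOpen_ball.mem_nhds hz)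
    rw [← hfd z hz, ← hfd z hz, (hd.hasFDerivAt.restrictScalars ℝ).fderiv]
    simp
  · rintro ⟨h1, h2, h3⟩
    refine ⟨fun z hz => ?_, sub_eq_zero.1 h2, fun z hz => ⟨h.mem t ht z hz.2, h3 z hz⟩⟩
    refine (differentiableAt_complex_of_fderiv_I (h.fderiv_slice ht hz).differentiableAt
      fun v => ?_).differentiableWithinAt
    rw [hfd z hz, hfd z hz]
    exact sub_eq_zero.1 (h1 z hz v)

/-- An analytic family capturing a non-negligible set of parameters admits an analytic section
consisting of solutions. -/
theorem JetParam.exists_section {M : Set (Cn N)} {p : Cn N} {D : Deformation N' m d p'} {J : Type}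
    [NormedAddCommGroup J] [NormedSpace ℝ J] [FiniteDimensional ℝ J]
    {Ψ : Rm m × Cn N × J → Cn N'} {𝒯 : Set (Rm m × J)} {β : ℝ} (h : JetParam M p D ℓ Ψ 𝒯 β)
    {r : ℕ} {G : Set (Fin r → ℝ)} (hG : IsOpen G) {θ : (Fin r → ℝ) → Rm m}
    (hθ : AnalyticOnNhd ℝ θ G)
    (hpos : MeasureTheory.volume {u | u ∈ G ∧ ∃ l, (θ u, l) ∈ 𝒯 ∧
      IsSolutionOn M p D β (θ u) fun z => Ψ (θ u, z, l)} ≠ 0) :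
    ∃ (u₁ : Fin r → ℝ) (s : (Fin r → ℝ) → J), AnalyticAt ℝ s u₁ ∧
      ∀ᶠ u in 𝓝 u₁, u ∈ G ∧ (θ u, s u) ∈ 𝒯 ∧
        IsSolutionOn M p D β (θ u) fun z => Ψ (θ u, z, s u) := by
  let Ω : Set ((Fin r → ℝ) × J) := {x | x.1 ∈ G ∧ (θ x.1, x.2) ∈ 𝒯}
  have hΩ : IsOpen Ω := by
    have hc : ContinuousOn (fun x : (Fin r → ℝ) × J => (θ x.1, x.2)) (Prod.fst ⁻¹' G) :=
      (hθ.continuousOn.comp continuousOn_fst fun x hx => hx).prodMk continuousOn_snd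
    exact hc.isOpen_inter_preimage (hG.preimage continuous_fst) h.isOpen
  let 𝓕 : Set ((Fin r → ℝ) × J → ℝ) :=
    {f | ∃ z ∈ Metric.ball p β, ∃ (v : Cn N) (φ : Cn N' →L[ℝ] ℝ), f = fun x =>
      φ (fderiv ℝ Ψ (θ x.1, z, x.2) (0, I • v, 0) - I • fderiv ℝ Ψ (θ x.1, z, x.2) (0, v, 0))} ∪
    ({f | ∃ φ : Cn N' →L[ℝ] ℝ, f = fun x => φ (Ψ (θ x.1, p, x.2) - p')} ∪
    {f | ∃ z ∈ M ∩ Metric.ball p β, ∃ k, f = fun x => D.ρ (Ψ (θ x.1, z, x.2)) (θ x.1) k})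
  have hin : ∀ z : Cn N, ∀ x ∈ Ω, AnalyticAt ℝ (fun x : (Fin r → ℝ) × J => (θ x.1, z, x.2)) x :=
    fun z x hx => by
      have : AnalyticAt ℝ (fun x : (Fin r → ℝ) × J => θ x.1) x :=
        AnalyticAt.comp_eq (hθ _ hx.1) analyticAt_fst rfl
      exact this.prod (analyticAt_const.prod analyticAt_snd)
  obtain ⟨J₀, hJ₀⟩ : ∃ L : Cn N' →L[ℝ] Cn N', ∀ w, L w = I • w :=
    ⟨((I • ContinuousLinearMap.id ℂ (Cn N')).restrictScalars ℝ), fun w => rfl⟩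
  have h𝓕 : ∀ f ∈ 𝓕, AnalyticOnNhd ℝ f Ω := by
    rintro f (⟨z, hz, v, φ, rfl⟩ | ⟨φ, rfl⟩ | ⟨z, hz, k, rfl⟩) x hx
    · refine AnalyticAt.clm_const_apply φ ?_
      have h1 : ∀ w, AnalyticAt ℝ (fun x : (Fin r → ℝ) × J =>
          fderiv ℝ Ψ (θ x.1, z, x.2) w) x := fun w =>
        AnalyticAt.comp_eq ((h.an _ hx.2 z hz).fderiv_apply_const w) (hin z x hx) rfl
      simp only [← hJ₀]
      exact (h1 _).sub (AnalyticAt.clm_const_apply J₀ (h1 _))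
    · exact AnalyticAt.clm_const_apply φ ((AnalyticAt.comp_eq
        (h.an _ hx.2 p (Metric.mem_ball_self h.pos)) (hin p x hx) rfl).sub analyticAt_const)
    · exact AnalyticAt.comp_eq (D.analytic_ρ k (_, _) ⟨h.mem _ hx.2 z hz.2, h.subset_W _ hx.2⟩)
        ((AnalyticAt.comp_eq (h.an _ hx.2 z hz.2) (hin z x hx) rfl).prod
          (AnalyticAt.comp_eq (hθ _ hx.1) analyticAt_fst rfl)) rfl
  have hiff : ∀ x ∈ Ω, (∀ f ∈ 𝓕, f x = 0) ↔
      IsSolutionOn M p D β (θ x.1) fun z => Ψ (θ x.1, z, x.2) := fun x hx => by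
    rw [h.isSolutionOn_iff hx.2]
    constructor
    · intro hall
      refine ⟨fun z hz v => ?_, ?_, fun z hz k => hall _ (Or.inr (Or.inr ⟨z, hz, k, rfl⟩))⟩
      · exact SeparatingDual.eq_zero_of_forall_dual_eq_zero (R := ℝ) fun φ =>
          hall _ (Or.inl ⟨z, hz, v, φ, rfl⟩)
      · exact SeparatingDual.eq_zero_of_forall_dual_eq_zero (R := ℝ) fun φ =>
          hall _ (Or.inr (Or.inl ⟨φ, rfl⟩))
    · rintro ⟨h1, h2, h3⟩ f (⟨z, hz, v, φ, rfl⟩ | ⟨φ, rfl⟩ | ⟨z, hz, k, rfl⟩)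
      · simp only [h1 z hz v, map_zero]
      · simp only [h2, map_zero]
      · exact h3 z hz k
  obtain ⟨u₁, s, hs, hev⟩ := exists_analytic_section hΩ h𝓕 (by
    refine fun h0 => hpos (MeasureTheory.measure_mono_null ?_ h0)
    rintro u ⟨hu, l, hl, hsol⟩
    exact ⟨(u, l), ⟨⟨hu, hl⟩, (hiff (u, l) ⟨hu, hl⟩).2 hsol⟩, rfl⟩)
  refine ⟨u₁, s, hs, ?_⟩
  filter_upwards [hev] with u hu
  exact ⟨hu.1.1, hu.1.2, (hiff _ hu.1).1 hu.2⟩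

end Selection

/-- **Lemma 3.1 (selection lemma).** If the mapping locus `E_ℓ` of a deformation contains a
real-analytic submanifold `R` then, near some point `δ₁` of any given neighborhood `R ∩ O` of
a point `ε ∈ R`, one can choose the maps `H^δ : (M,p) → (M'_δ, p')` to depend real-analytically
on the parameter `δ ∈ R`. -/
theorem analytic_selection_on_submanifold
    {N N' m d dM ℓ : ℕ} (M : Set (Cn N)) (p : Cn N)
    (hM : IsGenericAt M dM p) (hmin : IsMinimalAt M dM p)
    (p' : Cn N') (D : Deformation N' m d p')
    (R : Set (Rm m)) (hRE : R ⊆ DefLocus M p D ℓ)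
    (hR : ∀ q ∈ R, ∃ k, IsRASubmanifoldAt R q k)
    (ε : Rm m) (hε : ε ∈ R) (O : Set (Rm m)) (hO : IsOpen O) (hεO : ε ∈ O) :
    ∃ δ₁ ∈ R ∩ O, ∃ O' : Set (Rm m), IsOpen O' ∧ δ₁ ∈ O' ∧
      ∃ V' : Set (Cn N), IsOpen V' ∧ p ∈ V' ∧
        ∃ F : Rm m → Cn N → Cn N',
          (∀ z ∈ V', ∀ η ∈ R ∩ O', AnalyticWithinAt ℝ (fun e => F e z) (R ∩ O') η) ∧
          ∀ η ∈ R ∩ O', DifferentiableOn ℂ (F η) V' ∧ F η p = p' ∧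
            (∀ z ∈ M ∩ V', F η z ∈ D.Mfib η) ∧ FinNondeg M p (D.Mfib η) ℓ (F η) := by
  obtain ⟨k, hk⟩ := hR ε hε
  obtain ⟨r, θ, χ, hθ, hθ0, hχ, hθχ, hχθ⟩ := hk.exists_chart hε
  obtain ⟨𝒜, h𝒜, hcov, hfam⟩ := exists_countable_jetParam (ℓ := ℓ) hM hmin D
  obtain ⟨𝒰, h𝒰χ, h𝒰, hε𝒰⟩ := eventually_nhds_iff.1 hχθ
  have hθt : Filter.Tendsto θ (𝓝 0) (𝓝 ε) := hθ0 ▸ hθ.continuousAt.tendsto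
  obtain ⟨G, hGp, hG, h0G⟩ := eventually_nhds_iff.1 (hθ.eventually_analyticAt.and (hθχ.and
    (hθt.eventually ((hO.inter h𝒰).mem_nhds ⟨hεO, hε𝒰⟩))))
  obtain ⟨A, hA, hApos⟩ : ∃ A ∈ 𝒜, MeasureTheory.volume (G ∩ θ ⁻¹' A) ≠ 0 := by
    by_contra! hcon
    refine (hG.measure_pos MeasureTheory.volume ⟨0, h0G⟩).ne' (MeasureTheory.measure_mono_null ?_
      ((MeasureTheory.measure_biUnion_null_iff h𝒜).2 hcon))
    intro u hu
    obtain ⟨A, hA, huA⟩ := hcov (hRE (hGp u hu).2.1.1)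
    exact Set.mem_iUnion₂.2 ⟨A, hA, hu, huA⟩
  obtain ⟨K, Ψ, 𝒯, β, hJ, hAsol⟩ := hfam A hA
  obtain ⟨u₁, s, hs, hev⟩ := hJ.exists_section hG (fun u hu => (hGp u hu).1) fun h0 => by
    refine hApos (MeasureTheory.measure_mono_null ?_ h0)
    exact fun u hu => ⟨hu.1, hAsol _ hu.2⟩
  obtain ⟨P, hPp, hP, hu₁P⟩ := eventually_nhds_iff.1 (hev.and hs.eventually_analyticAt)
  have hu₁ := hGp u₁ (hPp u₁ hu₁P).1.1
  have hχc : Continuous χ := continuous_iff_continuousAt.2 fun x => (hχ x).continuousAt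
  refine ⟨θ u₁, ⟨hu₁.2.1.1, hu₁.2.2.1⟩, 𝒰 ∩ χ ⁻¹' P, h𝒰.inter (hP.preimage hχc),
    ⟨hu₁.2.2.2, by rw [Set.mem_preimage, hu₁.2.1.2]; exact hu₁P⟩, Metric.ball p β,
    Metric.isOpen_ball, Metric.mem_ball_self hJ.pos, fun e z => Ψ (e, z, s (χ e)), ?_, ?_⟩
  · rintro z hz η ⟨hηR, hη𝒰, hηP⟩
    obtain ⟨⟨-, hmem, -⟩, hsan⟩ := hPp _ hηP
    rw [h𝒰χ η hη𝒰 hηR] at hmem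
    exact (AnalyticAt.comp_eq (hJ.an _ hmem z hz) (analyticAt_id.prod (analyticAt_const.prod
      (AnalyticAt.comp_eq hsan (hχ η) rfl))) rfl).analyticWithinAt
  · rintro η ⟨hηR, hη𝒰, hηP⟩
    obtain ⟨⟨-, hmem, hsol⟩, -⟩ := hPp _ hηP
    rw [h𝒰χ η hη𝒰 hηR] at hmem hsol
    exact ⟨hsol.holo, hsol.base, hsol.maps, hJ.nondeg _ hmem (hRE hηR).1
      (hsol.holo.analyticOnNhd_euclidean Metric.isOpen_ball p (Metric.mem_ball_self hJ.pos))
      hsol.base (hsol.eventually hJ.pos)⟩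

end
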